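/- Let n ≥ 2. There exist constants r > 0, C > 0 and α₀ > 0, depending only on n, such that: for every measurable W with |W| ≤ 1, every smooth solution u of Δ²u = W·u on B₁(0) ⊂ ℝⁿ that is not identically zero, and every closed axis-parallel cube Q ⊂ B_r(0), one has H^{n−1}({x ∈ Q : u(x) = 0}) ≤ C · diam(Q)^{n−1} · (1 + N(Q))^{α₀}, where H^{n−1} is the (n−1)-dimensional Hausdorff measure. -/

import Mathlib

open MeasureTheory Metric Set

noncomputable section

/-- The Euclidean Laplacian of `u : ℝⁿ → ℝ`. -/
def lap {n : ℕ} (u : EuclideanSpace ℝ (Fin n) → ℝ) (x : EuclideanSpace ℝ (Fin n)) : ℝ :=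
  ∑ i : Fin n, iteratedFDeriv ℝ 2 u x ![EuclideanSpace.single i 1, EuclideanSpace.single i 1]

/-- `sup_s |u|`. -/
def supAbs {n : ℕ} (u : EuclideanSpace ℝ (Fin n) → ℝ) (s : Set (EuclideanSpace ℝ (Fin n))) : ℝ :=
  sSup ((fun y => |u y|) '' s)

/-- The doubling index `N(x,r) = log₂ ( sup_{B_{2r}(x)} |u| / sup_{B_r(x)} |u| )`. -/
def dbIdx {n : ℕ} (u : EuclideanSpace ℝ (Fin n) → ℝ) (x : EuclideanSpace ℝ (Fin n)) (r : ℝ) : ℝ :=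
  Real.logb 2 (supAbs u (ball x (2 * r)) / supAbs u (ball x r))

/-- The maximal doubling index of a cube: `N(Q) = sup { N(x,r) : x ∈ Q, 0 < r < diam Q }`. -/
def cubeN {n : ℕ} (u : EuclideanSpace ℝ (Fin n) → ℝ) (Q : Set (EuclideanSpace ℝ (Fin n))) : ℝ :=
  sSup {N : ℝ | ∃ x ∈ Q, ∃ r : ℝ, 0 < r ∧ r < diam Q ∧ N = dbIdx u x r}

/-- The closed axis-parallel cube with center `c` and side length `ℓ`. -/
def cube {n : ℕ} (c : EuclideanSpace ℝ (Fin n)) (ℓ : ℝ) : Set (EuclideanSpace ℝ (Fin n)) :=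
  {x | ∀ i : Fin n, x i ∈ Set.Icc (c i - ℓ / 2) (c i + ℓ / 2)}

namespace BL
set_option linter.unusedVariables false
open scoped ContDiff

abbrev E (n : ℕ) := EuclideanSpace ℝ (Fin n)

abbrev ee {n : ℕ} (i : Fin n) : E n := EuclideanSpace.single i 1

/-- directional derivative -/
def dd {n : ℕ} (v : E n) (f : E n → ℝ) : E n → ℝ := fun x => fderiv ℝ f x v

abbrev Sm {n : ℕ} (f : E n → ℝ) : Prop := ContDiff ℝ ∞ f

variable {n : ℕ} {v w : E n} {f g h : E n → ℝ}

@[fun_prop]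
theorem sm_dd (hf : ContDiff ℝ ∞ f) : ContDiff ℝ ∞ (dd v f) := by
  unfold dd
  exact (hf.fderiv_right (m := ∞) (by simp)).clm_apply contDiff_const

theorem sm_diff (hf : ContDiff ℝ ∞ f) : Differentiable ℝ f := hf.differentiable (by simp)

theorem sm_cont (hf : ContDiff ℝ ∞ f) : Continuous f := hf.continuous

theorem dd_add (hf : ContDiff ℝ ∞ f) (hg : ContDiff ℝ ∞ g) : dd v (f + g) = dd v f + dd v g := by
  ext x; simp [dd, fderiv_add (sm_diff hf x) (sm_diff hg x)]

theorem dd_sub (hf : ContDiff ℝ ∞ f) (hg : ContDiff ℝ ∞ g) : dd v (f - g) = dd v f - dd v g := by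
  ext x; simp [dd, fderiv_sub (sm_diff hf x) (sm_diff hg x)]

theorem dd_neg : dd v (-f) = -dd v f := by
  ext x; simp [dd, fderiv_neg]

theorem dd_const (c : ℝ) : dd v (fun _ => c) = 0 := by
  ext x; simp [dd]

theorem dd_zero : dd v (0 : E n → ℝ) = 0 := dd_const 0

theorem dd_mul (hf : ContDiff ℝ ∞ f) (hg : ContDiff ℝ ∞ g) :
    dd v (f * g) = dd v f * g + f * dd v g := by
  ext x
  simp [dd, fderiv_mul (sm_diff hf x) (sm_diff hg x)]; ring

theorem dd_smul (c : ℝ) (hf : ContDiff ℝ ∞ f) : dd v (c • f) = c • dd v f := by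
  ext x; simp [dd, fderiv_const_smul (sm_diff hf x)]

theorem dd_sum {ι : Type*} (s : Finset ι) (F : ι → E n → ℝ) (hF : ∀ i ∈ s, ContDiff ℝ ∞ (F i)) :
    dd v (∑ i ∈ s, F i) = ∑ i ∈ s, dd v (F i) := by
  ext x
  simp only [dd, Finset.sum_apply]
  rw [fderiv_sum (fun i hi => sm_diff (hF i hi) x)]
  simp

theorem dd_comm (hf : ContDiff ℝ ∞ f) : dd v (dd w f) = dd w (dd v f) := by
  ext x
  have hd : DifferentiableAt ℝ (fderiv ℝ f) x :=
    (hf.fderiv_right (m := ∞) (by simp)).differentiable (by simp) x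
  have key : ∀ a b : E n, dd a (dd b f) x = fderiv ℝ (fderiv ℝ f) x a b := by
    intro a b
    unfold dd
    rw [fderiv_clm_apply hd (differentiableAt_const _)]
    simp
  rw [key, key]
  exact (hf.contDiffAt.isSymmSndFDerivAt (by simp only [minSmoothness_of_isRCLikeNormedField]; exact WithTop.coe_le_coe.2 le_top)) v w

theorem dd_congr {x : E n} (h : f =ᶠ[nhds x] g) : dd v f =ᶠ[nhds x] dd v g := by
  filter_upwards [h.fderiv (𝕜 := ℝ)] with y hy
  simp [dd, hy]

theorem dd_eqOn {U : Set (E n)} (hU : IsOpen U) (h : EqOn f g U) : EqOn (dd v f) (dd v g) U :=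
  fun x hx => (dd_congr (Filter.eventuallyEq_of_mem (hU.mem_nhds hx) h)).self_of_nhds

theorem dd_tsupport : tsupport (dd v f) ⊆ tsupport f := by
  apply closure_minimal _ (isClosed_tsupport f)
  intro x hx
  by_contra hc
  apply hx
  have : f =ᶠ[nhds x] fun _ => 0 := notMem_tsupport_iff_eventuallyEq.1 hc
  have := (dd_congr (v := v) this).self_of_nhds
  rw [this, dd_const]; rfl

theorem dd_hcs (hf : HasCompactSupport f) : HasCompactSupport (dd v f) :=
  hf.mono' (subset_closure.trans dd_tsupport)

theorem dd_comp_add (x a : E n) : dd v (fun y => f (y + a)) x = dd v f (x + a) := by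
  simp only [dd]
  rw [fderiv_comp_add_right]

theorem dd_comp_smul_add (hf : ContDiff ℝ ∞ f) (r : ℝ) (a : E n) :
    dd v (fun y => f (a + r • y)) = fun y => r * dd v f (a + r • y) := by
  ext x
  have h1 : HasFDerivAt (fun y : E n => a + r • y) (r • ContinuousLinearMap.id ℝ (E n)) x :=
    ((hasFDerivAt_id x).const_smul r).const_add a
  have := ((sm_diff hf (a + r • x)).hasFDerivAt.comp x h1).fderiv
  simp only [dd]
  change fderiv ℝ (f ∘ fun y => a + r • y) x v = _
  rw [this]; simp

theorem dd_vec_add (hf : ContDiff ℝ ∞ f) : dd (v + w) f = dd v f + dd w f := by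
  ext x; simp [dd]

theorem dd_vec_smul (c : ℝ) : dd (c • v) f = c • dd v f := by
  ext x; simp [dd]

/-- Laplacian as a sum of iterated directional derivatives -/
def lp (f : E n → ℝ) : E n → ℝ := ∑ i : Fin n, dd (ee i) (dd (ee i) f)

@[fun_prop]
theorem sm_sum {ι : Type*} (s : Finset ι) (F : ι → E n → ℝ) (hF : ∀ i ∈ s, ContDiff ℝ ∞ (F i)) :
    ContDiff ℝ ∞ (∑ i ∈ s, F i) := by
  have := ContDiff.sum (𝕜 := ℝ) (n := ∞) (s := s) (f := F) hF
  convert this using 1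
  ext x; simp

@[fun_prop]
theorem sm_lp (hf : ContDiff ℝ ∞ f) : ContDiff ℝ ∞ (lp f) := by
  unfold lp
  exact sm_sum _ _ (fun i _ => sm_dd (sm_dd hf))

@[fun_prop]
theorem sm_mul' (hf : ContDiff ℝ ∞ f) (hg : ContDiff ℝ ∞ g) : ContDiff ℝ ∞ (f * g) := hf.mul hg

@[fun_prop]
theorem sm_add' (hf : ContDiff ℝ ∞ f) (hg : ContDiff ℝ ∞ g) : ContDiff ℝ ∞ (f + g) := hf.add hg

@[fun_prop]
theorem sm_sub' (hf : ContDiff ℝ ∞ f) (hg : ContDiff ℝ ∞ g) : ContDiff ℝ ∞ (f - g) := hf.sub hg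

@[fun_prop]
theorem sm_smul' (c : ℝ) (hf : ContDiff ℝ ∞ f) : ContDiff ℝ ∞ (c • f) := contDiff_const.smul hf

@[fun_prop]
theorem sm_neg' (hf : ContDiff ℝ ∞ f) : ContDiff ℝ ∞ (-f) := hf.neg

theorem lap_congr {x : E n} (h : f =ᶠ[nhds x] g) : lap f x = lap g x := by
  unfold lap
  rw [(h.iteratedFDeriv ℝ 2).self_of_nhds]

theorem lap_eq_lp (hf : ContDiff ℝ ∞ f) (x : E n) : lap f x = lp f x := by
  simp only [lap, lp, Finset.sum_apply]
  refine Finset.sum_congr rfl (fun i _ => ?_)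
  have hd : DifferentiableAt ℝ (fderiv ℝ f) x :=
    (hf.fderiv_right (m := ∞) (by simp)).differentiable (by simp) x
  rw [iteratedFDeriv_two_apply]
  unfold dd
  rw [fderiv_clm_apply hd (differentiableAt_const _)]
  simp

theorem lp_eqOn {U : Set (E n)} (hU : IsOpen U) (h : EqOn f g U) : EqOn (lp f) (lp g) U := by
  intro x hx
  simp only [lp, Finset.sum_apply]
  exact Finset.sum_congr rfl (fun i _ => dd_eqOn hU (dd_eqOn hU h) hx)

theorem lp_tsupport : tsupport (lp f) ⊆ tsupport f := by
  apply closure_minimal _ (isClosed_tsupport f)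
  intro x hx
  by_contra hc
  apply hx
  simp only [lp, Finset.sum_apply]
  refine Finset.sum_eq_zero (fun i _ => ?_)
  exact image_eq_zero_of_notMem_tsupport (fun h => hc (dd_tsupport (dd_tsupport h)))

theorem lp_hcs (hf : HasCompactSupport f) : HasCompactSupport (lp f) :=
  hf.mono' (subset_closure.trans lp_tsupport)

theorem lp_add (hf : ContDiff ℝ ∞ f) (hg : ContDiff ℝ ∞ g) : lp (f + g) = lp f + lp g := by
  simp only [lp, ← Finset.sum_add_distrib]
  refine Finset.sum_congr rfl (fun i _ => ?_)
  rw [dd_add hf hg, dd_add (sm_dd hf) (sm_dd hg)]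

theorem lp_sub (hf : ContDiff ℝ ∞ f) (hg : ContDiff ℝ ∞ g) : lp (f - g) = lp f - lp g := by
  simp only [lp, ← Finset.sum_sub_distrib]
  refine Finset.sum_congr rfl (fun i _ => ?_)
  rw [dd_sub hf hg, dd_sub (sm_dd hf) (sm_dd hg)]

theorem lp_smul (c : ℝ) (hf : ContDiff ℝ ∞ f) : lp (c • f) = c • lp f := by
  simp only [lp, Finset.smul_sum]
  refine Finset.sum_congr rfl (fun i _ => ?_)
  rw [dd_smul c hf, dd_smul c (sm_dd hf)]

/-- gradient inner product -/
def gr (f g : E n → ℝ) : E n → ℝ := ∑ i : Fin n, dd (ee i) f * dd (ee i) g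

@[fun_prop]
theorem sm_gr (hf : ContDiff ℝ ∞ f) (hg : ContDiff ℝ ∞ g) : ContDiff ℝ ∞ (gr f g) := by
  unfold gr
  exact sm_sum _ _ (fun i _ => by fun_prop)

theorem lp_mul (hf : ContDiff ℝ ∞ f) (hg : ContDiff ℝ ∞ g) :
    lp (f * g) = lp f * g + 2 * gr f g + f * lp g := by
  simp only [lp, gr, Finset.sum_mul, Finset.mul_sum, ← Finset.sum_add_distrib]
  refine Finset.sum_congr rfl (fun i _ => ?_)
  rw [dd_mul hf hg, dd_add (by fun_prop) (by fun_prop), dd_mul (by fun_prop) hg,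
    dd_mul hf (by fun_prop)]
  ring

theorem lp_dd (hf : ContDiff ℝ ∞ f) : lp (dd v f) = dd v (lp f) := by
  unfold lp
  rw [dd_sum _ _ (fun i _ => by fun_prop)]
  refine Finset.sum_congr rfl (fun i _ => ?_)
  rw [dd_comm (v := ee i) (w := v) hf, dd_comm (by fun_prop)]

theorem lp_comp_smul_add (hf : ContDiff ℝ ∞ f) (r : ℝ) (a : E n) :
    lp (fun y => f (a + r • y)) = fun y => r ^ 2 * lp f (a + r • y) := by
  have : ∀ i : Fin n, dd (ee i) (dd (ee i) (fun y => f (a + r • y)))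
      = fun y => r ^ 2 * dd (ee i) (dd (ee i) f) (a + r • y) := by
    intro i
    rw [dd_comp_smul_add hf]
    have := dd_comp_smul_add (v := ee i) (f := dd (ee i) f) (by fun_prop) r a
    change dd (ee i) (r • fun y => dd (ee i) f (a + r • y)) = _
    rw [dd_smul _ (by fun_prop), this]
    ext y; simp; ring
  ext y
  simp only [lp, Finset.sum_apply, this, Finset.mul_sum]

theorem integrable_cs (hf : Continuous f) (h : HasCompactSupport f) : Integrable f :=
  hf.integrable_of_hasCompactSupport h

/-- integration by parts -/
theorem ibp (hf : ContDiff ℝ ∞ f) (hg : ContDiff ℝ ∞ g) (hc : HasCompactSupport g) :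
    ∫ x, dd v f x * g x = - ∫ x, f x * dd v g x := by
  have h1 : Integrable (fun x => dd v f x * g x) :=
    integrable_cs (f := dd v f * g) (by fun_prop) hc.mul_left
  have h2 : Integrable (fun x => f x * dd v g x) :=
    integrable_cs (f := f * dd v g) (by fun_prop) (dd_hcs hc).mul_left
  have h3 : Integrable (fun x => f x * g x) :=
    integrable_cs (f := f * g) (by fun_prop) hc.mul_left
  have := integral_mul_fderiv_eq_neg_fderiv_mul_of_integrable (μ := (volume : Measure (E n)))
    (f := f) (g := g) (v := v) h1 h2 h3
    (fun x _ => sm_diff hf x) (fun x _ => sm_diff hg x)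
  simp only [dd] at *
  rw [this]; simp

theorem ibp' (hf : ContDiff ℝ ∞ f) (hg : ContDiff ℝ ∞ g) (hc : HasCompactSupport f) :
    ∫ x, dd v f x * g x = - ∫ x, f x * dd v g x := by
  have := ibp (v := v) hg hf hc
  have e1 : ∫ x, dd v f x * g x = ∫ x, g x * dd v f x := by simp only [mul_comm]
  have e2 : ∫ x, f x * dd v g x = ∫ x, dd v g x * f x := by simp only [mul_comm]
  rw [e1, e2, this]; simp

theorem integral_dd (hf : ContDiff ℝ ∞ f) (hc : HasCompactSupport f) : ∫ x, dd v f x = 0 := by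
  have := ibp' (v := v) (g := fun _ => 1) hf contDiff_const hc
  simpa [dd_const] using this

theorem ibp_gr (hf : ContDiff ℝ ∞ f) (hg : ContDiff ℝ ∞ g) (hc : HasCompactSupport g) :
    ∫ x, lp f x * g x = - ∫ x, gr f g x := by
  simp only [lp, gr, Finset.sum_apply, Finset.sum_mul, Pi.mul_apply]
  rw [integral_finsetSum, integral_finsetSum, ← Finset.sum_neg_distrib]
  · exact Finset.sum_congr rfl (fun i _ => ibp (by fun_prop) hg hc)
  · intro i _
    exact integrable_cs (f := dd (ee i) f * dd (ee i) g) (by fun_prop) (dd_hcs hc).mul_left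
  · intro i _
    exact integrable_cs (f := dd (ee i) (dd (ee i) f) * g) (by fun_prop) hc.mul_left

theorem gr_comm : gr f g = gr g f := by
  simp [gr, mul_comm]

theorem gr_hcs (hc : HasCompactSupport g) : HasCompactSupport (gr f g) := by
  refine hc.mono' ?_
  intro x hx
  by_contra h
  apply hx
  simp only [gr, Finset.sum_apply, Pi.mul_apply]
  refine Finset.sum_eq_zero (fun i _ => ?_)
  rw [image_eq_zero_of_notMem_tsupport (f := dd (ee i) g) (fun h' => h (dd_tsupport h'))]
  simp

theorem lp_symm (hf : ContDiff ℝ ∞ f) (hg : ContDiff ℝ ∞ g) (hc : HasCompactSupport g) :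
    ∫ x, lp f x * g x = ∫ x, f x * lp g x := by
  rw [ibp_gr hf hg hc]
  have : ∫ x, f x * lp g x = - ∫ x, gr f g x := by
    simp only [lp, gr, Finset.sum_apply, Finset.mul_sum, Pi.mul_apply]
    rw [integral_finsetSum, integral_finsetSum, ← Finset.sum_neg_distrib]
    · refine Finset.sum_congr rfl (fun i _ => ?_)
      have := ibp (v := ee i) (f := f) (g := dd (ee i) g) hf (by fun_prop) (dd_hcs hc)
      rw [this]; simp
    · intro i _
      exact integrable_cs (f := dd (ee i) f * dd (ee i) g) (by fun_prop) (dd_hcs hc).mul_left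
    · intro i _
      exact integrable_cs (f := f * dd (ee i) (dd (ee i) g)) (by fun_prop) (dd_hcs (dd_hcs hc)).mul_left
  rw [this]

end BL
end

open MeasureTheory Metric Set
noncomputable section
namespace BL
set_option linter.unusedVariables false
set_option linter.unusedSimpArgs false
open scoped ContDiff

variable {n : ℕ} {v w : E n} {f g h : E n → ℝ}

def K (c : ℝ) : E n → ℝ := fun _ => c
def sq : E n → ℝ := fun x => ‖x‖ ^ 2
def co (i : Fin n) : E n → ℝ := fun x => x i
def Xd (f : E n → ℝ) : E n → ℝ := ∑ i : Fin n, co i * dd (ee i) f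

@[fun_prop] theorem sm_K (c : ℝ) : ContDiff ℝ ∞ (K c : E n → ℝ) := contDiff_const
@[fun_prop] theorem sm_sq : ContDiff ℝ ∞ (sq : E n → ℝ) := contDiff_norm_sq ℝ
@[fun_prop] theorem sm_co (i : Fin n) : ContDiff ℝ ∞ (co i : E n → ℝ) := by
  unfold co; fun_prop
@[fun_prop] theorem sm_Xd (hf : ContDiff ℝ ∞ f) : ContDiff ℝ ∞ (Xd f) :=
  sm_sum _ _ (fun i _ => by fun_prop)

theorem dd_K (c : ℝ) : dd v (K c) = 0 := dd_const c

theorem dd_co (i j : Fin n) : dd (ee j) (co i) = K (if i = j then 1 else 0) := by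
  ext x
  have : HasFDerivAt (co i) (EuclideanSpace.proj i : E n →L[ℝ] ℝ) x :=
    (EuclideanSpace.proj i : E n →L[ℝ] ℝ).hasFDerivAt
  simp [dd, this.fderiv, K]

theorem dd_sq (i : Fin n) : dd (ee i) sq = K 2 * co i := by
  ext x
  have := (hasStrictFDerivAt_norm_sq x).hasFDerivAt
  change fderiv ℝ (fun x : E n => ‖x‖ ^ 2) x (ee i) = 2 * x i
  rw [this.fderiv]
  simp [EuclideanSpace.inner_single_right]

theorem sq_eq : (sq : E n → ℝ) = ∑ i, co i * co i := by
  ext x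
  simp only [sq, EuclideanSpace.norm_sq_eq, co, Finset.sum_apply, Pi.mul_apply, Real.norm_eq_abs, sq_abs]
  exact Finset.sum_congr rfl (fun i _ => pow_two _)

theorem Xd_add (hf : ContDiff ℝ ∞ f) (hg : ContDiff ℝ ∞ g) : Xd (f + g) = Xd f + Xd g := by
  simp only [Xd, ← Finset.sum_add_distrib]
  exact Finset.sum_congr rfl (fun i _ => by rw [dd_add hf hg]; ring)

theorem Xd_sub (hf : ContDiff ℝ ∞ f) (hg : ContDiff ℝ ∞ g) : Xd (f - g) = Xd f - Xd g := by
  simp only [Xd, ← Finset.sum_sub_distrib]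
  exact Finset.sum_congr rfl (fun i _ => by rw [dd_sub hf hg]; ring)

theorem Xd_mul (hf : ContDiff ℝ ∞ f) (hg : ContDiff ℝ ∞ g) : Xd (f * g) = Xd f * g + f * Xd g := by
  simp only [Xd, Finset.sum_mul, Finset.mul_sum, ← Finset.sum_add_distrib]
  exact Finset.sum_congr rfl (fun i _ => by rw [dd_mul hf hg]; ring)

theorem Xd_K (c : ℝ) : Xd (K c : E n → ℝ) = 0 := by
  simp [Xd, dd_K]

theorem Xd_sq : Xd (sq : E n → ℝ) = K 2 * sq := by
  simp only [Xd, dd_sq]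
  rw [sq_eq, Finset.mul_sum]
  exact Finset.sum_congr rfl (fun i _ => by ring)

theorem gr_sq : gr f sq = K 2 * Xd f := by
  simp only [gr, Xd, dd_sq, Finset.mul_sum]
  exact Finset.sum_congr rfl (fun i _ => by ring)

theorem gr_add (hg : ContDiff ℝ ∞ g) (hh : ContDiff ℝ ∞ h) : gr f (g + h) = gr f g + gr f h := by
  simp only [gr, ← Finset.sum_add_distrib]
  exact Finset.sum_congr rfl (fun i _ => by rw [dd_add hg hh]; ring)

theorem gr_sub (hg : ContDiff ℝ ∞ g) (hh : ContDiff ℝ ∞ h) : gr f (g - h) = gr f g - gr f h := by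
  simp only [gr, ← Finset.sum_sub_distrib]
  exact Finset.sum_congr rfl (fun i _ => by rw [dd_sub hg hh]; ring)

theorem gr_mul (hg : ContDiff ℝ ∞ g) (hh : ContDiff ℝ ∞ h) :
    gr f (g * h) = gr f g * h + g * gr f h := by
  simp only [gr, Finset.sum_mul, Finset.mul_sum, ← Finset.sum_add_distrib]
  exact Finset.sum_congr rfl (fun i _ => by rw [dd_mul hg hh]; ring)

theorem gr_K (c : ℝ) : gr f (K c) = 0 := by simp [gr, dd_K]

theorem lp_sq : lp (sq : E n → ℝ) = K (2 * n) := by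
  have : ∀ i : Fin n, dd (ee i) (dd (ee i) sq) = (K 2 : E n → ℝ) := by
    intro i
    rw [dd_sq, dd_mul (by fun_prop) (by fun_prop), dd_K, dd_co]; ext x; simp [K]
  simp only [lp, this]
  ext x; simp [K]; ring

theorem gr_Xd (hg : ContDiff ℝ ∞ g) : K 2 * gr g (Xd g) = K 2 * gr g g + Xd (gr g g) := by
  have e1 : ∀ i : Fin n, dd (ee i) (Xd g) = dd (ee i) g + ∑ j, co j * dd (ee i) (dd (ee j) g) := by
    intro i
    simp only [Xd]
    rw [dd_sum _ _ (fun j _ => by fun_prop)]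
    have : ∀ j : Fin n, dd (ee i) (co j * dd (ee j) g)
        = K (if j = i then 1 else 0) * dd (ee j) g + co j * dd (ee i) (dd (ee j) g) := by
      intro j
      rw [dd_mul (by fun_prop) (by fun_prop), dd_co]
    simp only [this, Finset.sum_add_distrib]
    congr 1
    ext x
    simp [K, Finset.sum_apply, Finset.sum_ite_eq']
  have e2 : Xd (gr g g) = K 2 * ∑ i, dd (ee i) g * ∑ j, co j * dd (ee i) (dd (ee j) g) := by
    simp only [Xd, gr, Finset.mul_sum]
    have : ∀ j : Fin n, co j * dd (ee j) (∑ i, dd (ee i) g * dd (ee i) g)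
        = ∑ i, K 2 * (dd (ee i) g * (co j * dd (ee i) (dd (ee j) g))) := by
      intro j
      rw [dd_sum _ _ (fun j _ => by fun_prop), Finset.mul_sum]
      refine Finset.sum_congr rfl (fun i _ => ?_)
      rw [dd_mul (by fun_prop) (by fun_prop), dd_comm (v := ee j) hg]
      ext x; simp [K]; ring
    rw [Finset.sum_congr rfl (fun j _ => this j), Finset.sum_comm]
  rw [e2]
  simp only [gr, e1]
  rw [← mul_add, ← Finset.sum_add_distrib]
  congr 1
  exact Finset.sum_congr rfl (fun i _ => by ring)

theorem Xd_hcs (hc : HasCompactSupport f) : HasCompactSupport (Xd f) := by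
  refine hc.mono' ?_
  intro x hx
  by_contra h
  apply hx
  simp only [Xd, Finset.sum_apply, Pi.mul_apply]
  refine Finset.sum_eq_zero (fun i _ => ?_)
  rw [image_eq_zero_of_notMem_tsupport (f := dd (ee i) f) (fun h' => h (dd_tsupport h'))]
  simp

theorem int_Xd (hf : ContDiff ℝ ∞ f) (hc : HasCompactSupport f) :
    ∫ x, (Xd f + K n * f : E n → ℝ) x = 0 := by
  have e : Xd f + K n * f = ∑ i, dd (ee i) (co i * f) := by
    have : ∀ i : Fin n, dd (ee i) (co i * f) = K 1 * f + co i * dd (ee i) f := by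
      intro i; rw [dd_mul (by fun_prop) hf, dd_co]; simp
    simp only [this, Finset.sum_add_distrib, Xd]
    ext x; simp [K]; ring
  rw [e]
  simp only [Finset.sum_apply]
  rw [integral_finsetSum]
  · exact Finset.sum_eq_zero (fun i _ => integral_dd (by fun_prop) hc.mul_left)
  · exact fun i _ => integrable_cs (by fun_prop) (dd_hcs hc.mul_left)

/-- integral of `div (s ∇ g) h` -/
theorem int_D (hg : ContDiff ℝ ∞ g) (hh : ContDiff ℝ ∞ h) (hc : HasCompactSupport h) :
    ∫ x, ((sq * lp g + K 2 * Xd g) * h : E n → ℝ) x = - ∫ x, (sq * gr g h : E n → ℝ) x := by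
  have h1 := ibp_gr (f := g) (g := sq * h) hg (by fun_prop) hc.mul_left
  have e1 : gr g (sq * h) = K 2 * Xd g * h + sq * gr g h := by
    rw [gr_mul (by fun_prop) hh, gr_sq]
  rw [e1] at h1
  have e2 : (sq * lp g + K 2 * Xd g) * h = lp g * (sq * h) + K 2 * Xd g * h := by ring
  have i1 : Integrable (lp g * (sq * h)) :=
    integrable_cs (by fun_prop) (hc.mul_left.mul_left)
  have i2 : Integrable (K 2 * Xd g * h) :=
    integrable_cs (by fun_prop) (hc.mul_left)
  have i3 : Integrable (sq * gr g h) :=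
    integrable_cs (by fun_prop) (gr_hcs hc).mul_left
  rw [e2, integral_add' i1 i2]
  rw [integral_add' i2 i3] at h1
  have : ∫ x, (lp g * (sq * h) : E n → ℝ) x = ∫ x, lp g x * (sq * h : E n → ℝ) x := rfl
  rw [this, h1]; ring

section carl
variable (τ : ℝ)

def fa : E n → ℝ := K (2 * τ + n - 2) - K τ * sq
def fq : E n → ℝ := K (-2 * τ) * sq + K n * fa τ
def fb : E n → ℝ := K (1/4) * fa τ * fa τ + K (n - 1)
def Sg (g : E n → ℝ) : E n → ℝ := sq * lp g + K 2 * Xd g + fb τ * g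
def Ag (g : E n → ℝ) : E n → ℝ := fa τ * Xd g + K (1/2) * fq τ * g

@[fun_prop] theorem sm_fa : ContDiff ℝ ∞ (fa τ : E n → ℝ) := by unfold fa; fun_prop
@[fun_prop] theorem sm_fq : ContDiff ℝ ∞ (fq τ : E n → ℝ) := by unfold fq; fun_prop
@[fun_prop] theorem sm_fb : ContDiff ℝ ∞ (fb τ : E n → ℝ) := by unfold fb; fun_prop

theorem Xfa : Xd (fa τ : E n → ℝ) = K (-2 * τ) * sq := by
  unfold fa
  rw [Xd_sub (by fun_prop) (by fun_prop), Xd_mul (by fun_prop) (by fun_prop), Xd_K, Xd_K, Xd_sq]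
  ext x; simp [K]; ring

theorem gfa : gr g (fa τ : E n → ℝ) = K (-2 * τ) * Xd g := by
  unfold fa
  rw [gr_sub (by fun_prop) (by fun_prop), gr_mul (by fun_prop) (by fun_prop), gr_K, gr_K, gr_sq]
  ext x; simp [K]; ring

theorem gfq : gr g (fq τ : E n → ℝ) = K (-(n + 2) * 2 * τ) * Xd g := by
  unfold fq
  rw [gr_add (by fun_prop) (by fun_prop), gr_mul (by fun_prop) (by fun_prop),
    gr_mul (by fun_prop) (by fun_prop), gr_K, gr_K, gr_sq, gfa]
  ext x; simp [K]; ring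

theorem Xfb : Xd (fb τ : E n → ℝ) = K (-τ) * sq * fa τ := by
  unfold fb
  rw [Xd_add (by fun_prop) (by fun_prop), Xd_mul (by fun_prop) (by fun_prop),
    Xd_mul (by fun_prop) (by fun_prop), Xd_K, Xd_K, Xfa]
  ext x; simp [K]; ring

def fPhi (g : E n → ℝ) : E n → ℝ :=
  K (-1) * sq * fa τ * gr g g + fa τ * fb τ * g * g + K (τ * (n + 2)) * sq * g * g

theorem Phi_id (hg : ContDiff ℝ ∞ g) :
    Xd (fPhi τ g) + K n * fPhi τ g =
    K (-1) * (sq * gr g (K 2 * fa τ * Xd g + fq τ * g)) +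
      fb τ * g * (K 2 * fa τ * Xd g + fq τ * g)
      - (K (4 * τ) * sq * Xd g * Xd g + K τ * sq * (fa τ * fa τ - K ((n + 2)^2)) * g * g) := by
  have e0 := gr_Xd hg
  rw [gr_add (by fun_prop) (by fun_prop), gr_mul (f := g) (g := K 2 * fa τ) (by fun_prop) (by fun_prop),
    gr_mul (f := g) (g := fq τ) (by fun_prop) hg, gr_mul (f := g) (g := K 2) (by fun_prop) (by fun_prop),
    gr_K, gfa, gfq]
  unfold fPhi
  rw [Xd_add (by fun_prop) (by fun_prop), Xd_add (by fun_prop) (by fun_prop),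
    Xd_mul (by fun_prop) (by fun_prop), Xd_mul (by fun_prop) (by fun_prop),
    Xd_mul (by fun_prop) (by fun_prop), Xd_mul (g := g) (by fun_prop) (by fun_prop),
    Xd_mul (g := g) (by fun_prop) (by fun_prop), Xd_mul (by fun_prop) (by fun_prop),
    Xd_mul (f := K (τ * (n + 2)) * sq * g) (by fun_prop) (by fun_prop),
    Xd_mul (f := K (τ * (n + 2)) * sq) (by fun_prop) (by fun_prop),
    Xd_mul (f := K (τ * (n + 2))) (by fun_prop) (by fun_prop),
    Xd_K, Xd_K, Xd_sq, Xfa, Xfb]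
  ext x
  have e0x := congrFun e0 x
  have hq : fq τ x = -2 * τ * sq x + n * fa τ x := by simp [fq, K]
  simp only [K, Pi.add_apply, Pi.sub_apply, Pi.mul_apply, Pi.zero_apply] at e0x ⊢
  rw [hq]
  linear_combination (sq x * fa τ x) * e0x

theorem int_SA (hg : ContDiff ℝ ∞ g) (hc : HasCompactSupport g) :
    2 * ∫ x, (Sg τ g * Ag τ g) x =
     ∫ x, (K (4 * τ) * sq * Xd g * Xd g + K τ * sq * (fa τ * fa τ - K ((n + 2)^2)) * g * g : E n → ℝ) x := by
  set H := K 2 * fa τ * Xd g + fq τ * g with hH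
  have smH : ContDiff ℝ ∞ H := by rw [hH]; fun_prop
  have hcH : HasCompactSupport H := by
    rw [hH]; exact (Xd_hcs hc).mul_left.add hc.mul_left
  have hcP : HasCompactSupport (fPhi τ g) := by
    unfold fPhi
    exact ((gr_hcs hc).mul_left.add hc.mul_left).add hc.mul_left
  have smP : ContDiff ℝ ∞ (fPhi τ g) := by unfold fPhi; fun_prop
  have hD := int_D hg smH hcH
  have hP := int_Xd smP hcP
  rw [Phi_id τ hg, ← hH] at hP
  have i1 : Integrable ((sq * lp g + K 2 * Xd g) * H) := integrable_cs (by fun_prop) hcH.mul_left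
  have i2 : Integrable (sq * gr g H) := integrable_cs (by fun_prop) (gr_hcs hcH).mul_left
  have i3 : Integrable (fb τ * g * H) := integrable_cs (by fun_prop) hcH.mul_left
  have i4 : Integrable (K (4 * τ) * sq * Xd g * Xd g + K τ * sq * (fa τ * fa τ - K ((n + 2)^2)) * g * g) :=
    integrable_cs (by fun_prop) ((Xd_hcs hc).mul_left.add hc.mul_left)
  have i2' : Integrable (K (-1) * (sq * gr g H)) :=
    integrable_cs (by fun_prop) (gr_hcs hcH).mul_left.mul_left
  rw [integral_sub' (i2'.add i3) i4, integral_add' i2' i3] at hP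
  have e1 : ∫ x, (K (-1) * (sq * gr g H) : E n → ℝ) x = - ∫ x, (sq * gr g H : E n → ℝ) x := by
    rw [← integral_neg]; congr 1; ext x; simp [K]
  have e2 : 2 * ∫ x, (Sg τ g * Ag τ g) x = ∫ x, ((sq * lp g + K 2 * Xd g) * H + fb τ * g * H : E n → ℝ) x := by
    rw [← integral_const_mul]; congr 1; ext x; simp [K, Sg, Ag, hH]; ring
  rw [e2, integral_add' i1 i3, hD]
  linarith

theorem carl0 (hn : 2 ≤ n) (hτ : 2 * (n + 2) ≤ τ) (hg : ContDiff ℝ ∞ g) (hc : HasCompactSupport g)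
    (hs : tsupport g ⊆ ball 0 1) :
    τ ^ 3 * ∫ x, (sq * g * g : E n → ℝ) x ≤ ∫ x, ((Sg τ g + Ag τ g) * (Sg τ g + Ag τ g)) x := by
  have hn' : (2 : ℝ) ≤ n := by exact_mod_cast hn
  have cS : HasCompactSupport (Sg τ g) := by
    unfold Sg; exact ((lp_hcs hc).mul_left.add (Xd_hcs hc).mul_left).add hc.mul_left
  have sS : ContDiff ℝ ∞ (Sg τ g) := by unfold Sg; fun_prop
  have sA : ContDiff ℝ ∞ (Ag τ g) := by unfold Ag; fun_prop
  have cA : HasCompactSupport (Ag τ g) := by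
    unfold Ag; exact (Xd_hcs hc).mul_left.add hc.mul_left
  have h1 : ∫ x, 4 * (Sg τ g * Ag τ g) x ≤ ∫ x, ((Sg τ g + Ag τ g) * (Sg τ g + Ag τ g)) x := by
    apply integral_mono
    · exact (integrable_cs (f := Sg τ g * Ag τ g) (by fun_prop) cA.mul_left).const_mul 4
    · exact (integrable_cs (by fun_prop) (cS.add cA).mul_left)
    · intro x
      simp only [Pi.mul_apply, Pi.add_apply]
      nlinarith [sq_nonneg (Sg τ g x - Ag τ g x)]
  have h2 : ∫ x, (1/2 : ℝ) * τ^3 * (sq * g * g : E n → ℝ) x ≤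
     ∫ x, (K (4 * τ) * sq * Xd g * Xd g + K τ * sq * (fa τ * fa τ - K ((n + 2)^2)) * g * g : E n → ℝ) x := by
    apply integral_mono
    · exact (integrable_cs (f := sq * g * g) (by fun_prop) hc.mul_left).const_mul _
    · exact integrable_cs (by fun_prop) ((Xd_hcs hc).mul_left.add hc.mul_left)
    · intro x
      simp only [Pi.mul_apply, Pi.add_apply, K, Pi.sub_apply]
      by_cases hx : x ∈ tsupport g
      · have hx1 := hs hx
        simp only [mem_ball, dist_zero_right] at hx1
        have hs0 : 0 ≤ sq x := by simp only [sq]; positivity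
        have hs1 : sq x ≤ 1 := by simp only [sq]; nlinarith [norm_nonneg x]
        have ha : τ ≤ fa τ x := by
          simp only [fa, K, Pi.sub_apply, Pi.mul_apply]
          nlinarith
        have : (1/2 : ℝ) * τ^2 ≤ fa τ x * fa τ x - (n+2)^2 := by
          nlinarith
        have h3 : 0 ≤ τ * (sq x * (g x * g x)) := by
          have : 0 ≤ τ := by linarith
          have := mul_self_nonneg (g x)
          positivity
        have h4 : 0 ≤ 4 * τ * sq x * (Xd g x * Xd g x) := by
          have : 0 ≤ τ := by linarith
          have := mul_self_nonneg (Xd g x)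
          positivity
        nlinarith [mul_le_mul_of_nonneg_left this h3]
      · have g0 : g x = 0 := image_eq_zero_of_notMem_tsupport hx
        have hτ0 : 0 ≤ τ := by linarith
        have : 0 ≤ sq x := by simp only [sq]; positivity
        rw [g0]
        have := mul_self_nonneg (Xd g x)
        have : 0 ≤ 4 * τ * sq x * (Xd g x * Xd g x) := by positivity
        nlinarith
  rw [← int_SA τ hg hc] at h2
  rw [integral_const_mul] at h1 h2
  nlinarith

end carl
end BL
end

open MeasureTheory Metric Set
noncomputable section
namespace BL
set_option linter.unusedVariables false
set_option linter.unusedSimpArgs false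
open scoped ContDiff

variable {n : ℕ} {v w : E n} {f g h : E n → ℝ}

/-- Carleman weight -/
def Wt (τ : ℝ) : E n → ℝ := fun x => (sq x) ^ (-τ - n / 2) * Real.exp (τ * sq x / 2)

theorem sq_pos {x : E n} (hx : x ≠ 0) : 0 < sq x := by
  have := norm_pos_iff.2 hx
  unfold sq; positivity

theorem sq_nonneg' (x : E n) : 0 ≤ sq x := by unfold sq; positivity

theorem Wt_nonneg (τ : ℝ) (x : E n) : 0 ≤ Wt τ x := by
  have := sq_nonneg' x
  unfold Wt; positivity

theorem sq_le_one {x : E n} (hx : ‖x‖ < 1) : sq x ≤ 1 := by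
  simp only [sq]; nlinarith [norm_nonneg x]

theorem Wt_contAt (τ : ℝ) {x : E n} (hx : x ≠ 0) : ContinuousAt (Wt τ) x := by
  unfold Wt
  have h1 : ContinuousAt (sq : E n → ℝ) x := (sm_cont sm_sq).continuousAt
  exact (h1.rpow_const (Or.inl (sq_pos hx).ne')).mul
    (Real.continuous_exp.continuousAt.comp ((h1.const_mul τ).div_const 2))

theorem int_Wt (τ : ℝ) (hf : Continuous f) (hc : HasCompactSupport f) (h0 : (0 : E n) ∉ tsupport f) :
    Integrable (Wt τ * f) := by
  refine integrable_cs ?_ hc.mul_left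
  rw [continuous_iff_continuousAt]
  intro x
  by_cases hx : x = 0
  · subst hx
    have : f =ᶠ[nhds 0] fun _ => 0 := notMem_tsupport_iff_eventuallyEq.1 h0
    have h2 : Wt τ * f =ᶠ[nhds 0] fun _ => 0 := by
      filter_upwards [this] with y hy
      simp [hy]
    exact continuousAt_const.congr h2.symm
  · exact (Wt_contAt τ hx).mul hf.continuousAt

theorem tsupport_mul_subset_right' : tsupport (f * g) ⊆ tsupport g := by
  apply closure_mono
  intro x hx
  simp only [Function.mem_support, Pi.mul_apply] at hx ⊢
  intro h; apply hx; simp [h]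

theorem Xd_zero_of_notMem {x : E n} (hx : x ∉ tsupport f) : Xd f x = 0 := by
  simp only [Xd, Finset.sum_apply, Pi.mul_apply]
  refine Finset.sum_eq_zero (fun i _ => ?_)
  rw [image_eq_zero_of_notMem_tsupport (f := dd (ee i) f) (fun h' => hx (dd_tsupport h'))]
  simp

theorem lp_zero_of_notMem {x : E n} (hx : x ∉ tsupport f) : lp f x = 0 :=
  image_eq_zero_of_notMem_tsupport (fun h => hx (lp_tsupport h))

/-- conjugation identity -/
theorem conj_id (τ : ℝ) (hf : ContDiff ℝ ∞ f) (h0 : (0 : E n) ∉ tsupport f) :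
    ∃ om : E n → ℝ, ContDiff ℝ ∞ om ∧ (∀ x ∈ tsupport f, om x ^ 2 = Wt τ x) ∧
      ∀ x, (Sg τ (om * f) + Ag τ (om * f)) x = sq x * om x * lp f x := by
  obtain ⟨ε, hε, hball⟩ := Metric.isOpen_iff.1 (isClosed_tsupport f).isOpen_compl 0 h0
  let b : ContDiffBump (0 : E n) := ⟨ε/4, ε/2, by positivity, by linarith⟩
  set st : E n → ℝ := sq + fun x => b x with hst
  have smst : ContDiff ℝ ∞ st := by
    have : ContDiff ℝ ∞ (fun x => b x) := b.contDiff
    rw [hst]; exact sm_sq.add this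
  have stpos : ∀ x, 0 < st x := by
    intro x
    simp only [hst, Pi.add_apply]
    by_cases hx : x = 0
    · subst hx
      have : b (0 : E n) = 1 := b.one_of_mem_closedBall (by simp; positivity)
      rw [this]; have := sq_nonneg' (0 : E n); linarith
    · have := sq_pos hx
      have := b.nonneg (x := x); linarith
  set U : Set (E n) := (closedBall 0 (ε/2))ᶜ with hU
  have Uo : IsOpen U := isClosed_closedBall.isOpen_compl
  have steq : EqOn st sq U := by
    intro x hx
    simp only [hst, Pi.add_apply]
    rw [b.zero_of_le_dist]; · simp
    simp only [hU, mem_compl_iff, mem_closedBall, not_le] at hx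
    exact hx.le
  have tsU : tsupport f ⊆ U := by
    intro x hx hxc
    simp only [mem_closedBall] at hxc
    exact hball (mem_ball.2 (by linarith)) hx
  have U0 : ∀ x ∈ U, x ≠ 0 := by
    rintro x hx rfl
    apply hx; simp; positivity
  set θ : E n → ℝ := fun x => Real.log (st x) with hθ
  have smθ : ContDiff ℝ ∞ θ := smst.log (fun x => (stpos x).ne')
  have dθ : ∀ i : Fin n, dd (ee i) θ * st = dd (ee i) st := by
    intro i; ext x
    have : HasFDerivAt θ ((st x)⁻¹ • fderiv ℝ st x) x :=
      (sm_diff smst x).hasFDerivAt.log (stpos x).ne'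
    simp only [dd, Pi.mul_apply, this.fderiv]
    have := (stpos x).ne'
    simp; field_simp
  set ψ : E n → ℝ := K (-(τ/2 + n/4)) * θ + K (τ/4) * sq with hψ
  have smψ : ContDiff ℝ ∞ ψ := by rw [hψ]; fun_prop
  set om : E n → ℝ := fun x => Real.exp (ψ x) with hom
  have smom : ContDiff ℝ ∞ om := smψ.exp
  have dom : ∀ i : Fin n, dd (ee i) om = om * dd (ee i) ψ := by
    intro i; ext x
    have := ((sm_diff smψ x).hasFDerivAt.exp).fderiv
    simp only [dd, Pi.mul_apply, hom] at *
    rw [this]; simp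
  refine ⟨om, smom, ?_, ?_⟩
  · intro x hx
    have hxU := tsU hx
    have sp := sq_pos (U0 x hxU)
    simp only [hom, hψ, Wt, K, Pi.add_apply, Pi.mul_apply, hθ, steq hxU]
    rw [Real.rpow_def_of_pos sp, ← Real.exp_add, ← Real.exp_nat_mul]
    congr 1; push_cast; ring
  · intro x
    by_cases hx : x ∈ tsupport f
    swap
    · have h1 : x ∉ tsupport (om * f) := fun h => hx (tsupport_mul_subset_right' h)
      simp [Sg, Ag, lp_zero_of_notMem hx, lp_zero_of_notMem h1, Xd_zero_of_notMem h1,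
        image_eq_zero_of_notMem_tsupport hx]
    have hxU := tsU hx
    have sp := sq_pos (U0 x hxU)
    -- values at x
    have gst : ∀ F : E n → ℝ, gr F st x = 2 * Xd F x := by
      intro F
      have : gr F st x = gr F sq x := by
        simp only [gr, Finset.sum_apply, Pi.mul_apply]
        exact Finset.sum_congr rfl (fun i _ => by rw [dd_eqOn Uo steq hxU])
      rw [this, gr_sq]; simp [K]
    have gθ : ∀ F : E n → ℝ, gr F θ * st = gr F st := by
      intro F
      simp only [gr, Finset.sum_mul]
      exact Finset.sum_congr rfl (fun i _ => by rw [← dθ]; ring)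
    have lθ : lp θ * st + gr θ st = lp st := by
      simp only [gr, Finset.sum_mul, lp, ← Finset.sum_add_distrib]
      refine Finset.sum_congr rfl (fun i _ => ?_)
      rw [← dθ, dd_mul (by fun_prop) smst, ← dθ]
    have Xθ : Xd θ x * sq x = 2 * sq x := by
      have e1 : Xd θ * st = Xd st := by
        simp only [Xd, Finset.sum_mul]
        exact Finset.sum_congr rfl (fun i _ => by rw [← dθ]; ring)
      have e2 : Xd st x = Xd sq x := by
        simp only [Xd, Finset.sum_apply, Pi.mul_apply]
        exact Finset.sum_congr rfl (fun i _ => by rw [dd_eqOn Uo steq hxU])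
      have := congrFun e1 x
      rw [e2, Xd_sq] at this
      simpa [K, steq hxU] using this
    have Xθ' : Xd θ x = 2 := mul_right_cancel₀ sp.ne' Xθ
    have gθf : gr f θ x * sq x = 2 * Xd f x := by
      have := congrFun (gθ f) x
      simpa [gst, steq hxU] using this
    have gθθ : gr θ θ x * sq x = 4 := by
      have := congrFun (gθ θ) x
      simp only [Pi.mul_apply, gst, steq hxU, Xθ'] at this
      linarith
    have lθ' : lp θ x * sq x = 2 * n - 4 := by
      have := congrFun lθ x
      simp only [Pi.add_apply, Pi.mul_apply, gst, steq hxU, Xθ', lp_eqOn Uo steq hxU, lp_sq, K] at this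
      linarith
    -- ψ
    have gψf : gr f ψ = K (-(τ/2 + n/4)) * gr f θ + K (τ/2) * Xd f := by
      rw [hψ, gr_add (by fun_prop) (by fun_prop), gr_mul (by fun_prop) (by fun_prop),
        gr_mul (by fun_prop) (by fun_prop), gr_K, gr_K, gr_sq]
      ext y; simp [K]; ring
    have gψψ : gr ψ ψ = K ((τ/2 + n/4)^2) * gr θ θ - K (τ * (τ/2 + n/4)) * Xd θ
        + K (τ^2/4) * sq := by
      have a1 : gr ψ ψ = K (-(τ/2 + n/4)) * gr ψ θ + K (τ/2) * Xd ψ := by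
        conv_lhs => rw [hψ]
        rw [← hψ, gr_add (by fun_prop) (by fun_prop), gr_mul (by fun_prop) (by fun_prop),
          gr_mul (by fun_prop) (by fun_prop), gr_K, gr_K, gr_sq]
        ext y; simp [K]; ring
      have a2 : gr ψ θ = K (-(τ/2 + n/4)) * gr θ θ + K (τ/2) * Xd θ := by
        rw [gr_comm, hψ, gr_add (by fun_prop) (by fun_prop), gr_mul (by fun_prop) (by fun_prop),
          gr_mul (by fun_prop) (by fun_prop), gr_K, gr_K, gr_sq]
        ext y; simp [K]; ring
      have a3 : Xd ψ = K (-(τ/2 + n/4)) * Xd θ + K (τ/2) * sq := by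
        rw [hψ, Xd_add (by fun_prop) (by fun_prop), Xd_mul (by fun_prop) (by fun_prop),
          Xd_mul (by fun_prop) (by fun_prop), Xd_K, Xd_K, Xd_sq]
        ext y; simp [K]; ring
      rw [a1, a2, a3]; ext y; simp [K]; ring
    have Xψ : Xd ψ = K (-(τ/2 + n/4)) * Xd θ + K (τ/2) * sq := by
      rw [hψ, Xd_add (by fun_prop) (by fun_prop), Xd_mul (by fun_prop) (by fun_prop),
        Xd_mul (by fun_prop) (by fun_prop), Xd_K, Xd_K, Xd_sq]
      ext y; simp [K]; ring
    have lψ : lp ψ = K (-(τ/2 + n/4)) * lp θ + K (τ * n /2) := by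
      have z : ∀ c : ℝ, lp (K c : E n → ℝ) = 0 := by intro c; simp [lp, dd_K, dd_zero]
      have z2 : ∀ (c : ℝ) (F : E n → ℝ), gr (K c : E n → ℝ) F = 0 := by
        intro c F; rw [gr_comm, gr_K]
      rw [hψ, lp_add (by fun_prop) (by fun_prop), lp_mul (by fun_prop) (by fun_prop),
        lp_mul (by fun_prop) (by fun_prop), z, z, z2, z2, lp_sq]
      ext y; simp [K]; ring
    have gomf : gr om f = om * gr f ψ := by
      simp only [gr, Finset.mul_sum, dom]
      exact Finset.sum_congr rfl (fun i _ => by ring)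
    have lom : lp om = om * (lp ψ + gr ψ ψ) := by
      simp only [lp, gr, ← Finset.sum_add_distrib, Finset.mul_sum]
      refine Finset.sum_congr rfl (fun i _ => ?_)
      rw [dom, dd_mul smom (by fun_prop), dom]; ring
    have Xom : Xd om = om * Xd ψ := by
      simp only [Xd, Finset.mul_sum, dom]
      exact Finset.sum_congr rfl (fun i _ => by ring)
    simp only [Sg, Ag]
    rw [lp_mul smom hf, Xd_mul smom hf, gomf, lom, Xom, Xψ, gψf, gψψ, lψ]
    simp only [fb, fq, fa, K, Pi.add_apply, Pi.mul_apply, Pi.sub_apply, Xθ', Pi.ofNat_apply]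
    have e3 : (2 : E n → ℝ) x = 2 := rfl
    linear_combination (-(2 * om x * (τ/2 + n/4))) * gθf + (om x * f x * (τ/2 + n/4)^2) * gθθ
      - (om x * f x * (τ/2 + n/4)) * lθ'

theorem carl1 (hn : 2 ≤ n) {τ : ℝ} (hτ : 2 * (n + 2) ≤ τ) (hf : ContDiff ℝ ∞ f)
    (hc : HasCompactSupport f) (hs : tsupport f ⊆ ball 0 1) (h0 : (0 : E n) ∉ tsupport f) :
    τ ^ 3 * ∫ x, sq x * Wt τ x * f x ^ 2 ≤ ∫ x, sq x ^ 2 * Wt τ x * lp f x ^ 2 := by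
  obtain ⟨om, smom, hom, hid⟩ := conj_id τ hf h0
  have := carl0 τ hn hτ (g := om * f) (by fun_prop) hc.mul_left
    (tsupport_mul_subset_right'.trans hs)
  have e1 : ∫ x, (sq * (om * f) * (om * f) : E n → ℝ) x = ∫ x, sq x * Wt τ x * f x ^ 2 := by
    congr 1; ext x
    by_cases hx : x ∈ tsupport f
    · rw [← hom x hx]; simp only [Pi.mul_apply]; ring
    · simp [image_eq_zero_of_notMem_tsupport hx]
  have e2 : ∫ x, ((Sg τ (om * f) + Ag τ (om * f)) * (Sg τ (om * f) + Ag τ (om * f)) : E n → ℝ) x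
      = ∫ x, sq x ^ 2 * Wt τ x * lp f x ^ 2 := by
    congr 1; ext x
    rw [Pi.mul_apply, hid]
    by_cases hx : x ∈ tsupport f
    · rw [← hom x hx]; ring
    · simp [lp_zero_of_notMem hx]
  rw [e1, e2] at this
  exact this

theorem int_W3 (τ : ℝ) (k : ℕ) (hf : Continuous f) (hc : HasCompactSupport f)
    (h0 : (0 : E n) ∉ tsupport f) : Integrable (fun x => sq x ^ k * Wt τ x * f x ^ 2) := by
  have : (fun x => sq x ^ k * Wt τ x * f x ^ 2) = Wt τ * ((fun x => sq x ^ k * f x) * f) := by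
    ext x; simp only [Pi.mul_apply]; ring
  rw [this]
  refine int_Wt τ ?_ hc.mul_left (fun h => h0 (tsupport_mul_subset_right' h))
  have : Continuous (sq : E n → ℝ) := sm_cont sm_sq
  fun_prop

theorem sqWt (τ : ℝ) {x : E n} (hx : x ≠ 0) :
    Wt (τ - 1) x = sq x * Wt τ x * Real.exp (-(sq x / 2)) := by
  have sp := sq_pos hx
  simp only [Wt]
  have : -(τ - 1) - (n : ℝ) / 2 = 1 + (-τ - n / 2) := by ring
  rw [this, Real.rpow_add sp, Real.rpow_one]
  have e : (τ - 1) * sq x / 2 = τ * sq x / 2 + -(sq x / 2) := by ring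
  rw [e, Real.exp_add]; ring

/-- Carleman estimate for the bi-Laplacian inequality with cut-off -/
theorem carl2 (hn : 2 ≤ n) {τ : ℝ} (hτ : 2 * (n + 2) + 1 ≤ τ) {χ u : E n → ℝ}
    (hχ : ContDiff ℝ ∞ χ) (hu : ContDiff ℝ ∞ u)
    (hc : HasCompactSupport χ) (hs : tsupport χ ⊆ ball 0 1) (h0 : (0 : E n) ∉ tsupport χ)
    (hsol : ∀ x ∈ tsupport χ, |lp (lp u) x| ≤ |u x|) :
    ∫ x, sq x * Wt τ x * (χ x * u x) ^ 2 ≤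
      (∫ x, sq x ^ 2 * Wt τ x * (2 * gr χ u x + lp χ x * u x) ^ 2) +
      ∫ x, sq x ^ 3 * Wt τ x * (2 * gr χ (lp u) x + lp χ x * lp u x) ^ 2 := by
  have ne0 : ∀ x ∈ tsupport χ, x ≠ 0 := by rintro x hx rfl; exact h0 hx
  have tm : ∀ F : E n → ℝ, tsupport (χ * F) ⊆ tsupport χ := by
    intro F; rw [mul_comm]; exact tsupport_mul_subset_right'
  set c1 : E n → ℝ := 2 * gr χ u + lp χ * u with hc1
  set c2 : E n → ℝ := 2 * gr χ (lp u) + lp χ * lp u with hc2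
  have sm2 : ContDiff ℝ ∞ (2 : E n → ℝ) := contDiff_const
  have smc1 : ContDiff ℝ ∞ c1 := by rw [hc1]; fun_prop
  have smc2 : ContDiff ℝ ∞ c2 := by rw [hc2]; fun_prop
  have zc1 : ∀ x ∉ tsupport χ, c1 x = 0 := by
    intro x hx
    have : gr χ u x = 0 := by
      simp only [gr, Finset.sum_apply, Pi.mul_apply]
      refine Finset.sum_eq_zero (fun i _ => ?_)
      rw [image_eq_zero_of_notMem_tsupport (f := dd (ee i) χ) (fun h' => hx (dd_tsupport h'))]
      simp
    simp [hc1, this, lp_zero_of_notMem hx]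
  have zc2 : ∀ x ∉ tsupport χ, c2 x = 0 := by
    intro x hx
    have : gr χ (lp u) x = 0 := by
      simp only [gr, Finset.sum_apply, Pi.mul_apply]
      refine Finset.sum_eq_zero (fun i _ => ?_)
      rw [image_eq_zero_of_notMem_tsupport (f := dd (ee i) χ) (fun h' => hx (dd_tsupport h'))]
      simp
    simp [hc2, this, lp_zero_of_notMem hx]
  have ts : ∀ F : E n → ℝ, (∀ x ∉ tsupport χ, F x = 0) → tsupport F ⊆ tsupport χ := by
    intro F hF
    apply closure_minimal _ (isClosed_tsupport χ)
    intro x hx; by_contra h; exact hx (hF x h)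
  have hcc : ∀ F : E n → ℝ, tsupport F ⊆ tsupport χ → HasCompactSupport F := by
    intro F hF; exact hc.mono' (subset_closure.trans hF)
  have II : ∀ (k : ℕ) (F : E n → ℝ), Continuous F → tsupport F ⊆ tsupport χ →
      Integrable (fun x => sq x ^ k * Wt τ x * F x ^ 2) := fun k F hF ht =>
    int_W3 τ k hF (hcc F ht) (fun h => h0 (ht h))
  -- first estimate
  have k1 := carl1 hn (τ := τ) (f := χ * u) (by linarith) (by fun_prop) (hcc _ (tm u))
    ((tm u).trans hs) (fun h => h0 (tm u h))
  have l1 : lp (χ * u) = χ * lp u + c1 := by rw [lp_mul hχ hu, hc1]; ring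
  have k2 := carl1 hn (τ := τ - 1) (f := χ * lp u) (by linarith) (by fun_prop) (hcc _ (tm _))
    ((tm _).trans hs) (fun h => h0 (tm _ h))
  have l2 : lp (χ * lp u) = χ * lp (lp u) + c2 := by rw [lp_mul hχ (by fun_prop), hc2]; ring
  rw [l1] at k1
  rw [l2] at k2
  have tl1 : tsupport (χ * lp u + c1) ⊆ tsupport χ := ts _ (fun x hx => by
    simp [zc1 x hx, image_eq_zero_of_notMem_tsupport hx])
  have tl2 : tsupport (χ * lp (lp u) + c2) ⊆ tsupport χ := ts _ (fun x hx => by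
    simp [zc2 x hx, image_eq_zero_of_notMem_tsupport hx])
  set P := ∫ x, sq x * Wt τ x * (χ x * u x) ^ 2 with hP
  set Q := ∫ x, sq x ^ 2 * Wt τ x * (χ * lp u : E n → ℝ) x ^ 2 with hQ
  set C1 := ∫ x, sq x ^ 2 * Wt τ x * c1 x ^ 2 with hC1
  set C2 := ∫ x, sq x ^ 3 * Wt τ x * c2 x ^ 2 with hC2
  have P0 : 0 ≤ P := integral_nonneg (fun x => by
    have := sq_nonneg' x; have := Wt_nonneg τ x; positivity)
  have C10 : 0 ≤ C1 := integral_nonneg (fun x => by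
    have := sq_nonneg' x; have := Wt_nonneg τ x; positivity)
  have C20 : 0 ≤ C2 := integral_nonneg (fun x => by
    have := sq_nonneg' x; have := Wt_nonneg τ x; positivity)
  have m1 : ∫ x, sq x ^ 2 * Wt τ x * (χ * lp u + c1 : E n → ℝ) x ^ 2 ≤ 2 * Q + 2 * C1 := by
    rw [hQ, hC1, ← integral_const_mul, ← integral_const_mul,
      ← integral_add ((II 2 (χ * lp u) (by fun_prop) (tm _)).const_mul 2)
        ((II 2 c1 (by fun_prop) (ts _ zc1)).const_mul 2)]
    apply integral_mono (II 2 _ (by fun_prop) tl1)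
    · exact ((II 2 (χ * lp u) (by fun_prop) (tm _)).const_mul 2).add
        ((II 2 c1 (by fun_prop) (ts _ zc1)).const_mul 2)
    · intro x
      have h1 := sq_nonneg' x; have h2 := Wt_nonneg τ x
      have h3 : 0 ≤ sq x ^ 2 * Wt τ x := by positivity
      simp only [Pi.add_apply]
      nlinarith [sq_nonneg ((χ * lp u) x - c1 x), mul_nonneg h3 (sq_nonneg ((χ * lp u) x - c1 x))]
  have iP : Integrable (fun x => sq x * Wt τ x * (χ x * u x) ^ 2) := by
    have := II 1 (χ * u) (by fun_prop) (tm _)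
    simpa using this
  have m2 : ∫ x, sq x ^ 2 * Wt (τ - 1) x * (χ * lp (lp u) + c2 : E n → ℝ) x ^ 2 ≤ 2 * P + 2 * C2 := by
    rw [hP, hC2, ← integral_const_mul, ← integral_const_mul,
      ← integral_add (iP.const_mul 2) ((II 3 c2 (by fun_prop) (ts _ zc2)).const_mul 2)]
    apply integral_mono (int_W3 (τ - 1) 2 (by fun_prop) (hcc _ tl2) (fun h => h0 (tl2 h)))
    · exact (iP.const_mul 2).add ((II 3 c2 (by fun_prop) (ts _ zc2)).const_mul 2)
    · intro x
      simp only
      by_cases hx : x ∈ tsupport χ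
      · rw [sqWt τ (ne0 x hx)]
        have h1 := sq_nonneg' x; have h2 := Wt_nonneg τ x
        have s1 : sq x ≤ 1 := sq_le_one (by simpa using hs hx)
        have e1 : Real.exp (-(sq x / 2)) ≤ 1 := Real.exp_le_one_iff.2 (by linarith)
        have e0 := Real.exp_pos (-(sq x / 2))
        have hb : (χ x * lp (lp u) x) ^ 2 ≤ (χ x * u x) ^ 2 := by
          rw [mul_pow, mul_pow]
          exact mul_le_mul_of_nonneg_left (sq_le_sq.2 (hsol x hx)) (sq_nonneg _)
        have hA : 0 ≤ sq x ^ 3 * Wt τ x := by positivity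
        calc sq x ^ 2 * (sq x * Wt τ x * Real.exp (-(sq x / 2))) * (χ * lp (lp u) + c2 : E n → ℝ) x ^ 2
            = (sq x ^ 3 * Wt τ x) * (χ x * lp (lp u) x + c2 x) ^ 2 * Real.exp (-(sq x / 2)) := by
              simp only [Pi.add_apply, Pi.mul_apply]; ring
          _ ≤ (sq x ^ 3 * Wt τ x) * (χ x * lp (lp u) x + c2 x) ^ 2 :=
              mul_le_of_le_one_right (by positivity) e1
          _ ≤ (sq x ^ 3 * Wt τ x) * (2 * (χ x * u x) ^ 2 + 2 * c2 x ^ 2) := by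
              apply mul_le_mul_of_nonneg_left _ hA
              nlinarith [sq_nonneg (χ x * lp (lp u) x - c2 x)]
          _ ≤ 2 * (sq x * Wt τ x * (χ x * u x) ^ 2) + 2 * (sq x ^ 3 * Wt τ x * c2 x ^ 2) := by
              have : sq x ^ 3 ≤ sq x := by nlinarith [mul_nonneg h1 h1]
              nlinarith [mul_le_mul_of_nonneg_right this (mul_nonneg h2 (sq_nonneg (χ x * u x)))]
      · simp [zc2 x hx, image_eq_zero_of_notMem_tsupport hx]
  have m3 : Q / 2 ≤ ∫ x, sq x * Wt (τ - 1) x * (χ * lp u : E n → ℝ) x ^ 2 := by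
    rw [hQ, ← integral_div]
    have i5 := int_W3 (τ - 1) 1 (f := χ * lp u) (by fun_prop) (hcc _ (tm _)) (fun h => h0 (tm _ h))
    simp only [pow_one] at i5
    apply integral_mono ((II 2 (χ * lp u) (by fun_prop) (tm _)).div_const 2) i5
    intro x
    simp only
    by_cases hx : x ∈ tsupport χ
    · rw [sqWt τ (ne0 x hx)]
      have h1 := sq_nonneg' x; have h2 := Wt_nonneg τ x
      have s1 : sq x ≤ 1 := sq_le_one (by simpa using hs hx)
      have e1 : 1 / 2 ≤ Real.exp (-(sq x / 2)) := by
        have := Real.add_one_le_exp (-(sq x / 2)); linarith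
      have : 0 ≤ sq x ^ 2 * Wt τ x * (χ * lp u) x ^ 2 := by positivity
      nlinarith [mul_le_mul_of_nonneg_left e1 this]
    · simp [image_eq_zero_of_notMem_tsupport hx]
  have hn' : (2 : ℝ) ≤ n := by exact_mod_cast hn
  have t1 : 8 ≤ τ - 1 := by linarith
  have k1' : τ ^ 3 * P ≤ 2 * Q + 2 * C1 := le_trans k1 m1
  have k2' : (τ - 1) ^ 3 * (Q / 2) ≤ 2 * P + 2 * C2 :=
    le_trans (le_trans (mul_le_mul_of_nonneg_left m3 (by positivity)) k2) m2
  have t3 : (8:ℝ) ^ 3 ≤ (τ - 1) ^ 3 := pow_le_pow_left₀ (by norm_num) t1 3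
  have t4 : (8:ℝ) ^ 3 ≤ τ ^ 3 := pow_le_pow_left₀ (by norm_num) (by linarith) 3
  have Q0 : 0 ≤ Q := integral_nonneg (fun x => by
    have := sq_nonneg' x; have := Wt_nonneg τ x; positivity)
  have q1 : 256 * Q ≤ 2 * P + 2 * C2 := by nlinarith
  have q2 : 512 * P ≤ 2 * Q + 2 * C1 := by nlinarith
  have fin : P ≤ C1 + C2 := by linarith
  simpa [hC1, hC2, hc1, hc2] using fin

end BL
end

open MeasureTheory Metric Set
noncomputable section
namespace BL
set_option linter.unusedVariables false
set_option linter.unusedSimpArgs false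
open scoped ContDiff

variable {n : ℕ} {v w : E n} {f g h : E n → ℝ}

theorem dd_comp_sq {H H' : ℝ → ℝ} (hd : ∀ s, HasDerivAt H (H' s) s) (i : Fin n) :
    dd (ee i) (fun x : E n => H (sq x)) = K 2 * co i * fun x => H' (sq x) := by
  ext x
  have h1 := (hd (sq x)).comp_hasFDerivAt x (sm_diff (sm_sq (n := n)) x).hasFDerivAt
  have h2 := congrFun (dd_sq i) x
  simp only [dd] at h2 ⊢
  rw [HasFDerivAt.fderiv (f := fun x : E n => H (sq x)) h1]
  simp only [Pi.mul_apply, _root_.smul_apply, h2, smul_eq_mul]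
  ring

theorem lp_comp_sq {H H' H'' : ℝ → ℝ} (hd : ∀ s, HasDerivAt H (H' s) s)
    (hd' : ∀ s, HasDerivAt H' (H'' s) s) (hH' : ContDiff ℝ ∞ H') :
    lp (fun x : E n => H (sq x)) = fun x => 4 * sq x * H'' (sq x) + 2 * n * H' (sq x) := by
  have sm : ContDiff ℝ ∞ (fun x : E n => H' (sq x)) := hH'.comp sm_sq
  have : ∀ i : Fin n, dd (ee i) (dd (ee i) (fun x : E n => H (sq x)))
      = K 2 * (fun x => H' (sq x)) + K 4 * (fun x => H'' (sq x)) * (co i * co i) := by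
    intro i
    rw [dd_comp_sq hd, dd_mul (by fun_prop) sm, dd_mul (by fun_prop) (by fun_prop), dd_K, dd_co,
      dd_comp_sq hd']
    ext x; simp [K]; ring
  simp only [lp, this, Finset.sum_add_distrib, ← Finset.mul_sum, ← sq_eq]
  ext x; simp [K]; ring

theorem moll (hn : 1 ≤ n) : ∃ Ψ ψ : E n → ℝ, ContDiff ℝ ∞ Ψ ∧ ContDiff ℝ ∞ ψ ∧
    tsupport Ψ ⊆ closedBall 0 (1/2) ∧ tsupport ψ ⊆ closedBall 0 (1/2) ∧ ∫ x, ψ x = 1 ∧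
    ∀ i, co i * ψ = - dd (ee i) (lp Ψ) := by
  let b : ContDiffBump (0 : ℝ) := ⟨1/8, 1/4, by norm_num, by norm_num⟩
  have smb : ContDiff ℝ ∞ (fun x => b x) := b.contDiff
  have cb : Continuous (fun x => b x) := smb.continuous
  set B1 : ℝ → ℝ := fun s => ∫ t in (1:ℝ)..s, b t with hB1
  have dB1 : ∀ s, HasDerivAt B1 (b s) s := fun s =>
    intervalIntegral.integral_hasDerivAt_right (cb.intervalIntegrable _ _)
      cb.stronglyMeasurable.stronglyMeasurableAtFilter cb.continuousAt
  have smB1 : ContDiff ℝ ∞ B1 := by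
    rw [contDiff_infty_iff_deriv]
    refine ⟨fun s => (dB1 s).differentiableAt, ?_⟩
    have : deriv B1 = fun s => b s := funext (fun s => (dB1 s).deriv)
    rw [this]; exact smb
  have cB1 := smB1.continuous
  set B2 : ℝ → ℝ := fun s => ∫ t in (1:ℝ)..s, B1 t with hB2
  have dB2 : ∀ s, HasDerivAt B2 (B1 s) s := fun s =>
    intervalIntegral.integral_hasDerivAt_right (cB1.intervalIntegrable _ _)
      cB1.stronglyMeasurable.stronglyMeasurableAtFilter cB1.continuousAt
  have smB2 : ContDiff ℝ ∞ B2 := by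
    rw [contDiff_infty_iff_deriv]
    refine ⟨fun s => (dB2 s).differentiableAt, ?_⟩
    have : deriv B2 = B1 := funext (fun s => (dB2 s).deriv)
    rw [this]; exact smB1
  set b' : ℝ → ℝ := deriv (fun x => b x) with hb'
  have db : ∀ s, HasDerivAt (fun x => b x) (b' s) s := fun s =>
    (smb.differentiable (by simp) s).hasDerivAt
  have smb' : ContDiff ℝ ∞ b' := (contDiff_infty_iff_deriv.1 smb).2
  have zb : ∀ s, 1/4 ≤ s → b s = 0 := by
    intro s hs; apply b.zero_of_le_dist
    rw [Real.dist_eq, sub_zero, abs_of_nonneg (by linarith)]; exact hs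
  have zB1 : ∀ s, 1/4 ≤ s → B1 s = 0 := by
    intro s hs
    simp only [hB1]
    rw [intervalIntegral.integral_congr (g := fun _ => 0)]; · simp
    intro t ht
    refine zb t ?_
    rcases le_total 1 s with h | h
    · rw [uIcc_of_le h] at ht; linarith [ht.1]
    · rw [uIcc_of_ge h] at ht; linarith [ht.1]
  have zB2 : ∀ s, 1/4 ≤ s → B2 s = 0 := by
    intro s hs
    simp only [hB2]
    rw [intervalIntegral.integral_congr (g := fun _ => 0)]; · simp
    intro t ht
    refine zB1 t ?_
    rcases le_total 1 s with h | h
    · rw [uIcc_of_le h] at ht; linarith [ht.1]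
    · rw [uIcc_of_ge h] at ht; linarith [ht.1]
  have zb' : ∀ s, 1/4 < s → b' s = 0 := by
    intro s hs
    have : (fun x => b x) =ᶠ[nhds s] fun _ => 0 := by
      filter_upwards [Ioi_mem_nhds hs] with t ht using zb t (le_of_lt ht)
    simp only [hb']
    rw [this.deriv_eq]; simp
  set L : ℝ → ℝ := fun s => 4 * s * b s + 2 * n * B1 s with hL
  set L' : ℝ → ℝ := fun s => (4 * b s + 4 * s * b' s) + 2 * n * b s with hL'
  have dL : ∀ s, HasDerivAt L (L' s) s := by
    intro s
    have h1 : HasDerivAt (fun s : ℝ => 4 * s) (4 * 1) s := (hasDerivAt_id s).const_mul 4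
    have := (h1.mul (db s)).add ((dB1 s).const_mul (2 * (n:ℝ)))
    have e : L' s = 4 * 1 * b s + 4 * s * b' s + 2 * n * b s := by simp only [hL']; ring
    rw [e]; exact this
  have smL' : ContDiff ℝ ∞ L' := by
    simp only [hL']; fun_prop
  set Ψ : E n → ℝ := fun x => B2 (sq x) with hΨ
  have smΨ : ContDiff ℝ ∞ Ψ := smB2.comp sm_sq
  have lΨ : lp Ψ = fun x => L (sq x) := by
    rw [hΨ, lp_comp_sq dB2 dB1 smB1]
  have dlΨ : ∀ i, dd (ee i) (lp Ψ) = K 2 * co i * fun x => L' (sq x) := by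
    intro i; rw [lΨ, dd_comp_sq dL]
  set ψ : E n → ℝ := K (-2) * fun x => L' (sq x) with hψ
  have smψ : ContDiff ℝ ∞ ψ := by
    have : ContDiff ℝ ∞ (fun x : E n => L' (sq x)) := smL'.comp sm_sq
    rw [hψ]; fun_prop
  have hx14 : ∀ x : E n, x ∉ closedBall (0 : E n) (1/2) → 1/4 < sq x := by
    intro x hx
    simp only [mem_closedBall, dist_zero_right, not_le] at hx
    simp only [sq]; nlinarith
  have tΨ : tsupport Ψ ⊆ closedBall 0 (1/2) := by
    apply closure_minimal _ isClosed_closedBall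
    intro x hx
    by_contra h; exact hx (zB2 _ (hx14 x h).le)
  have tψ : tsupport ψ ⊆ closedBall 0 (1/2) := by
    apply closure_minimal _ isClosed_closedBall
    intro x hx
    by_contra h; apply hx
    simp [hψ, hL', zb _ (hx14 x h).le, zb' _ (hx14 x h)]
  -- the integral
  set β : E n → ℝ := fun x => b (sq x) with hβ
  have smβ : ContDiff ℝ ∞ β := smb.comp sm_sq
  have tβ : tsupport β ⊆ closedBall 0 (1/2) := by
    apply closure_minimal _ isClosed_closedBall
    intro x hx
    by_contra h; exact hx (zb _ (hx14 x h).le)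
  have cβ : HasCompactSupport β := HasCompactSupport.of_support_subset_isCompact
    (isCompact_closedBall (0 : E n) (1/2)) (subset_closure.trans tβ)
  have Xβ : Xd β = K 2 * sq * fun x => b' (sq x) := by
    simp only [Xd, hβ]
    have : ∀ i : Fin n, co i * dd (ee i) (fun x : E n => b (sq x))
        = (K 2 * fun x => b' (sq x)) * (co i * co i) := by
      intro i
      rw [dd_comp_sq (H := fun s => b s) db]; ring
    rw [Finset.sum_congr rfl (fun i _ => this i), ← Finset.mul_sum, ← sq_eq]; ring
  have iβ := int_Xd smβ cβ
  have eψ : ψ = (-4 : ℝ) • (Xd β + K n * β) + (-8 : ℝ) • β := by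
    rw [Xβ]; ext x; simp [hψ, hL', hβ, K]; ring
  have i0 : ∫ x, ψ x = -8 * ∫ x, β x := by
    rw [eψ]
    have j1 : Integrable (Xd β + K n * β) := integrable_cs (by fun_prop) ((Xd_hcs cβ).add cβ.mul_left)
    rw [integral_add' (j1.smul (-4 : ℝ)) ((integrable_cs (by fun_prop) cβ).smul (-8 : ℝ))]
    simp only [Pi.smul_apply, integral_smul, iβ]
    simp
  have βpos : 0 < ∫ x, β x := by
    rw [integral_pos_iff_support_of_nonneg (fun x => b.nonneg) (integrable_cs (by fun_prop) cβ)]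
    refine (IsOpen.measure_pos volume (smβ.continuous.isOpen_support) ⟨0, ?_⟩)
    simp only [Function.mem_support, hβ, sq]
    rw [b.one_of_mem_closedBall (by simp [b])]
    norm_num
  set c := ∫ x, ψ x with hc
  have c0 : c ≠ 0 := by rw [i0]; have := βpos.ne'; simp [this]
  refine ⟨c⁻¹ • Ψ, c⁻¹ • ψ, by fun_prop, by fun_prop, ?_, ?_, ?_, ?_⟩
  · exact (closure_mono (Function.support_const_smul_subset _ _)).trans tΨ
  · exact (closure_mono (Function.support_const_smul_subset _ _)).trans tψ
  · change ∫ x, c⁻¹ * ψ x = 1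
    rw [integral_const_mul, ← hc]; exact inv_mul_cancel₀ c0
  · intro i
    rw [lp_smul _ smΨ, dd_smul _ (by fun_prop), dlΨ, hψ]
    ext x; simp [K]; ring

/-- differentiating a compactly supported parametric integral -/
theorem param_deriv {F F' : ℝ → E n → ℝ} (hF : Continuous (Function.uncurry F))
    (hF' : Continuous (Function.uncurry F')) (hd : ∀ s z, HasDerivAt (fun t => F t z) (F' s z) s)
    (hz : ∀ s z, z ∉ closedBall (0 : E n) 1 → F s z = 0) (s : ℝ) :
    HasDerivAt (fun t => ∫ z, F t z) (∫ z, F' s z) s := by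
  have hz' : ∀ s z, z ∉ closedBall (0 : E n) 1 → F' s z = 0 := by
    intro s z h
    have : (fun t => F t z) = fun _ => 0 := funext (fun t => hz t z h)
    have h2 := hd s z
    rw [this] at h2
    exact h2.unique (hasDerivAt_const _ _)
  have cF : ∀ t, Continuous (F t) := fun t => hF.comp (by fun_prop : Continuous (fun z => (t, z)))
  have cF' : ∀ t, Continuous (F' t) := fun t => hF'.comp (by fun_prop : Continuous (fun z => (t, z)))
  obtain ⟨C, hC⟩ := ((isCompact_Icc (a := s - 1) (b := s + 1)).prod
    (isCompact_closedBall (0 : E n) 1)).exists_bound_of_continuousOn hF'.continuousOn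
  have cs : HasCompactSupport (F s) := HasCompactSupport.of_support_subset_isCompact
    (isCompact_closedBall (0 : E n) 1) (fun z hz1 => by
      by_contra h; exact hz1 (hz s z h))
  refine (hasDerivAt_integral_of_dominated_loc_of_deriv_le (F := F) (F' := F')
    (bound := (closedBall (0 : E n) 1).indicator (fun _ => C)) (s := Icc (s-1) (s+1))
    (Icc_mem_nhds (by linarith) (by linarith)) ?_ ?_ ?_ ?_ ?_ ?_).2
  · exact Filter.Eventually.of_forall (fun t => (cF t).aestronglyMeasurable)
  · exact integrable_cs (cF s) cs
  · exact (cF' s).aestronglyMeasurable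
  · refine Filter.Eventually.of_forall (fun z t ht => ?_)
    by_cases h : z ∈ closedBall (0 : E n) 1
    · rw [indicator_of_mem h]; exact hC (t, z) ⟨ht, h⟩
    · rw [indicator_of_notMem h, hz' t z h]; simp
  · refine (integrable_indicator_iff isClosed_closedBall.measurableSet).2 ?_
    exact integrableOn_const (isCompact_closedBall (0 : E n) 1).measure_lt_top.ne
  · exact Filter.Eventually.of_forall (fun z t ht => hd t z)

/-- averages -/
def Av (ρ : ℝ) (φ f : E n → ℝ) (x : E n) : ℝ := ∫ z, f (x + ρ • z) * φ z

def Moll (φ : E n → ℝ) : Prop := ContDiff ℝ ∞ φ ∧ tsupport φ ⊆ closedBall 0 (1/2)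

theorem Moll.hcs {φ : E n → ℝ} (h : Moll φ) : HasCompactSupport φ :=
  HasCompactSupport.of_support_subset_isCompact (isCompact_closedBall (0 : E n) (1/2))
    (subset_closure.trans h.2)

theorem Moll.zero {φ : E n → ℝ} (h : Moll φ) {z : E n} (hz : z ∉ closedBall (0 : E n) 1) : φ z = 0 := by
  apply image_eq_zero_of_notMem_tsupport
  intro h1; exact hz (closedBall_subset_closedBall (by norm_num) (h.2 h1))

theorem Moll.dd {φ : E n → ℝ} (h : Moll φ) : Moll (dd v φ) :=
  ⟨by have := h.1; fun_prop, dd_tsupport.trans h.2⟩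

theorem Av_int {φ : E n → ℝ} (h : Moll φ) (hf : Continuous f) (ρ : ℝ) (x : E n) :
    Integrable (fun z => f (x + ρ • z) * φ z) :=
  integrable_cs (f := (fun z => f (x + ρ • z)) * φ) (by have := h.1.continuous; fun_prop) h.hcs.mul_left

theorem Av_le {φ : E n → ℝ} (h : Moll φ) (hf : Continuous f) {ρ B : ℝ} {x : E n} (hρ : 0 < ρ)
    (hB : ∀ y ∈ ball x ρ, |f y| ≤ B) : |Av ρ φ f x| ≤ B * ∫ z, |φ z| := by
  unfold Av
  rw [← integral_const_mul]
  refine (abs_integral_le_integral_abs).trans ?_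
  apply integral_mono (Av_int h hf ρ x).abs ((integrable_cs h.1.continuous h.hcs).abs.const_mul B)
  intro z
  simp only [abs_mul]
  by_cases hz : z ∈ tsupport φ
  · apply mul_le_mul_of_nonneg_right _ (abs_nonneg _)
    apply hB
    have := h.2 hz
    simp only [mem_closedBall, dist_zero_right] at this
    simp only [mem_ball, dist_self_add_left, norm_smul, Real.norm_eq_abs, abs_of_pos hρ]
    nlinarith
  · simp [image_eq_zero_of_notMem_tsupport hz]

theorem Av_ibp {φ : E n → ℝ} (h : Moll φ) (hf : ContDiff ℝ ∞ f) (ρ : ℝ) (x : E n) :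
    ρ * Av ρ φ (dd v f) x = - Av ρ (dd v φ) f x := by
  have := ibp (v := v) (f := fun z => f (x + ρ • z)) (g := φ) (by fun_prop) h.1 h.hcs
  rw [dd_comp_smul_add hf] at this
  unfold Av
  rw [← this, ← integral_const_mul]
  congr 1; ext z; ring

theorem Av_hasDeriv {φ : E n → ℝ} (h : Moll φ) (hf : ContDiff ℝ ∞ f) (ρ : ℝ) (x : E n) :
    HasDerivAt (fun t => Av t φ f x) (∫ z, fderiv ℝ f (x + ρ • z) z * φ z) ρ := by
  unfold Av
  have c1 := h.1.continuous
  have c2 := hf.continuous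
  have c3 : Continuous (fderiv ℝ f) := hf.continuous_fderiv (by simp)
  refine param_deriv (F := fun t z => f (x + t • z) * φ z)
    (F' := fun t z => fderiv ℝ f (x + t • z) z * φ z) ?_ ?_ ?_ ?_ ρ
  · simp only [Function.uncurry_def]; fun_prop
  · simp only [Function.uncurry_def]
    refine Continuous.mul ?_ (by fun_prop)
    exact (c3.comp (by fun_prop)).clm_apply (by fun_prop)
  · intro s z
    refine HasDerivAt.mul_const ?_ _
    have h1 : HasDerivAt (fun t : ℝ => x + t • z) ((1 : ℝ) • z) s :=
      ((hasDerivAt_id s).smul_const z).const_add x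
    have := (sm_diff hf (x + s • z)).hasFDerivAt.comp_hasDerivAt s h1
    rw [one_smul] at this; exact this
  · intro s z hz; simp [h.zero hz]

theorem fderiv_eq_sum (x z : E n) : fderiv ℝ f x z = ∑ i, z i * dd (ee i) f x := by
  have : z = ∑ i, z i • ee i := by
    ext j; simp [ee, Pi.single_apply]
  conv_lhs => rw [this]
  simp only [map_sum, map_smul, dd, smul_eq_mul]

/-- representation formula -/
theorem rep {Ψ ψ : E n → ℝ} (h1 : Moll Ψ) (h2 : Moll ψ) (h3 : ∫ x, ψ x = 1)
    (h4 : ∀ i, co i * ψ = - dd (ee i) (lp Ψ)) (hf : ContDiff ℝ ∞ f) (x : E n) (ρ : ℝ) :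
    Av ρ ψ f x - f x = ∫ s in (0:ℝ)..ρ, s ^ 3 * Av s Ψ (lp (lp f)) x := by
  have hd : ∀ s, HasDerivAt (fun t => Av t ψ f x) (s ^ 3 * Av s Ψ (lp (lp f)) x) s := by
    intro s
    convert Av_hasDeriv h2 hf s x using 1
    set fs : E n → ℝ := fun z => f (x + s • z) with hfs
    have smfs : ContDiff ℝ ∞ fs := by rw [hfs]; fun_prop
    have smΨ := h1.1
    have e1 : ∀ z, fderiv ℝ f (x + s • z) z * ψ z = - ∑ i, dd (ee i) f (x + s • z) * dd (ee i) (lp Ψ) z := by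
      intro z
      rw [fderiv_eq_sum, Finset.sum_mul, ← Finset.sum_neg_distrib]
      refine Finset.sum_congr rfl (fun i _ => ?_)
      have := congrFun (h4 i) z
      simp only [Pi.mul_apply, co, Pi.neg_apply] at this
      linear_combination (dd (ee i) f (x + s • z)) * this
    simp only [e1]
    rw [integral_neg, integral_finsetSum]
    · have e2 : ∀ i, ∫ z, dd (ee i) f (x + s • z) * dd (ee i) (lp Ψ) z
          = - (s * ∫ z, dd (ee i) (dd (ee i) f) (x + s • z) * lp Ψ z) := by
        intro i
        have := ibp (v := ee i) (f := fun z => dd (ee i) f (x + s • z)) (g := lp Ψ) (by fun_prop)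
          (by fun_prop) (lp_hcs h1.hcs)
        rw [dd_comp_smul_add (by fun_prop)] at this
        rw [← integral_const_mul]
        simp only [mul_assoc] at this ⊢
        rw [this]; simp
      simp only [e2]
      rw [Finset.sum_neg_distrib, neg_neg, ← Finset.mul_sum, ← integral_finsetSum]
      · have e3 : ∀ z, ∑ i, dd (ee i) (dd (ee i) f) (x + s • z) * lp Ψ z = lp f (x + s • z) * lp Ψ z := by
          intro z; rw [← Finset.sum_mul]; simp [lp]
        simp only [e3]
        have := lp_symm (f := fun z => lp f (x + s • z)) (g := Ψ) (by fun_prop) h1.1 h1.hcs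
        rw [lp_comp_smul_add (by fun_prop)] at this
        rw [← this]
        unfold Av
        simp only [mul_assoc]
        rw [integral_const_mul]; ring
      · intro i _
        exact integrable_cs (f := (fun z => dd (ee i) (dd (ee i) f) (x + s • z)) * lp Ψ)
          (by fun_prop) (lp_hcs h1.hcs).mul_left
    · intro i _
      exact integrable_cs (f := (fun z => dd (ee i) f (x + s • z)) * dd (ee i) (lp Ψ))
          (by fun_prop) (dd_hcs (lp_hcs h1.hcs)).mul_left
  have cont : Continuous (fun s => s ^ 3 * Av s Ψ (lp (lp f)) x) := by
    have : Continuous (fun s => Av s Ψ (lp (lp f)) x) :=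
      continuous_iff_continuousAt.2 (fun s => (Av_hasDeriv h1 (by fun_prop) s x).continuousAt)
    fun_prop
  rw [intervalIntegral.integral_eq_sub_of_hasDerivAt (fun s _ => hd s) (cont.intervalIntegrable _ _)]
  congr 1
  simp [Av, integral_const_mul, h3]

end BL
end

open MeasureTheory Metric Set
noncomputable section
namespace BL
set_option linter.unusedVariables false
set_option linter.unusedSimpArgs false
open scoped ContDiff

variable {n : ℕ} {v w : E n} {f g h : E n → ℝ}

/-- iterated partial derivatives -/
def pl : List (Fin n) → (E n → ℝ) → E n → ℝ
  | [], f => f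
  | i :: l, f => dd (ee i) (pl l f)

theorem sm_pl (hf : ContDiff ℝ ∞ f) (l : List (Fin n)) : ContDiff ℝ ∞ (pl l f) := by
  induction l with
  | nil => exact hf
  | cons i l ih => simp only [pl]; fun_prop

theorem dd_pl (hf : ContDiff ℝ ∞ f) (l : List (Fin n)) : dd v (pl l f) = pl l (dd v f) := by
  induction l with
  | nil => rfl
  | cons i l ih => simp only [pl]; rw [dd_comm (sm_pl hf l), ih]

theorem pl_lp (hf : ContDiff ℝ ∞ f) (l : List (Fin n)) : lp (pl l f) = pl l (lp f) := by
  induction l with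
  | nil => rfl
  | cons i l ih => simp only [pl]; rw [lp_dd (sm_pl hf l), ih]

theorem Av_pl (l : List (Fin n)) : ∀ {φ : E n → ℝ}, Moll φ → ∃ φ', Moll φ' ∧
    ∀ (f : E n → ℝ), ContDiff ℝ ∞ f → ∀ s x, s ^ l.length * Av s φ (pl l f) x = Av s φ' f x := by
  induction l with
  | nil => intro φ h; exact ⟨φ, h, fun f hf s x => by simp [pl]⟩
  | cons i l ih =>
    intro φ h
    obtain ⟨φ', h', H⟩ := ih (φ := dd (ee i) φ) h.dd
    refine ⟨-φ', ⟨h'.1.neg, by rw [tsupport_neg]; exact h'.2⟩, fun f hf s x => ?_⟩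
    have h1 := Av_ibp (v := ee i) h (sm_pl hf l) s x
    have h2 := H f hf s x
    simp only [pl, List.length_cons, pow_succ]
    have h3 : Av s (-φ') f x = - Av s φ' f x := by
      simp only [Av, Pi.neg_apply, mul_neg, integral_neg]
    rw [h3, ← h2, mul_assoc, h1]; ring

theorem Av_contin {φ : E n → ℝ} (h : Moll φ) (hf : ContDiff ℝ ∞ f) (x : E n) :
    Continuous (fun s => Av s φ f x) :=
  continuous_iff_continuousAt.2 (fun s => (Av_hasDeriv h hf s x).continuousAt)

/-- approximation of derivatives by averages -/
theorem der_approx (hn : 1 ≤ n) : ∃ ψ : E n → ℝ, Moll ψ ∧ ∫ x, ψ x = 1 ∧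
    ∀ l : List (Fin n), l.length ≤ 3 → ∃ C : ℝ, 0 < C ∧ 
    ∀ (f : E n → ℝ), ContDiff ℝ ∞ f → ∀ (x : E n) (ρ B : ℝ), 0 < ρ → 
      (∀ y ∈ ball x ρ, |lp (lp f) y| ≤ B) →
      ρ ^ l.length * |pl l f x - Av ρ ψ (pl l f) x| ≤ C * (ρ ^ 4 * B) := by
  obtain ⟨Ψ, ψ, s1, s2, t1, t2, i1, h4⟩ := moll hn
  have m1 : Moll Ψ := ⟨s1, t1⟩
  have m2 : Moll ψ := ⟨s2, t2⟩
  refine ⟨ψ, m2, i1, fun l hl => ?_⟩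
  obtain ⟨φ, mφ, H⟩ := Av_pl l m1
  refine ⟨(∫ z, |φ z|) + 1, by positivity, fun f hf x ρ B hρ hB => ?_⟩
  have B0 : 0 ≤ B := (abs_nonneg _).trans (hB x (mem_ball_self hρ))
  have r := rep m1 m2 i1 h4 (sm_pl hf l) x ρ
  rw [abs_sub_comm, r, pl_lp hf, pl_lp (by fun_prop)]
  have smF : ContDiff ℝ ∞ (lp (lp f)) := by fun_prop
  have key : ∀ s ∈ uIoc 0 ρ, ‖s ^ 3 * Av s Ψ (pl l (lp (lp f))) x‖ ≤ ρ ^ (3 - l.length) * (B * ∫ z, |φ z|) := by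
    intro s hs
    rw [uIoc_of_le hρ.le] at hs
    have e : s ^ 3 = s ^ (3 - l.length) * s ^ l.length := by rw [← pow_add]; congr 1; omega
    rw [e, mul_assoc, H _ smF, Real.norm_eq_abs, abs_mul, abs_of_nonneg (pow_nonneg hs.1.le _)]
    apply mul_le_mul (pow_le_pow_left₀ hs.1.le hs.2 _) _ (abs_nonneg _) (by positivity)
    exact Av_le mφ smF.continuous hs.1 (fun y hy => hB y (ball_subset_ball hs.2 hy))
  have k2 := intervalIntegral.norm_integral_le_of_norm_le_const key
  rw [Real.norm_eq_abs, sub_zero, abs_of_pos hρ] at k2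
  calc _ ≤ ρ ^ l.length * (ρ ^ (3 - l.length) * (B * ∫ z, |φ z|) * ρ) := by gcongr
    _ = (ρ ^ l.length * ρ ^ (3 - l.length) * ρ) * B * ∫ z, |φ z| := by ring
    _ = ρ ^ 4 * B * ∫ z, |φ z| := by
        congr 2; rw [← pow_add, ← pow_succ]; congr 1; omega
    _ ≤ _ := by nlinarith [show 0 ≤ ρ ^ 4 * B by positivity]

/-- derivative bounds -/
theorem der_bd (hn : 1 ≤ n) : ∃ C : ℝ, 0 < C ∧ ∀ l : List (Fin n), l.length ≤ 3 →
    ∀ (f : E n → ℝ), ContDiff ℝ ∞ f → ∀ (x : E n) (ρ A B : ℝ), 0 < ρ → (∀ y ∈ ball x ρ, |f y| ≤ A) →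
      (∀ y ∈ ball x ρ, |lp (lp f) y| ≤ B) → ρ ^ l.length * |pl l f x| ≤ C * (A + ρ ^ 4 * B) := by
  obtain ⟨ψ, mψ, i1, H⟩ := der_approx hn
  have : ∀ l : List (Fin n), l.length ≤ 3 → ∃ C : ℝ, 0 < C ∧ 
    ∀ (f : E n → ℝ), ContDiff ℝ ∞ f → ∀ (x : E n) (ρ A B : ℝ), 0 < ρ → (∀ y ∈ ball x ρ, |f y| ≤ A) →
      (∀ y ∈ ball x ρ, |lp (lp f) y| ≤ B) → ρ ^ l.length * |pl l f x| ≤ C * (A + ρ ^ 4 * B) := by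
    intro l hl
    obtain ⟨C, C0, hC⟩ := H l hl
    obtain ⟨φ, mφ, hφ⟩ := Av_pl l mψ
    refine ⟨C + ∫ z, |φ z|, by positivity, fun f hf x ρ A B hρ hA hB => ?_⟩
    have B0 : 0 ≤ B := (abs_nonneg _).trans (hB x (mem_ball_self hρ))
    have A0 : 0 ≤ A := (abs_nonneg _).trans (hA x (mem_ball_self hρ))
    have h1 := hC f hf x ρ B hρ hB
    have h2 := Av_le mφ hf.continuous hρ hA
    rw [← hφ f hf, abs_mul, abs_of_pos (by positivity : 0 < ρ ^ l.length)] at h2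
    have h3 : ρ ^ l.length * |pl l f x| ≤ ρ ^ l.length * |pl l f x - Av ρ ψ (pl l f) x| +
        ρ ^ l.length * |Av ρ ψ (pl l f) x| := by
      rw [← mul_add]; gcongr
      have := abs_add_le (pl l f x - Av ρ ψ (pl l f) x) (Av ρ ψ (pl l f) x)
      simpa using this
    have h4 : 0 ≤ ∫ z, |φ z| := integral_nonneg (fun z => abs_nonneg _)
    nlinarith [mul_nonneg h4 (by positivity : 0 ≤ ρ ^ 4 * B), mul_nonneg C0.le A0]
  choose! c c0 hc using this
  have fin : {l : List (Fin n) | l.length ≤ 3}.Finite := List.finite_length_le _ _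
  refine ⟨1 + ∑ l ∈ fin.toFinset, c l, ?_, ?_⟩
  · have : 0 ≤ ∑ l ∈ fin.toFinset, c l := Finset.sum_nonneg (fun l hl => (c0 l (by simpa using hl)).le)
    positivity
  · intro l hl f hf x ρ A B hρ hA hB
    have B0 : 0 ≤ B := (abs_nonneg _).trans (hB x (mem_ball_self hρ))
    have A0 : 0 ≤ A := (abs_nonneg _).trans (hA x (mem_ball_self hρ))
    refine (hc l hl f hf x ρ A B hρ hA hB).trans ?_
    apply mul_le_mul_of_nonneg_right _ (by positivity)
    have := Finset.single_le_sum (f := c) (fun l hl => (c0 l (by simpa using hl)).le)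
      (show l ∈ fin.toFinset by simpa using hl)
    linarith

theorem lp_pl (f : E n → ℝ) : lp f = ∑ i, pl [i, i] f := by
  simp [lp, pl]

end BL
end

open MeasureTheory Metric Set
noncomputable section
namespace BL
set_option linter.unusedVariables false
set_option linter.unusedSimpArgs false
open scoped ContDiff

variable {n : ℕ} {v w : E n} {f g h u : E n → ℝ}

def Sol (u : E n → ℝ) (x : E n) (S : ℝ) : Prop :=
  ContDiff ℝ ∞ u ∧ ∀ y ∈ ball x S, |lp (lp u) y| ≤ |u y|

def M (u : E n → ℝ) (x : E n) (r : ℝ) : ℝ := supAbs u (ball x r)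

theorem M_bdd (hu : Continuous u) (x : E n) (r : ℝ) : BddAbove ((fun y => |u y|) '' ball x r) := by
  have := (isCompact_closedBall x r).bddAbove_image (f := fun y => |u y|) (by fun_prop)
  exact this.mono (image_mono ball_subset_closedBall)

theorem le_M (hu : Continuous u) {x y : E n} {r : ℝ} (hy : y ∈ ball x r) : |u y| ≤ M u x r :=
  le_csSup (M_bdd hu x r) ⟨y, hy, rfl⟩

theorem M_le {x : E n} {r B : ℝ} (hr : 0 < r) (h : ∀ y ∈ ball x r, |u y| ≤ B) : M u x r ≤ B := by
  refine csSup_le (Set.Nonempty.image _ ⟨x, mem_ball_self hr⟩) ?_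
  rintro _ ⟨y, hy, rfl⟩; exact h y hy

theorem M_nonneg (x : E n) (r : ℝ) : 0 ≤ M u x r := by
  apply Real.sSup_nonneg
  rintro _ ⟨y, hy, rfl⟩; exact abs_nonneg _

theorem M_sub (hu : Continuous u) {x y : E n} {r s : ℝ} (h : ball x r ⊆ ball y s) : M u x r ≤ M u y s := by
  apply Real.sSup_le _ (M_nonneg _ _)
  rintro _ ⟨z, hz, rfl⟩; exact le_M hu (h hz)

theorem M_mono (hu : Continuous u) {x : E n} {r s : ℝ} (h : r ≤ s) : M u x r ≤ M u x s :=
  M_sub hu (ball_subset_ball h)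

theorem Av_sq {φ : E n → ℝ} (h : Moll φ) (hf : Continuous f) {ρ : ℝ} (hρ : 0 < ρ) (x : E n) :
    (Av ρ φ f x) ^ 2 ≤ (∫ z, φ z ^ 2) * ((ρ ^ n)⁻¹ * ∫ y in ball x ρ, f y ^ 2) := by
  set G : E n → ℝ := (ball x ρ).indicator (fun y => f y ^ 2) with hG
  set I := ∫ z, G (x + ρ • z) with hI
  have c1 := h.1.continuous
  have iG : Integrable G := by
    rw [hG, integrable_indicator_iff measurableSet_ball]
    exact ((hf.pow 2).continuousOn.integrableOn_compact (isCompact_closedBall x ρ)).mono_set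
      ball_subset_closedBall
  have eI : I = (ρ ^ n)⁻¹ * ∫ y in ball x ρ, f y ^ 2 := by
    rw [hI, Measure.integral_comp_smul volume (fun w => G (x + w)) ρ,
      integral_add_left_eq_self, hG, integral_indicator measurableSet_ball, finrank_euclideanSpace,
      Fintype.card_fin, abs_of_pos (by positivity), smul_eq_mul]
  rw [← eI]
  have iG2 : Integrable (fun z => G (x + ρ • z)) :=
    ((integrable_comp_smul_iff volume (fun w => G (x + w)) hρ.ne').2 (iG.comp_add_left x))
  have iA := Av_int h hf ρ x
  have iφ : Integrable (fun z => φ z ^ 2) := by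
    have := integrable_cs (f := φ * φ) (by fun_prop) h.hcs.mul_left
    refine this.congr (Filter.Eventually.of_forall fun z => ?_)
    simp [pow_two]
  have key : ∀ t : ℝ, 0 ≤ I * (t * t) + (-2 * Av ρ φ f x) * t + ∫ z, φ z ^ 2 := by
    intro t
    have : 0 ≤ ∫ z, (t ^ 2 * G (x + ρ • z) - (2 * t) * (f (x + ρ • z) * φ z) + φ z ^ 2) := by
      apply integral_nonneg
      intro z
      simp only [Pi.zero_apply]
      by_cases hz : z ∈ tsupport φ
      · have h2 : x + ρ • z ∈ ball x ρ := by
          have := h.2 hz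
          simp only [mem_closedBall, dist_zero_right] at this
          simp only [mem_ball, dist_self_add_left, norm_smul, Real.norm_eq_abs, abs_of_pos hρ]
          nlinarith
        rw [hG, indicator_of_mem h2]
        nlinarith [sq_nonneg (t * f (x + ρ • z) - φ z)]
      · rw [image_eq_zero_of_notMem_tsupport hz]
        have : 0 ≤ G (x + ρ • z) := indicator_nonneg (fun _ _ => by positivity) _
        have := mul_nonneg (sq_nonneg t) this
        simpa using this
    rw [integral_add (f := fun z => t ^ 2 * G (x + ρ • z) - (2 * t) * (f (x + ρ • z) * φ z))
        ((iG2.const_mul _).sub (iA.const_mul _)) iφ,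
      integral_sub (iG2.const_mul _) (iA.const_mul _), integral_const_mul, integral_const_mul] at this
    unfold Av
    linarith
  have := discrim_le_zero key
  simp only [discrim] at this
  nlinarith

theorem supL2 (hn : 1 ≤ n) : ∃ ρ0 : ℝ, 0 < ρ0 ∧ ∃ C : ℝ, 0 < C ∧ ∀ (u : E n → ℝ) (z : E n) (R : ℝ),
    0 < R → R ≤ ρ0 → Sol u z R → u z ^ 2 * R ^ n ≤ C * ∫ y in ball z R, u y ^ 2 := by
  obtain ⟨ψ, mψ, i1, H⟩ := der_approx hn
  obtain ⟨C, C0, hC⟩ := H [] (by simp)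
  simp only [pl, List.length_nil, pow_zero, one_mul] at hC
  refine ⟨min 1 (1 / (C * 2 ^ n * 2)), by positivity, 4 * 2 ^ n * ((∫ z, ψ z ^ 2) + 1), by positivity, ?_⟩
  intro u z R hR hRρ ⟨hu, hs⟩
  have cu := hu.continuous
  have J0 : 0 ≤ ∫ z, ψ z ^ 2 := integral_nonneg (fun _ => by positivity)
  have I0 : 0 ≤ ∫ y in ball z R, u y ^ 2 := integral_nonneg (fun _ => by positivity)
  obtain ⟨y0, hy0, hmax⟩ := (isCompact_closedBall z R).exists_isMaxOn (nonempty_closedBall.2 hR.le)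
    (f := fun y => (R - dist y z) ^ n * u y ^ 2) (by fun_prop)
  have hm : ∀ y ∈ closedBall z R, (R - dist y z) ^ n * u y ^ 2 ≤ (R - dist y0 z) ^ n * u y0 ^ 2 :=
    fun y hy => hmax hy
  set d := R - dist y0 z with hd
  have hz := hm z (mem_closedBall_self hR.le)
  rw [dist_self, sub_zero] at hz
  have d0 : 0 ≤ d := by rw [mem_closedBall] at hy0; linarith
  rcases d0.eq_or_lt with h0 | dpos
  · rw [← h0, zero_pow (by omega), zero_mul] at hz
    calc _ ≤ (0:ℝ) := by linarith
      _ ≤ _ := by positivity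
  have dR : d ≤ R := by rw [hd]; linarith [dist_nonneg (x := y0) (y := z)]
  have sub : ball y0 (d/2) ⊆ ball z R := ball_subset_ball' (by linarith)
  have hB : ∀ y ∈ ball y0 (d/2), |lp (lp u) y| ≤ 2 ^ n * |u y0| := by
    intro y hy
    refine (hs y (sub hy)).trans ?_
    have h1 := hm y (ball_subset_closedBall (sub hy))
    have h2 : d / 2 ≤ R - dist y z := by
      have := dist_triangle y y0 z
      rw [mem_ball] at hy; linarith
    have h3 : (d/2) ^ n * u y ^ 2 ≤ d ^ n * u y0 ^ 2 := le_trans (by gcongr) h1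
    rw [div_pow, div_mul_eq_mul_div, div_le_iff₀ (by positivity)] at h3
    have h4 : u y ^ 2 ≤ 2 ^ n * u y0 ^ 2 := by
      have : 0 < d ^ n := by positivity
      nlinarith
    apply abs_le_of_sq_le_sq _ (by positivity : 0 ≤ 2 ^ n * |u y0|)
    rw [mul_pow, sq_abs]
    have : (1:ℝ) ≤ 2 ^ n := one_le_pow₀ (by norm_num)
    nlinarith [sq_nonneg (u y0)]
  have h1 := hC u hu y0 (d/2) _ (by positivity) hB
  have h2 : C * ((d/2) ^ 4 * (2 ^ n * |u y0|)) ≤ |u y0| / 2 := by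
    have e1 : d ≤ 1 := dR.trans (hRρ.trans (min_le_left _ _))
    have e2 : d ≤ 1 / (C * 2 ^ n * 2) := dR.trans (hRρ.trans (min_le_right _ _))
    rw [le_div_iff₀ (by positivity)] at e2
    have e3 : (d/2) ^ 4 ≤ d := by
      have : d ^ 4 ≤ d := pow_le_of_le_one d0 e1 (by norm_num)
      have : (d/2)^4 ≤ d ^ 4 := by gcongr; linarith
      linarith
    calc C * ((d/2) ^ 4 * (2 ^ n * |u y0|)) ≤ C * (d * (2 ^ n * |u y0|)) := by gcongr
      _ = d * (C * 2 ^ n * 2) * |u y0| / 2 := by ring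
      _ ≤ 1 * |u y0| / 2 := by gcongr
      _ = _ := by ring
  have h3 : |u y0| ≤ 2 * |Av (d/2) ψ u y0| := by
    have := abs_sub_abs_le_abs_sub (u y0) (Av (d/2) ψ u y0)
    linarith
  have h4 := Av_sq mψ cu (half_pos dpos) y0
  have h5 : ∫ y in ball y0 (d/2), u y ^ 2 ≤ ∫ y in ball z R, u y ^ 2 := by
    apply setIntegral_mono_set _ (Filter.Eventually.of_forall fun _ => by positivity) sub.eventuallyLE
    exact ((cu.pow 2).continuousOn.integrableOn_compact (isCompact_closedBall z R)).mono_set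
      ball_subset_closedBall
  have h6 : u y0 ^ 2 ≤ 4 * (Av (d/2) ψ u y0) ^ 2 := by
    rw [← sq_abs (u y0), ← sq_abs (Av _ _ _ _)]
    nlinarith [abs_nonneg (u y0)]
  calc u z ^ 2 * R ^ n ≤ d ^ n * u y0 ^ 2 := by linarith
    _ ≤ d ^ n * (4 * ((∫ z, ψ z ^ 2) * (((d/2) ^ n)⁻¹ * ∫ y in ball z R, u y ^ 2))) := by
        gcongr
        refine h6.trans ?_
        gcongr
        exact h4.trans (by gcongr)
    _ = 4 * 2 ^ n * (∫ z, ψ z ^ 2) * ∫ y in ball z R, u y ^ 2 := by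
        rw [div_pow]; field_simp
    _ ≤ _ := by gcongr; linarith

end BL
end

open MeasureTheory Metric Set
noncomputable section
namespace BL
set_option linter.unusedVariables false
set_option linter.unusedSimpArgs false
open scoped ContDiff

variable {n : ℕ} {v w : E n} {f g h u χ : E n → ℝ}

theorem abs_sum_le_n {F : Fin n → ℝ} {B : ℝ} (h : ∀ i, |F i| ≤ B) : |∑ i, F i| ≤ n * B := by
  refine (Finset.abs_sum_le_sum_abs _ _).trans ?_
  refine (Finset.sum_le_sum (fun i _ => h i)).trans ?_
  simp

theorem c_bound (hn : 1 ≤ n) (hu : ContDiff ℝ ∞ u) {x : E n} {B D : ℝ}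
    (h1 : ∀ l : List (Fin n), l ≠ [] → l.length ≤ 2 → |pl l χ x| ≤ B)
    (h2 : ∀ l : List (Fin n), l.length ≤ 3 → |pl l u x| ≤ D) :
    (2 * gr χ u x + lp χ x * u x) ^ 2 ≤ 9 * n ^ 4 * (B ^ 2 * D ^ 2) ∧
    (2 * gr χ (lp u) x + lp χ x * lp u x) ^ 2 ≤ 9 * n ^ 4 * (B ^ 2 * D ^ 2) := by
  have B0 : 0 ≤ B := (abs_nonneg _).trans (h1 [⟨0, hn⟩] (by simp) (by simp))
  have D0 : 0 ≤ D := (abs_nonneg _).trans (h2 [] (by simp))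
  have n1 : (1:ℝ) ≤ n := by exact_mod_cast hn
  have lχ : |lp χ x| ≤ n * B := by
    rw [lp_pl, Finset.sum_apply]
    exact abs_sum_le_n (fun i => h1 _ (by simp) (by simp))
  have lu : |lp u x| ≤ n * D := by
    rw [lp_pl, Finset.sum_apply]
    exact abs_sum_le_n (fun i => h2 _ (by simp))
  have glu : ∀ i, |dd (ee i) (lp u) x| ≤ n * D := by
    intro i
    rw [← lp_dd hu, lp_pl, Finset.sum_apply]
    refine abs_sum_le_n (fun j => ?_)
    have : pl [j, j] (dd (ee i) u) = pl [j, j, i] u := rfl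
    rw [this]; exact h2 _ (by simp)
  have g1 : |gr χ u x| ≤ n * (B * D) := by
    simp only [gr, Finset.sum_apply, Pi.mul_apply]
    refine abs_sum_le_n (fun i => ?_)
    rw [abs_mul]
    exact mul_le_mul (h1 [i] (by simp) (by simp)) (h2 [i] (by simp)) (abs_nonneg _) B0
  have g2 : |gr χ (lp u) x| ≤ n * (B * (n * D)) := by
    simp only [gr, Finset.sum_apply, Pi.mul_apply]
    refine abs_sum_le_n (fun i => ?_)
    rw [abs_mul]
    exact mul_le_mul (h1 [i] (by simp) (by simp)) (glu i) (abs_nonneg _) B0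
  have e : 9 * (n:ℝ) ^ 4 * (B ^ 2 * D ^ 2) = (3 * n ^ 2 * (B * D)) ^ 2 := by ring
  have BD : 0 ≤ B * D := by positivity
  have nn : (n:ℝ) ≤ n ^ 2 := by nlinarith
  rw [e]
  constructor
  · apply sq_le_sq'
    all_goals
      have t1 := abs_le.1 g1
      have t2 : |lp χ x * u x| ≤ n * B * D := by
        rw [abs_mul]; exact mul_le_mul lχ (h2 [] (by simp)) (abs_nonneg _) (by positivity)
      have t3 := abs_le.1 t2
      nlinarith
  · apply sq_le_sq'
    all_goals
      have t1 := abs_le.1 g2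
      have t2 : |lp χ x * lp u x| ≤ n * B * (n * D) := by
        rw [abs_mul]; exact mul_le_mul lχ lu (abs_nonneg _) (by positivity)
      have t3 := abs_le.1 t2
      nlinarith

theorem Wt_le {τ p ρ : ℝ} (hτ : 0 ≤ τ) (hp : 0 < p) {x : E n} (h1 : p ≤ ‖x‖) (h2 : ‖x‖ ≤ ρ) :
    Wt τ x ≤ (p ^ n)⁻¹ * p ^ (-(2 * τ)) * Real.exp (τ * ρ ^ 2 / 2) := by
  have hx : 0 < ‖x‖ := hp.trans_le h1
  unfold Wt
  have e : (p ^ n)⁻¹ * p ^ (-(2 * τ)) = (p ^ 2) ^ (-τ - (n:ℝ) / 2) := by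
    rw [← Real.rpow_natCast p n, ← Real.rpow_neg hp.le, ← Real.rpow_add hp, ← Real.rpow_natCast p 2,
      ← Real.rpow_mul hp.le]
    congr 1; push_cast; ring
  rw [e]
  apply mul_le_mul _ _ (Real.exp_pos _).le (by positivity)
  · apply Real.rpow_le_rpow_of_nonpos (by positivity)
    · unfold sq; gcongr
    · have : (0:ℝ) ≤ n := by positivity
      linarith
  · apply Real.exp_le_exp.2
    unfold sq; gcongr

theorem le_Wt (hn : 2 ≤ n) {τ q : ℝ} (hτ : 0 ≤ τ) {x : E n} (hx : x ≠ 0) (h1 : ‖x‖ ≤ q) (hq : q ≤ 1) :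
    q ^ (-(2 * τ)) ≤ sq x * Wt τ x := by
  have hx' := norm_pos_iff.2 hx
  have sp := sq_pos hx
  have q0 : 0 < q := hx'.trans_le h1
  have s1 : sq x ≤ 1 := by unfold sq; nlinarith
  have e : sq x * Wt τ x = sq x ^ (1 - τ - (n:ℝ)/2) * Real.exp (τ * sq x / 2) := by
    unfold Wt
    rw [← mul_assoc]; congr 1
    rw [show (1 - τ - (n:ℝ)/2) = 1 + (-τ - n/2) by ring, Real.rpow_add sp, Real.rpow_one]
  have n2 : (2:ℝ) ≤ n := by exact_mod_cast hn
  rw [e]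
  calc q ^ (-(2 * τ)) = (q ^ 2) ^ (-τ) := by
        rw [← Real.rpow_natCast q 2, ← Real.rpow_mul q0.le]; congr 1; push_cast; ring
    _ ≤ sq x ^ (-τ) := by
        apply Real.rpow_le_rpow_of_nonpos sp _ (by linarith)
        unfold sq; gcongr
    _ ≤ sq x ^ (1 - τ - (n:ℝ)/2) := by
        apply Real.rpow_le_rpow_of_exponent_ge sp s1; linarith
    _ ≤ _ := by
        apply le_mul_of_one_le_right (by positivity)
        apply Real.one_le_exp; positivity

theorem carl3 (hn : 2 ≤ n) : ∃ C : ℝ, 0 < C ∧ ∃ ρ1 : ℝ, 0 < ρ1 ∧ 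
    ∀ (τ : ℝ), 2 * (n + 2) + 1 ≤ τ → ∀ (χ u : E n → ℝ), ContDiff ℝ ∞ χ → Sol u 0 1 →
    tsupport χ ⊆ ball 0 1 → (0 : E n) ∉ tsupport χ → ∀ Bd : ℝ, 
    (∀ x ∈ tsupport χ, Wt τ x * (2 * gr χ u x + lp χ x * u x) ^ 2 ≤ Bd ∧
      Wt τ x * (2 * gr χ (lp u) x + lp χ x * lp u x) ^ 2 ≤ Bd) →
    ∀ (y : E n) (R w : ℝ), 0 < R → R ≤ ρ1 → ball y R ⊆ ball 0 1 → 0 ≤ w → 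
    (∀ x ∈ ball y R, χ x = 1 ∧ w ≤ sq x * Wt τ x) → w * R ^ n * u y ^ 2 ≤ C * Bd := by
  obtain ⟨ρ1, hρ1, C, C0, hC⟩ := supL2 (n := n) (by omega)
  refine ⟨C * (2 * volume.real (closedBall (0 : E n) 1)) + 1, by positivity, ρ1, hρ1, ?_⟩
  intro τ hτ χ u hχ hu ts h0 Bd hBd y R w hR hR1 hyR hw hw2
  have cχ : HasCompactSupport χ := HasCompactSupport.of_support_subset_isCompact
    (isCompact_closedBall (0 : E n) 1) ((subset_closure.trans ts).trans ball_subset_closedBall)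
  have yt : y ∈ tsupport χ := subset_closure (by
    rw [Function.mem_support, (hw2 y (mem_ball_self hR)).1]; norm_num)
  have Bd0 : 0 ≤ Bd := le_trans (mul_nonneg (Wt_nonneg _ _) (sq_nonneg _)) (hBd y yt).1
  have c2 := carl2 hn hτ hχ hu.1 cχ ts h0 (fun x hx => hu.2 x (ts hx))
  have iB : Integrable ((closedBall (0 : E n) 1).indicator (fun _ => Bd)) := by
    refine (integrable_indicator_iff isClosed_closedBall.measurableSet).2 ?_
    exact integrableOn_const (isCompact_closedBall (0 : E n) 1).measure_lt_top.ne
  have eB : ∫ x, (closedBall (0 : E n) 1).indicator (fun _ => Bd) x = volume.real (closedBall (0 : E n) 1) * Bd := by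
    rw [integral_indicator isClosed_closedBall.measurableSet]; simp
  have grz : ∀ g : E n → ℝ, ∀ x ∉ tsupport χ, gr χ g x = 0 := by
    intro g x hx
    simp only [gr, Finset.sum_apply, Pi.mul_apply]
    refine Finset.sum_eq_zero (fun i _ => ?_)
    rw [image_eq_zero_of_notMem_tsupport (f := dd (ee i) χ) (fun h' => hx (dd_tsupport h'))]
    simp
  have gen : ∀ (k : ℕ) (c : E n → ℝ), (∀ x ∈ tsupport χ, Wt τ x * c x ^ 2 ≤ Bd) → (∀ x ∉ tsupport χ, c x = 0) →
      ∫ x, sq x ^ k * Wt τ x * c x ^ 2 ≤ volume.real (closedBall (0 : E n) 1) * Bd := by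
    intro k c hc hc0
    rw [← eB]
    apply integral_mono_of_nonneg _ iB
    · refine Filter.Eventually.of_forall fun x => ?_
      by_cases hx : x ∈ tsupport χ
      · have hx2 := ts hx
        simp only []
        rw [indicator_of_mem (ball_subset_closedBall hx2)]
        have : sq x ^ k ≤ 1 := pow_le_one₀ (sq_nonneg' x) (sq_le_one (by simpa using hx2))
        rw [mul_assoc]
        have h2 := mul_nonneg (Wt_nonneg τ x) (sq_nonneg (c x))
        exact (mul_le_of_le_one_left h2 this).trans (hc x hx)
      · simp only [hc0 x hx]
        have := indicator_nonneg (s := closedBall (0:E n) 1) (f := fun _ => Bd) (fun _ _ => Bd0) x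
        simpa using this
    · refine Filter.Eventually.of_forall fun x => ?_
      have := Wt_nonneg τ x
      have := sq_nonneg' x
      simp only [Pi.zero_apply]; positivity
  have g1 := gen 2 (fun x => 2 * gr χ u x + lp χ x * u x) (fun x hx => (hBd x hx).1)
    (fun x hx => by simp [grz _ x hx, lp_zero_of_notMem hx])
  have g2 := gen 3 (fun x => 2 * gr χ (lp u) x + lp χ x * lp u x) (fun x hx => (hBd x hx).2)
    (fun x hx => by simp [grz _ x hx, lp_zero_of_notMem hx])
  have h3 : w * ∫ x in ball y R, u x ^ 2 ≤ ∫ x, sq x * Wt τ x * (χ x * u x) ^ 2 := by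
    have tt : tsupport (χ * u) ⊆ tsupport χ := by rw [mul_comm]; exact tsupport_mul_subset_right'
    have smu := hu.1.continuous
    have smχ := hχ.continuous
    have i3 : Integrable (fun x => sq x ^ 1 * Wt τ x * (χ * u) x ^ 2) := int_W3 τ 1 (f := χ * u)
      (by fun_prop) cχ.mul_right (fun h => h0 (tt h))
    simp only [pow_one, Pi.mul_apply] at i3
    rw [← integral_const_mul]
    refine le_trans ?_ (setIntegral_le_integral (s := ball y R) i3 (Filter.Eventually.of_forall fun x => ?_))
    · apply setIntegral_mono_on _ i3.integrableOn measurableSet_ball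
      · intro x hx
        obtain ⟨e1, e2⟩ := hw2 x hx
        rw [e1, one_mul]
        exact mul_le_mul_of_nonneg_right e2 (sq_nonneg _)
      · exact ((by fun_prop : Continuous (fun x => w * u x ^ 2)).continuousOn.integrableOn_compact
          (isCompact_closedBall y R)).mono_set ball_subset_closedBall
    · have := Wt_nonneg τ x
      have := sq_nonneg' x
      simp only [Pi.zero_apply]; positivity
  have h4 := hC u y R hR hR1 ⟨hu.1, fun x hx => hu.2 x (hyR hx)⟩
  calc w * R ^ n * u y ^ 2 = w * (u y ^ 2 * R ^ n) := by ring
    _ ≤ w * (C * ∫ x in ball y R, u x ^ 2) := by gcongr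
    _ = C * (w * ∫ x in ball y R, u x ^ 2) := by ring
    _ ≤ C * (volume.real (closedBall (0 : E n) 1) * Bd + volume.real (closedBall (0 : E n) 1) * Bd) := by
      gcongr; linarith
    _ ≤ _ := by nlinarith

end BL
end

open MeasureTheory Metric Set
noncomputable section
namespace BL
set_option linter.unusedVariables false
set_option linter.unusedSimpArgs false
open scoped ContDiff

variable {n : ℕ} {v w : E n} {f g h u χ : E n → ℝ}

theorem pl_comp (hf : ContDiff ℝ ∞ f) (r : ℝ) (a : E n) (l : List (Fin n)) :
    pl l (fun y => f (a + r • y)) = fun y => r ^ l.length * pl l f (a + r • y) := by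
  induction l with
  | nil => simp [pl]
  | cons i l ih =>
    simp only [pl, ih]
    have := sm_pl hf l
    have e : (fun y : E n => r ^ l.length * pl l f (a + r • y)) = (r ^ l.length) • fun y => pl l f (a + r • y) := by
      ext y; simp
    rw [e, dd_smul _ (by fun_prop), dd_comp_smul_add this]
    ext y; simp [pow_succ]; ring

theorem pl_tsupport (l : List (Fin n)) : tsupport (pl l f) ⊆ tsupport f := by
  induction l with
  | nil => exact subset_rfl
  | cons i l ih => exact dd_tsupport.trans ih

theorem pl_eqOn {U : Set (E n)} (hU : IsOpen U) (h : EqOn f g U) (l : List (Fin n)) :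
    EqOn (pl l f) (pl l g) U := by
  induction l with
  | nil => exact h
  | cons i l ih => exact dd_eqOn hU ih

theorem pl_zero' (l : List (Fin n)) : pl l (0 : E n → ℝ) = 0 := by
  induction l with
  | nil => rfl
  | cons i l ih => simp only [pl, ih, dd_zero]

theorem pl_const (c : ℝ) {l : List (Fin n)} (hl : l ≠ []) : pl l (fun _ : E n => c) = 0 := by
  induction l with
  | nil => exact absurd rfl hl
  | cons i l ih =>
    by_cases h : l = []
    · subst h; simp only [pl, dd_const]
    · simp only [pl, ih h, dd_zero]

theorem pl_sub (hf : ContDiff ℝ ∞ f) (hg : ContDiff ℝ ∞ g) (l : List (Fin n)) :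
    pl l (f - g) = pl l f - pl l g := by
  induction l with
  | nil => rfl
  | cons i l ih => simp only [pl, ih, dd_sub (sm_pl hf l) (sm_pl hg l)]

theorem pl_bdd (hf : ContDiff ℝ ∞ f) (hc : HasCompactSupport f) (k : ℕ) : ∃ B : ℝ, 0 < B ∧
    ∀ l : List (Fin n), l.length ≤ k → ∀ x, |pl l f x| ≤ B := by
  have : ∀ l : List (Fin n), ∃ B : ℝ, 0 < B ∧ ∀ x, |pl l f x| ≤ B := by
    intro l
    have hc' : HasCompactSupport (pl l f) := HasCompactSupport.of_support_subset_isCompact hc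
      (subset_closure.trans (pl_tsupport l))
    obtain ⟨C, hC⟩ := hc'.exists_bound_of_continuous (sm_pl hf l).continuous
    exact ⟨|C| + 1, by positivity, fun x => (hC x).trans (by linarith [le_abs_self C])⟩
  choose c c0 hc using this
  have fin : {l : List (Fin n) | l.length ≤ k}.Finite := List.finite_length_le _ _
  refine ⟨1 + ∑ l ∈ fin.toFinset, c l, ?_, ?_⟩
  · have : 0 ≤ ∑ l ∈ fin.toFinset, c l := Finset.sum_nonneg (fun l hl => (c0 l).le)
    positivity
  · intro l hl x
    have := Finset.single_le_sum (f := c) (fun l hl => (c0 l).le)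
      (show l ∈ fin.toFinset by simpa using hl)
    linarith [hc l x]

/-- crude derivative bounds for solutions -/
theorem der_sol (hn : 1 ≤ n) : ∃ C : ℝ, 0 < C ∧ ∀ (u : E n → ℝ) (x : E n) (ρ A : ℝ), 0 < ρ → ρ ≤ 1 →
    Sol u x ρ → (∀ y ∈ ball x ρ, |u y| ≤ A) → ∀ l : List (Fin n), l.length ≤ 3 →
    |pl l u x| ≤ C * A * (ρ ^ 3)⁻¹ := by
  obtain ⟨C, C0, hC⟩ := der_bd hn
  refine ⟨2 * C, by positivity, fun u x ρ A hρ hρ1 hu hA l hl => ?_⟩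
  have A0 : 0 ≤ A := (abs_nonneg _).trans (hA x (mem_ball_self hρ))
  have h1 := hC l hl u hu.1 x ρ A A hρ hA (fun y hy => (hu.2 y hy).trans (hA y hy))
  rw [← div_eq_mul_inv, le_div_iff₀ (by positivity)]
  have h2 : ρ ^ 3 ≤ ρ ^ l.length := pow_le_pow_of_le_one hρ.le hρ1 hl
  have h3 : ρ ^ 4 ≤ 1 := pow_le_one₀ hρ.le hρ1
  calc |pl l u x| * ρ ^ 3 ≤ ρ ^ l.length * |pl l u x| := by rw [mul_comm]; gcongr
    _ ≤ C * (A + ρ ^ 4 * A) := h1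
    _ ≤ _ := by nlinarith [mul_nonneg C0.le A0]

theorem tb1_alg {δ a b d c1 k c2 nn p ex X Y Z A B : ℝ} (n : ℕ) (hδ : 0 < δ) (ha : 0 < a) (hp : 0 < p)
    (hab : a ≤ b) (hbd : b ≤ d) (hc1 : 0 < c1) (hk : 0 < k) (hc2 : 0 < c2) (hn : 0 ≤ nn) (hex : 0 < ex) (hX : 0 ≤ X)
    (hY : 0 ≤ Y) (hZ : 0 ≤ Z) (hA : 0 ≤ A) (hB : 0 ≤ B) :
    X * ((δ * b) ^ n)⁻¹ * (c1 * (9 * nn * ((2 * k * (a ^ 2)⁻¹) ^ 2 * (c2 * ((δ * a) ^ 3)⁻¹) ^ 2) *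
      ((((p * a) ^ n)⁻¹ * Y * ex) * A) + 9 * nn * ((2 * k * (d ^ 2)⁻¹) ^ 2 * (c2 * ((δ * d) ^ 3)⁻¹) ^ 2) *
      ((((p * d) ^ n)⁻¹ * Z * ex) * B))) ≤
    (δ ^ n)⁻¹ * c1 * (9 * nn) * (2 * k) ^ 2 * (c2 * (δ ^ 3)⁻¹) ^ 2 * (p ^ n)⁻¹ * ex *
      ((a ^ (2 * n + 10))⁻¹ * (X * Y * A) + (b ^ (2 * n + 10))⁻¹ * (X * Z * B)) := by
  have hb : 0 < b := ha.trans_le hab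
  have e : ∀ t : ℝ, t ^ (2 * n + 10) = t ^ n * t ^ n * t ^ 10 := fun t => by
    rw [← pow_add, ← pow_add]; congr 1; ring
  have L : ∀ t Y A : ℝ, 0 < t → X * ((δ * b) ^ n)⁻¹ * (c1 * (9 * nn * ((2 * k * (t ^ 2)⁻¹) ^ 2 * (c2 * ((δ * t) ^ 3)⁻¹) ^ 2) *
      ((((p * t) ^ n)⁻¹ * Y * ex) * A))) = (δ ^ n)⁻¹ * c1 * (9 * nn) * (2 * k) ^ 2 * (c2 * (δ ^ 3)⁻¹) ^ 2 * (p ^ n)⁻¹ * ex *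
      ((b ^ n * t ^ n * t ^ 10)⁻¹ * (X * Y * A)) := by
    intro t Y A ht
    rw [mul_pow δ b n, mul_pow p t n, mul_pow δ t 3]
    generalize δ ^ n = D
    generalize p ^ n = P
    generalize t ^ n = R
    generalize b ^ n = R'
    simp only [mul_inv]
    ring
  rw [mul_add c1, mul_add, L a Y A ha, L d Z B (hb.trans_le hbd), ← mul_add, e, e]
  have hd : 0 < d := hb.trans_le hbd
  have : 0 ≤ b ^ n * d ^ n := by positivity
  gcongr

set_option maxHeartbeats 2000000 in
theorem tb1 (hn : 2 ≤ n) {δ : ℝ} (hδ : 0 < δ) (hδ1 : δ ≤ 1/8) : ∃ C : ℝ, 0 < C ∧ ∃ ρ1 : ℝ, 0 < ρ1 ∧ 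
    ∀ (τ : ℝ), 2 * (n + 2) + 1 ≤ τ → ∀ (u : E n → ℝ), Sol u 0 1 → ∀ (a b d : ℝ), 0 < a → a ≤ b → 
    (1 + δ) * b ≤ (1 - 2 * δ) * d → d ≤ ρ1 → d ≤ 1 → ∀ y : E n, ‖y‖ = b →
    u y ^ 2 ≤ C * Real.exp (τ * d ^ 2 / 2) *
      ((a ^ (2 * n + 10))⁻¹ * ((((1 + δ) * b / ((1 - 2 * δ) * a)) ^ (2 * τ)) * M u 0 a ^ 2) +
       (b ^ (2 * n + 10))⁻¹ * ((((1 + δ) * b / ((1 - 2 * δ) * d)) ^ (2 * τ)) * M u 0 d ^ 2)) := by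
  obtain ⟨C1, C10, ρ1, hρ1, H⟩ := carl3 hn
  obtain ⟨C2, C20, H2⟩ := der_sol (n := n) (by omega)
  let z : ContDiffBump (0 : E n) := ⟨1 - 2 * δ, 1 - δ, by linarith, by linarith⟩
  have smz : ContDiff ℝ ∞ (fun x => z x) := z.contDiff
  have tz : tsupport (fun x => z x) = closedBall 0 (1 - δ) := z.tsupport_eq
  obtain ⟨Kz, Kz0, hK⟩ := pl_bdd smz z.hasCompactSupport 2
  set Q : ℝ := (δ ^ n)⁻¹ * C1 * (9 * n ^ 4) * (2 * Kz) ^ 2 * (C2 * (δ ^ 3)⁻¹) ^ 2 * ((1 - 2 * δ) ^ n)⁻¹ with hQ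
  have δ2 : 0 < 1 - 2 * δ := by linarith
  have n0 : (0:ℝ) < n := by exact_mod_cast (by omega : 0 < n)
  refine ⟨Q, by rw [hQ]; positivity, ρ1, hρ1, ?_⟩
  intro τ hτ u hu a b d ha hab hbd hdρ hd1 y hyb
  have hy1 : a ≤ ‖y‖ := by rw [hyb]; exact hab
  have hy2 : ‖y‖ ≤ b := hyb.le
  have cu := hu.1.continuous
  have b0 : 0 < b := ha.trans_le hab
  have qb : 0 < δ * b := by positivity
  have qa : 0 < δ * a := by positivity
  have qab : δ * a ≤ δ * b := by gcongr
  have bd' : b ≤ d := by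
    by_contra hh
    push Not at hh
    have : δ * d ≤ δ * b := by gcongr
    rcases le_or_gt 0 d with h | h
    · have := mul_nonneg hδ.le h; linarith
    · have := mul_pos_of_neg_of_neg (show 2 * δ - 1 < 0 by linarith) h
      linarith
  have d0 : 0 < d := by linarith
  have qd : 0 < δ * d := by positivity
  have qbd : δ * b ≤ δ * d := by gcongr
  have ad : (1 - δ) * a < (1 - 2 * δ) * d := by linarith
  have ad' : a ≤ d := hab.trans bd'
  have τ0 : 0 ≤ τ := le_trans (by positivity) hτ
  -- the cutoff
  set zr : ℝ → E n → ℝ := fun r x => z (0 + r⁻¹ • x) with hzr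
  have smzr : ∀ r, ContDiff ℝ ∞ (zr r) := fun r => by
    simp only [hzr]; exact smz.comp (by fun_prop)
  have z1 : ∀ r, 0 < r → ∀ x : E n, ‖x‖ ≤ (1 - 2 * δ) * r → zr r x = 1 := by
    intro r hr x hx
    apply z.one_of_mem_closedBall
    simp only [zero_add, mem_closedBall, dist_zero_right, norm_smul, norm_inv, Real.norm_eq_abs, abs_of_pos hr]
    rw [inv_mul_le_iff₀ hr]; linarith
  have z0 : ∀ r, 0 < r → ∀ x : E n, (1 - δ) * r ≤ ‖x‖ → zr r x = 0 := by
    intro r hr x hx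
    apply z.zero_of_le_dist
    simp only [zero_add, dist_zero_right, norm_smul, norm_inv, Real.norm_eq_abs, abs_of_pos hr]
    rw [le_inv_mul_iff₀ hr]; linarith
  have pz : ∀ r, 0 < r → r ≤ 1 → ∀ l : List (Fin n), l.length ≤ 2 → ∀ x, |pl l (zr r) x| ≤ Kz * (r ^ 2)⁻¹ := by
    intro r hr hr1 l hl x
    simp only [hzr, pl_comp smz]
    rw [abs_mul, abs_of_pos (by positivity), mul_comm]
    refine mul_le_mul (hK l hl _) ?_ (by positivity) Kz0.le
    rw [inv_pow]
    exact inv_anti₀ (by positivity) (pow_le_pow_of_le_one hr.le hr1 hl)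
  have pin : ∀ r, 0 < r → ∀ l : List (Fin n), l ≠ [] → ∀ x, ‖x‖ < (1 - 2 * δ) * r → pl l (zr r) x = 0 := by
    intro r hr l hl x hx
    have := pl_eqOn (f := zr r) (g := fun _ => 1) (isOpen_ball (x := (0 : E n)) (ε := (1 - 2 * δ) * r))
      (fun y hy => z1 r hr y (by simpa using (mem_ball.1 hy).le)) l (by simpa using hx)
    rw [this, pl_const _ hl]; rfl
  have pout : ∀ r, 0 < r → ∀ l : List (Fin n), ∀ x, (1 - δ) * r < ‖x‖ → pl l (zr r) x = 0 := by
    intro r hr l x hx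
    have := pl_eqOn (f := zr r) (g := 0) (isClosed_closedBall (x := (0 : E n)) (ε := (1 - δ) * r)).isOpen_compl
      (fun y hy => z0 r hr y (by simp at hy; exact hy.le)) l (by simpa using hx)
    rw [this, pl_zero']; rfl
  set χ : E n → ℝ := zr d - zr a with hχ
  have smχ : ContDiff ℝ ∞ χ := (smzr d).sub (smzr a)
  have s1 : tsupport χ ⊆ {x | (1 - 2 * δ) * a ≤ ‖x‖ ∧ ‖x‖ ≤ (1 - δ) * d} := by
    apply closure_minimal
    · intro x hx
      by_contra hcon
      simp only [mem_ofPred_eq, not_and_or, not_le] at hcon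
      apply hx
      simp only [hχ, Pi.sub_apply]
      rcases hcon with h | h
      · rw [z1 d d0 x (by linarith), z1 a ha x h.le]; ring
      · rw [z0 d d0 x h.le, z0 a ha x (by linarith)]; ring
    · exact (isClosed_le continuous_const continuous_norm).inter (isClosed_le continuous_norm continuous_const)
  set Ma := M u 0 a with hMa
  set Md := M u 0 d with hMd
  have Ma0 : 0 ≤ Ma := M_nonneg _ _
  have Md0 : 0 ≤ Md := M_nonneg _ _
  set ex := Real.exp (τ * d ^ 2 / 2) with hex
  have ex0 : 0 < ex := Real.exp_pos _
  -- derivative bounds of u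
  have du : ∀ r, a ≤ r → r ≤ 1 → r ≤ d → ∀ x : E n, ‖x‖ ≤ (1 - δ) * r → ∀ l : List (Fin n), l.length ≤ 3 →
      |pl l u x| ≤ C2 * M u 0 r * ((δ * r) ^ 3)⁻¹ := by
    intro r har hr1 hrd x hx l hl
    have hr : 0 < r := ha.trans_le har
    have sub : ball x (δ * r) ⊆ ball 0 r := ball_subset_ball' (by rw [dist_zero_right]; linarith)
    have := H2 u x (δ * r) (M u 0 r) (by positivity) (by have := mul_le_mul hδ1 hr1 hr.le (by norm_num); linarith)
      ⟨hu.1, fun y hy => hu.2 y (ball_subset_ball hr1 (sub hy))⟩ (fun y hy => le_M cu (sub hy)) l hl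
    exact this
  -- weights
  set wa := (((1 - 2*δ) * a) ^ n)⁻¹ * ((1 - 2*δ) * a) ^ (-(2 * τ)) * ex with hwa
  set wd := (((1 - 2*δ) * d) ^ n)⁻¹ * ((1 - 2*δ) * d) ^ (-(2 * τ)) * ex with hwd
  set G := 9 * (n:ℝ) ^ 4 * ((2 * Kz * (a ^ 2)⁻¹) ^ 2 * (C2 * ((δ * a) ^ 3)⁻¹) ^ 2) with hG
  have G0 : 0 ≤ G := by rw [hG]; positivity
  set G' := 9 * (n:ℝ) ^ 4 * ((2 * Kz * (d ^ 2)⁻¹) ^ 2 * (C2 * ((δ * d) ^ 3)⁻¹) ^ 2) with hG'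
  have G'0 : 0 ≤ G' := by rw [hG']; positivity
  have wa0 : 0 ≤ wa := by rw [hwa]; positivity
  have wd0 : 0 ≤ wd := by rw [hwd]; positivity
  have ia2 : 0 < (a ^ 2)⁻¹ := by positivity
  have id2 : (d ^ 2)⁻¹ ≤ (a ^ 2)⁻¹ := inv_anti₀ (by positivity) (by gcongr)
  have bd : ∀ x ∈ tsupport χ, Wt τ x * (2 * gr χ u x + lp χ x * u x) ^ 2 ≤ G * (wa * Ma ^ 2) + G' * (wd * Md ^ 2) ∧
      Wt τ x * (2 * gr χ (lp u) x + lp χ x * lp u x) ^ 2 ≤ G * (wa * Ma ^ 2) + G' * (wd * Md ^ 2) := by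
    intro x hx
    obtain ⟨hx1, hx2⟩ := s1 hx
    rcases le_or_gt ‖x‖ ((1 - δ) * a) with hc | hc
    · have bχ : ∀ l : List (Fin n), l ≠ [] → l.length ≤ 2 → |pl l χ x| ≤ 2 * Kz * (a ^ 2)⁻¹ := by
        intro l hl hl2
        rw [hχ, pl_sub (smzr d) (smzr a), Pi.sub_apply, pin d d0 l hl x (by linarith), zero_sub, abs_neg]
        have t1 := pz a ha (by linarith) l hl2 x
        have : 0 < Kz * (a ^ 2)⁻¹ := by positivity
        linarith
      have W := Wt_le (n := n) τ0 (by positivity) hx1 (ρ := d) (by linarith)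
      obtain ⟨g1, g2⟩ := c_bound (by omega) hu.1 bχ (du a le_rfl (by linarith) ad' x hc)
      have fin : ∀ c : ℝ, c ^ 2 ≤ 9 * (n:ℝ) ^ 4 * ((2 * Kz * (a ^ 2)⁻¹) ^ 2 * (C2 * M u 0 a * ((δ * a) ^ 3)⁻¹) ^ 2) →
          Wt τ x * c ^ 2 ≤ G * (wa * Ma ^ 2) + G' * (wd * Md ^ 2) := by
        intro c hc
        calc Wt τ x * c ^ 2 ≤ wa * (9 * (n:ℝ) ^ 4 * ((2 * Kz * (a ^ 2)⁻¹) ^ 2 * (C2 * M u 0 a * ((δ * a) ^ 3)⁻¹) ^ 2)) :=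
              mul_le_mul W hc (sq_nonneg _) wa0
          _ = G * (wa * Ma ^ 2) := by rw [hG]; ring
          _ ≤ _ := le_add_of_nonneg_right (by positivity)
      exact ⟨fin _ g1, fin _ g2⟩
    · rcases lt_or_ge ‖x‖ ((1 - 2 * δ) * d) with hc2 | hc2
      · have bχ0 : ∀ l : List (Fin n), l ≠ [] → l.length ≤ 2 → |pl l χ x| ≤ 0 := by
          intro l hl hl2
          rw [hχ, pl_sub (smzr d) (smzr a), Pi.sub_apply, pin d d0 l hl x hc2, pout a ha l x hc]; simp
        obtain ⟨g1, g2⟩ := c_bound (by omega) hu.1 bχ0 (du d ad' hd1 le_rfl x hx2)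
        have fin : ∀ c : ℝ, c ^ 2 ≤ 9 * (n:ℝ) ^ 4 * (0 ^ 2 * (C2 * M u 0 d * ((δ * d) ^ 3)⁻¹) ^ 2) →
          Wt τ x * c ^ 2 ≤ G * (wa * Ma ^ 2) + G' * (wd * Md ^ 2) := by
          intro c hc
          have : c ^ 2 = 0 := le_antisymm (by simpa using hc) (sq_nonneg _)
          rw [this, mul_zero]; positivity
        exact ⟨fin _ g1, fin _ g2⟩
      · have bχ : ∀ l : List (Fin n), l ≠ [] → l.length ≤ 2 → |pl l χ x| ≤ 2 * Kz * (d ^ 2)⁻¹ := by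
          intro l hl hl2
          rw [hχ, pl_sub (smzr d) (smzr a), Pi.sub_apply, pout a ha l x hc, sub_zero]
          have t1 := pz d d0 (by linarith) l hl2 x
          have : 0 < Kz * (d ^ 2)⁻¹ := by positivity
          linarith
        have W := Wt_le (n := n) τ0 (by positivity) hc2 (ρ := d) (by linarith)
        obtain ⟨g1, g2⟩ := c_bound (by omega) hu.1 bχ (du d ad' hd1 le_rfl x hx2)
        have W2 : Wt τ x ≤ wd := by
          refine W.trans ?_
          rw [hwd]
        have fin : ∀ c : ℝ, c ^ 2 ≤ 9 * (n:ℝ) ^ 4 * ((2 * Kz * (d ^ 2)⁻¹) ^ 2 * (C2 * M u 0 d * ((δ * d) ^ 3)⁻¹) ^ 2) →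
          Wt τ x * c ^ 2 ≤ G * (wa * Ma ^ 2) + G' * (wd * Md ^ 2) := by
          intro c hc
          calc Wt τ x * c ^ 2 ≤ wd * (9 * (n:ℝ) ^ 4 * ((2 * Kz * (d ^ 2)⁻¹) ^ 2 * (C2 * M u 0 d * ((δ * d) ^ 3)⁻¹) ^ 2)) :=
                mul_le_mul W2 hc (sq_nonneg _) wd0
            _ = G' * (wd * Md ^ 2) := by rw [hG']; ring
            _ ≤ _ := le_add_of_nonneg_left (by positivity)
        exact ⟨fin _ g1, fin _ g2⟩
  have ypos : 0 < ‖y‖ := ha.trans_le hy1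
  have qy1 : δ * a ≤ δ * ‖y‖ := by gcongr
  have qy2 : δ * ‖y‖ ≤ δ * b := by gcongr
  set w := ((1 + δ) * b) ^ (-(2 * τ)) with hw
  have key := H τ hτ χ u smχ hu (s1.trans (fun x hx => by
      simp only [mem_ofPred_eq] at hx; rw [mem_ball_zero_iff]; linarith [hx.2]))
    (fun h => by have := (s1 h).1; rw [norm_zero] at this; linarith [mul_pos δ2 ha]) _ bd y (δ * ‖y‖) w
    (by positivity) (by linarith) (ball_subset_ball' (by rw [dist_zero_right]; linarith)) (by positivity) (by
      intro x hx
      rw [mem_ball, dist_eq_norm] at hx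
      have e1 : ‖x‖ ≤ ‖y‖ + ‖x - y‖ := by have := norm_add_le y (x - y); simpa using this
      have e2 : ‖y‖ ≤ ‖x‖ + ‖x - y‖ := by have := norm_sub_le x (x - y); simpa using this
      have e3 : (1 - δ) * a ≤ ‖x‖ := by linarith [mul_nonneg (show 0 ≤ 1 - δ by linarith) (sub_nonneg.2 hy1)]
      have e4 : ‖x‖ ≤ (1 + δ) * b := by linarith
      refine ⟨?_, le_Wt hn τ0 ?_ e4 (by linarith)⟩
      · simp only [hχ, Pi.sub_apply]
        rw [z1 d d0 x (by linarith), z0 a ha x e3]; ring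
      · intro h; rw [h, norm_zero] at e3; linarith [mul_pos δ2 ha])
  have key2 : w * ((δ * b) ^ n * u y ^ 2) ≤ C1 * (G * (wa * Ma ^ 2) + G' * (wd * Md ^ 2)) := by
    refine le_trans (le_of_eq ?_) key
    rw [← mul_assoc, hyb]
  have b'0 : 0 < (1 + δ) * b := by positivity
  have wi : w * ((1 + δ) * b) ^ (2 * τ) = 1 := by
    rw [hw, ← Real.rpow_add b'0]; simp
  have key3 : u y ^ 2 ≤ ((1 + δ) * b) ^ (2 * τ) * ((δ * b) ^ n)⁻¹ * (C1 * (G * (wa * Ma ^ 2) + G' * (wd * Md ^ 2))) := by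
    calc u y ^ 2 = ((1 + δ) * b) ^ (2 * τ) * ((δ * b) ^ n)⁻¹ * (w * ((δ * b) ^ n * u y ^ 2)) := by
          have : ((δ * b) ^ n) ≠ 0 := by positivity
          calc u y ^ 2 = (w * ((1 + δ) * b) ^ (2 * τ)) * u y ^ 2 := by rw [wi, one_mul]
            _ = _ := by field_simp
      _ ≤ _ := by gcongr
  refine key3.trans ?_
  have r1 : ((1 + δ) * b / ((1 - 2 * δ) * a)) ^ (2 * τ) = ((1 + δ) * b) ^ (2 * τ) * ((1 - 2*δ) * a) ^ (-(2 * τ)) := by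
    rw [Real.div_rpow (by positivity) (by positivity), Real.rpow_neg (by positivity)]; rfl
  have r2 : ((1 + δ) * b / ((1 - 2 * δ) * d)) ^ (2 * τ) = ((1 + δ) * b) ^ (2 * τ) * ((1 - 2*δ) * d) ^ (-(2 * τ)) := by
    rw [Real.div_rpow (by positivity) (by positivity), Real.rpow_neg (by positivity)]; rfl
  rw [r1, r2, hQ, hG, hG', hwa, hwd]
  exact tb1_alg n hδ ha δ2 hab bd' C10 Kz0 C20 (by positivity) ex0 (by positivity) (by positivity) (by positivity)
    (by positivity) (by positivity)

end BL
end

open MeasureTheory Metric Set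
noncomputable section
namespace BL
set_option linter.unusedVariables false
set_option linter.unusedSimpArgs false
open scoped ContDiff

variable {n : ℕ} {v w : E n} {f g h u χ : E n → ℝ}

theorem M_scale {x : E n} {S r : ℝ} (hS : 0 < S) : M (fun z => u (x + S • z)) 0 r = M u x (S * r) := by
  unfold M supAbs
  congr 1
  ext t
  simp only [mem_image]
  constructor
  · rintro ⟨y, hy, rfl⟩
    refine ⟨x + S • y, ?_, rfl⟩
    rw [mem_ball_zero_iff] at hy
    simp only [mem_ball, dist_eq_norm, add_sub_cancel_left, norm_smul, Real.norm_eq_abs, abs_of_pos hS]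
    gcongr
  · rintro ⟨y, hy, rfl⟩
    refine ⟨S⁻¹ • (y - x), ?_, by simp [smul_smul, hS.ne']⟩
    rw [mem_ball, dist_eq_norm] at hy
    simp only [mem_ball_zero_iff, norm_smul, norm_inv, Real.norm_eq_abs, abs_of_pos hS]
    rwa [inv_mul_lt_iff₀ hS]

theorem Sol_scale {x : E n} {S : ℝ} (hS : 0 < S) (hS1 : S ≤ 1) (h : Sol u x S) :
    Sol (fun z => u (x + S • z)) 0 1 := by
  have hu := h.1
  refine ⟨hu.comp (by fun_prop), fun y hy => ?_⟩
  have e1 : lp (fun z => u (x + S • z)) = fun z => S ^ 2 * lp u (x + S • z) := by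
    rw [lp_comp_smul_add hu]
  have hl : ContDiff ℝ ∞ (lp u) := by fun_prop
  have e2 : lp (fun z => S ^ 2 * lp u (x + S • z)) = fun z => S ^ 2 * (S ^ 2 * lp (lp u) (x + S • z)) := by
    have : (fun z : E n => S ^ 2 * lp u (x + S • z)) = (S ^ 2) • fun z => lp u (x + S • z) := by ext z; simp
    rw [this, lp_smul _ (by fun_prop), lp_comp_smul_add hl]; ext z; simp
  rw [e1, e2]
  have : |lp (lp u) (x + S • y)| ≤ |u (x + S • y)| := h.2 _ (by
    rw [mem_ball_zero_iff] at hy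
    simp only [mem_ball, dist_eq_norm, add_sub_cancel_left, norm_smul, Real.norm_eq_abs, abs_of_pos hS]
    nlinarith)
  have s2 : S ^ 2 ≤ 1 := pow_le_one₀ hS.le hS1
  rw [abs_mul, abs_mul, abs_of_pos (by positivity)]
  have : S ^ 2 * |lp (lp u) (x + S • y)| ≤ |lp (lp u) (x + S • y)| := mul_le_of_le_one_left (abs_nonneg _) s2
  have : S ^ 2 * (S ^ 2 * |lp (lp u) (x + S • y)|) ≤ S ^ 2 * |lp (lp u) (x + S • y)| := mul_le_of_le_one_left (by positivity) s2
  linarith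

theorem tb_alg {C r r' e Q X Y A B a d : ℝ} (C0 : 0 < C) (r0 : 0 ≤ r) (r0' : 0 ≤ r') (e0 : 0 ≤ e) (ex : e ≤ Q ^ 2) (X0 : 0 ≤ X) (Y0 : 0 ≤ Y)
    (k1 : Q ^ 2 * X ≤ A ^ 2) (k2 : Q ^ 2 * (Y) ≤ B ^ 2) (A0 : 0 ≤ A) (B0 : 0 ≤ B) (a0 : 0 ≤ a) (d0 : 0 ≤ d) :
    C * e * (r ^ 2 * (X * a ^ 2) + r' ^ 2 * (Y * d ^ 2)) ≤ ((√C + 1) * (r * (A * a) + r' * (B * d))) ^ 2 := by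
  calc C * e * (r ^ 2 * (X * a ^ 2) + r' ^ 2 * (Y * d ^ 2)) ≤ C * Q ^ 2 * (r ^ 2 * (X * a ^ 2) + r' ^ 2 * (Y * d ^ 2)) := by gcongr
      _ = C * (r ^ 2 * ((Q ^ 2 * X) * a ^ 2) + r' ^ 2 * ((Q ^ 2 * Y) * d ^ 2)) := by ring
      _ ≤ C * (r ^ 2 * (A ^ 2 * a ^ 2) + r' ^ 2 * (B ^ 2 * d ^ 2)) := by gcongr
      _ ≤ (√C + 1) ^ 2 * (r * (A * a) + r' * (B * d)) ^ 2 := by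
          gcongr
          · nlinarith [Real.sq_sqrt C0.le, Real.sqrt_nonneg C]
          · have := mul_nonneg (mul_nonneg r0 (mul_nonneg A0 a0)) (mul_nonneg r0' (mul_nonneg B0 d0))
            linarith
      _ = _ := by ring

theorem tb_mono {β b d c τ : ℝ} {m : ℕ} (hβ : 0 < β) (hb : β ≤ b) (hd : 0 < d) (hc : 0 < c) (hτ : m ≤ 2 * τ) :
    (β ^ m)⁻¹ * (c * β / d) ^ (2 * τ) ≤ (b ^ m)⁻¹ * (c * b / d) ^ (2 * τ) := by
  have e : ∀ t : ℝ, 0 < t → (t ^ m)⁻¹ * (c * t / d) ^ (2 * τ) = (c / d) ^ (2 * τ) * t ^ (2 * τ - m) := by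
    intro t ht
    rw [Real.rpow_sub ht, Real.rpow_natCast, show c * t / d = (c / d) * t by ring,
      Real.mul_rpow (by positivity) ht.le]
    field_simp
  rw [e β hβ, e b (hβ.trans_le hb)]
  gcongr

/-- three balls inequality -/
theorem TB (hn : 2 ≤ n) {θ : ℝ} (hθ : 1 < θ) : ∃ ρ0 : ℝ, 0 < ρ0 ∧ ρ0 ≤ 1 ∧ ∃ C : ℝ, 1 ≤ C ∧ ∃ p : ℕ, ∃ τ0 : ℝ, 0 < τ0 ∧
    ∀ (u : E n → ℝ) (x : E n) (S : ℝ), 0 < S → S ≤ 1 → Sol u x S → ∀ a b d τ : ℝ, 0 < a → a ≤ b → θ * b ≤ d → d ≤ ρ0 →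
    τ0 ≤ τ → M u x (S * b) ≤ C * ((a ^ p)⁻¹ * ((θ * b / a) ^ τ * M u x (S * a)) + (b ^ p)⁻¹ * ((θ * b / d) ^ τ * M u x (S * d))) := by
  obtain ⟨q, hq1, hq⟩ : ∃ q : ℝ, 1 < q ∧ θ = q * q := ⟨√θ, Real.lt_sqrt_of_sq_lt (by linarith), (Real.mul_self_sqrt (by linarith)).symm⟩
  set δ : ℝ := min (1/8) ((q - 1) / (1 + 2 * q)) with hδ
  have δ0 : 0 < δ := lt_min (by norm_num) (div_pos (by linarith) (by linarith))
  have δ1 : δ ≤ 1 / 8 := min_le_left _ _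
  have δ2 : 1 + δ ≤ q * (1 - 2 * δ) := by
    have : δ ≤ (q - 1) / (1 + 2 * q) := min_le_right _ _
    rw [le_div_iff₀ (by linarith)] at this
    linarith
  obtain ⟨C, C0, ρ1, hρ1, H⟩ := tb1 hn δ0 δ1
  have lq : 0 < Real.log q := Real.log_pos hq1
  refine ⟨min (min ρ1 1) (Real.log q), lt_min (lt_min hρ1 one_pos) lq, (min_le_left _ _).trans (min_le_right _ _),
    √C + 1, by linarith [Real.sqrt_nonneg C], n + 5, 2 * (n + 2) + 1, by positivity, ?_⟩
  intro u x S hS hS1 hu a b d τ ha hab hbd hd hτ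
  have τ0 : 0 ≤ τ := le_trans (by positivity) hτ
  have hdρ : d ≤ ρ1 := hd.trans ((min_le_left _ _).trans (min_le_left _ _))
  have hd1 : d ≤ 1 := hd.trans ((min_le_left _ _).trans (min_le_right _ _))
  have hdq : d ≤ Real.log q := hd.trans (min_le_right _ _)
  have b0 : 0 < b := ha.trans_le hab
  have bd : b ≤ d := by nlinarith
  have d0 : 0 < d := by linarith
  rw [← M_scale hS, ← M_scale hS, ← M_scale hS]
  have hf := Sol_scale hS hS1 hu
  set f := fun z => u (x + S • z) with hfdef
  have Ma0 : 0 ≤ M f 0 a := M_nonneg _ _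
  have Md0 : 0 ≤ M f 0 d := M_nonneg _ _
  have p1 : 0 < θ * b / a := by positivity
  have p2 : 0 < θ * b / d := by positivity
  have q1 : 1 - 2 * δ > 0 := by linarith
  apply M_le b0
  intro y hy
  rw [mem_ball_zero_iff] at hy
  rcases lt_or_ge ‖y‖ a with hya | hya
  · have h1 : |f y| ≤ M f 0 a := le_M hf.1.continuous (by simpa using hya)
    have h2 : 1 ≤ (√C + 1) * (a ^ (n + 5))⁻¹ * (θ * b / a) ^ τ := by
      have e1 : 1 ≤ (θ * b / a) ^ τ := Real.one_le_rpow (by rw [one_le_div ha]; nlinarith) τ0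
      have e2 : 1 ≤ (a ^ (n + 5))⁻¹ := by
        rw [one_le_inv₀ (by positivity)]; exact pow_le_one₀ ha.le (by linarith)
      have e3 : 1 ≤ √C + 1 := by linarith [Real.sqrt_nonneg C]
      exact one_le_mul_of_one_le_of_one_le (one_le_mul_of_one_le_of_one_le e3 e2) e1
    calc |f y| ≤ 1 * M f 0 a := by linarith
      _ ≤ ((√C + 1) * (a ^ (n + 5))⁻¹ * (θ * b / a) ^ τ) * M f 0 a := by gcongr
      _ = (√C + 1) * ((a ^ (n + 5))⁻¹ * ((θ * b / a) ^ τ * M f 0 a)) := by ring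
      _ ≤ _ := by gcongr; exact le_add_of_nonneg_right (by positivity)
  · have y0 : 0 < ‖y‖ := ha.trans_le hya
    have key0 := H τ hτ f hf a ‖y‖ d ha hya (by
      calc (1 + δ) * ‖y‖ ≤ q * (1 - 2 * δ) * b := by gcongr
        _ = (1 - 2 * δ) * (q * b) * 1 := by ring
        _ ≤ (1 - 2 * δ) * (q * b) * q := by gcongr
        _ = (1 - 2 * δ) * (θ * b) := by rw [hq]; ring
        _ ≤ _ := by gcongr) hdρ hd1 y rfl
    have key : f y ^ 2 ≤ C * Real.exp (τ * d ^ 2 / 2) *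
      ((a ^ (2 * n + 10))⁻¹ * ((((1 + δ) * b / ((1 - 2 * δ) * a)) ^ (2 * τ)) * M f 0 a ^ 2) +
       (b ^ (2 * n + 10))⁻¹ * ((((1 + δ) * b / ((1 - 2 * δ) * d)) ^ (2 * τ)) * M f 0 d ^ 2)) := by
      refine key0.trans ?_
      rw [← mul_assoc (‖y‖ ^ _)⁻¹, ← mul_assoc (b ^ _)⁻¹]
      gcongr ?_ * (?_ + ?_ * ?_)
      · gcongr
      · exact tb_mono y0 hy.le (by positivity) (by positivity) (by push_cast; linarith)
    have ex : Real.exp (τ * d ^ 2 / 2) ≤ (q ^ τ) ^ 2 := by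
      rw [Real.rpow_def_of_pos (by linarith), ← Real.exp_nat_mul]
      apply Real.exp_le_exp.2
      push_cast
      have : d ^ 2 ≤ Real.log q := by nlinarith
      have := mul_le_mul_of_nonneg_left this τ0
      nlinarith [mul_nonneg τ0 lq.le]
    have sm : ∀ r, 0 < r → (q ^ τ) ^ 2 * ((1 + δ) * b / ((1 - 2 * δ) * r)) ^ (2 * τ) ≤ ((θ * b / r) ^ τ) ^ 2 := by
      intro r hr
      have e1 : (θ * b / r) ^ τ = q ^ τ * (q * b / r) ^ τ := by
        rw [← Real.mul_rpow (by linarith) (by positivity)]; congr 1; rw [hq]; ring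
      rw [e1, mul_pow]
      gcongr
      rw [← Real.rpow_mul_natCast (by positivity), mul_comm τ]
      push_cast
      apply Real.rpow_le_rpow (by positivity) _ (by positivity)
      rw [div_le_div_iff₀ (by positivity) hr]
      have := mul_le_mul_of_nonneg_right δ2 (show 0 ≤ b * r by positivity)
      linarith
    have k1 := sm a ha
    have k2 := sm d d0
    set A := (θ * b / a) ^ τ
    set B := (θ * b / d) ^ τ
    have A0 : 0 < A := by positivity
    have B0 : 0 < B := by positivity
    set X := ((1 + δ) * b / ((1 - 2 * δ) * a)) ^ (2 * τ)
    set Y := ((1 + δ) * b / ((1 - 2 * δ) * d)) ^ (2 * τ)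
    have X0 : 0 ≤ X := by positivity
    have Y0 : 0 ≤ Y := by positivity
    set e := Real.exp (τ * d ^ 2 / 2)
    apply abs_le_of_sq_le_sq _ (by positivity)
    have as : ∀ t : ℝ, (t ^ (2 * n + 10))⁻¹ = ((t ^ (n + 5))⁻¹) ^ 2 := fun t => by rw [inv_pow, ← pow_mul]; congr 2; ring
    rw [as, as] at key
    have := tb_alg C0 (show 0 ≤ (a ^ (n + 5))⁻¹ by positivity) (show 0 ≤ (b ^ (n + 5))⁻¹ by positivity) (Real.exp_pos _).le ex X0 Y0 k1 k2 A0.le B0.le Ma0 Md0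
    exact key.trans this

end BL
end

open MeasureTheory Metric Set
noncomputable section
namespace BL
set_option linter.unusedVariables false
set_option linter.unusedSimpArgs false
open scoped ContDiff

variable {n : ℕ} {v w : E n} {f g h u χ : E n → ℝ}

theorem TBa (hn : 2 ≤ n) {θ : ℝ} (hθ : 1 < θ) : ∃ ρ0 : ℝ, 0 < ρ0 ∧ ρ0 ≤ 1 ∧ ∃ C : ℝ, 1 ≤ C ∧ ∃ p : ℕ, ∃ τ0 : ℝ, 0 < τ0 ∧
    ∀ (u : E n → ℝ) (x : E n) (S : ℝ), 0 < S → S ≤ 1 → Sol u x S → ∀ a b d τ : ℝ, 0 < a → a ≤ b → θ * b ≤ d → d ≤ ρ0 * S →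
    τ0 ≤ τ → M u x b ≤ C * (((a / S) ^ p)⁻¹ * ((θ * b / a) ^ τ * M u x a) + ((b / S) ^ p)⁻¹ * ((θ * b / d) ^ τ * M u x d)) := by
  obtain ⟨ρ0, h0, h1, C, hC, p, τ0, hτ, H⟩ := TB hn hθ
  refine ⟨ρ0, h0, h1, C, hC, p, τ0, hτ, ?_⟩
  intro u x S hS hS1 hu a b d τ ha hab hbd hd hτ
  have := H u x S hS hS1 hu (a / S) (b / S) (d / S) τ (by positivity) (by gcongr) (by rw [← mul_div_assoc]; gcongr)
    (by rwa [div_le_iff₀ hS]) hτ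
  have e : ∀ t, S * (t / S) = t := fun t => by field_simp
  have e2 : ∀ t s : ℝ, θ * (t / S) / (s / S) = θ * t / s := fun t s => by field_simp
  simpa only [e, e2] using this

/-- monotonicity of the slope for large slopes, adjacent scales -/
theorem SM1 (hn : 2 ≤ n) {ε : ℝ} (hε : 0 < ε) (hε1 : ε ≤ 1) : ∃ ρ0 : ℝ, 0 < ρ0 ∧ ρ0 ≤ 1 ∧ ∀ κ : ℝ, 0 < κ → κ ≤ 1 → ∃ N0 : ℝ, 0 < N0 ∧
    ∀ (u : E n → ℝ) (x : E n) (S : ℝ), 0 < S → S ≤ 1 → Sol u x S → ∀ a b d N : ℝ, κ * S ≤ a → 2 * a ≤ b → 2 * b ≤ d →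
    d ≤ ρ0 * S → N0 ≤ N → M u x d ≤ (d / b) ^ N * M u x b → M u x b ≤ (b / a) ^ ((1 + ε) * N) * M u x a := by
  set θ : ℝ := 2 ^ (ε / 8) with hθ
  have θ1 : 1 < θ := Real.one_lt_rpow (by norm_num) (by positivity)
  have θ2 : θ ≤ 2 := by
    calc θ ≤ 2 ^ (1:ℝ) := Real.rpow_le_rpow_of_exponent_le (by norm_num) (by linarith)
      _ = 2 := by simp
  obtain ⟨ρ0, h0, h1, C, hC, p, τ0, hτ, H⟩ := TBa hn θ1
  refine ⟨ρ0, h0, h1, fun κ hκ hκ1 => ?_⟩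
  set L := 2 * C * (κ ^ p)⁻¹ with hL
  have L0 : 0 < L := by positivity
  refine ⟨max τ0 (4 / ε * Real.logb 2 L), lt_max_of_lt_left hτ, ?_⟩
  intro u x S hS hS1 hu a b d N ha hab hbd hd hN hM
  have a0 : 0 < a := lt_of_lt_of_le (by positivity) ha
  have b0 : 0 < b := by linarith
  have d0 : 0 < d := by linarith
  have N1 : τ0 ≤ N := (le_max_left _ _).trans hN
  have N0 : 0 < N := by linarith
  have LN : L ≤ 2 ^ (ε * N / 4) := by
    have : 4 / ε * Real.logb 2 L ≤ N := (le_max_right _ _).trans hN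
    rw [← Real.logb_le_iff_le_rpow (by norm_num) L0]
    have := mul_le_mul_of_nonneg_left this (show 0 ≤ ε / 4 by positivity)
    have e : ε / 4 * (4 / ε * Real.logb 2 L) = Real.logb 2 L := by field_simp
    linarith
  have Mb := M_nonneg (u := u) x b
  have Ma := M_nonneg (u := u) x a
  set τ := (1 + ε / 2) * N with hτd
  have τN : N ≤ τ := by rw [hτd]; nlinarith
  have key := H u x S hS hS1 hu a b d τ a0 (by linarith) (by nlinarith) hd (N1.trans τN)
  have ka : ((a / S) ^ p)⁻¹ ≤ (κ ^ p)⁻¹ := by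
    apply inv_anti₀ (by positivity); gcongr; rwa [le_div_iff₀ hS]
  have kb : ((b / S) ^ p)⁻¹ ≤ (κ ^ p)⁻¹ := by
    apply inv_anti₀ (by positivity); gcongr; rw [le_div_iff₀ hS]; linarith
  have θτ : θ ^ τ ≤ 2 ^ (ε * N / 4) := by
    rw [hθ, ← Real.rpow_mul (by norm_num)]
    apply Real.rpow_le_rpow_of_exponent_le (by norm_num)
    rw [hτd]; nlinarith [mul_pos hε N0, mul_pos hε (mul_pos hε N0)]
  have half : ((2:ℝ) ^ (ε * N / 2))⁻¹ * 2 ^ (ε * N / 4) * 2 ^ (ε * N / 4) = 1 := by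
    rw [mul_assoc, ← Real.rpow_add (by norm_num), show ε * N / 4 + ε * N / 4 = ε * N / 2 by ring]
    exact inv_mul_cancel₀ (by positivity)
  -- second term
  have Md := M_nonneg (u := u) x d
  have t2 : C * (((b / S) ^ p)⁻¹ * ((θ * b / d) ^ τ * M u x d)) ≤ (1 / 2) * M u x b := by
    have e1 : (θ * b / d) ^ τ * (d / b) ^ N ≤ 2 ^ (ε * N / 4) * (2 ^ (ε * N / 2))⁻¹ := by
      have : (θ * b / d) ^ τ * (d / b) ^ N = θ ^ τ * ((d / b) ^ (ε * N / 2))⁻¹ := by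
        rw [show θ * b / d = θ / (d / b) by field_simp, Real.div_rpow (by positivity) (by positivity),
          show τ = N + ε * N / 2 by rw [hτd]; ring, Real.rpow_add (x := d / b) (by positivity)]
        have : (d / b) ^ N ≠ 0 := by positivity
        field_simp
      rw [this]
      gcongr
      rw [le_div_iff₀ b0]; linarith
    calc C * (((b / S) ^ p)⁻¹ * ((θ * b / d) ^ τ * M u x d)) ≤ C * ((κ ^ p)⁻¹ * ((θ * b / d) ^ τ * ((d / b) ^ N * M u x b))) := by gcongr
      _ = C * (κ ^ p)⁻¹ * ((θ * b / d) ^ τ * (d / b) ^ N) * M u x b := by ring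
      _ ≤ C * (κ ^ p)⁻¹ * (2 ^ (ε * N / 4) * (2 ^ (ε * N / 2))⁻¹) * M u x b := by gcongr
      _ = (1 / 2) * ((2 ^ (ε * N / 2))⁻¹ * 2 ^ (ε * N / 4) * L) * M u x b := by rw [hL]; ring
      _ ≤ (1 / 2) * ((2 ^ (ε * N / 2))⁻¹ * 2 ^ (ε * N / 4) * 2 ^ (ε * N / 4)) * M u x b := by gcongr
      _ = _ := by rw [half]; ring
  have t1 : 2 * C * ((a / S) ^ p)⁻¹ * (θ * b / a) ^ τ ≤ (b / a) ^ ((1 + ε) * N) := by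
    calc 2 * C * ((a / S) ^ p)⁻¹ * (θ * b / a) ^ τ ≤ 2 * C * (κ ^ p)⁻¹ * (θ * b / a) ^ τ := by gcongr
      _ = L * θ ^ τ * (b / a) ^ τ := by
        rw [mul_div_assoc, Real.mul_rpow (by positivity) (by positivity), hL]; ring
      _ ≤ 2 ^ (ε * N / 4) * 2 ^ (ε * N / 4) * (b / a) ^ τ := by gcongr
      _ = 2 ^ (ε * N / 2) * (b / a) ^ τ := by rw [← Real.rpow_add (by norm_num)]; ring_nf
      _ ≤ (b / a) ^ (ε * N / 2) * (b / a) ^ τ := by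
        gcongr; rw [le_div_iff₀ a0]; linarith
      _ = _ := by rw [← Real.rpow_add (by positivity)]; congr 1; rw [hτd]; ring
  have t3 : M u x b ≤ 2 * C * ((a / S) ^ p)⁻¹ * (θ * b / a) ^ τ * M u x a := by
    rw [mul_add] at key
    have e : 2 * C * ((a / S) ^ p)⁻¹ * (θ * b / a) ^ τ * M u x a = 2 * (C * (((a / S) ^ p)⁻¹ * ((θ * b / a) ^ τ * M u x a))) := by ring
    linarith
  exact t3.trans (by gcongr)

/-- monotonicity of slope -/
theorem SM (hn : 2 ≤ n) {ε : ℝ} (hε : 0 < ε) (hε1 : ε ≤ 1) : ∃ ρ0 : ℝ, 0 < ρ0 ∧ ρ0 ≤ 1 ∧ ∀ κ : ℝ, 0 < κ → κ ≤ 1 → ∃ N0 : ℝ, 0 < N0 ∧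
    ∀ (u : E n → ℝ) (x : E n) (S : ℝ), 0 < S → S ≤ 1 → Sol u x S → ∀ a b c d N : ℝ, κ * S ≤ a → 2 * a ≤ b → 2 * b ≤ c → 2 * c ≤ d →
    d ≤ ρ0 * S → N0 ≤ N → M u x d ≤ (d / c) ^ N * M u x c → M u x b ≤ (b / a) ^ ((1 + ε) * N) * M u x a := by
  obtain ⟨ρ0, h0, h1, H⟩ := SM1 hn (ε := ε / 3) (by positivity) (by linarith)
  refine ⟨ρ0, h0, h1, fun κ hκ hκ1 => ?_⟩
  obtain ⟨N0, hN0, H⟩ := H κ hκ hκ1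
  refine ⟨N0, hN0, ?_⟩
  intro u x S hS hS1 hu a b c d N ha hab hbc hcd hd hN hM
  have a0 : 0 < a := lt_of_lt_of_le (by positivity) ha
  have k1 := H u x S hS hS1 hu b c d N (by linarith) hbc hcd hd hN hM
  have N1 : N ≤ (1 + ε / 3) * N := by nlinarith
  have k2 := H u x S hS hS1 hu a b c _ ha hab hbc (by linarith) (hN.trans N1) k1
  refine k2.trans ?_
  have := M_nonneg (u := u) x a
  refine mul_le_mul_of_nonneg_right (Real.rpow_le_rpow_of_exponent_le ?_ ?_) this
  · rw [le_div_iff₀ a0]; linarith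
  · have : 0 ≤ N := by linarith
    nlinarith [mul_nonneg hε.le this, mul_nonneg hε.le (mul_nonneg hε.le this)]

/-- polynomial lower bound from a single doubling bound -/
theorem lowE (hn : 2 ≤ n) : ∃ ρ0 : ℝ, 0 < ρ0 ∧ ρ0 ≤ 1 ∧ ∀ N0 : ℝ, ∃ c : ℝ, 0 < c ∧ ∃ P : ℝ, 0 < P ∧
    ∀ (u : E n → ℝ) (x : E n) (S : ℝ), 0 < S → S ≤ 1 → Sol u x S → ∀ s : ℝ, s = ρ0 * S → 
    M u x s ≤ 2 ^ N0 * M u x (s / 2) → ∀ a, 0 < a → a ≤ s / 2 → c * (a / s) ^ P * M u x s ≤ M u x a := by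
  obtain ⟨ρ0, h0, h1, C, hC, p, τ0, hτ, H⟩ := TBa hn (θ := 3 / 2) (by norm_num)
  refine ⟨ρ0, h0, h1, fun N0 => ?_⟩
  have : Filter.Tendsto (fun τ : ℝ => C * ((ρ0 / 2) ^ p)⁻¹ * (3 / 4) ^ τ * 2 ^ N0) Filter.atTop (nhds (C * ((ρ0 / 2) ^ p)⁻¹ * 0 * 2 ^ N0)) :=
    ((tendsto_rpow_atTop_of_base_lt_one (3/4) (by norm_num) (by norm_num)).const_mul _).mul_const _
  rw [mul_zero, zero_mul] at this
  obtain ⟨τ, h2, h3⟩ := ((this.eventually (gt_mem_nhds (show (0:ℝ) < 1 / 2 by norm_num))).and (Filter.eventually_ge_atTop τ0)).exists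
  have τ1 : 0 < τ := by linarith
  refine ⟨(2 ^ (N0 + 1) * C * (ρ0 ^ p)⁻¹ * (3 / 4) ^ τ)⁻¹, by positivity, τ + p, by positivity, ?_⟩
  intro u x S hS hS1 hu s hs hM a ha has
  have s0 : 0 < s := by rw [hs]; positivity
  have key := H u x S hS hS1 hu a (s / 2) s τ ha has (by linarith) hs.le h3
  have e1 : s / 2 / S = ρ0 / 2 := by rw [hs]; field_simp
  have e2 : 3 / 2 * (s / 2) / s = 3 / 4 := by field_simp; norm_num
  rw [e1, e2, mul_add] at key
  set m := M u x (s / 2)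
  have m0 : 0 ≤ m := M_nonneg _ _
  have ma : 0 ≤ M u x a := M_nonneg _ _
  have k2 : C * (((ρ0 / 2) ^ p)⁻¹ * ((3 / 4) ^ τ * M u x s)) ≤ 1 / 2 * m := by
    calc C * (((ρ0 / 2) ^ p)⁻¹ * ((3 / 4) ^ τ * M u x s)) ≤ C * (((ρ0 / 2) ^ p)⁻¹ * ((3 / 4) ^ τ * (2 ^ N0 * m))) := by gcongr
      _ = (C * ((ρ0 / 2) ^ p)⁻¹ * (3 / 4) ^ τ * 2 ^ N0) * m := by ring
      _ ≤ _ := by gcongr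
  have k3 : M u x s ≤ 2 ^ (N0 + 1) * (C * (((a / S) ^ p)⁻¹ * ((3 / 2 * (s / 2) / a) ^ τ * M u x a))) := by
    rw [Real.rpow_add (by norm_num), Real.rpow_one]
    have : m ≤ 2 * (C * (((a / S) ^ p)⁻¹ * ((3 / 2 * (s / 2) / a) ^ τ * M u x a))) := by linarith
    calc M u x s ≤ 2 ^ N0 * m := hM
      _ ≤ 2 ^ N0 * (2 * (C * (((a / S) ^ p)⁻¹ * ((3 / 2 * (s / 2) / a) ^ τ * M u x a)))) := by gcongr
      _ = _ := by ring
  have e3 : 3 / 2 * (s / 2) / a = 3 / 4 * (a / s)⁻¹ := by field_simp; norm_num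
  have e4 : a / S = ρ0 * (a / s) := by rw [hs]; field_simp
  rw [e3, e4] at k3
  set t := a / s with ht
  have t0 : 0 < t := by positivity
  rw [mul_assoc, inv_mul_le_iff₀ (by positivity), Real.rpow_add t0, Real.rpow_natCast]
  rw [Real.mul_rpow (by norm_num) (by positivity), Real.inv_rpow t0.le, mul_pow] at k3
  calc t ^ τ * t ^ p * M u x s ≤ t ^ τ * t ^ p * _ := mul_le_mul_of_nonneg_left k3 (by positivity)
    _ = _ := by
      have : t ^ τ ≠ 0 := by positivity
      field_simp

/-- local unique continuation -/
theorem ucp0 (hn : 2 ≤ n) : ∃ ρ0 : ℝ, 0 < ρ0 ∧ ρ0 ≤ 1 ∧ ∀ (u : E n → ℝ) (x : E n) (S : ℝ), 0 < S → S ≤ 1 → Sol u x S →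
    ∀ r, 0 < r → (∀ z ∈ ball x r, u z = 0) → ∀ z ∈ ball x (ρ0 * S), u z = 0 := by
  obtain ⟨ρ0, h0, h1, C, hC, p, τ0, hτ, H⟩ := TBa hn (θ := 2) (by norm_num)
  refine ⟨ρ0 / 4, by positivity, by linarith, ?_⟩
  intro u x S hS hS1 hu r hr hz z hzb
  set b := ρ0 / 4 * S with hb
  have b0 : 0 < b := by positivity
  set a := min r b with ha
  have a0 : 0 < a := lt_min hr b0
  have Ma : M u x a = 0 := le_antisymm (M_le a0 fun y hy => by
    rw [hz y (ball_subset_ball (min_le_left _ _) hy), abs_zero]) (M_nonneg _ _)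
  have : ∀ τ, τ0 ≤ τ → |u z| ≤ C * ((b / S) ^ p)⁻¹ * (1 / 2) ^ τ * M u x (4 * b) := by
    intro τ hτ
    have := H u x S hS hS1 hu a b (4 * b) τ a0 (min_le_right _ _) (by linarith) (by rw [hb]; linarith) hτ
    rw [Ma, show 2 * b / (4 * b) = 1 / 2 by field_simp; norm_num] at this
    refine (le_M hu.1.continuous hzb).trans (this.trans (le_of_eq (by ring)))
  have lim : Filter.Tendsto (fun τ : ℝ => C * ((b / S) ^ p)⁻¹ * (1 / 2) ^ τ * M u x (4 * b)) Filter.atTop (nhds (C * ((b / S) ^ p)⁻¹ * 0 * M u x (4 * b))) :=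
    ((tendsto_rpow_atTop_of_base_lt_one (1/2) (by norm_num) (by norm_num)).const_mul _).mul_const _
  rw [mul_zero, zero_mul] at lim
  have := ge_of_tendsto lim ((Filter.eventually_ge_atTop τ0).mono this)
  exact abs_eq_zero.1 (le_antisymm this (abs_nonneg _))

theorem ucp (hn : 2 ≤ n) {u : E n → ℝ} (hu : Sol u 0 1) {x : E n} (hx : x ∈ ball (0 : E n) 1) {r : ℝ} (hr : 0 < r)
    (h : ∀ z ∈ ball x r, u z = 0) : ∀ z ∈ ball (0 : E n) 1, u z = 0 := by
  obtain ⟨ρ0, h0, h1, H⟩ := ucp0 hn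
  set U : Set (E n) := interior {z | u z = 0} with hU
  have hxU : x ∈ U := mem_interior.2 ⟨_, h, isOpen_ball, mem_ball_self hr⟩
  have key : ball (0 : E n) 1 ⊆ U := by
    apply (convex_ball (0 : E n) 1).isPreconnected.subset_of_closure_inter_subset isOpen_interior ⟨x, hx, hxU⟩
    rintro y ⟨hy1, hy2⟩
    rw [mem_ball_zero_iff] at hy2
    set S := (1 - ‖y‖) / 2 with hS
    have S0 : 0 < S := by rw [hS]; linarith
    have S1 : S ≤ 1 := by rw [hS]; linarith [norm_nonneg y]
    obtain ⟨y', hy', hd⟩ := Metric.mem_closure_iff.1 hy1 (ρ0 * S) (by positivity)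
    obtain ⟨r', hr', hb⟩ := Metric.mem_nhds_iff.1 (mem_interior_iff_mem_nhds.1 hy')
    have := H u y' S S0 S1 ⟨hu.1, fun z hz => hu.2 z (by
      rw [mem_ball] at hz
      rw [mem_ball_zero_iff]
      have e1 := dist_triangle z y' y
      have e2 : ‖z‖ ≤ dist z y + ‖y‖ := by rw [dist_eq_norm]; have := norm_add_le (z - y) y; simpa using this
      rw [dist_comm y'] at e1
      nlinarith)⟩ r' hr' hb
    exact mem_interior.2 ⟨_, this, isOpen_ball, hd⟩
  intro z hz
  have : z ∈ {z | u z = 0} := interior_subset (key hz)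
  exact this
end BL
end

open MeasureTheory Metric Set
noncomputable section
namespace BL
set_option linter.unusedVariables false
set_option linter.unusedSimpArgs false
open scoped ContDiff

variable {n : ℕ} {v w : E n} {f g h u χ : E n → ℝ}


theorem taylor1 (m : ℕ) : ∀ (G : ℕ → ℝ → ℝ) (T B : ℝ), (∀ k t, HasDerivAt (G k) (G (k + 1) t) t) →
    (∀ t ∈ Icc 0 T, |G m t| ≤ B) → ∀ t ∈ Icc 0 T,
    |G 0 t - ∑ k ∈ Finset.range m, G k 0 / k.factorial * t ^ k| ≤ B * t ^ m := by
  induction m with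
  | zero => intro G T B _ hB t ht; simpa using hB t ht
  | succ m ih =>
    intro G T B hd hB t ht
    have B0 : 0 ≤ B := (abs_nonneg _).trans (hB t ht)
    have ih' := ih (fun k => G (k + 1)) T B (fun k t => hd _ t) hB
    set H : ℝ → ℝ := fun t => G 0 t - ∑ k ∈ Finset.range (m + 1), G k 0 / k.factorial * t ^ k with hH
    have hder : ∀ y, HasDerivAt H (G 1 y - ∑ k ∈ Finset.range m, G (k + 1) 0 / k.factorial * y ^ k) y := by
      intro y
      refine (hd 0 y).sub ?_
      have : ∑ k ∈ Finset.range m, G (k + 1) 0 / k.factorial * y ^ k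
          = ∑ k ∈ Finset.range (m + 1), G k 0 / k.factorial * (k * y ^ (k - 1)) := by
        rw [Finset.sum_range_succ']
        simp only [Nat.cast_zero, zero_mul, mul_zero, add_zero, Nat.add_sub_cancel]
        refine Finset.sum_congr rfl fun k _ => ?_
        rw [Nat.factorial_succ]; push_cast; field_simp
      rw [this]
      refine HasDerivAt.fun_sum fun k _ => ?_
      exact (hasDerivAt_pow k y).const_mul _
    have := norm_image_sub_le_of_norm_deriv_le_segment' (f := H) (a := 0) (b := t) (C := B * t ^ m)
      (fun y hy => (hder y).hasDerivWithinAt) (fun y hy => by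
        rw [Real.norm_eq_abs]
        refine (ih' y ⟨hy.1, hy.2.le.trans ht.2⟩).trans ?_
        have := hy.1; have := hy.2.le; gcongr) t ⟨ht.1, le_rfl⟩
    have H0 : H 0 = 0 := by
      simp only [hH]; rw [Finset.sum_range_succ']; simp
    rw [H0, sub_zero, sub_zero, Real.norm_eq_abs] at this
    rw [pow_succ, ← mul_assoc]; exact this

theorem extrap (d : ℕ) : ∃ C : ℝ, 0 < C ∧ ∀ (c : ℕ → ℝ) (b A : ℝ), 0 < b →
    (∀ t ∈ Icc 0 b, |∑ k ∈ Finset.range (d + 1), c k * t ^ k| ≤ A) →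
    ∀ k ∈ Finset.range (d + 1), |c k| * b ^ k ≤ C * A := by
  set t : Fin (d + 1) → ℝ := fun j => ((j : ℝ) + 1) / (d + 1) with ht
  have tinj : Function.Injective t := by
    intro i j h
    have d0 : (d : ℝ) + 1 ≠ 0 := by positivity
    simp only [ht] at h
    field_simp at h
    ext; exact_mod_cast (by linarith : (i : ℝ) = j)
  set L : (Fin (d + 1) → ℝ) →ₗ[ℝ] (Fin (d + 1) → ℝ) := Matrix.mulVecLin (Matrix.vandermonde t) with hL
  have Linj : Function.Injective L := by
    have h1 : IsUnit (Matrix.vandermonde t) := by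
      rw [Matrix.isUnit_iff_isUnit_det, isUnit_iff_ne_zero]
      exact Matrix.det_vandermonde_ne_zero_iff.2 tinj
    exact Matrix.mulVec_injective_iff_isUnit.2 h1
  obtain ⟨Kc, K0, hK⟩ := LinearMap.exists_antilipschitzWith L (LinearMap.ker_eq_bot.2 Linj)
  refine ⟨Kc, by exact_mod_cast K0, fun c b A hb hA k hk => ?_⟩
  have A0 : 0 ≤ A := (abs_nonneg _).trans (hA 0 ⟨le_rfl, hb.le⟩)
  set x : Fin (d + 1) → ℝ := fun k => c k * b ^ (k : ℕ) with hx
  have h1 : ‖x‖ ≤ Kc * ‖L x‖ := by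
    have := hK.le_mul_dist x 0
    simpa [dist_eq_norm] using this
  have h2 : ‖L x‖ ≤ A := by
    rw [pi_norm_le_iff_of_nonneg A0]
    intro j
    have e : L x j = ∑ k ∈ Finset.range (d + 1), c k * (b * t j) ^ k := by
      rw [hL, Matrix.mulVecLin_apply, Matrix.mulVec, dotProduct, ← Fin.sum_univ_eq_sum_range (fun k => c k * (b * t j) ^ k)]
      refine Finset.sum_congr rfl fun k _ => ?_
      simp only [Matrix.vandermonde_apply, hx, mul_pow]; ring
    rw [e, Real.norm_eq_abs]
    have t0 : 0 ≤ t j := by simp only [ht]; positivity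
    have t1 : t j ≤ 1 := by
      simp only [ht]; rw [div_le_one (by positivity)]
      have : (j : ℕ) + 1 ≤ d + 1 := j.2
      exact_mod_cast this
    exact hA _ ⟨by positivity, by nlinarith⟩
  have h3 := norm_le_pi_norm x ⟨k, Finset.mem_range.1 hk⟩
  simp only [hx, Real.norm_eq_abs, abs_mul, abs_pow, abs_of_pos hb] at h3
  calc _ ≤ ‖x‖ := h3
    _ ≤ Kc * ‖L x‖ := h1
    _ ≤ Kc * A := by gcongr

theorem sm_ddit (hf : ContDiff ℝ ∞ f) (m : ℕ) : ContDiff ℝ ∞ ((dd v)^[m] f) := by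
  induction m with
  | zero => exact hf
  | succ m ih => rw [Function.iterate_succ_apply']; fun_prop

theorem dd_eq_sum (hf : ContDiff ℝ ∞ f) (v : E n) : dd v f = ∑ i, v i • dd (ee i) f := by
  ext x; simp [dd, fderiv_eq_sum x v]

theorem Av_it (m : ℕ) : ∀ {φ : E n → ℝ}, Moll φ → ∃ C : ℝ, 0 < C ∧ ∀ (θ : E n), ‖θ‖ ≤ 1 → ∀ f : E n → ℝ, ContDiff ℝ ∞ f →
    ∀ (x : E n) (ρ B : ℝ), 0 < ρ → (∀ y ∈ ball x ρ, |f y| ≤ B) → ρ ^ m * |Av ρ φ ((dd θ)^[m] f) x| ≤ C * B := by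
  induction m with
  | zero =>
    intro φ h
    have : 0 ≤ ∫ z, |φ z| := integral_nonneg fun _ => abs_nonneg _
    refine ⟨(∫ z, |φ z|) + 1, by positivity, fun θ hθ f hf x ρ B hρ hB => ?_⟩
    have h1 := Av_le h hf.continuous hρ hB
    have B0 : 0 ≤ B := (abs_nonneg _).trans (hB x (mem_ball_self hρ))
    simp only [pow_zero, one_mul, Function.iterate_zero, id]
    nlinarith
  | succ m ih =>
    intro φ h
    have := fun i : Fin n => ih (φ := dd (ee i) φ) h.dd
    choose C C0 hC using this
    refine ⟨∑ i, C i + 1, by have := Finset.sum_nonneg (fun i (_ : i ∈ Finset.univ) => (C0 i).le); linarith, fun θ hθ f hf x ρ B hρ hB => ?_⟩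
    have B0 : 0 ≤ B := (abs_nonneg _).trans (hB x (mem_ball_self hρ))
    set g := (dd θ)^[m] f with hg
    have sg : ContDiff ℝ ∞ g := sm_ddit hf m
    have e1 : ρ * Av ρ φ (dd θ g) x = - ∑ i, θ i * Av ρ (dd (ee i) φ) g x := by
      rw [Av_ibp h sg, dd_eq_sum h.1 θ]
      simp only [Av]
      simp_rw [← integral_const_mul]
      rw [← integral_finsetSum _ (fun i _ => (Av_int (h.dd (v := ee i)) sg.continuous ρ x).const_mul (θ i))]
      congr 2; ext z
      simp [Finset.mul_sum]; 
      refine Finset.sum_congr rfl fun i _ => by ring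
    rw [Function.iterate_succ_apply', ← hg, pow_succ, mul_assoc]
    have e2 : ρ * |Av ρ φ (dd θ g) x| = |∑ i, θ i * Av ρ (dd (ee i) φ) g x| := by
      rw [← abs_of_pos hρ, ← abs_mul, abs_of_pos hρ, e1, abs_neg]
    rw [e2]
    calc ρ ^ m * |∑ i, θ i * Av ρ (dd (ee i) φ) g x| ≤ ρ ^ m * ∑ i, |Av ρ (dd (ee i) φ) g x| := by
          gcongr
          refine (Finset.abs_sum_le_sum_abs _ _).trans (Finset.sum_le_sum fun i _ => ?_)
          rw [abs_mul]
          have : |θ i| ≤ 1 := by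
            have := PiLp.norm_apply_le θ i
            rw [Real.norm_eq_abs] at this; linarith
          exact mul_le_of_le_one_left (abs_nonneg _) this
      _ ≤ ∑ i, C i * B := by
          rw [Finset.mul_sum]; exact Finset.sum_le_sum fun i _ => hC i θ hθ f hf x ρ B hρ hB
      _ ≤ (∑ i, C i + 1) * B := by rw [← Finset.sum_mul]; nlinarith

theorem Av_line {φ : E n → ℝ} (h : Moll φ) (hf : ContDiff ℝ ∞ f) (ρ : ℝ) (x θ : E n) (t : ℝ) :
    HasDerivAt (fun t => Av ρ φ f (x + t • θ)) (Av ρ φ (dd θ f) (x + t • θ)) t := by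
  unfold Av
  have c1 := h.1.continuous
  have c2 := hf.continuous
  have c3 : Continuous (dd θ f) := (sm_dd hf).continuous
  refine param_deriv (F := fun t z => f (x + t • θ + ρ • z) * φ z)
    (F' := fun t z => dd θ f (x + t • θ + ρ • z) * φ z) ?_ ?_ ?_ ?_ t
  · simp only [Function.uncurry_def]; fun_prop
  · simp only [Function.uncurry_def]; fun_prop
  · intro s z
    refine HasDerivAt.mul_const ?_ _
    have h1 : HasDerivAt (fun t : ℝ => x + t • θ + ρ • z) ((1 : ℝ) • θ) s :=
      (((hasDerivAt_id s).smul_const θ).const_add x).add_const _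
    have := (sm_diff hf (x + s • θ + ρ • z)).hasFDerivAt.comp_hasDerivAt s h1
    rw [one_smul] at this; exact this
  · intro s z hz; simp [h.zero hz]
end BL
end

open MeasureTheory Metric Set
noncomputable section
namespace BL
set_option linter.unusedVariables false
set_option linter.unusedSimpArgs false
open scoped ContDiff

variable {n : ℕ} {v w : E n} {f g h u χ : E n → ℝ}


theorem inv0_alg {c3 c1 r0 m b e k X : ℝ} (h3 : 0 ≤ c3) (h1 : 0 ≤ c1) (h0 : 0 ≤ r0) (hm : 0 ≤ m) (hb : 0 ≤ b) (he : 0 ≤ e) (hk : 0 ≤ k)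
    (hX : X ≤ c3 * (m + c1 * (e * b) + r0 * b * k) + c1 * (e * b) + r0 * b * k) :
    X ≤ ((c3 + 1) * (1 + c1 + r0)) * (m + e * b + k * b) := by
  refine hX.trans ?_
  have a1 : 0 ≤ c3 * m := by positivity
  have a2 : 0 ≤ (c3 + 1) * (e * b) := by positivity
  have a3 : 0 ≤ (c3 + 1) * (k * b) := by positivity
  have a4 : 0 ≤ (c3 + 1) * m * (c1 + r0) := by positivity
  have a5 : 0 ≤ (c3 + 1) * (e * b) * (1 + r0) := by positivity
  have a6 : 0 ≤ (c3 + 1) * (k * b) * (1 + c1) := by positivity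
  nlinarith

theorem INV0 (hn : 1 ≤ n) (d : ℕ) : ∃ C : ℝ, 1 ≤ C ∧ ∀ κ : ℝ, 0 < κ → κ ≤ 1 / 2 → ∀ (f : E n → ℝ) (e b : ℝ), ContDiff ℝ ∞ f →
    0 ≤ e → (∀ y ∈ ball (0 : E n) 1, |f y| ≤ b) → (∀ y ∈ ball (0 : E n) 1, |lp (lp f) y| ≤ e * b) →
    κ ^ d * M f 0 κ ≤ C * (M f 0 (κ ^ 2) + e * b + κ ^ (2 * d + 1) * b) := by
  obtain ⟨ψ, mψ, i1, H⟩ := der_approx hn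
  obtain ⟨C1, C10, h1⟩ := H [] (by simp)
  obtain ⟨C2, C20, h2⟩ := Av_it (d + 1) mψ
  obtain ⟨C3, C30, h3⟩ := extrap d
  set c3 := (d + 1) * (C3 * 2 ^ d) with hc3
  set r0 := C2 * 2 ^ (d + 1) with hr0
  have c30 : 0 < c3 := by positivity
  have r00 : 0 < r0 := by positivity
  refine ⟨(c3 + 1) * (1 + C1 + r0), by nlinarith [mul_pos c30 C10, mul_pos c30 r00], ?_⟩
  intro κ κ0 κ1 f e b hf he hfb hlf
  have b0 : 0 ≤ b := (abs_nonneg _).trans (hfb 0 (mem_ball_self one_pos))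
  have Mn := M_nonneg (u := f) 0 (κ ^ 2)
  have ballsub : ∀ x : E n, ‖x‖ ≤ 1 / 2 → ball x (1 / 2) ⊆ ball 0 1 := by
    intro x hx y hy
    rw [mem_ball, dist_eq_norm] at hy; rw [mem_ball_zero_iff]
    have := norm_add_le (y - x) x
    rw [sub_add_cancel] at this; linarith
  have ap : ∀ x : E n, ‖x‖ ≤ 1 / 2 → |f x - Av (1 / 2) ψ f x| ≤ C1 * (e * b) := by
    intro x hx
    have := h1 f hf x (1 / 2) (e * b) (by norm_num) (fun y hy => hlf y (ballsub x hx hy))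
    simp only [pl, List.length_nil, pow_zero, one_mul] at this
    have : 0 ≤ C1 * (e * b) := by positivity
    linarith
  have key : ∀ y ∈ ball (0 : E n) κ, κ ^ d * |f y| ≤ ((c3 + 1) * (1 + C1 + r0)) * (M f 0 (κ ^ 2) + e * b + κ ^ (2 * d + 1) * b) := by
    intro y hy
    rw [mem_ball_zero_iff] at hy
    set θ : E n := ‖y‖⁻¹ • y with hθ
    have yθ : ‖y‖ • θ = y := by
      by_cases h : y = 0
      · simp [h]
      · rw [hθ, smul_smul, mul_inv_cancel₀ (norm_ne_zero_iff.2 h), one_smul]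
    have θ1 : ‖θ‖ ≤ 1 := by
      rw [hθ, norm_smul, norm_inv, norm_norm]; exact inv_mul_le_one
    set G : ℕ → ℝ → ℝ := fun k t => Av (1 / 2) ψ ((dd θ)^[k] f) (0 + t • θ) with hG
    have nt : ∀ t ∈ Icc 0 κ, ‖(0 : E n) + t • θ‖ ≤ t := by
      intro t ht
      rw [zero_add, norm_smul, Real.norm_eq_abs, abs_of_nonneg ht.1]
      exact mul_le_of_le_one_right ht.1 θ1
    have T := taylor1 (d + 1) G κ (r0 * b) (fun k t => by
        have := Av_line mψ (sm_ddit (v := θ) hf k) (1 / 2) 0 θ t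
        rw [hG]; simp only [Function.iterate_succ_apply']; exact this) (fun t ht => by
        have := h2 θ θ1 f hf (0 + t • θ) (1 / 2) b (by norm_num) (fun y hy => hfb y (ballsub _ ((nt t ht).trans (ht.2.trans κ1)) hy))
        rw [one_div, inv_pow, inv_mul_le_iff₀ (by positivity)] at this
        simp only [hG]; rw [one_div]; refine this.trans (le_of_eq ?_); rw [hr0]; ring)
    set c : ℕ → ℝ := fun k => G k 0 / k.factorial with hc
    have k2 : κ ^ 2 ≤ κ := by nlinarith
    have pe := h3 c (κ ^ 2 / 2) (M f 0 (κ ^ 2) + C1 * (e * b) + r0 * b * κ ^ (2 * d + 1)) (by positivity) (by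
      intro t ht
      have tκ : t ∈ Icc 0 κ := ⟨ht.1, by nlinarith [ht.2]⟩
      have t1 := abs_le.1 (T t tκ)
      have t2 := abs_le.1 (ap _ ((nt t tκ).trans (tκ.2.trans κ1)))
      have t3 := abs_le.1 (le_M (u := f) hf.continuous (x := 0) (r := κ ^ 2) (y := 0 + t • θ) (by
        rw [mem_ball_zero_iff]; refine (nt t tκ).trans_lt ?_; have := ht.2; nlinarith [pow_pos κ0 2]))
      have t4 : r0 * b * t ^ (d + 1) ≤ r0 * b * κ ^ (2 * d + 1) := by
        have : t ^ (d + 1) ≤ κ ^ (2 * d + 1) := by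
          have : t ≤ κ ^ 2 := by nlinarith [ht.2, pow_pos κ0 2]
          calc t ^ (d + 1) ≤ (κ ^ 2) ^ (d + 1) := by have := ht.1; gcongr
            _ = κ ^ (2 * d + 2) := by rw [← pow_mul]; ring_nf
            _ ≤ κ ^ (2 * d + 1) := pow_le_pow_of_le_one κ0.le (by linarith) (by omega)
        gcongr
      have e0 : G 0 t = Av (1 / 2) ψ f (0 + t • θ) := rfl
      rw [e0] at t1
      rw [abs_le]
      constructor <;> linarith [t1.1, t1.2, t2.1, t2.2, t3.1, t3.2])
    set A := M f 0 (κ ^ 2) + C1 * (e * b) + r0 * b * κ ^ (2 * d + 1) with hA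
    have A0 : 0 ≤ A := by rw [hA]; positivity
    have yκ : ‖y‖ ∈ Icc 0 κ := ⟨norm_nonneg _, hy.le⟩
    have p1 : κ ^ d * |∑ k ∈ Finset.range (d + 1), c k * ‖y‖ ^ k| ≤ c3 * A := by
      calc κ ^ d * |∑ k ∈ Finset.range (d + 1), c k * ‖y‖ ^ k|
          ≤ κ ^ d * ∑ k ∈ Finset.range (d + 1), |c k| * κ ^ k := by
            gcongr
            refine (Finset.abs_sum_le_sum_abs _ _).trans (Finset.sum_le_sum fun k _ => ?_)
            rw [abs_mul, abs_pow, abs_norm]; gcongr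
        _ ≤ ∑ k ∈ Finset.range (d + 1), C3 * 2 ^ d * A := by
            rw [Finset.mul_sum]; refine Finset.sum_le_sum fun k hk => ?_
            have kd : k ≤ d := by have := Finset.mem_range.1 hk; omega
            have q1 := pe k hk
            have q2 : κ ^ d ≤ κ ^ k := pow_le_pow_of_le_one κ0.le (by linarith) kd
            have q3 : (2 : ℝ) ^ k ≤ 2 ^ d := pow_le_pow_right₀ (by norm_num) kd
            calc κ ^ d * (|c k| * κ ^ k) ≤ κ ^ k * (|c k| * κ ^ k) := by gcongr
              _ = 2 ^ k * (|c k| * (κ ^ 2 / 2) ^ k) := by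
                rw [div_pow, ← pow_mul]; field_simp; ring
              _ ≤ 2 ^ d * (C3 * A) := by gcongr
              _ = _ := by ring
        _ = c3 * A := by simp [hc3]; ring
    have t1 := T _ yκ
    have e0 : G 0 ‖y‖ = Av (1 / 2) ψ f y := by simp only [hG, zero_add, yθ]; rfl
    rw [e0] at t1
    have t2 := ap y (by linarith)
    have hfy : |f y| ≤ |∑ k ∈ Finset.range (d + 1), c k * ‖y‖ ^ k| + C1 * (e * b) + r0 * b * κ ^ (d + 1) := by
      have : r0 * b * ‖y‖ ^ (d + 1) ≤ r0 * b * κ ^ (d + 1) := by gcongr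
      have a1 := abs_sub_abs_le_abs_sub (f y) (Av (1 / 2) ψ f y)
      have a2 := abs_sub_abs_le_abs_sub (Av (1 / 2) ψ f y) (∑ k ∈ Finset.range (d + 1), c k * ‖y‖ ^ k)
      linarith
    have kd1 : κ ^ d ≤ 1 := pow_le_one₀ κ0.le (by linarith)
    refine inv0_alg c30.le C10.le r00.le Mn b0 he (by positivity) ?_
    calc κ ^ d * |f y| ≤ κ ^ d * (|∑ k ∈ Finset.range (d + 1), c k * ‖y‖ ^ k| + C1 * (e * b) + r0 * b * κ ^ (d + 1)) := by gcongr
      _ = κ ^ d * |∑ k ∈ Finset.range (d + 1), c k * ‖y‖ ^ k| + κ ^ d * (C1 * (e * b)) + r0 * b * κ ^ (2 * d + 1) := by ring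
      _ ≤ c3 * A + 1 * (C1 * (e * b)) + r0 * b * κ ^ (2 * d + 1) := by gcongr
      _ = _ := by rw [hA]; ring
  have : M f 0 κ ≤ (κ ^ d)⁻¹ * (((c3 + 1) * (1 + C1 + r0)) * (M f 0 (κ ^ 2) + e * b + κ ^ (2 * d + 1) * b)) :=
    M_le κ0 fun y hy => by rw [le_inv_mul_iff₀ (by positivity)]; exact key y hy
  rwa [le_inv_mul_iff₀ (by positivity)] at this

theorem inv_alg {C q Qd m b s4 mk Q2 : ℝ} (hQ : 0 < Qd) (C1 : 1 ≤ C) (q0 : 0 < q) (hq : 4 * C * q ≤ 1) (hm : 0 ≤ m) (hmk : 0 ≤ mk) (hb : 0 ≤ b)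
   (hs : s4 ≤ Q2) (h1 : Qd * mk ≤ C * (m + s4 * b + Q2 * b)) (h2 : Q2 * b ≤ Qd * q * mk) : mk * (Qd * q) ≤ m := by
  have a1 : s4 * b ≤ Q2 * b := by gcongr
  have a2 : C * (m + s4 * b + Q2 * b) ≤ C * (m + 2 * (Qd * q * mk)) :=
    mul_le_mul_of_nonneg_left (by linarith) (by linarith)
  have a3 : (4 * C * q) * (Qd * mk) ≤ 1 * (Qd * mk) := by gcongr
  have a4 : Qd * mk ≤ 2 * C * m := by linarith
  calc mk * (Qd * q) = q * (Qd * mk) := by ring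
    _ ≤ q * (2 * C * m) := by gcongr
    _ = (4 * C * q) * m / 2 := by ring
    _ ≤ 1 * m / 2 := by gcongr
    _ ≤ m := by linarith

theorem lplp_scale (hu : ContDiff ℝ ∞ u) (x : E n) (S : ℝ) (y : E n) :
    lp (lp (fun z => u (x + S • z))) y = S ^ 4 * lp (lp u) (x + S • y) := by
  have e1 : lp (fun z => u (x + S • z)) = fun z => S ^ 2 * lp u (x + S • z) := by
    rw [lp_comp_smul_add hu]
  have hl : ContDiff ℝ ∞ (lp u) := by fun_prop
  have e2 : lp (fun z => S ^ 2 * lp u (x + S • z)) = fun z => S ^ 2 * (S ^ 2 * lp (lp u) (x + S • z)) := by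
    have : (fun z : E n => S ^ 2 * lp u (x + S • z)) = (S ^ 2) • fun z => lp u (x + S • z) := by ext z; simp
    rw [this, lp_smul _ (by fun_prop), lp_comp_smul_add hl]; ext z; simp
  rw [e1, e2]; ring

theorem INV (hn : 1 ≤ n) (d : ℕ) : ∃ q0 : ℝ, 0 < q0 ∧ ∀ q : ℝ, 0 < q → q ≤ q0 → ∃ s1 : ℝ, 0 < s1 ∧ ∀ (u : E n → ℝ) (x : E n) (s : ℝ), 
    0 < s → s ≤ s1 → Sol u x s → M u x s * q ^ (2 * d + 1) ≤ M u x (q ^ 2 * s) → 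
    M u x (q ^ 2 * s) * q ^ (2 * d + 1) ≤ M u x (q ^ 2 * (q ^ 2 * s)) := by
  obtain ⟨C, C1, H⟩ := INV0 hn d
  refine ⟨(4 * C)⁻¹, by positivity, fun q q0 hq => ?_⟩
  have q1 : 4 * C * q ≤ 1 := by
    have := mul_le_mul_of_nonneg_left hq (by positivity : 0 ≤ 4 * C)
    rwa [mul_inv_cancel₀ (by positivity)] at this
  have q4 : q ≤ 1 / 4 := by nlinarith
  refine ⟨q ^ (4 * d + 2), by positivity, ?_⟩
  intro u x s s0 hs hu hM
  have sl : s ≤ 1 := hs.trans (pow_le_one₀ q0.le (by linarith))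
  have e : ∀ r, M (fun z => u (x + s • z)) 0 r = M u x (s * r) := fun r => M_scale s0
  have := H (q ^ 2) (by positivity) (by nlinarith) (fun z => u (x + s • z)) (s ^ 4) (M u x s) (hu.1.comp (by fun_prop)) (by positivity) (by
      intro y hy
      refine le_M hu.1.continuous ?_
      rw [mem_ball_zero_iff] at hy
      simp only [mem_ball, dist_eq_norm, add_sub_cancel_left, norm_smul, Real.norm_eq_abs, abs_of_pos s0]
      nlinarith) (by
      intro y hy
      rw [lplp_scale hu.1, abs_mul, abs_of_pos (by positivity)]
      have hy' : x + s • y ∈ ball x s := by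
        rw [mem_ball_zero_iff] at hy
        simp only [mem_ball, dist_eq_norm, add_sub_cancel_left, norm_smul, Real.norm_eq_abs, abs_of_pos s0]
        nlinarith
      gcongr
      exact (hu.2 _ hy').trans (le_M hu.1.continuous hy'))
  rw [e, e, mul_comm s, mul_comm s, ← pow_mul] at this
  have r1 : q ^ (2 * d + 1) = q ^ (2 * d) * q := pow_succ _ _
  rw [r1]
  have r2 : q ^ 2 * (q ^ 2 * s) = (q ^ 2) ^ 2 * s := by ring
  rw [r2]
  refine inv_alg (by positivity) C1 q0 q1 (M_nonneg _ _) (M_nonneg _ _) (M_nonneg x s) (Q2 := (q ^ 2) ^ (2 * d + 1)) ?_ this ?_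
  · calc s ^ 4 ≤ s ^ 1 := pow_le_pow_of_le_one s0.le sl (by norm_num)
      _ ≤ (q ^ 2) ^ (2 * d + 1) := by rw [pow_one]; refine hs.trans (le_of_eq ?_); ring
  · calc (q ^ 2) ^ (2 * d + 1) * M u x s = q ^ (2 * d + 1) * (M u x s * q ^ (2 * d + 1)) := by ring
      _ ≤ q ^ (2 * d + 1) * M u x (q ^ 2 * s) := by gcongr
      _ = _ := by ring

theorem Sol.mono {x : E n} {s S : ℝ} (h : Sol u x S) (hs : s ≤ S) : Sol u x s :=
  ⟨h.1, fun y hy => h.2 y (ball_subset_ball hs hy)⟩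

/-- bounded doubling at one scale gives bounded doubling at all smaller scales -/
theorem LOWN (hn : 2 ≤ n) : ∃ ρ0 : ℝ, 0 < ρ0 ∧ ρ0 ≤ 1 ∧ ∀ N0 : ℝ, ∃ s1 : ℝ, 0 < s1 ∧ s1 ≤ 1 ∧ ∃ N1 : ℝ, 1 ≤ N1 ∧
    ∀ (u : E n → ℝ) (x : E n) (S : ℝ), 0 < S → S ≤ s1 → Sol u x S → ∀ s : ℝ, s = ρ0 * S → 
    M u x s ≤ 2 ^ N0 * M u x (s / 2) → ∀ r, 0 < r → r ≤ s → M u x r ≤ N1 * M u x (r / 4) := by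
  obtain ⟨ρ0, h0, h1, H⟩ := lowE hn
  refine ⟨ρ0, h0, h1, fun N0 => ?_⟩
  obtain ⟨c, c0, P, P0, H⟩ := H N0
  obtain ⟨d, hd⟩ := exists_nat_ge P
  obtain ⟨q0, q00, HI⟩ := INV (n := n) (by omega) d
  set q := min (min q0 c) (1 / 4) with hq
  have qp : 0 < q := by rw [hq]; positivity
  have qq0 : q ≤ q0 := (min_le_left _ _).trans (min_le_left _ _)
  have qc : q ≤ c := (min_le_left _ _).trans (min_le_right _ _)
  have q4 : q ≤ 1 / 4 := min_le_right _ _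
  obtain ⟨s1, s10, HI⟩ := HI q qp qq0
  set Q := q ^ (2 * d + 1) with hQ
  have Q0 : 0 < Q := by positivity
  have Q1 : Q ≤ 1 := pow_le_one₀ qp.le (by linarith)
  refine ⟨min s1 1, by positivity, min_le_right _ _, (Q ^ 2)⁻¹, (one_le_inv₀ (by positivity)).2 (pow_le_one₀ Q0.le Q1), ?_⟩
  intro u x S hS hS1 hu s hs hM r r0 hr
  have s0 : 0 < s := by rw [hs]; positivity
  have sS : s ≤ S := by rw [hs]; exact mul_le_of_le_one_left hS.le h1
  have κ0 : 0 < q ^ 2 := by positivity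
  have κ4 : q ^ 2 ≤ 1 / 4 := by nlinarith
  have base : M u x s * Q ≤ M u x (q ^ 2 * s) := by
    have := H u x S hS (hS1.trans (min_le_right _ _)) hu s hs hM (q ^ 2 * s) (by positivity) (by nlinarith)
    rw [mul_div_assoc, div_self s0.ne', mul_one] at this
    refine le_trans ?_ this
    rw [mul_comm]
    refine mul_le_mul_of_nonneg_right ?_ (M_nonneg _ _)
    rw [hQ, pow_succ, mul_comm, pow_mul, ← Real.rpow_natCast (q ^ 2) d]
    refine mul_le_mul qc ?_ (by positivity) c0.le
    exact Real.rpow_le_rpow_of_exponent_ge κ0 (by linarith) hd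
  have all : ∀ j : ℕ, M u x ((q ^ 2) ^ j * s) * Q ≤ M u x ((q ^ 2) ^ (j + 1) * s) := by
    intro j
    induction j with
    | zero => simpa using base
    | succ j ih =>
      have js : (q ^ 2) ^ j * s ≤ s := mul_le_of_le_one_left s0.le (pow_le_one₀ κ0.le (by linarith))
      have := HI u x ((q ^ 2) ^ j * s) (by positivity) ((js.trans sS).trans (hS1.trans (min_le_left _ _))) (hu.mono (js.trans sS)) (by
        rw [← mul_assoc, ← pow_succ']; exact ih)
      rw [← mul_assoc, ← pow_succ', ← mul_assoc, ← pow_succ'] at this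
      exact this
  obtain ⟨j, j1, j2⟩ := exists_nat_pow_near_of_lt_one (x := r / s) (y := q ^ 2) (by positivity) ((div_le_one s0).2 hr) κ0 (by linarith)
  rw [lt_div_iff₀ s0] at j1
  rw [div_le_iff₀ s0] at j2
  have a1 : M u x r ≤ M u x ((q ^ 2) ^ j * s) := M_mono hu.1.continuous j2
  have a2 := all j
  have a3 := all (j + 1)
  have a4 : M u x ((q ^ 2) ^ (j + 1 + 1) * s) ≤ M u x (r / 4) := by
    refine M_mono hu.1.continuous ?_
    rw [pow_succ' _ (j + 1), mul_assoc]
    nlinarith [mul_pos κ0 r0]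
  rw [le_inv_mul_iff₀ (by positivity)]
  calc Q ^ 2 * M u x r ≤ Q ^ 2 * M u x ((q ^ 2) ^ j * s) := by gcongr
    _ = (M u x ((q ^ 2) ^ j * s) * Q) * Q := by ring
    _ ≤ M u x ((q ^ 2) ^ (j + 1) * s) * Q := by gcongr
    _ ≤ _ := a3.trans a4
end BL
end

open MeasureTheory Metric Set
noncomputable section
namespace BL
set_option linter.unusedVariables false
set_option linter.unusedSimpArgs false
open scoped ContDiff

variable {n : ℕ} {v w : E n} {f g h u χ : E n → ℝ}

open RealInnerProductSpace

theorem simplex0 {w0 : ℝ} (hw0 : 0 < w0) (m : ℕ) : ∃ a : ℝ, 0 < a ∧ ∀ (F : Set (E n)) (σ : ℝ), 0 < σ → F.Nonempty →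
    (∀ x ∈ F, ∀ y ∈ F, ‖x - y‖ ≤ 2 * σ) → (∀ ν p : E n, ‖ν‖ = 1 → ∃ f ∈ F, w0 * σ < |⟪f - p, ν⟫|) → m ≤ n →
    ∃ (T : Finset (E n)) (f0 : E n) (V : Submodule ℝ (E n)), (T : Set (E n)) ⊆ F ∧ T.card ≤ m + 1 ∧ f0 ∈ T ∧ Module.finrank ℝ V = m ∧
      (∀ f ∈ T, f - f0 ∈ V) ∧ ∀ v ∈ V, ∃ f ∈ T, ∃ f' ∈ T, a * σ * ‖v‖ ≤ ⟪f - f', v⟫ := by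
  induction m with
  | zero =>
    refine ⟨1, one_pos, fun F σ hσ hF hd hs _ => ?_⟩
    obtain ⟨f0, h0⟩ := hF
    refine ⟨{f0}, f0, ⊥, by simpa using h0, by simp, by simp, by simp, by simp, fun v hv => ?_⟩
    rw [Submodule.mem_bot] at hv
    exact ⟨f0, by simp, f0, by simp, by simp [hv]⟩
  | succ m ih =>
    obtain ⟨a, a0, H⟩ := ih
    refine ⟨min (w0 / 4) (a / (1 + 4 / w0)), by positivity, fun F σ hσ hF hd hs hm => ?_⟩
    obtain ⟨T, f0, V, hT, hc, h0, hV, hTV, hv⟩ := H F σ hσ hF hd hs (by omega)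
    have hVo : Vᗮ ≠ ⊥ := by
      intro h
      have := Submodule.finrank_add_finrank_orthogonal V
      rw [h, hV] at this
      simp at this; omega
    obtain ⟨x, hx, hx0⟩ := Submodule.exists_mem_ne_zero_of_ne_bot hVo
    obtain ⟨f, hf, hfw⟩ := hs (‖x‖⁻¹ • x) f0 (by rw [norm_smul, norm_inv, norm_norm, inv_mul_cancel₀ (norm_ne_zero_iff.2 hx0)])
    set P := V.starProjection (f - f0) with hP
    set q := f - f0 - P with hq
    have hqV : q ∈ Vᗮ := Submodule.sub_starProjection_mem_orthogonal (f - f0)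
    have hPV : P ∈ V := Submodule.starProjection_apply_mem V _
    have hqn : w0 * σ < ‖q‖ := by
      have h1 : ⟪f - f0, ‖x‖⁻¹ • x⟫ = ⟪q, ‖x‖⁻¹ • x⟫ := by
        rw [hq, inner_sub_left (f - f0) P, inner_smul_right P, Submodule.inner_right_of_mem_orthogonal hPV hx]; simp
      rw [h1] at hfw
      refine hfw.trans_le ((abs_real_inner_le_norm _ _).trans ?_)
      rw [norm_smul, norm_inv, norm_norm, inv_mul_cancel₀ (norm_ne_zero_iff.2 hx0), mul_one]
    have q0 : 0 < ‖q‖ := lt_trans (by positivity) hqn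
    have hff : ‖f - f0‖ ≤ 2 * σ := hd f hf f0 (hT h0)
    have pq : ‖f - f0‖ ^ 2 = ‖P‖ ^ 2 + ‖q‖ ^ 2 := by
      have : f - f0 = P + q := by rw [hq]; abel
      rw [this, pow_two, norm_add_sq_eq_norm_sq_add_norm_sq_real (Submodule.inner_right_of_mem_orthogonal hPV hqV)]; ring
    have P2 : ‖P‖ ≤ 2 * σ := by
      have : ‖P‖ ≤ ‖f - f0‖ := abs_le_of_sq_le_sq' (by nlinarith [sq_nonneg ‖q‖]) (norm_nonneg _) |>.2
      linarith
    have q2 : ‖q‖ ≤ 2 * σ := by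
      have : ‖q‖ ≤ ‖f - f0‖ := abs_le_of_sq_le_sq' (by nlinarith [sq_nonneg ‖P‖]) (norm_nonneg _) |>.2
      linarith
    classical
    refine ⟨insert f T, f0, V ⊔ Submodule.span ℝ {q}, ?_, (Finset.card_insert_le _ _).trans (by omega), by simp [h0], ?_, ?_, ?_⟩
    · rw [Finset.coe_insert]; exact insert_subset hf hT
    · have hdis : V ⊓ Submodule.span ℝ {q} = ⊥ := by
        have : Submodule.span ℝ {q} ≤ Vᗮ := by rw [Submodule.span_singleton_le_iff_mem]; exact hqV
        exact eq_bot_iff.2 ((inf_le_inf_left V this).trans (Submodule.inf_orthogonal_eq_bot V).le)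
      have := Submodule.finrank_sup_add_finrank_inf_eq V (Submodule.span ℝ {q})
      rw [hdis, hV, finrank_span_singleton (norm_pos_iff.1 q0)] at this
      simpa using this
    · intro g hg
      rw [Finset.mem_insert] at hg
      rcases hg with rfl | hg
      · rw [Submodule.mem_sup]; exact ⟨P, hPV, q, Submodule.mem_span_singleton_self q, by rw [hq]; abel⟩
      · exact Submodule.mem_sup_left (hTV g hg)
    · intro v hvV
      rw [Submodule.mem_sup] at hvV
      obtain ⟨v', hv', z, hz, rfl⟩ := hvV
      obtain ⟨t, rfl⟩ := Submodule.mem_span_singleton.1 hz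
      have nv : ‖v' + t • q‖ ≤ ‖v'‖ + |t| * ‖q‖ := by
        refine (norm_add_le _ _).trans ?_; rw [norm_smul, Real.norm_eq_abs]
      by_cases hcase : 4 * σ * ‖v'‖ ≤ |t| * ‖q‖ ^ 2
      · have e1 : ⟪f - f0, v' + t • q⟫ = ⟪P, v'⟫ + t * ‖q‖ ^ 2 := by
          have : f - f0 = P + q := by rw [hq]; abel
          rw [this, inner_add_left, inner_add_right, inner_add_right, inner_smul_right, inner_smul_right,
            Submodule.inner_right_of_mem_orthogonal hPV hqV, Submodule.inner_left_of_mem_orthogonal hv' hqV, real_inner_self_eq_norm_sq]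
          ring
        have e2 : |⟪P, v'⟫| ≤ 2 * σ * ‖v'‖ := (abs_real_inner_le_norm _ _).trans (by gcongr)
        have e3 : |t| * ‖q‖ ^ 2 / 2 ≤ |⟪f - f0, v' + t • q⟫| := by
          rw [e1]
          have : |t| * ‖q‖ ^ 2 = |t * ‖q‖ ^ 2| := by rw [abs_mul, abs_of_nonneg (sq_nonneg ‖q‖)]
          have h2 := abs_sub_abs_le_abs_sub (t * ‖q‖ ^ 2) (-⟪P, v'⟫)
          rw [abs_neg, sub_neg_eq_add, add_comm] at h2
          linarith
        have e4 : min (w0 / 4) (a / (1 + 4 / w0)) * σ * ‖v' + t • q‖ ≤ |⟪f - f0, v' + t • q⟫| := by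
          refine le_trans ?_ e3
          have n2 : ‖v' + t • q‖ ≤ 2 * (|t| * ‖q‖) := by
            have : 4 * σ * ‖v'‖ ≤ 4 * σ * (|t| * ‖q‖) := by
              have : |t| * ‖q‖ * ‖q‖ ≤ |t| * ‖q‖ * (2 * σ) := by gcongr
              have : 0 ≤ |t| * ‖q‖ * σ := by positivity
              nlinarith
            have := le_of_mul_le_mul_left this (by positivity); linarith
          calc min (w0 / 4) (a / (1 + 4 / w0)) * σ * ‖v' + t • q‖ ≤ w0 / 4 * σ * (2 * (|t| * ‖q‖)) := by
                gcongr; exact min_le_left _ _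
            _ = (w0 * σ) * (|t| * ‖q‖) / 2 := by ring
            _ ≤ ‖q‖ * (|t| * ‖q‖) / 2 := by gcongr
            _ = _ := by ring
        rcases le_total 0 ⟪f - f0, v' + t • q⟫ with h | h
        · rw [abs_of_nonneg h] at e4; exact ⟨f, by simp, f0, by simp [h0], e4⟩
        · rw [abs_of_nonpos h, ← inner_neg_left, neg_sub] at e4; exact ⟨f0, by simp [h0], f, by simp, e4⟩
      · push Not at hcase
        obtain ⟨g, hg, g', hg', hgg⟩ := hv v' hv'
        refine ⟨g, by simp [hg], g', by simp [hg'], ?_⟩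
        have e1 : ⟪g - g', v' + t • q⟫ = ⟪g - g', v'⟫ := by
          have : g - g' ∈ V := by
            have := V.sub_mem (hTV g hg) (hTV g' hg'); simpa using this
          rw [inner_add_right, inner_smul_right, Submodule.inner_right_of_mem_orthogonal this hqV]; simp
        rw [e1]; refine le_trans ?_ hgg
        have n2 : ‖v' + t • q‖ ≤ (1 + 4 / w0) * ‖v'‖ := by
          have : |t| * ‖q‖ * (w0 * σ) ≤ 4 * σ * ‖v'‖ := by
            refine le_trans ?_ hcase.le
            have := mul_le_mul_of_nonneg_left hqn.le (by positivity : 0 ≤ |t| * ‖q‖)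
            rw [pow_two]; linarith
          have : |t| * ‖q‖ ≤ 4 / w0 * ‖v'‖ := by
            rw [div_mul_eq_mul_div, le_div_iff₀ hw0]
            have : σ * (|t| * ‖q‖ * w0) ≤ σ * (4 * ‖v'‖) := by linarith
            exact le_of_mul_le_mul_left this hσ
          linarith
        calc min (w0 / 4) (a / (1 + 4 / w0)) * σ * ‖v' + t • q‖ ≤ (a / (1 + 4 / w0)) * σ * ((1 + 4 / w0) * ‖v'‖) := by
              gcongr; exact min_le_right _ _
          _ = a * σ * ‖v'‖ := by field_simp

theorem simplex {w0 : ℝ} (hw0 : 0 < w0) : ∃ a : ℝ, 0 < a ∧ ∀ (F : Set (E n)) (σ : ℝ), 0 < σ → F.Nonempty →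
    (∀ x ∈ F, ∀ y ∈ F, ‖x - y‖ ≤ 2 * σ) → (∀ ν p : E n, ‖ν‖ = 1 → ∃ f ∈ F, w0 * σ < |⟪f - p, ν⟫|) →
    ∃ x ∈ convexHull ℝ F, ∀ v : E n, ∃ f ∈ F, a * σ * ‖v‖ ≤ ⟪f - x, v⟫ := by
  obtain ⟨a, a0, H⟩ := simplex0 (n := n) hw0 n
  refine ⟨a / (n + 2), by positivity, fun F σ hσ hF hd hs => ?_⟩
  obtain ⟨T, f0, V, hT, hc, h0, hV, hTV, hv⟩ := H F σ hσ hF hd hs le_rfl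
  have Vt : V = ⊤ := Submodule.eq_top_of_finrank_eq (by rw [hV]; simp)
  have Tn : T.Nonempty := ⟨f0, h0⟩
  have Tc : 0 < (T.card : ℝ) := by exact_mod_cast Tn.card_pos
  set x := ∑ f ∈ T, (T.card : ℝ)⁻¹ • f with hx
  have xc : x ∈ convexHull ℝ F := by
    refine (convex_convexHull ℝ F).sum_mem (fun _ _ => by positivity) ?_ (fun f hf => subset_convexHull ℝ F (hT hf))
    rw [Finset.sum_const, nsmul_eq_mul, mul_inv_cancel₀ Tc.ne']
  refine ⟨x, xc, fun v => ?_⟩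
  by_contra hcon
  push Not at hcon
  set A := a / (n + 2) * σ * ‖v‖ with hA
  have A0 : 0 ≤ A := by positivity
  have hsum : ∑ f ∈ T, ⟪f - x, v⟫ = 0 := by
    rw [← sum_inner, Finset.sum_sub_distrib, Finset.sum_const, hx, ← Finset.smul_sum]
    rw [← Nat.cast_smul_eq_nsmul ℝ, smul_smul, mul_inv_cancel₀ Tc.ne', one_smul, sub_self, inner_zero_left]
  have lower : ∀ f ∈ T, -(n * A) ≤ ⟪f - x, v⟫ := by
    classical
    intro f hf
    rw [← Finset.add_sum_erase T _ hf] at hsum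
    have : ∑ g ∈ T.erase f, ⟪g - x, v⟫ ≤ ∑ g ∈ T.erase f, A := Finset.sum_le_sum fun g hg => (hcon g (hT (Finset.mem_of_mem_erase hg))).le
    rw [Finset.sum_const, nsmul_eq_mul, Finset.card_erase_of_mem hf] at this
    have : ((T.card - 1 : ℕ) : ℝ) * A ≤ n * A := by gcongr; omega
    linarith
  obtain ⟨f, hf, f', hf', hff⟩ := hv v (by rw [Vt]; trivial)
  have e1 : ⟪f - f', v⟫ = ⟪f - x, v⟫ - ⟪f' - x, v⟫ := by rw [← inner_sub_left]; congr 1; abel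
  have := hcon f (hT hf)
  have := lower f' hf'
  have e2 : a * σ * ‖v‖ = (n + 2) * A := by rw [hA]; field_simp
  rw [e1, e2] at hff
  linarith
end BL
end

open MeasureTheory Metric Set
noncomputable section
namespace BL
set_option linter.unusedVariables false
set_option linter.unusedSimpArgs false
open scoped ContDiff

variable {n : ℕ} {v w : E n} {f g h u χ : E n → ℝ}

open RealInnerProductSpace

def HypU (u : E n → ℝ) (K : Set (E n)) (e r0 R0 : ℝ) : Prop :=
  ∀ x ∈ K, ∀ a b, r0 ≤ a → 2 * a ≤ b → b ≤ R0 → M u x b ≤ (b / a) ^ e * M u x a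

def HypL (u : E n → ℝ) (K : Set (E n)) (e r0 R0 : ℝ) : Prop :=
  ∀ x ∈ K, ∀ a b, r0 ≤ a → 2 * a ≤ b → b ≤ R0 → (b / a) ^ e * M u x a ≤ M u x b

theorem HypU.mono {K K' : Set (E n)} {e r0 R0 r0' R0' : ℝ} (h : HypU u K e r0 R0) (hK : K' ⊆ K) (h1 : r0 ≤ r0') (h2 : R0' ≤ R0) :
    HypU u K' e r0' R0' := fun x hx a b ha hab hb => h x (hK hx) a b (h1.trans ha) hab (hb.trans h2)

theorem HypL.mono {K K' : Set (E n)} {e r0 R0 r0' R0' : ℝ} (h : HypL u K e r0 R0) (hK : K' ⊆ K) (h1 : r0 ≤ r0') (h2 : R0' ≤ R0) :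
    HypL u K' e r0' R0' := fun x hx a b ha hab hb => h x (hK hx) a b (h1.trans ha) hab (hb.trans h2)

theorem ball_cov {x : E n} {F : Set (E n)} {a σ k : ℝ} (hσ : 0 < σ) (a0 : 0 < a) (a1 : a ≤ 1) (hk : k = 8 / a)
    (hF : ∀ f ∈ F, ‖f - x‖ ≤ 2 * σ) (h : ∀ v : E n, ∃ f ∈ F, a * σ * ‖v‖ ≤ ⟪f - x, v⟫) {w : E n}
    (hw : ‖w - x‖ < k * σ + a * σ / 2) : ∃ f ∈ F, w ∈ ball f (k * σ) := by
  obtain ⟨f, hf, h1⟩ := h (w - x)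
  refine ⟨f, hf, ?_⟩
  rw [mem_ball, dist_eq_norm]
  have hka : k * a = 8 := by rw [hk]; field_simp
  have k8 : 8 ≤ k := by rw [hk, le_div_iff₀ a0]; linarith
  set t := ‖w - x‖ with ht
  have t0 : 0 ≤ t := norm_nonneg _
  have e1 : ‖w - f‖ ^ 2 = t ^ 2 - 2 * ⟪f - x, w - x⟫ + ‖f - x‖ ^ 2 := by
    have : w - f = (w - x) - (f - x) := by abel
    rw [this, norm_sub_sq_real, real_inner_comm]
  have e2 : ‖f - x‖ ^ 2 ≤ 4 * σ ^ 2 := by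
    have := hF f hf; have := norm_nonneg (f - x); nlinarith
  by_cases hc : t ≤ k * σ / 2
  · have : ‖w - f‖ ≤ t + ‖f - x‖ := by
      have : w - f = (w - x) - (f - x) := by abel
      rw [this]; exact norm_sub_le _ _
    have := hF f hf
    nlinarith
  · push Not at hc
    have b0 : 0 ≤ k * σ := by positivity
    refine lt_of_pow_lt_pow_left₀ 2 b0 ?_
    have h3 : 0 ≤ t - a * σ := by nlinarith
    have h4 : t - a * σ < k * σ - a * σ / 2 := by linarith
    have h5 : (t - a * σ) ^ 2 < (k * σ - a * σ / 2) ^ 2 := by gcongr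
    have h6 : k * σ * (a * σ) = 8 * σ ^ 2 := by linear_combination σ ^ 2 * hka
    have h7 : a ^ 2 * σ ^ 2 ≤ 1 * σ ^ 2 := by gcongr; nlinarith
    have h8 : 0 < σ ^ 2 := by positivity
    nlinarith

theorem SL {w0 : ℝ} (hw0 : 0 < w0) : ∃ η : ℝ, 0 < η ∧ η ≤ 1 / 2 ∧ ∃ Λ : ℝ, 1 ≤ Λ ∧ ∀ (u : E n → ℝ) (K F : Set (E n)) (σ N : ℝ), Continuous u →
    0 < σ → 0 < N → Convex ℝ K → F ⊆ K → (∀ x ∈ F, ∀ y ∈ F, ‖x - y‖ ≤ 2 * σ) → (∀ x ∈ K, 0 < M u x σ) →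
    HypU u K ((1 + η) * N) σ (Λ * σ) → HypL u F ((1 - η) * N) σ (Λ * σ) → F.Nonempty → 
    ∃ ν p : E n, ‖ν‖ = 1 ∧ ∀ f ∈ F, |⟪f - p, ν⟫| ≤ w0 * σ := by
  obtain ⟨a', a0', H⟩ := simplex (n := n) hw0
  set a := min a' 1 with ha
  have a0 : 0 < a := by rw [ha]; positivity
  have a1 : a ≤ 1 := min_le_right _ _
  set k := 8 / a with hk
  have hka : k * a = 8 := by rw [hk]; field_simp
  have k8 : 8 ≤ k := by rw [hk, le_div_iff₀ a0]; linarith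
  set b := (k * k + 2) / (k + a / 2) with hb
  have bk : b < k := by
    rw [hb, div_lt_iff₀ (by positivity)]; nlinarith
  have b2 : 2 ≤ b := by rw [hb, le_div_iff₀ (by positivity)]; nlinarith
  obtain ⟨η, η0, η1, hη⟩ : ∃ η : ℝ, 0 < η ∧ η ≤ 1 / 2 ∧ (1 + η) * Real.log b < (1 - η) * Real.log k := by
    have hl : Real.log b < Real.log k := Real.log_lt_log (by linarith) bk
    have hb0 : 0 < Real.log b := Real.log_pos (by linarith)
    have hk0 : 0 < Real.log k := Real.log_pos (by linarith)
    refine ⟨min (1 / 2) ((Real.log k - Real.log b) / (4 * Real.log k)), by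
      have := sub_pos.2 hl; positivity, min_le_left _ _, ?_⟩
    have h1 := min_le_right (1 / 2) ((Real.log k - Real.log b) / (4 * Real.log k))
    set η := min (1 / 2) ((Real.log k - Real.log b) / (4 * Real.log k))
    rw [le_div_iff₀ (by positivity)] at h1
    have η0 : 0 < η := by have := sub_pos.2 hl; positivity
    have : η * Real.log b ≤ η * Real.log k := by gcongr
    have : 0 < η * Real.log k := by positivity
    nlinarith
  refine ⟨η, η0, η1, k * k + 2, by nlinarith, ?_⟩
  intro u K F σ N hu hσ hN hK hFK hd hpos hU hL hne
  by_contra hcon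
  push Not at hcon
  obtain ⟨x, hx, hv⟩ := H F σ hσ hne hd (fun ν p hν => hcon ν p hν)
  have xK : x ∈ K := convexHull_min hFK hK hx
  have hFx : ∀ f ∈ F, ‖f - x‖ ≤ 2 * σ := by
    intro f hf
    have : x ∈ closedBall f (2 * σ) := convexHull_min (fun y hy => by
      rw [mem_closedBall, dist_eq_norm]; exact hd y hy f hf) (convex_closedBall _ _) hx
    rw [mem_closedBall, dist_eq_norm, norm_sub_rev] at this; exact this
  have hv' : ∀ v : E n, ∃ f ∈ F, a * σ * ‖v‖ ≤ ⟪f - x, v⟫ := fun v => by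
    obtain ⟨f, hf, h⟩ := hv v
    refine ⟨f, hf, le_trans ?_ h⟩
    gcongr; exact min_le_left _ _
  set r := k * σ + a * σ / 2 with hr
  set R := k * (k * σ) + 2 * σ with hR
  have r0 : 0 < r := by positivity
  have σr : σ ≤ r := by rw [hr]; nlinarith [mul_pos a0 hσ]
  have Rr : R / r = b := by
    rw [hR, hr, hb, show k * (k * σ) + 2 * σ = (k * k + 2) * σ by ring, show k * σ + a * σ / 2 = (k + a / 2) * σ by ring]
    exact mul_div_mul_right _ _ hσ.ne'
  have kpos : 0 < k := by linarith
  have h1 : M u x r ≤ (k ^ ((1 - η) * N))⁻¹ * M u x R := by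
    refine M_le r0 fun w hw => ?_
    rw [mem_ball, dist_eq_norm] at hw
    obtain ⟨f, hf, hwf⟩ := ball_cov hσ a0 a1 hk hFx hv' hw
    rw [le_inv_mul_iff₀ (by positivity)]
    have h2 := hL f hf (k * σ) (k * (k * σ)) (by nlinarith) (by nlinarith [mul_pos kpos hσ]) (by nlinarith)
    rw [mul_div_assoc, div_self (by positivity), mul_one] at h2
    refine le_trans ?_ (h2.trans (M_sub hu ?_))
    · gcongr; exact le_M hu hwf
    · intro y hy
      rw [mem_ball, dist_eq_norm] at hy ⊢
      have := norm_add_le (y - f) (f - x)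
      rw [sub_add_sub_cancel] at this
      have := hFx f hf
      linarith
  have h2 := hU x xK r R σr (by rw [← le_div_iff₀ r0, Rr]; exact b2) (by rw [hR]; nlinarith)
  rw [Rr] at h2
  have Mr : 0 < M u x r := (hpos x xK).trans_le (M_mono hu σr)
  have h3 : M u x r ≤ (k ^ ((1 - η) * N))⁻¹ * (b ^ ((1 + η) * N) * M u x r) := h1.trans (by gcongr)
  have h4 : b ^ ((1 + η) * N) < k ^ ((1 - η) * N) := by
    rw [Real.rpow_def_of_pos (by linarith), Real.rpow_def_of_pos kpos]
    apply Real.exp_lt_exp.2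
    nlinarith
  rw [le_inv_mul_iff₀ (by positivity)] at h3
  have := le_of_mul_le_mul_right h3 Mr
  linarith
end BL
end

open MeasureTheory Metric Set
noncomputable section
namespace BL
set_option linter.unusedVariables false
set_option linter.unusedSimpArgs false
open scoped ContDiff

variable {n : ℕ} {v w : E n} {f g h u χ : E n → ℝ}

open RealInnerProductSpace

theorem dd_ridge {g : ℝ → ℝ} (hg : ContDiff ℝ ∞ g) (ν v : E n) :
    dd v (fun x => g ⟪x, ν⟫) = ⟪v, ν⟫ • (fun x => deriv g ⟪x, ν⟫) := by
  funext x
  have h1 : HasFDerivAt (fun x : E n => ⟪x, ν⟫) ((innerSL ℝ).flip ν) x := ((innerSL ℝ).flip ν).hasFDerivAt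
  have h2 : HasDerivAt g (deriv g ⟪x, ν⟫) ⟪x, ν⟫ := (hg.differentiable (by simp) _).hasDerivAt
  have := (h2.comp_hasFDerivAt x h1).fderiv
  simp only [dd]
  rw [show (fun x : E n => g ⟪x, ν⟫) = g ∘ (fun x : E n => ⟪x, ν⟫) from rfl, this]
  exact mul_comm _ _

theorem ridge_bd {g : ℝ → ℝ} (hg : ContDiff ℝ ∞ g) : ∃ B : ℝ, 0 < B ∧ ∀ ν : E n, ‖ν‖ = 1 →
    ∀ l : List (Fin n), l.length ≤ 2 → ∀ x : E n, ‖x‖ ≤ 1 → |pl l (fun x => g ⟪x, ν⟫) x| ≤ B := by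
  have hg1 : ContDiff ℝ ∞ (deriv g) := (contDiff_infty_iff_deriv.1 hg).2
  have hg2 : ContDiff ℝ ∞ (deriv (deriv g)) := (contDiff_infty_iff_deriv.1 hg1).2
  have bdd : ∀ f : ℝ → ℝ, Continuous f → ∃ B, ∀ t ∈ Icc (-1:ℝ) 1, ‖f t‖ ≤ B := fun f hf =>
    isCompact_Icc.exists_bound_of_continuousOn hf.continuousOn
  obtain ⟨B0, h0⟩ := bdd g hg.continuous
  obtain ⟨B1, h1⟩ := bdd _ hg1.continuous
  obtain ⟨B2, h2⟩ := bdd _ hg2.continuous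
  have z0 : (0:ℝ) ∈ Icc (-1:ℝ) 1 := by norm_num
  have p0 := (norm_nonneg _).trans (h0 0 z0)
  have p1 := (norm_nonneg _).trans (h1 0 z0)
  have p2 := (norm_nonneg _).trans (h2 0 z0)
  refine ⟨B0 + B1 + B2 + 1, by positivity, fun ν hν l hl x hx => ?_⟩
  have hi : ⟪x, ν⟫ ∈ Icc (-1:ℝ) 1 := by
    have := abs_real_inner_le_norm x ν
    rw [hν, mul_one] at this
    exact abs_le.1 (this.trans hx)
  have he : ∀ i : Fin n, |⟪(ee i : E n), ν⟫| ≤ 1 := fun i => by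
    have := abs_real_inner_le_norm (ee i : E n) ν
    simpa [hν, ee] using this
  have sm : ∀ f : ℝ → ℝ, ContDiff ℝ ∞ f → ContDiff ℝ ∞ (fun x : E n => f ⟪x, ν⟫) := fun f hf =>
    hf.comp (contDiff_id.inner ℝ contDiff_const)
  match l, hl with
  | [], _ => 
    have := h0 _ hi
    simp only [pl]; rw [← Real.norm_eq_abs]; linarith
  | [i], _ =>
    simp only [pl, dd_ridge hg]
    have := h1 _ hi
    simp only [Pi.smul_apply, smul_eq_mul, abs_mul]
    have t := mul_le_mul (he i) this (norm_nonneg _) zero_le_one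
    rw [Real.norm_eq_abs] at t
    linarith
  | [i, j], _ =>
    simp only [pl, dd_ridge hg]
    rw [dd_smul _ (sm _ hg1), dd_ridge hg1]
    have := h2 _ hi
    simp only [Pi.smul_apply, smul_eq_mul, abs_mul]
    have t := mul_le_mul (he j) (mul_le_mul (he i) this (norm_nonneg _) zero_le_one) (by positivity) zero_le_one
    rw [Real.norm_eq_abs] at t
    linarith

theorem pl_mul_bd (hf : ContDiff ℝ ∞ f) (hg : ContDiff ℝ ∞ g) {x : E n} {A B : ℝ}
    (h1 : ∀ l : List (Fin n), l.length ≤ 2 → |pl l f x| ≤ A) (h2 : ∀ l : List (Fin n), l.length ≤ 2 → |pl l g x| ≤ B) :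
    ∀ l : List (Fin n), l.length ≤ 2 → |pl l (f * g) x| ≤ 4 * (A * B) := by
  have A0 : 0 ≤ A := (abs_nonneg _).trans (h1 [] (by simp))
  have B0 : 0 ≤ B := (abs_nonneg _).trans (h2 [] (by simp))
  have m : ∀ l l' : List (Fin n), l.length ≤ 2 → l'.length ≤ 2 → |pl l f x * pl l' g x| ≤ A * B := fun l l' a b => by
    rw [abs_mul]; exact mul_le_mul (h1 l a) (h2 l' b) (abs_nonneg _) A0
  have m' : ∀ l l' : List (Fin n), l.length ≤ 2 → l'.length ≤ 2 → 
    -(A * B) ≤ pl l f x * pl l' g x ∧ pl l f x * pl l' g x ≤ A * B := fun l l' a b => abs_le.1 (m l l' a b)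
  have AB : 0 ≤ A * B := by positivity
  intro l hl
  match l, hl with
  | [], _ => 
    have := m' [] [] (by simp) (by simp)
    simp only [pl] at this ⊢
    rw [abs_le]; simp only [Pi.mul_apply]; constructor <;> linarith
  | [i], _ =>
    have a := m' [i] [] (by simp) (by simp)
    have b := m' [] [i] (by simp) (by simp)
    simp only [pl, dd_mul hf hg] at a b ⊢
    rw [abs_le]; simp only [Pi.mul_apply, Pi.add_apply]; constructor <;> linarith
  | [i, j], _ =>
    have a := m' [i, j] [] (by simp) (by simp)
    have b := m' [] [i, j] (by simp) (by simp)
    have c := m' [i] [j] (by simp) (by simp)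
    have d := m' [j] [i] (by simp) (by simp)
    simp only [pl, dd_mul hf hg] at a b c d ⊢
    rw [dd_add (by fun_prop) (by fun_prop), dd_mul (by fun_prop) (by fun_prop), dd_mul (by fun_prop) (by fun_prop)]
    rw [abs_le]; simp only [Pi.mul_apply, Pi.add_apply]; constructor <;> linarith

theorem exp16 {τ : ℝ} (hτ : 0 ≤ τ) : Real.exp (τ * (1/2) ^ 2 / 2) ≤ (16/15 : ℝ) ^ (2 * τ) := by
  have h : Real.exp (1/16) ≤ 16/15 := by
    have := Real.one_sub_le_exp_neg (1/16)
    rw [Real.exp_neg] at this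
    have e := Real.exp_pos (1/16)
    have := (le_inv_comm₀ (by norm_num) e).1 this
    refine this.trans (by norm_num)
  calc Real.exp (τ * (1/2) ^ 2 / 2) = Real.exp (1/16) ^ (2 * τ) := by
        rw [← Real.exp_mul]; congr 1; ring
    _ ≤ _ := Real.rpow_le_rpow (Real.exp_pos _).le h (by linarith)

set_option maxHeartbeats 2000000 in
theorem hl0 (hn : 2 ≤ n) {A : ℝ} (hA : 40 ≤ A) : ∃ C : ℝ, 0 < C ∧ 
    ∀ (τ : ℝ), 2 * (n + 2) + 1 ≤ τ → ∀ (u : E n → ℝ), Sol u 0 1 → ∀ (ν z : E n), ‖ν‖ = 1 → z = (1/4 : ℝ) • ν →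
    ∀ m Mx : ℝ, (∀ x, |⟪x - z, ν⟫| ≤ 1 / (2 * A) → ‖x - z‖ ≤ 1/2 → |u x| ≤ m) →
    (∀ x ∈ ball (0 : E n) (1/2), |u x| ≤ Mx) → ∀ y : E n, ‖y - z‖ ≤ 1/20 → 0 ≤ ⟪y - z, ν⟫ →
    u y ^ 2 ≤ C * ((2:ℝ) ^ (2 * τ) * m ^ 2 + (9/10 : ℝ) ^ (2 * τ) * Mx ^ 2) := by
  obtain ⟨C1, C10, ρ1, hρ1, H⟩ := carl3 hn
  obtain ⟨C2, C20, H2⟩ := der_sol (n := n) (by omega)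
  have A0 : 0 < A := by linarith
  let z0 : ContDiffBump (0 : E n) := ⟨2/5, 9/20, by norm_num, by norm_num⟩
  have smz : ContDiff ℝ ∞ (fun x => z0 x) := z0.contDiff
  obtain ⟨Kz, Kz0, hK⟩ := pl_bdd smz z0.hasCompactSupport 2
  let g : ℝ → ℝ := fun t => Real.smoothTransition (8 * A * (t - 1/4) + 2)
  have smg : ContDiff ℝ ∞ g := Real.smoothTransition.contDiff.comp (by fun_prop)
  obtain ⟨Kg, Kg0, hKg⟩ := ridge_bd (n := n) smg
  have n0 : (0:ℝ) < n := by exact_mod_cast (by omega : 0 < n)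
  set R : ℝ := min ρ1 (1 / (16 * A)) with hR
  have R0 : 0 < R := by rw [hR]; positivity
  have iA : 1 / (16 * A) ≤ 1/640 := by
    rw [div_le_div_iff₀ (by positivity) (by norm_num)]; linarith
  have RA : R ≤ 1 / (16 * A) := min_le_right _ _
  set B := 4 * (Kg * Kz) with hB
  have B0 : 0 < B := by positivity
  set D1 := C2 * ((1 / (4 * A)) ^ 3)⁻¹ with hD1
  set D2 := C2 * ((1 / 20 : ℝ) ^ 3)⁻¹ with hD2
  set G1 := 9 * (n:ℝ) ^ 4 * (B ^ 2 * D1 ^ 2) * ((1/5 : ℝ) ^ n)⁻¹ with hG1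
  set G2 := 9 * (n:ℝ) ^ 4 * (B ^ 2 * D2 ^ 2) * ((2/5 : ℝ) ^ n)⁻¹ with hG2
  have G10 : 0 < G1 := by positivity
  have G20 : 0 < G2 := by positivity
  refine ⟨(R ^ n)⁻¹ * C1 * (G1 + G2), by positivity, ?_⟩
  intro τ hτ u hu ν z hν hz m Mx hm hMx y hy hyν
  have cu := hu.1.continuous
  have τ0 : 0 ≤ τ := le_trans (by positivity) hτ
  have zin : ∀ x : E n, ⟪x - z, ν⟫ = ⟪x, ν⟫ - 1/4 := fun x => by
    rw [inner_sub_left, hz, inner_smul_left, real_inner_self_eq_norm_sq, hν]; simp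
  have zn : ‖z‖ = 1/4 := by rw [hz, norm_smul, hν]; norm_num
  have zd : ∀ x : E n, ‖x - z‖ ^ 2 = ‖x‖ ^ 2 - 1/2 * ⟪x, ν⟫ + 1/16 := fun x => by
    rw [norm_sub_sq_real, zn, hz, inner_smul_right]; ring
  have hin : ∀ x : E n, |⟪x, ν⟫| ≤ ‖x‖ := fun x => by
    have := abs_real_inner_le_norm x ν
    rwa [hν, mul_one] at this
  set χ1 : E n → ℝ := fun x => g ⟪x, ν⟫ with hχ1
  have smχ1 : ContDiff ℝ ∞ χ1 := smg.comp (contDiff_id.inner ℝ contDiff_const)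
  set χ : E n → ℝ := χ1 * (fun x => z0 x) with hχ
  have smχ : ContDiff ℝ ∞ χ := smχ1.mul smz
  have g1 : ∀ t : ℝ, 1/4 - 1 / (8 * A) ≤ t → g t = 1 := fun t ht => by
    apply Real.smoothTransition.one_of_one_le
    have := mul_le_mul_of_nonneg_left ht (show 0 ≤ 8 * A by positivity)
    rw [mul_sub, mul_one_div_cancel (by positivity)] at this
    linarith
  have g0 : ∀ t : ℝ, t ≤ 1/4 - 1 / (4 * A) → g t = 0 := fun t ht => by
    apply Real.smoothTransition.zero_of_nonpos
    have := mul_le_mul_of_nonneg_left ht (show 0 ≤ 8 * A by positivity)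
    rw [mul_sub, show 8 * A * (1 / (4 * A)) = 2 by field_simp; norm_num] at this
    linarith
  have e8 : 1 / (8 * A) = 2 * (1 / (16 * A)) := by field_simp; norm_num
  have e4 : 1 / (4 * A) = 4 * (1 / (16 * A)) := by field_simp; norm_num
  have e2 : 1 / (2 * A) = 8 * (1 / (16 * A)) := by field_simp; norm_num
  set a := 1 / (16 * A) with ha
  have a0 : 0 < a := by positivity
  rw [e8] at g1
  rw [e4] at g0 hD1
  rw [e2] at hm
  have s1 : tsupport χ ⊆ {x | 1/4 - 4 * a ≤ ⟪x, ν⟫ ∧ ‖x‖ ≤ 9/20} := by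
    apply closure_minimal
    · intro x hx
      by_contra hcon
      simp only [mem_ofPred_eq, not_and_or, not_le] at hcon
      apply hx
      simp only [hχ, Pi.mul_apply, hχ1]
      rcases hcon with h | h
      · rw [g0 _ h.le]; ring
      · rw [z0.zero_of_le_dist (by simpa using h.le)]; ring
    · have q1 : IsClosed {x : E n | 1/4 - 4 * a ≤ ⟪x, ν⟫} := isClosed_le continuous_const (continuous_id.inner continuous_const)
      have q2 : IsClosed {x : E n | ‖x‖ ≤ 9/20} := isClosed_le continuous_norm continuous_const
      exact q1.inter q2
  have m0 : 0 ≤ m := (abs_nonneg _).trans (hm z (by simp; linarith) (by simp))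
  have M0 : 0 ≤ Mx := (abs_nonneg _).trans (hMx 0 (by simp))
  set ex := Real.exp (τ * (1/2) ^ 2 / 2) with hex
  have ex0 : 0 < ex := Real.exp_pos _
  have bχ : ∀ x : E n, ‖x‖ ≤ 1 → ∀ l : List (Fin n), l.length ≤ 2 → |pl l χ x| ≤ B := fun x hx =>
    pl_mul_bd smχ1 smz (fun l hl => hKg ν hν l hl x hx) (fun l hl => hK l hl x)
  set w1 := (1/5 : ℝ) ^ (-(2 * τ)) * ex with hw1
  set w2 := (2/5 : ℝ) ^ (-(2 * τ)) * ex with hw2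
  have w10 : 0 < w1 := by positivity
  have w20 : 0 < w2 := by positivity
  have bd : ∀ x ∈ tsupport χ, Wt τ x * (2 * gr χ u x + lp χ x * u x) ^ 2 ≤ G1 * (w1 * m ^ 2) + G2 * (w2 * Mx ^ 2) ∧
      Wt τ x * (2 * gr χ (lp u) x + lp χ x * lp u x) ^ 2 ≤ G1 * (w1 * m ^ 2) + G2 * (w2 * Mx ^ 2) := by
    intro x hx
    obtain ⟨hx1, hx2⟩ := s1 hx
    rcases le_or_gt (2/5) ‖x‖ with hc | hc
    · have W := Wt_le (n := n) τ0 (by norm_num) hc (ρ := 1/2) (by linarith)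
      have sub : ball x (1/20) ⊆ ball 0 (1/2) := ball_subset_ball' (by rw [dist_zero_right]; linarith)
      have du := H2 u x (1/20) Mx (by norm_num) (by norm_num) 
        ⟨hu.1, fun y hy => hu.2 y (ball_subset_ball (by norm_num) (sub hy))⟩ (fun y hy => hMx y (sub hy))
      obtain ⟨g1, g2⟩ := c_bound (by omega) hu.1 (fun l _ h => bχ x (by linarith) l h) du
      have fin : ∀ c : ℝ, c ^ 2 ≤ 9 * (n:ℝ) ^ 4 * (B ^ 2 * (C2 * Mx * ((1/20 : ℝ) ^ 3)⁻¹) ^ 2) →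
          Wt τ x * c ^ 2 ≤ G1 * (w1 * m ^ 2) + G2 * (w2 * Mx ^ 2) := by
        intro c hc
        calc Wt τ x * c ^ 2 ≤ (((2/5:ℝ) ^ n)⁻¹ * (2/5:ℝ) ^ (-(2 * τ)) * ex) * 
              (9 * (n:ℝ) ^ 4 * (B ^ 2 * (C2 * Mx * ((1/20 : ℝ) ^ 3)⁻¹) ^ 2)) :=
              mul_le_mul W hc (sq_nonneg _) (by positivity)
          _ = G2 * (w2 * Mx ^ 2) := by rw [hG2, hw2, hD2]; ring
          _ ≤ _ := le_add_of_nonneg_left (by positivity)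
      exact ⟨fin _ g1, fin _ g2⟩
    · rcases le_or_gt ⟪x, ν⟫ (1/4 - 2 * a) with hc2 | hc2
      · have W := Wt_le (n := n) τ0 (by norm_num) (p := 1/5) (x := x)
          (by linarith [hin x, le_abs_self ⟪x, ν⟫]) (ρ := 1/2) (by linarith)
        have hxz : ‖x - z‖ ≤ 2/5 := by
          have := zd x
          have h3 : ‖x‖ ^ 2 ≤ (2/5) ^ 2 := by gcongr
          by_contra hh
          push Not at hh
          have : (2/5:ℝ) ^ 2 < ‖x - z‖ ^ 2 := by gcongr
          linarith
        have du := H2 u x (4 * a) m (by positivity) (by linarith) 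
          ⟨hu.1, fun y hy => hu.2 y (by
            have : dist y x < 4 * a := hy
            have t := dist_triangle y x 0
            rw [mem_ball]
            rw [dist_zero_right x] at t; linarith)⟩ (fun y hy => by
            have h4 : ‖y - x‖ < 4 * a := by rw [← dist_eq_norm]; exact hy
            have h5 := hin (y - x)
            rw [inner_sub_left] at h5
            have h6 := abs_le.1 (h5.trans h4.le)
            apply hm
            · rw [zin, abs_le]; constructor <;> linarith [h6.1, h6.2]
            · have := norm_add_le (y - x) (x - z)
              rw [sub_add_sub_cancel] at this; linarith)
        obtain ⟨g1, g2⟩ := c_bound (by omega) hu.1 (fun l _ h => bχ x (by linarith) l h) du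
        have fin : ∀ c : ℝ, c ^ 2 ≤ 9 * (n:ℝ) ^ 4 * (B ^ 2 * (C2 * m * ((4 * a) ^ 3)⁻¹) ^ 2) →
          Wt τ x * c ^ 2 ≤ G1 * (w1 * m ^ 2) + G2 * (w2 * Mx ^ 2) := by
          intro c hc
          calc Wt τ x * c ^ 2 ≤ (((1/5:ℝ) ^ n)⁻¹ * (1/5:ℝ) ^ (-(2 * τ)) * ex) * 
                (9 * (n:ℝ) ^ 4 * (B ^ 2 * (C2 * m * ((4 * a) ^ 3)⁻¹) ^ 2)) :=
                mul_le_mul W hc (sq_nonneg _) (by positivity)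
            _ = G1 * (w1 * m ^ 2) := by rw [hG1, hw1, hD1]; ring
            _ ≤ _ := le_add_of_nonneg_right (by positivity)
        exact ⟨fin _ g1, fin _ g2⟩
      · have bχ0 : ∀ l : List (Fin n), l ≠ [] → l.length ≤ 2 → |pl l χ x| ≤ 0 := by
          intro l hl hl2
          have := pl_eqOn (f := χ) (g := fun _ => 1) (U := {x | 1/4 - 2 * a < ⟪x, ν⟫} ∩ {x | ‖x‖ < 2/5})
            ((isOpen_lt continuous_const (by fun_prop)).inter (isOpen_lt continuous_norm continuous_const))
            (fun y hy => by
              simp only [hχ, Pi.mul_apply, hχ1]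
              rw [g1 _ (le_of_lt hy.1), z0.one_of_mem_closedBall (by simpa using (le_of_lt hy.2))]; ring) l ⟨hc2, hc⟩
          rw [this, pl_const _ hl]; simp
        have sub : ball x (1/20) ⊆ ball 0 (1/2) := ball_subset_ball' (by rw [dist_zero_right]; linarith)
        have du := H2 u x (1/20) Mx (by norm_num) (by norm_num) 
          ⟨hu.1, fun y hy => hu.2 y (ball_subset_ball (by norm_num) (sub hy))⟩ (fun y hy => hMx y (sub hy))
        obtain ⟨g1, g2⟩ := c_bound (by omega) hu.1 bχ0 du
        have fin : ∀ c : ℝ, c ^ 2 ≤ 9 * (n:ℝ) ^ 4 * (0 ^ 2 * (C2 * Mx * ((1/20 : ℝ) ^ 3)⁻¹) ^ 2) →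
            Wt τ x * c ^ 2 ≤ G1 * (w1 * m ^ 2) + G2 * (w2 * Mx ^ 2) := by
          intro c hc
          have : c ^ 2 = 0 := le_antisymm (by simpa using hc) (sq_nonneg _)
          rw [this, mul_zero]; positivity
        exact ⟨fin _ g1, fin _ g2⟩
  have yn : ‖y‖ ≤ 3/10 := by
    have := norm_add_le (y - z) z
    rw [sub_add_cancel] at this; linarith
  rw [zin] at hyν
  set w := (31/100 : ℝ) ^ (-(2 * τ)) with hw
  have key := H τ hτ χ u smχ hu (s1.trans (fun x hx => by
      simp only [mem_ofPred_eq] at hx; rw [mem_ball_zero_iff]; linarith [hx.2]))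
    (fun h => by have := (s1 h).1; rw [inner_zero_left] at this; linarith) _ bd y R w
    R0 (min_le_left _ _) (ball_subset_ball' (by rw [dist_zero_right]; linarith)) (by positivity) (by
      intro x hx
      rw [mem_ball, dist_eq_norm] at hx
      have e1 : ‖x‖ ≤ ‖y‖ + ‖x - y‖ := by have := norm_add_le y (x - y); simpa using this
      have h5 := hin (x - y)
      rw [inner_sub_left] at h5
      have h6 := abs_le.1 (h5.trans hx.le)
      have h7 : 1/4 - 2 * a ≤ ⟪x, ν⟫ := by linarith [h6.1]
      refine ⟨?_, le_Wt hn τ0 ?_ (by linarith) (by norm_num)⟩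
      · simp only [hχ, Pi.mul_apply, hχ1]
        rw [g1 _ h7, z0.one_of_mem_closedBall (show x ∈ closedBall (0 : E n) (2/5) by simp; linarith)]; ring
      · intro h; rw [h, inner_zero_left] at h7; linarith)
  have wi : w * (31/100 : ℝ) ^ (2 * τ) = 1 := by
    rw [hw, ← Real.rpow_add (by norm_num)]; simp
  have key3 : u y ^ 2 ≤ (31/100 : ℝ) ^ (2 * τ) * (R ^ n)⁻¹ * (C1 * (G1 * (w1 * m ^ 2) + G2 * (w2 * Mx ^ 2))) := by
    calc u y ^ 2 = (31/100 : ℝ) ^ (2 * τ) * (R ^ n)⁻¹ * (w * R ^ n * u y ^ 2) := by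
          have : R ^ n ≠ 0 := by positivity
          calc u y ^ 2 = (w * (31/100 : ℝ) ^ (2 * τ)) * u y ^ 2 := by rw [wi, one_mul]
            _ = _ := by field_simp
      _ ≤ _ := mul_le_mul_of_nonneg_left key (by positivity)
  have cmp : ∀ p q : ℝ, 0 < p → 31/100 / p * (16/15) ≤ q → (31/100 : ℝ) ^ (2 * τ) * (p ^ (-(2 * τ)) * ex) ≤ q ^ (2 * τ) := by
    intro p q hp hpq
    have := Real.rpow_le_rpow (by positivity) hpq (show 0 ≤ 2 * τ by linarith)
    refine le_trans ?_ this
    rw [Real.mul_rpow (by positivity) (by norm_num), Real.div_rpow (by norm_num) hp.le, Real.rpow_neg hp.le, 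
      div_eq_mul_inv, ← mul_assoc]
    exact mul_le_mul_of_nonneg_left (exp16 τ0) (by positivity)
  have c1 := mul_le_mul_of_nonneg_right (cmp (1/5) 2 (by norm_num) (by norm_num)) (sq_nonneg m)
  have c2 := mul_le_mul_of_nonneg_right (cmp (2/5) (9/10) (by norm_num) (by norm_num)) (sq_nonneg Mx)
  refine key3.trans ?_
  set P := (31/100 : ℝ) ^ (2 * τ) with hP
  have k0 : 0 ≤ (R ^ n)⁻¹ * C1 := by positivity
  have p1 : 0 ≤ (2:ℝ) ^ (2 * τ) * m ^ 2 := by positivity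
  have p2 : 0 ≤ (9/10:ℝ) ^ (2 * τ) * Mx ^ 2 := by positivity
  calc P * (R ^ n)⁻¹ * (C1 * (G1 * (w1 * m ^ 2) + G2 * (w2 * Mx ^ 2))) = (R ^ n)⁻¹ * C1 * 
        (G1 * (P * w1 * m ^ 2) + G2 * (P * w2 * Mx ^ 2)) := by ring
    _ ≤ (R ^ n)⁻¹ * C1 * (G1 * ((2:ℝ) ^ (2 * τ) * m ^ 2) + G2 * ((9/10:ℝ) ^ (2 * τ) * Mx ^ 2)) :=
        mul_le_mul_of_nonneg_left (add_le_add (mul_le_mul_of_nonneg_left c1 G10.le) (mul_le_mul_of_nonneg_left c2 G20.le)) k0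
    _ ≤ (R ^ n)⁻¹ * C1 * ((G1 + G2) * ((2:ℝ) ^ (2 * τ) * m ^ 2 + (9/10:ℝ) ^ (2 * τ) * Mx ^ 2)) := by
        apply mul_le_mul_of_nonneg_left _ k0
        have := mul_nonneg G10.le p2
        have := mul_nonneg G20.le p1
        linarith
    _ = _ := by ring

end BL
end

open MeasureTheory Metric Set
noncomputable section
namespace BL
set_option linter.unusedVariables false
set_option linter.unusedSimpArgs false
open scoped ContDiff

variable {n : ℕ} {v w : E n} {f g h u χ : E n → ℝ}

open RealInnerProductSpace

theorem hl1 (hn : 2 ≤ n) {A : ℝ} (hA : 40 ≤ A) : ∃ C : ℝ, 0 < C ∧ 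
    ∀ (τ : ℝ), 2 * (n + 2) + 1 ≤ τ → ∀ (u : E n → ℝ) (z ν : E n) (ℓ : ℝ), 0 < ℓ → ℓ ≤ 1/3 → Sol u z (3 * ℓ) → ‖ν‖ = 1 → 
    ∀ m : ℝ, (∀ x, |⟪x - z, ν⟫| ≤ ℓ / A → ‖x - z‖ ≤ ℓ → |u x| ≤ m) →
    ∀ y : E n, ‖y - z‖ ≤ ℓ / 10 →
    u y ^ 2 ≤ C * ((2:ℝ) ^ (2 * τ) * m ^ 2 + (9/10 : ℝ) ^ (2 * τ) * M u z (3 * ℓ) ^ 2) := by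
  obtain ⟨C, C0, H⟩ := hl0 hn hA
  refine ⟨C, C0, ?_⟩
  have A0 : 0 < A := by linarith
  have main : ∀ (τ : ℝ), 2 * (n + 2) + 1 ≤ τ → ∀ (u : E n → ℝ) (z ν : E n) (ℓ : ℝ), 0 < ℓ → ℓ ≤ 1/3 → Sol u z (3 * ℓ) → ‖ν‖ = 1 → 
    ∀ m : ℝ, (∀ x, |⟪x - z, ν⟫| ≤ ℓ / A → ‖x - z‖ ≤ ℓ → |u x| ≤ m) →
    ∀ y : E n, ‖y - z‖ ≤ ℓ / 10 → 0 ≤ ⟪y - z, ν⟫ →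
    u y ^ 2 ≤ C * ((2:ℝ) ^ (2 * τ) * m ^ 2 + (9/10 : ℝ) ^ (2 * τ) * M u z (3 * ℓ) ^ 2) := by
    intro τ hτ u z ν ℓ h0 h1 hu hν m hm y hy hyν
    set c0 := z - (ℓ / 2) • ν with hc0
    have dz : dist c0 z = ℓ / 2 := by
      rw [hc0, dist_eq_norm, sub_sub_cancel_left, norm_neg, norm_smul, hν, mul_one, Real.norm_eq_abs, abs_of_pos (by positivity)]
    have h2 : (0:ℝ) < 2 * ℓ := by positivity
    have s2 : Sol u c0 (2 * ℓ) := ⟨hu.1, fun y hy => hu.2 y (ball_subset_ball' (by rw [dz]; linarith) hy)⟩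
    have s3 := Sol_scale h2 (by linarith) s2
    have key : ∀ x : E n, (c0 + (2 * ℓ) • x) - z = (2 * ℓ) • (x - (1/4 : ℝ) • ν) := fun x => by
      rw [hc0, smul_sub, smul_smul, show 2 * ℓ * (1/4) = ℓ / 2 by ring]; abel
    have back : c0 + (2 * ℓ) • ((2 * ℓ)⁻¹ • (y - c0)) = y := by
      rw [smul_smul, mul_inv_cancel₀ h2.ne', one_smul]; abel
    have kn : ∀ x : E n, ‖(c0 + (2 * ℓ) • x) - z‖ = 2 * ℓ * ‖x - (1/4 : ℝ) • ν‖ := fun x => by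
      rw [key, norm_smul, Real.norm_eq_abs, abs_of_pos h2]
    have ki : ∀ x : E n, ⟪(c0 + (2 * ℓ) • x) - z, ν⟫ = 2 * ℓ * ⟪x - (1/4 : ℝ) • ν, ν⟫ := fun x => by
      rw [key, inner_smul_left]; rfl
    have := H τ hτ _ s3 ν _ hν rfl m (M u z (3 * ℓ)) (fun x hx1 hx2 => hm _ (by
        rw [ki, abs_mul, abs_of_pos h2]
        calc 2 * ℓ * |⟪x - (1/4 : ℝ) • ν, ν⟫| ≤ 2 * ℓ * (1 / (2 * A)) := by gcongr
          _ = ℓ / A := by field_simp) (by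
        rw [kn]
        calc 2 * ℓ * ‖x - (1/4 : ℝ) • ν‖ ≤ 2 * ℓ * (1/2) := by gcongr
          _ = ℓ := by ring))
      (fun x hx => le_M hu.1.continuous (by
        rw [mem_ball]
        have t := dist_triangle (c0 + (2 * ℓ) • x) c0 z
        have : dist (c0 + (2 * ℓ) • x) c0 = 2 * ℓ * ‖x‖ := by
          rw [dist_eq_norm, add_sub_cancel_left, norm_smul, Real.norm_eq_abs, abs_of_pos h2]
        have hx' : ‖x‖ < 1/2 := by simpa using hx
        have := mul_lt_mul_of_pos_left hx' h2
        linarith))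
      ((2 * ℓ)⁻¹ • (y - c0)) (by
        have := kn ((2 * ℓ)⁻¹ • (y - c0))
        rw [back] at this
        have h4 : 2 * ℓ * ‖(2 * ℓ)⁻¹ • (y - c0) - (1/4 : ℝ) • ν‖ ≤ 2 * ℓ * (1/20) := by rw [← this]; linarith
        exact le_of_mul_le_mul_left h4 h2) (by
        have := ki ((2 * ℓ)⁻¹ • (y - c0))
        rw [back] at this
        rw [this] at hyν
        exact nonneg_of_mul_nonneg_right hyν h2)
    simp only [back] at this
    exact this
  intro τ hτ u z ν ℓ h0 h1 hu hν m hm y hy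
  rcases le_total 0 ⟪y - z, ν⟫ with h | h
  · exact main τ hτ u z ν ℓ h0 h1 hu hν m hm y hy h
  · exact main τ hτ u z (-ν) ℓ h0 h1 hu (by simpa using hν) m (fun x hx => hm x (by simpa using hx)) y hy (by simpa using h)

theorem hl_alg {C N M1 M3 : ℝ} (hC : 0 < C) (hN : 2 * C < (2:ℝ) ^ N) (M10 : 0 < M1) 
    (h1 : ∀ B : ℝ, 0 ≤ B → C * ((2:ℝ) ^ (-(176 * N)) + (2:ℝ) ^ (-(22 * N))) * M3 ^ 2 ≤ B ^ 2 → M1 ≤ B)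
    (hM3 : 0 ≤ M3) (N0 : 0 ≤ N)
    (h2 : M3 ≤ (80:ℝ) ^ (3 / 2 * N) * M1) : False := by
  have p0 : (0:ℝ) < (2:ℝ) ^ N := by positivity
  have a1 : (2:ℝ) ^ (-(176 * N)) ≤ (2:ℝ) ^ (-(22 * N)) := Real.rpow_le_rpow_of_exponent_le (by norm_num) (by linarith)
  have a2 : (80:ℝ) ^ (3 / 2 * N) ≤ (2:ℝ) ^ (21 / 2 * N) := by
    calc (80:ℝ) ^ (3 / 2 * N) ≤ ((2:ℝ) ^ (7:ℝ)) ^ (3 / 2 * N) := by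
          apply Real.rpow_le_rpow (by norm_num) _ (by positivity)
          rw [show (7:ℝ) = ((7:ℕ):ℝ) by norm_num, Real.rpow_natCast]; norm_num
      _ = _ := by rw [← Real.rpow_mul (by norm_num)]; congr 1; ring
  have hM := h2.trans (mul_le_mul_of_nonneg_right a2 M10.le)
  set q := Real.sqrt (2 * C * (2:ℝ) ^ (-(22 * N))) with hq
  have q0 : 0 ≤ q := Real.sqrt_nonneg _
  have qq : q ^ 2 = 2 * C * (2:ℝ) ^ (-(22 * N)) := Real.sq_sqrt (by positivity)
  have k1 := h1 (q * M3) (by positivity) (by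
    rw [mul_pow, qq]
    apply mul_le_mul_of_nonneg_right _ (sq_nonneg _)
    have := mul_le_mul_of_nonneg_left a1 hC.le
    linarith)
  have k2 : M1 ≤ (q * (2:ℝ) ^ (21 / 2 * N)) * M1 := k1.trans (by
    rw [mul_assoc]; exact mul_le_mul_of_nonneg_left hM q0)
  have k3 : 1 ≤ q * (2:ℝ) ^ (21 / 2 * N) := le_of_mul_le_mul_right (by linarith) M10
  have k4 : 1 ≤ (q * (2:ℝ) ^ (21 / 2 * N)) ^ 2 := one_le_pow₀ k3
  rw [mul_pow, qq, ← Real.rpow_natCast ((2:ℝ) ^ (21 / 2 * N)) 2, ← Real.rpow_mul (by norm_num), mul_assoc,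
    ← Real.rpow_add (by norm_num), show -(22 * N) + 21 / 2 * N * ((2:ℕ):ℝ) = -N by push_cast; ring, Real.rpow_neg (by norm_num),
    ← div_eq_mul_inv, le_div_iff₀ p0] at k4
  linarith

theorem HL (hn : 2 ≤ n) : ∃ A : ℝ, 40 ≤ A ∧ ∃ N0 : ℝ, 0 < N0 ∧
    ∀ (u : E n → ℝ) (z ν : E n) (ℓ N : ℝ) (F : Set (E n)), 0 < ℓ → ℓ ≤ 1/3 → Sol u z (3 * ℓ) → ‖ν‖ = 1 → N0 ≤ N →
    HypU u F (3 / 2 * N) (ℓ / A) (4 * ℓ) → HypL u F (N / 2) (ℓ / A) (4 * ℓ) → (∀ x ∈ F, 0 < M u x (ℓ / 20)) →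
    ∃ p, ⟪p - z, ν⟫ = 0 ∧ ‖p - z‖ ≤ ℓ ∧ ∀ f ∈ F, ℓ / A ≤ ‖f - p‖ := by
  obtain ⟨k, hk⟩ : ∃ k : ℝ, k = 352 := ⟨_, rfl⟩
  obtain ⟨A, hAd⟩ : ∃ A : ℝ, A = 2 * (2:ℝ) ^ k := ⟨_, rfl⟩
  have hA2 : A / 2 = (2:ℝ) ^ k := by rw [hAd]; ring
  have hA : 40 ≤ A := by
    have h5 : (2:ℝ) ^ (5:ℝ) ≤ (2:ℝ) ^ k := Real.rpow_le_rpow_of_exponent_le (by norm_num) (by linarith)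
    have h6 : (2:ℝ) ^ (5:ℝ) = 32 := by
      rw [show (5:ℝ) = ((5:ℕ):ℝ) by norm_num, Real.rpow_natCast]; norm_num
    rw [hAd]; linarith
  clear hAd
  obtain ⟨C, C0, H⟩ := hl1 hn hA
  have A0 : 0 < A := by linarith
  obtain ⟨N1, hN1⟩ := ((tendsto_rpow_atTop_of_base_gt_one 2 (by norm_num)).eventually_gt_atTop (2 * C)).exists_forall_of_atTop
  refine ⟨A, hA, max (max N1 1) (2 * (n + 2) + 1), by positivity, ?_⟩
  intro u z ν ℓ N F h0 h1 hu hν hN hU hL hpos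
  by_contra hcon
  push Not at hcon
  have cu := hu.1.continuous
  have N1N : N1 ≤ N := (le_max_left _ _).trans ((le_max_left _ _).trans hN)
  have N1' : 1 ≤ N := (le_max_right _ _).trans ((le_max_left _ _).trans hN)
  have N2 : 2 * (n + 2) + 1 ≤ N := (le_max_right _ _).trans hN
  have lA : ℓ / A ≤ ℓ / 40 := by gcongr
  have lA0 : 0 < ℓ / A := by positivity
  set M3 := M u z (3 * ℓ) with hM3
  have M30 : 0 ≤ M3 := M_nonneg _ _
  have pw : (A / 2) ^ (N / 2) = (2:ℝ) ^ (176 * N) := by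
    rw [hA2, ← Real.rpow_mul (by norm_num)]; congr 1; rw [hk]; ring
  have near : ∀ x, |⟪x - z, ν⟫| ≤ ℓ / A → ‖x - z‖ ≤ ℓ → |u x| ≤ (2:ℝ) ^ (-(176 * N)) * M3 := by
    intro x hx1 hx2
    set t := ⟪x - z, ν⟫ with ht
    have e1 : x - t • ν - z = (x - z) - t • ν := by abel
    obtain ⟨f, hf, hfp⟩ := hcon (x - t • ν) (by
        rw [e1, inner_sub_left, inner_smul_left, real_inner_self_eq_norm_sq, hν, ← ht]; simp) (by
        rw [e1]
        have : ‖(x - z) - t • ν‖ ^ 2 ≤ ‖x - z‖ ^ 2 := by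
          rw [norm_sub_sq_real, inner_smul_right, ← ht, norm_smul, hν, Real.norm_eq_abs, mul_one, sq_abs]
          have := sq_nonneg t
          linarith
        exact ((sq_le_sq₀ (norm_nonneg _) (norm_nonneg _)).1 this).trans hx2)
    have d1 : dist x f < 2 * (ℓ / A) := by
      have a1 : dist x (x - t • ν) ≤ ℓ / A := by
        rw [dist_eq_norm, sub_sub_cancel, norm_smul, hν, mul_one]; exact hx1
      have a2 : dist (x - t • ν) f < ℓ / A := by rw [dist_comm, dist_eq_norm]; exact hfp
      have := dist_triangle x (x - t • ν) f
      linarith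
    have d2 : dist f z ≤ ℓ + ℓ / 20 := by
      have := dist_triangle f x z
      rw [dist_comm f x, dist_eq_norm x z] at this; linarith
    have l1 : |u x| ≤ M u f (2 * (ℓ / A)) := le_M cu d1
    have l2 := hL f hf (2 * (ℓ / A)) ℓ (by linarith) (by linarith) (by linarith)
    have l3 : M u f ℓ ≤ M3 := M_sub cu (ball_subset_ball' (by linarith))
    rw [show ℓ / (2 * (ℓ / A)) = A / 2 by field_simp, pw] at l2
    have l4 := mul_le_mul_of_nonneg_left (l2.trans l3) (show 0 ≤ (2:ℝ) ^ (-(176 * N)) by positivity)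
    rw [← mul_assoc, ← Real.rpow_add (by norm_num)] at l4
    simp only [neg_add_cancel, Real.rpow_zero, one_mul] at l4
    linarith
  obtain ⟨f, hf, hfz⟩ := hcon z (by simp) (by simp [h0.le])
  rw [← dist_eq_norm] at hfz
  have b1 : M3 ≤ M u f (4 * ℓ) := M_sub cu (ball_subset_ball' (by rw [dist_comm]; linarith))
  have b2 := hU f hf (ℓ / 20) (4 * ℓ) (by linarith) (by linarith) le_rfl
  have b3 : M u f (ℓ / 20) ≤ M u z (ℓ / 10) := M_sub cu (ball_subset_ball' (by linarith))
  rw [show 4 * ℓ / (ℓ / 20) = 80 by field_simp; norm_num] at b2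
  refine hl_alg (N := N) (M1 := M u z (ℓ / 10)) (M3 := M3) C0 (hN1 N N1N) ((hpos f hf).trans_le b3) ?_ M30 (by linarith)
    (b1.trans (b2.trans (mul_le_mul_of_nonneg_left b3 (by positivity))))
  intro B B0 hB
  apply M_le (by positivity)
  intro y hy
  have hy' : ‖y - z‖ ≤ ℓ / 10 := by rw [← dist_eq_norm]; exact (mem_ball.1 hy).le
  have := H (88 * N) (by linarith) u z ν ℓ h0 h1 hu hν _ near y hy'
  apply abs_le_of_sq_le_sq _ B0
  refine this.trans (le_trans ?_ hB)
  rw [mul_assoc]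
  apply mul_le_mul_of_nonneg_left _ C0.le
  rw [add_mul]
  have c1 : (2:ℝ) ^ (2 * (88 * N)) * ((2:ℝ) ^ (-(176 * N)) * M3) ^ 2 = (2:ℝ) ^ (-(176 * N)) * M3 ^ 2 := by
    rw [show 2 * (88 * N) = 176 * N by ring, Real.rpow_neg (by norm_num)]
    have : (2:ℝ) ^ (176 * N) ≠ 0 := by positivity
    field_simp
  have c2 : (9/10:ℝ) ^ (2 * (88 * N)) ≤ (2:ℝ) ^ (-(22 * N)) := by
    have e : ((9/10:ℝ) ^ (8:ℝ)) ≤ (2:ℝ)⁻¹ := by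
      rw [show (8:ℝ) = ((8:ℕ):ℝ) by norm_num, Real.rpow_natCast]; norm_num
    calc (9/10:ℝ) ^ (2 * (88 * N)) = ((9/10:ℝ) ^ (8:ℝ)) ^ (22 * N) := by
          rw [← Real.rpow_mul (by norm_num)]; congr 1; ring
      _ ≤ ((2:ℝ)⁻¹) ^ (22 * N) := Real.rpow_le_rpow (by positivity) e (by positivity)
      _ = _ := by rw [Real.inv_rpow (by norm_num), Real.rpow_neg (by norm_num)]
  rw [c1]
  have := mul_le_mul_of_nonneg_right c2 (sq_nonneg M3)
  linarith

end BL
end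

open MeasureTheory Metric Set
noncomputable section
namespace BL
set_option linter.unusedVariables false
set_option linter.unusedSimpArgs false
open scoped ContDiff

variable {n : ℕ} {v w : E n} {f g h u χ : E n → ℝ}

open RealInnerProductSpace

theorem cell1 {D : ℕ} (hD : 0 < D) {z h x : ℝ} (h0 : 0 < h) (hx : |x - z| ≤ h) :
    ∃ j : Fin D, |x - (z + h * (2 * (j:ℝ) + 1 - D) / D)| ≤ h / D := by
  have D0 : (0:ℝ) < D := by exact_mod_cast hD
  obtain ⟨h1, h2⟩ := abs_le.1 hx
  set t := (x - z + h) * D / (2 * h) with ht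
  have t0 : 0 ≤ t := by
    rw [ht]; have : 0 ≤ x - z + h := by linarith
    positivity
  have xe : x - z = 2 * h * t / D - h := by rw [ht]; field_simp; ring
  have tD : t ≤ D := by rw [ht, div_le_iff₀ (by positivity)]; nlinarith
  -- choose j = min ⌊t⌋ (D-1)
  obtain ⟨j, hjD, hj1, hj2⟩ : ∃ j : ℕ, j < D ∧ (j:ℝ) ≤ t ∧ t ≤ j + 1 := by
    rcases lt_or_ge ⌊t⌋₊ D with h | h
    · exact ⟨_, h, Nat.floor_le t0, (Nat.lt_floor_add_one t).le⟩
    · refine ⟨D - 1, by omega, ?_, ?_⟩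
      · have : (D:ℝ) ≤ t := (Nat.le_floor_iff t0).1 h
        rw [Nat.cast_sub hD]; push_cast; linarith
      · rw [Nat.cast_sub hD]; push_cast; linarith
  refine ⟨⟨j, hjD⟩, ?_⟩
  have : x - (z + h * (2 * (j:ℝ) + 1 - D) / D) = h / D * (2 * (t - j) - 1) := by
    have : x = z + (2 * h * t / D - h) := by linarith
    rw [this]; field_simp; ring
  show |x - (z + h * (2 * (j:ℝ) + 1 - D) / D)| ≤ _
  rw [this, abs_mul, abs_of_pos (by positivity)]
  have : |2 * (t - j) - 1| ≤ 1 := by rw [abs_le]; constructor <;> linarith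
  calc h / D * |2 * (t - j) - 1| ≤ h / D * 1 := by gcongr
    _ = _ := mul_one _

theorem porous {ι : Type*} [Fintype ι] [DecidableEq ι] {D : ℕ} (hD : 0 < D) {a : ℝ} (ha : 2 / (D:ℝ) < a) (G : Set (ι → ℝ)) : ∀ (k : ℕ) (z : ι → ℝ) (h : ℝ),
    0 < h → (∀ i < k, ∀ z' : ι → ℝ, dist z' z ≤ h → ∃ p, dist p z' ≤ h / (D:ℝ) ^ i ∧ ∀ g ∈ G, a * (h / (D:ℝ) ^ i) ≤ dist g p) →
    ∃ T : Finset (ι → ℝ), T.card ≤ (D ^ (Fintype.card ι) - 1) ^ k ∧ ∀ g ∈ G, dist g z ≤ h → ∃ t ∈ T, dist t z ≤ h ∧ dist g t ≤ h / (D:ℝ) ^ k := by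
  have D0 : (0:ℝ) < D := by exact_mod_cast hD
  have D1 : (1:ℝ) ≤ D := by exact_mod_cast hD
  classical
  intro k
  induction k with
  | zero => 
    intro z h h0 _
    exact ⟨{z}, by simp, fun g _ hg => ⟨z, by simp, by simp [h0.le], by simpa using hg⟩⟩
  | succ k ih =>
    intro z h h0 hp
    obtain ⟨p, hp1, hp2⟩ := hp 0 (by omega) z (by simp [h0.le])
    simp only [pow_zero, div_one] at hp1 hp2
    set c : (ι → Fin D) → (ι → ℝ) := fun j i => z i + h * (2 * ((j i : ℕ):ℝ) + 1 - D) / D with hc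
    have cz : ∀ j, dist (c j) z ≤ h - h / D := by
      intro j
      have e0 : 0 ≤ h - h / D := sub_nonneg.2 (div_le_self h0.le D1)
      rw [dist_pi_le_iff e0]
      intro i
      rw [Real.dist_eq]
      have e : c j i - z i = h / D * (2 * ((j i : ℕ):ℝ) + 1 - D) := by simp only [hc]; ring
      rw [e, abs_mul, abs_of_pos (by positivity)]
      have : |2 * ((j i : ℕ):ℝ) + 1 - D| ≤ D - 1 := by
        have h1 : ((j i : ℕ):ℝ) + 1 ≤ D := by exact_mod_cast (j i).2
        have h2 : (0:ℝ) ≤ ((j i : ℕ):ℝ) := by positivity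
        rw [abs_le]; constructor <;> linarith
      calc h / D * |2 * ((j i : ℕ):ℝ) + 1 - D| ≤ h / D * (D - 1) := by gcongr
        _ = h - h / D := by field_simp
    have cell : ∀ x : ι → ℝ, dist x z ≤ h → ∃ j, dist x (c j) ≤ h / D := by
      intro x hx
      have := fun i => cell1 hD (z := z i) h0 ((Real.dist_eq _ _ ▸ dist_le_pi_dist x z i).trans hx)
      choose j hj using this
      refine ⟨j, ?_⟩
      rw [dist_pi_le_iff (by positivity)]
      intro i; rw [Real.dist_eq]; exact hj i
    obtain ⟨j0, hj0⟩ := cell p hp1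
    have ex : ∀ j, ∃ T : Finset (ι → ℝ), T.card ≤ (D ^ (Fintype.card ι) - 1) ^ k ∧ ∀ g ∈ G, dist g (c j) ≤ h / D → 
        ∃ t ∈ T, dist t (c j) ≤ h / D ∧ dist g t ≤ h / D / (D:ℝ) ^ k := by
      intro j
      apply ih (c j) (h / D) (by positivity)
      intro i hi z' hz'
      have := hp (i + 1) (by omega) z' ((dist_triangle _ (c j) _).trans (by linarith [cz j]))
      rw [pow_succ', ← div_div] at this
      exact this
    choose T hT1 hT2 using ex
    refine ⟨(Finset.univ.erase j0).biUnion T, ?_, ?_⟩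
    · refine (Finset.card_biUnion_le_card_mul _ _ _ fun j _ => hT1 j).trans (le_of_eq ?_)
      rw [Finset.card_erase_of_mem (Finset.mem_univ _)]
      simp [pow_succ']
    · intro g hg hgz
      obtain ⟨j, hj⟩ := cell g hgz
      obtain ⟨t, ht, ht1, ht2⟩ := hT2 j g hg hj
      refine ⟨t, ?_, (dist_triangle _ (c j) _).trans (by linarith [cz j]), by rw [pow_succ', ← div_div]; exact ht2⟩
      rw [Finset.mem_biUnion]
      refine ⟨j, ?_, ht⟩
      rw [Finset.mem_erase]
      refine ⟨?_, Finset.mem_univ _⟩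
      rintro rfl
      have := hp2 g hg
      have d1 := dist_triangle g (c j) p
      rw [dist_comm (c j) p] at d1
      have : h * (2 / D) < h * a := mul_lt_mul_of_pos_left ha h0
      have e : h * (2 / D) = h / D + h / D := by ring
      linarith

theorem exists_onb (hn : 1 ≤ n) (ν : E n) (hν : ‖ν‖ = 1) : ∃ (b : OrthonormalBasis (Fin n) ℝ (E n)) (i0 : Fin n), b i0 = ν := by
  let i0 : Fin n := ⟨0, hn⟩
  have : Orthonormal ℝ (({i0} : Set (Fin n)).domRestrict (fun _ => ν)) := by
    constructor
    · intro i; exact hν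
    · intro i j hij
      exact absurd (Subsingleton.elim i j) hij
  obtain ⟨b, hb⟩ := Orthonormal.exists_orthonormalBasis_extension_of_card_eq (by simp) this
  exact ⟨b, i0, hb i0 rfl⟩

set_option maxHeartbeats 800000 in
theorem plane_cov (hn : 2 ≤ n) {D k : ℕ} (hD : 0 < D) {A σ w : ℝ} (hA : 0 < A) (hσ : 0 < σ) (hDA : 2 / (D:ℝ) < 1 / (2 * n * A))
    (hw1 : w ≤ σ / (D:ℝ) ^ k / (2 * A)) (hw2 : w ≤ σ / (D:ℝ) ^ k) {ν p0 c : E n} (hν : ‖ν‖ = 1) {F : Set (E n)} (hFne : F.Nonempty)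
    (hF : ∀ f ∈ F, |⟪f - p0, ν⟫| ≤ w) (hFc : ∀ f ∈ F, ‖f - c‖ ≤ σ) 
    (hp : ∀ i < k, ∀ z, ⟪z - p0, ν⟫ = 0 → ‖z - c‖ ≤ (n + 2) * σ → ∃ p, ⟪p - z, ν⟫ = 0 ∧ ‖p - z‖ ≤ σ / (D:ℝ) ^ i ∧
      ∀ f ∈ F, (σ / (D:ℝ) ^ i) / A ≤ ‖f - p‖) :
    ∃ T : Finset (E n), T.card ≤ (D ^ (n - 1) - 1) ^ k ∧ ∀ f ∈ F, ∃ t ∈ T, dist f t ≤ 2 * n * (σ / (D:ℝ) ^ k) := by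
  classical
  obtain ⟨b, i0, hb⟩ := exists_onb (by omega) ν hν
  have D0 : (0:ℝ) < D := by exact_mod_cast hD
  have D1 : (1:ℝ) ≤ D := by exact_mod_cast hD
  have n2 : (2:ℝ) ≤ n := by exact_mod_cast hn
  let ι := {i : Fin n // i ≠ i0}
  let co : E n → (ι → ℝ) := fun x i => ⟪b i, x - p0⟫
  let pt : (ι → ℝ) → E n := fun g => p0 + ∑ i : ι, g i • b i
  have cod : ∀ x y i, co x i - co y i = ⟪b i, x - y⟫ := fun x y i => by
    simp only [co]; rw [← inner_sub_right]; congr 1; abel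
  have dco : ∀ x y, dist (co x) (co y) ≤ ‖x - y‖ := fun x y => by
    rw [dist_pi_le_iff (norm_nonneg _)]
    intro i
    rw [Real.dist_eq, cod]
    have := abs_real_inner_le_norm (b i) (x - y)
    simpa using this
  have crd : Fintype.card ι = n - 1 := by simp [ι]
  have nco : ∀ x y, ‖x - y‖ ≤ |⟪x - y, ν⟫| + (n - 1) * dist (co x) (co y) := fun x y => by
    have e : x - y = ∑ i, ⟪b i, x - y⟫ • b i := (b.sum_repr' (x - y)).symm
    calc ‖x - y‖ = ‖∑ i, ⟪b i, x - y⟫ • b i‖ := by rw [← e]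
      _ ≤ ∑ i, ‖⟪b i, x - y⟫ • b i‖ := norm_sum_le _ _
      _ = ∑ i, |⟪b i, x - y⟫| := by
          congr 1; funext i; rw [norm_smul, b.norm_eq_one, mul_one, Real.norm_eq_abs]
      _ = |⟪b i0, x - y⟫| + ∑ i : ι, |⟪b i, x - y⟫| := by
          rw [Fintype.sum_eq_add_sum_subtype_ne _ i0]
      _ ≤ |⟪x - y, ν⟫| + ∑ i : ι, dist (co x) (co y) := by
          rw [hb, real_inner_comm]
          gcongr with i _
          rw [← cod, ← Real.dist_eq]; exact dist_le_pi_dist _ _ i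
      _ = _ := by
          rw [Finset.sum_const, Finset.card_univ, crd, nsmul_eq_mul, Nat.cast_sub (by omega)]; simp
  have ptco : ∀ g, co (pt g) = g := fun g => by
    funext j
    simp only [co, pt, add_sub_cancel_left]
    rw [inner_sum]
    simp only [inner_smul_right]
    rw [Finset.sum_eq_single j]
    · rw [real_inner_self_eq_norm_sq, b.norm_eq_one]; simp
    · intro i _ hij
      rw [b.inner_eq_zero (fun h => hij (Subtype.ext h).symm), mul_zero]
    · simp
  have ptν : ∀ g, ⟪pt g - p0, ν⟫ = 0 := fun g => by
    simp only [pt, add_sub_cancel_left]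
    rw [sum_inner]
    apply Finset.sum_eq_zero
    intro i _
    rw [inner_smul_left, ← hb, b.inner_eq_zero i.2, mul_zero]
  have ptd : ∀ f ∈ F, ∀ p, ⟪p - p0, ν⟫ = 0 → ‖f - p‖ ≤ w + (n - 1) * dist (co f) (co p) := fun f hf p hp => by
    refine (nco f p).trans ?_
    have : ⟪f - p, ν⟫ = ⟪f - p0, ν⟫ := by
      rw [← sub_sub_sub_cancel_right f p p0, inner_sub_left, hp, sub_zero]
    rw [this]; linarith [hF f hf]
  obtain ⟨f0, hf0⟩ := hFne
  have w0 : 0 ≤ w := (abs_nonneg _).trans (hF f0 hf0)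
  have wσ : w ≤ σ := hw2.trans (div_le_self hσ.le (one_le_pow₀ D1))
  have pd : ∀ i, 0 < σ / (D:ℝ) ^ i := fun i => by positivity
  have cν : |⟪c - p0, ν⟫| ≤ 2 * σ := by
    have e : ⟪c - p0, ν⟫ = ⟪f0 - p0, ν⟫ - ⟪f0 - c, ν⟫ := by rw [← inner_sub_left]; congr 1; abel
    have h1 := abs_real_inner_le_norm (f0 - c) ν
    rw [hν, mul_one] at h1
    rw [e]
    refine (abs_sub _ _).trans ?_
    linarith [hF f0 hf0, hFc f0 hf0]
  obtain ⟨T, hT1, hT2⟩ := porous hD hDA (co '' F) k (co c) σ hσ (by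
    intro i hi z' hz'
    obtain ⟨p, hp1, hp2, hp3⟩ := hp i hi (pt z') (ptν z') (by
      refine (nco _ _).trans ?_
      rw [ptco]
      have : ⟪pt z' - c, ν⟫ = - ⟪c - p0, ν⟫ := by
        rw [← sub_sub_sub_cancel_right (pt z') c p0, inner_sub_left, ptν, zero_sub]
      rw [this, abs_neg]
      have : ((n:ℝ) - 1) * dist z' (co c) ≤ (n - 1) * σ := mul_le_mul_of_nonneg_left hz' (by linarith)
      linarith)
    have hpν : ⟪p - p0, ν⟫ = 0 := by
      rw [← sub_add_sub_cancel p (pt z') p0, inner_add_left, hp1, ptν, add_zero]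
    refine ⟨co p, ?_, ?_⟩
    · have := dco p (pt z')
      rw [ptco] at this; exact this.trans hp2
    · rintro _ ⟨f, hf, rfl⟩
      have h1 := hp3 f hf
      have h2 := ptd f hf p hpν
      set s := σ / (D:ℝ) ^ i with hs
      have s0 := pd i
      rw [← hs] at s0
      have h3 : w ≤ s / (2 * A) := hw1.trans (by
        rw [hs]; gcongr)
      by_contra hh
      push Not at hh
      have h4 : ((n:ℝ) - 1) * dist (co f) (co p) ≤ (n - 1) * (1 / (2 * n * A) * s) := mul_le_mul_of_nonneg_left hh.le (by linarith)
      have h5 : ((n:ℝ) - 1) * (1 / (2 * n * A) * s) = s / (2 * A) - s / (2 * n * A) := by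
        field_simp
      have h6 : 0 < s / (2 * n * A) := by positivity
      have h7 : s / A = s / (2 * A) + s / (2 * A) := by field_simp; norm_num
      linarith)
  rw [crd] at hT1
  refine ⟨T.image pt, Finset.card_image_le.trans hT1, ?_⟩
  intro f hf
  obtain ⟨t, ht, _, ht2⟩ := hT2 (co f) ⟨f, hf, rfl⟩ ((dco f c).trans (hFc f hf))
  refine ⟨pt t, Finset.mem_image_of_mem _ ht, ?_⟩
  rw [dist_eq_norm]
  refine (ptd f hf _ (ptν t)).trans ?_
  rw [ptco]
  set s := σ / (D:ℝ) ^ k with hs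
  have s0 : 0 < s := pd k
  have h4 : ((n:ℝ) - 1) * dist (co f) t ≤ (n - 1) * s := mul_le_mul_of_nonneg_left ht2 (by linarith)
  have : 0 ≤ (n:ℝ) * s := by positivity
  linarith

theorem HypU.mono_e {K : Set (E n)} {e e' r0 R0 : ℝ} (h : HypU u K e r0 R0) (hr : 0 < r0) (he : e ≤ e') : HypU u K e' r0 R0 :=
  fun x hx a b ha hab hb => (h x hx a b ha hab hb).trans (mul_le_mul_of_nonneg_right
    (Real.rpow_le_rpow_of_exponent_le (by rw [le_div_iff₀ (by linarith)]; linarith) he) (M_nonneg _ _))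

theorem HypL.mono_e {K : Set (E n)} {e e' r0 R0 : ℝ} (h : HypL u K e r0 R0) (hr : 0 < r0) (he : e' ≤ e) : HypL u K e' r0 R0 :=
  fun x hx a b ha hab hb => le_trans (mul_le_mul_of_nonneg_right
    (Real.rpow_le_rpow_of_exponent_le (by rw [le_div_iff₀ (by linarith)]; linarith) he) (M_nonneg _ _)) (h x hx a b ha hab hb)

theorem exists_k (hn : 2 ≤ n) {D : ℕ} (hD : 2 ≤ D) : ∃ k : ℕ, 1 ≤ k ∧ 
    (((D ^ (n - 1) - 1) ^ k : ℕ) : ℝ) ≤ ((D:ℝ) ^ k / (2 * n)) ^ (n - 1) / 2 := by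
  have D0 : (0:ℝ) < D := by exact_mod_cast (by omega : 0 < D)
  have n0 : (0:ℝ) < n := by exact_mod_cast (by omega : 0 < n)
  have P1 : 1 ≤ D ^ (n - 1) := Nat.one_le_pow _ _ (by omega)
  set P : ℝ := (D:ℝ) ^ (n - 1) with hP
  have P0 : 0 < P := by positivity
  have P1' : 1 ≤ P := by rw [hP]; exact_mod_cast P1
  have t := tendsto_pow_atTop_nhds_zero_of_lt_one (r := 1 - 1 / P) (by
    rw [sub_nonneg, div_le_one P0]; exact P1') (by have : 0 < 1 / P := by positivity
                                                   linarith)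
  have ev := (t.eventually_lt_const (show 0 < ((2 * n : ℝ) ^ (n - 1))⁻¹ / 2 by positivity)).and (Filter.eventually_ge_atTop 1)
  obtain ⟨k, hk1, hk2⟩ := ev.exists
  refine ⟨k, hk2, ?_⟩
  push_cast [Nat.cast_sub P1]
  rw [← hP]
  have e : P - 1 = P * (1 - 1 / P) := by field_simp
  rw [e, mul_pow, div_pow, pow_right_comm (D:ℝ) k, ← hP]
  calc P ^ k * (1 - 1 / P) ^ k ≤ P ^ k * (((2 * n : ℝ) ^ (n - 1))⁻¹ / 2) := by gcongr
    _ = _ := by ring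

set_option maxHeartbeats 800000 in
theorem CS (hn : 2 ≤ n) : ∃ A : ℝ, 2 ≤ A ∧ ∃ m0 : ℕ, (m0:ℝ) ≤ A ^ (n - 1) / 2 ∧ ∃ η : ℝ, 0 < η ∧ η ≤ 1/2 ∧ ∃ Λ : ℝ, 1 ≤ Λ ∧ ∃ N0 : ℝ, 0 < N0 ∧
    ∀ (u : E n → ℝ) (K F : Set (E n)) (c : E n) (σ N : ℝ), 0 < σ → Λ * σ ≤ 1 → Sol u c (Λ * σ) → N0 ≤ N → Convex ℝ K → F ⊆ K → 
      (∀ f ∈ F, ‖f - c‖ ≤ σ) → (∀ x ∈ K, ∀ r > 0, 0 < M u x r) → HypU u K ((1 + η) * N) (σ / Λ) (Λ * σ) → 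
      HypL u F ((1 - η) * N) (σ / Λ) (Λ * σ) → ∃ T : Finset (E n), T.card ≤ m0 ∧ ∀ f ∈ F, ∃ t ∈ T, ‖f - t‖ ≤ σ / A := by
  obtain ⟨Ah, hAh, N0, hN0, H⟩ := HL hn
  have n0 : (2:ℝ) ≤ n := by exact_mod_cast hn
  obtain ⟨D, hD⟩ := exists_nat_gt (4 * n * Ah)
  have Ah0 : 0 < Ah := by linarith
  have nA : (n:ℝ) * 40 ≤ n * Ah := by gcongr
  have D4 : (4:ℝ) * n ≤ D := by linarith
  have D8 : (8:ℝ) ≤ D := by linarith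
  have D0 : 0 < D := by exact_mod_cast (show (0:ℝ) < D by linarith)
  obtain ⟨k, hk1, hk2⟩ := exists_k (n := n) hn (D := D) (by exact_mod_cast (show (2:ℝ) ≤ D by linarith))
  have Dk : (D:ℝ) ≤ (D:ℝ) ^ k := by
    calc (D:ℝ) = (D:ℝ) ^ 1 := (pow_one _).symm
      _ ≤ _ := pow_le_pow_right₀ (by linarith) hk1
  set Q := (D:ℝ) ^ k with hQ
  have Q0 : 0 < Q := by linarith
  have Q1 : 1 ≤ Q := by linarith
  obtain ⟨η, η0, η1, Λ', hΛ', HS⟩ := SL (n := n) (w0 := 1 / Q / (2 * Ah)) (by positivity)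
  refine ⟨Q / (2 * n), by rw [le_div_iff₀ (by positivity)]; linarith, (D ^ (n - 1) - 1) ^ k, hk2, η, η0, η1, 
    Λ' + Ah * Q + n + 5, by have := mul_pos Ah0 Q0; linarith, N0, hN0, ?_⟩
  set Λ := Λ' + Ah * Q + n + 5 with hΛ
  have AQ0 := mul_pos Ah0 Q0
  have Λ0 : 1 ≤ Λ := by linarith
  intro u K F c σ N hσ hσ1 hu hN cK FK hFc hpos hU hL
  have N00 : 0 < N := hN0.trans_le hN
  rcases F.eq_empty_or_nonempty with rfl | hne
  · exact ⟨∅, by simp, by simp⟩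
  have σΛ : σ / Λ ≤ σ := div_le_self hσ.le Λ0
  have σΛ0 : 0 < σ / Λ := by positivity
  obtain ⟨ν, p0, hν, hslab⟩ := HS u K F σ N hu.1.continuous hσ N00 cK FK (fun x hx y hy => by
      have h1 := hFc x hx; have h2 := hFc y hy
      calc ‖x - y‖ = ‖(x - c) - (y - c)‖ := by congr 1; abel
        _ ≤ ‖x - c‖ + ‖y - c‖ := norm_sub_le _ _
        _ ≤ 2 * σ := by linarith) (fun x hx => hpos x hx σ hσ)
    (hU.mono subset_rfl σΛ (by gcongr; linarith)) (hL.mono subset_rfl σΛ (by gcongr; linarith)) hne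
  obtain ⟨T, hT, hT2⟩ := plane_cov hn (k := k) D0 (A := Ah) (w := 1 / Q / (2 * Ah) * σ) Ah0 hσ (by
      rw [div_lt_div_iff₀ (by exact_mod_cast D0) (by positivity)]; linarith)
    (le_of_eq (by rw [← hQ]; ring)) (by
      rw [← hQ]
      have : σ / Q / (2 * Ah) ≤ σ / Q := div_le_self (by positivity) (by linarith)
      calc 1 / Q / (2 * Ah) * σ = σ / Q / (2 * Ah) := by ring
        _ ≤ _ := this) hν hne hslab hFc (by
    intro i hi z hz1 hz2
    have Di : (1:ℝ) ≤ (D:ℝ) ^ i := one_le_pow₀ (by linarith)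
    have Di2 : (D:ℝ) ^ i ≤ Q := pow_le_pow_right₀ (by linarith) hi.le
    set ℓ := σ / (D:ℝ) ^ i with hl
    have l0 : 0 < ℓ := by positivity
    have lσ : ℓ ≤ σ := div_le_self hσ.le Di
    have lΛ : σ / Λ ≤ ℓ / Ah := by
      rw [hl, div_div]
      apply div_le_div_of_nonneg_left hσ.le (by positivity)
      have : (D:ℝ) ^ i * Ah ≤ Q * Ah := by gcongr
      linarith
    have hΛσ : ((n:ℝ) + 5) * σ ≤ Λ * σ := by gcongr; linarith
    have h7 : 7 * σ ≤ (n + 5) * σ := by gcongr; linarith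
    exact H u z ν ℓ N F l0 (by linarith) ⟨hu.1, fun y hy => hu.2 y (ball_subset_ball' (by
        rw [dist_eq_norm]; linarith) hy)⟩ hν hN
      (((hU.mono FK lΛ (by linarith)).mono_e (by positivity) (by have := mul_le_mul_of_nonneg_right η1 N00.le; linarith)))
      (((hL.mono subset_rfl lΛ (by linarith)).mono_e (by positivity) (by have := mul_le_mul_of_nonneg_right η1 N00.le; linarith)))
      (fun x hx => hpos x (FK hx) _ (by positivity)))
  refine ⟨T, hT, fun f hf => ?_⟩
  obtain ⟨t, ht, ht2⟩ := hT2 f hf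
  refine ⟨t, ht, ?_⟩
  rw [← dist_eq_norm]
  refine ht2.trans (le_of_eq ?_)
  rw [← hQ]; field_simp

end BL
end

open MeasureTheory Metric Set
noncomputable section
namespace BL
set_option linter.unusedVariables false
set_option linter.unusedSimpArgs false
open scoped ContDiff

variable {n : ℕ} {v w : E n} {f g h u χ : E n → ℝ}


theorem CSj (hn : 2 ≤ n) : ∃ A : ℝ, 2 ≤ A ∧ ∃ m0 : ℕ, (m0:ℝ) ≤ A ^ (n - 1) / 2 ∧ ∃ η : ℝ, 0 < η ∧ η ≤ 1/2 ∧ ∃ Λ : ℝ, 1 ≤ Λ ∧ ∃ N0 : ℝ, 0 < N0 ∧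
    ∀ (u : E n → ℝ) (K F : Set (E n)) (σ N : ℝ), 0 < σ → Λ * σ ≤ 1 → (∀ x ∈ K, Sol u x (2 * Λ * σ)) → N0 ≤ N → Convex ℝ K → F ⊆ K → 
      (∀ x ∈ K, ∀ r > 0, 0 < M u x r) → ∀ j : ℕ, HypU u K ((1 + η) * N) (σ / A ^ j / Λ) (Λ * σ) → 
      HypL u F ((1 - η) * N) (σ / A ^ j / Λ) (Λ * σ) → ∀ c : E n, (∀ f ∈ F, ‖f - c‖ ≤ σ) →
      ∃ T : Finset (E n), T.card ≤ m0 ^ j ∧ ∀ f ∈ F, ∃ t ∈ T, ‖f - t‖ ≤ σ / A ^ j := by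
  classical
  obtain ⟨A, hA, m0, hm0, η, η0, η1, Λ, hΛ, N0, hN0, H⟩ := CS hn
  refine ⟨A, hA, m0, hm0, η, η0, η1, Λ, hΛ, N0, hN0, ?_⟩
  intro u K F σ N hσ hσ1 hu hN cK FK hpos j
  induction j with
  | zero => intro _ _ c hc; exact ⟨{c}, by simp, fun f hf => ⟨c, by simp, by simpa using hc f hf⟩⟩
  | succ j ih =>
    intro hU hL c hc
    have A1 : 1 ≤ A ^ j := one_le_pow₀ (by linarith)
    have A1' : A ^ j ≤ A ^ (j+1) := pow_le_pow_right₀ (by linarith) (by omega)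
    set s := σ / A ^ j with hs
    have s0 : 0 < s := by positivity
    have sσ : s ≤ σ := div_le_self hσ.le A1
    have le : σ / A ^ (j + 1) / Λ ≤ s / Λ := by rw [hs]; gcongr
    have e : σ / A ^ (j + 1) = s / A := by rw [hs, pow_succ, div_div]
    obtain ⟨T, hT1, hT2⟩ := ih (hU.mono subset_rfl le le_rfl) (hL.mono subset_rfl le le_rfl) c hc
    have ex : ∀ t : E n, ∃ T' : Finset (E n), T'.card ≤ m0 ∧ ∀ f ∈ F, ‖f - t‖ ≤ s → ∃ t' ∈ T', ‖f - t'‖ ≤ s / A := by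
      intro t
      by_cases hne : ∃ f ∈ F, ‖f - t‖ ≤ s
      · obtain ⟨f0, hf0, hft⟩ := hne
        have m1 : Λ * s ≤ Λ * σ := by gcongr
        have m2 : 1 * σ ≤ Λ * σ := by gcongr
        have m3 : s / Λ ≤ s := div_le_self s0.le hΛ
        obtain ⟨T', h1, h2⟩ := H u K (F ∩ {f | ‖f - t‖ ≤ s}) t s N s0 (m1.trans hσ1)
          ⟨(hu f0 (FK hf0)).1, fun y hy => (hu f0 (FK hf0)).2 y (ball_subset_ball' (by
            rw [dist_comm, dist_eq_norm]; linarith) hy)⟩ hN cK (inter_subset_left.trans FK) (fun f hf => hf.2) hpos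
          (hU.mono subset_rfl le m1) (hL.mono inter_subset_left le m1)
        exact ⟨T', h1, fun f hf hft => h2 f ⟨hf, hft⟩⟩
      · exact ⟨∅, by simp, fun f hf hft => absurd ⟨f, hf, hft⟩ hne⟩
    choose T' hT1' hT2' using ex
    refine ⟨T.biUnion T', ?_, ?_⟩
    · refine (Finset.card_biUnion_le_card_mul _ _ _ fun j _ => hT1' j).trans ?_
      rw [pow_succ]; gcongr
    · intro f hf
      obtain ⟨t, ht, ht2⟩ := hT2 f hf
      obtain ⟨t', ht', h3⟩ := hT2' t f hf ht2
      exact ⟨t', Finset.mem_biUnion.2 ⟨t, ht, ht'⟩, by rw [e]; exact h3⟩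

end BL
end

open MeasureTheory Metric Set
noncomputable section
namespace BL
set_option linter.unusedVariables false
set_option linter.unusedSimpArgs false
open scoped ContDiff

variable {n : ℕ} {v w : E n} {f g h u χ : E n → ℝ}


theorem cov_ball (n : ℕ) {ρ : ℝ} (hρ : 0 < ρ) : ∃ m : ℕ, ∀ (z : E n) (s : ℝ), 0 < s → ∃ T : Finset (E n), T.card ≤ m ∧
    ∀ x ∈ closedBall z s, ∃ t ∈ T, ‖x - t‖ ≤ ρ * s := by
  classical
  obtain ⟨t, ht⟩ := (isCompact_closedBall (0 : E n) 1).elim_nhds_subcover (fun x => ball x ρ) (fun x _ => ball_mem_nhds x hρ)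
  refine ⟨t.card, fun z s hs => ⟨t.image (fun y => z + s • y), Finset.card_image_le, fun x hx => ?_⟩⟩
  have hy : s⁻¹ • (x - z) ∈ closedBall (0 : E n) 1 := by
    rw [mem_closedBall_zero_iff, norm_smul, Real.norm_of_nonneg (by positivity), inv_mul_le_iff₀ hs, mul_one]
    rwa [mem_closedBall, dist_eq_norm] at hx
  obtain ⟨y, hyt, hy2⟩ := mem_iUnion₂.1 (ht.2 hy)
  refine ⟨_, Finset.mem_image_of_mem _ hyt, ?_⟩
  have e : x - (z + s • y) = s • (s⁻¹ • (x - z) - y) := by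
    rw [smul_sub, smul_inv_smul₀ hs.ne']; abel
  rw [mem_ball, dist_eq_norm] at hy2
  rw [e, norm_smul, Real.norm_of_nonneg hs.le, mul_comm]
  gcongr

theorem SMs (hn : 2 ≤ n) {ε : ℝ} (hε : 0 < ε) (hε1 : ε ≤ 1) : ∃ s0 : ℝ, 0 < s0 ∧ s0 ≤ 1/4 ∧ ∀ κ : ℝ, 0 < κ → κ ≤ 1 → ∃ N0 : ℝ, 0 < N0 ∧
    ∀ (u : E n → ℝ) (x : E n) (s : ℝ), 0 < s → s ≤ s0 → Sol u x (1/2) → ∀ a b c d N : ℝ, κ * s ≤ a → 2 * a ≤ b → 2 * b ≤ c → 2 * c ≤ d →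
    d ≤ 2 * s → N0 ≤ N → M u x d ≤ (d / c) ^ N * M u x c → M u x b ≤ (b / a) ^ ((1 + ε) * N) * M u x a := by
  obtain ⟨ρ0, h0, h1, H⟩ := SM hn hε hε1
  refine ⟨ρ0 / 4, by positivity, by linarith, fun κ hκ hκ1 => ?_⟩
  obtain ⟨N0, hN0, H⟩ := H (κ * (ρ0 / 2)) (by positivity) (mul_le_one₀ hκ1 (by positivity) (by linarith))
  refine ⟨N0, hN0, fun u x s hs hs0 hu a b c d N ha hab hbc hcd hd hN hM => ?_⟩
  have e : ρ0 * (2 * s / ρ0) = 2 * s := by field_simp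
  have S2 : 2 * s / ρ0 ≤ 1 / 2 := by rw [div_le_iff₀ h0]; linarith
  exact H u x (2 * s / ρ0) (by positivity) (by linarith) (hu.mono S2) a b c d N (by
    have : κ * (ρ0 / 2) * (2 * s / ρ0) = κ * s := by field_simp
    linarith) hab hbc hcd (by linarith) hN hM

theorem del_alg {η : ℝ} (h0 : 0 < η) (h1 : η ≤ 1/2) {N : ℝ} (hN : 0 ≤ N) :
    ((2 + η / 64) / (1 - η / 64)) ^ ((1 + η / 4) * ((1 - η / 2) * N)) ≤ (2:ℝ) ^ ((1 - η / 8) * N) := by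
  have b1 : (2 + η / 64) / (1 - η / 64) ≤ (2:ℝ) ^ (1 + η / 8) := by
    rw [Real.rpow_add (by norm_num), Real.rpow_one]
    have : 1 + η / 16 ≤ (2:ℝ) ^ (η / 8) := by
      rw [Real.rpow_def_of_pos (by norm_num)]
      have := Real.add_one_le_exp (Real.log 2 * (η / 8))
      have l2 := Real.log_two_gt_d9
      have : 1/2 * (η/8) ≤ Real.log 2 * (η / 8) := by gcongr; linarith
      linarith
    rw [div_le_iff₀ (by linarith)]
    have : 2 * (1 + η / 16) * (1 - η / 64) ≤ 2 * 2 ^ (η / 8) * (1 - η / 64) := by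
      gcongr; linarith
    nlinarith
  have e0 : 0 ≤ (1 + η / 4) * ((1 - η / 2) * N) := mul_nonneg (by linarith) (mul_nonneg (by linarith) hN)
  refine (Real.rpow_le_rpow (div_nonneg (by linarith) (by linarith)) b1 e0).trans ?_
  rw [← Real.rpow_mul (by norm_num)]
  apply Real.rpow_le_rpow_of_exponent_le (by norm_num)
  have : (1 + η / 8) * ((1 + η / 4) * (1 - η / 2)) ≤ 1 - η / 8 := by nlinarith [mul_pos h0 h0, mul_pos (mul_pos h0 h0) h0]
  have := mul_le_mul_of_nonneg_right this hN
  linarith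

set_option maxHeartbeats 1000000 in
theorem STEP (hn : 2 ≤ n) : ∃ κb κg δ c : ℝ, 0 < κb ∧ κb ≤ 1/4 ∧ 0 < κg ∧ κg ≤ 1/4 ∧ 0 < δ ∧ δ ≤ 1 ∧ 0 < c ∧ c ≤ 1/2 ∧ ∃ A1 B1 : ℕ, B1 * κb ^ (n - 1) ≤ 1/2 ∧ 
    ∀ ε : ℝ, 0 < ε → ε ≤ 1 → ∃ N0 : ℝ, 0 < N0 ∧ ∃ s0 : ℝ, 0 < s0 ∧ s0 ≤ 1/4 ∧ ∀ (u : E n → ℝ) (K : Set (E n)) (z : E n) (s N : ℝ), 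
    0 < s → s ≤ s0 → (∀ x ∈ K, Sol u x (1/2)) → N0 ≤ N → Convex ℝ K → K ⊆ closedBall z s → (∀ x ∈ K, ∀ r > 0, 0 < M u x r) →
    (∀ x ∈ K, M u x (2 * s) ≤ 2 ^ N * M u x s) → ∃ G B : Finset (E n), G.card ≤ A1 ∧ B.card ≤ B1 ∧ 
      (∀ x ∈ K, (∃ t ∈ G, ‖x - t‖ ≤ δ * (κg * s)) ∨ ∃ t ∈ B, ‖x - t‖ ≤ κb * s) ∧ 
      (∀ t ∈ G, ∀ x ∈ K, ‖x - t‖ ≤ δ * (κg * s) → M u x (2 * (κg * s)) ≤ 2 ^ ((1 - c) * N) * M u x (κg * s)) ∧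
      (∀ x ∈ K, M u x (2 * (κb * s)) ≤ 2 ^ ((1 + ε) * N) * M u x (κb * s)) := by
  classical
  obtain ⟨A, hA, m0, hm0, η, η0, η1, Λ, hΛ, Nc, hNc, CSH⟩ := CSj hn
  have Λ0 : 0 < Λ := by linarith
  obtain ⟨m1, hm1⟩ := cov_ball n (ρ := 1 / (2 * Λ)) (by positivity)
  obtain ⟨j, hj⟩ := exists_pow_lt_of_lt_one (show (0:ℝ) < 1 / (2 * (m1 + 1)) by positivity) (show (1/2:ℝ) < 1 by norm_num)
  have Aj : 0 < A ^ (j+1) := by positivity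
  have Aj1 : 2 ≤ A ^ (j+1) := by
    rw [pow_succ]; have : 1 ≤ A ^ j := one_le_pow₀ (by linarith)
    nlinarith
  set κb := 1 / (2 * Λ) / A ^ (j+1) with hκb
  have κb0 : 0 < κb := by positivity
  have κb1 : κb ≤ 1/4 := by
    rw [hκb, div_div, div_le_div_iff₀ (by positivity) (by norm_num)]
    nlinarith
  set κ := κb / (4 * Λ) with hκ
  have κ0 : 0 < κ := by positivity
  have κκ : κ ≤ κb / 4 := by
    rw [hκ]; gcongr; linarith
  have κ4 : κb / Λ = 4 * κ := by rw [hκ]; field_simp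
  set δ := η / 64 with hδ
  have δ0 : 0 < δ := by positivity
  have δ1 : δ ≤ 1/128 := by linarith
  obtain ⟨A1, hA1⟩ := cov_ball n (ρ := δ * (κ / 5) / 2) (by positivity)
  refine ⟨κb, κ / 5, δ, η / 8, κb0, κb1, by positivity, by linarith, δ0, by linarith, by linarith, by linarith, A1, m1 * m0 ^ (j+1), ?_, ?_⟩
  · push_cast
    have e1 : κb ^ (n - 1) = (1 / (2 * Λ)) ^ (n - 1) / (A ^ (n - 1)) ^ (j+1) := by
      rw [hκb, div_pow, ← pow_mul, ← pow_mul, mul_comm (j+1)]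
    have e2 : (m0:ℝ) ^ (j+1) ≤ (A ^ (n - 1)) ^ (j+1) * (1/2) ^ (j+1) := by
      rw [← mul_pow]; gcongr; linarith
    have e3 : (1 / (2 * Λ)) ^ (n - 1) ≤ 1 := pow_le_one₀ (by positivity) (by rw [div_le_one (by positivity)]; linarith)
    have Ap : 0 < (A ^ (n - 1)) ^ (j+1) := by positivity
    rw [e1]
    calc (m1:ℝ) * m0 ^ (j+1) * ((1 / (2 * Λ)) ^ (n - 1) / (A ^ (n - 1)) ^ (j+1)) 
        ≤ m1 * ((A ^ (n - 1)) ^ (j+1) * (1/2) ^ (j+1)) * (1 / (A ^ (n - 1)) ^ (j+1)) := by gcongr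
      _ = m1 * (1/2) ^ (j+1) := by field_simp
      _ ≤ m1 * (1/2) ^ j := by
        have : (1/2:ℝ) ^ (j+1) ≤ (1/2) ^ j := pow_le_pow_of_le_one (by norm_num) (by norm_num) (by omega)
        gcongr
      _ ≤ (m1 + 1) * (1 / (2 * (m1 + 1))) := by gcongr; linarith
      _ = 1/2 := by field_simp
  intro ε ε0 ε1
  obtain ⟨sa, sa0, sa1, Ha⟩ := SMs hn (ε := η / 4) (by linarith) (by linarith)
  obtain ⟨sb, sb0, sb1, Hb⟩ := SMs hn ε0 ε1
  obtain ⟨Na, Na0, Ha⟩ := Ha (κ / 10) (by positivity) (by linarith)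
  obtain ⟨Nb, Nb0, Hb⟩ := Hb κb κb0 (by linarith)
  refine ⟨max (2 * Na) (max Nb Nc), by positivity, min sa sb, by positivity, (min_le_left _ _).trans sa1, ?_⟩
  intro u K z s N hs hs0 hu hN cK hKz hpos hdb
  have hsa := hs0.trans (min_le_left _ _)
  have hsb := hs0.trans (min_le_right _ _)
  have hNa : 2 * Na ≤ N := (le_max_left _ _).trans hN
  have hNb : Nb ≤ N := ((le_max_left _ _).trans (le_max_right _ _)).trans hN
  have hNc : Nc ≤ N := ((le_max_right _ _).trans (le_max_right _ _)).trans hN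
  have N0 : 0 < N := by linarith
  have e2s : 2 * s / s = 2 := by field_simp
  set F := {x ∈ K | 2 ^ ((1 - η / 2) * N) * M u x (κ * s) < M u x (2 * (κ * s))} with hF
  have κs : κ * s ≤ κb * s / 4 := by rw [mul_div_right_comm]; gcongr
  have κs0 : 0 < κ * s := by positivity
  have κbs : κb * s ≤ s / 4 := by rw [div_eq_inv_mul]; gcongr; linarith
  have hU : HypU u K ((1 + η / 4) * N) (κ * s) (s / 2) := fun x hx a b ha hab hb =>
    Ha u x s hs hsa (hu x hx) a b s (2 * s) N (by rw [div_mul_eq_mul_div]; linarith) hab (by linarith) (by linarith) le_rfl (by linarith) (by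
      rw [e2s]; exact hdb x hx)
  have hL : HypL u F ((1 - η) * N) (4 * (κ * s)) (s / 2) := by
    intro x hx a b ha hab hb
    by_contra hc
    push Not at hc
    have := Ha u x s hs hsa (hu x hx.1) (κ * s) (2 * (κ * s)) a b ((1 - η) * N) (by rw [div_mul_eq_mul_div]; linarith) le_rfl (by linarith) hab (by linarith)
      (by nlinarith) hc.le
    have e : 2 * (κ * s) / (κ * s) = 2 := by field_simp
    rw [e] at this
    have h2 : (2:ℝ) ^ ((1 + η / 4) * ((1 - η) * N)) ≤ 2 ^ ((1 - η / 2) * N) := by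
      apply Real.rpow_le_rpow_of_exponent_le (by norm_num)
      rw [← mul_assoc]; gcongr; nlinarith
    have h3 := mul_le_mul_of_nonneg_right h2 (M_nonneg (u := u) x (κ * s))
    have h4 := hx.2
    linarith
  set σ := 1 / (2 * Λ) * s with hσ
  have σ0 : 0 < σ := by positivity
  have Λσ : Λ * σ = s / 2 := by rw [hσ]; field_simp
  have σj : σ / A ^ (j+1) = κb * s := by rw [hσ, hκb]; ring
  have σj' : σ / A ^ (j+1) / Λ = 4 * (κ * s) := by rw [σj, mul_div_right_comm, κ4]; ring
  have key : ∀ c : E n, ∃ T : Finset (E n), T.card ≤ m0 ^ (j+1) ∧ ∀ f ∈ F, ‖f - c‖ ≤ σ → ∃ t ∈ T, ‖f - t‖ ≤ κb * s := by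
    intro c
    obtain ⟨T, h1, h2⟩ := CSH u K (F ∩ {f | ‖f - c‖ ≤ σ}) σ N σ0 (by linarith) (fun x hx => (hu x hx).mono (by rw [mul_assoc, Λσ]; linarith)) hNc cK (fun f hf => hf.1.1)
      hpos (j+1) (by
        rw [σj', Λσ]
        exact (hU.mono subset_rfl (by linarith) le_rfl).mono_e (by positivity) (by gcongr; linarith)) (by
        rw [σj', Λσ]
        exact (hL.mono inter_subset_left le_rfl le_rfl)) c (fun f hf => hf.2)
    exact ⟨T, h1, fun f hf hfc => by rw [← σj]; exact h2 f ⟨hf, hfc⟩⟩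
  choose T hT1 hT2 using key
  obtain ⟨T0, hT01, hT02⟩ := hm1 z s hs
  obtain ⟨G0, hG01, hG02⟩ := hA1 z s hs
  have pick : ∀ t : E n, ∃ x : E n, (∃ y, y ∈ K ∧ y ∉ F ∧ ‖y - t‖ ≤ δ * (κ / 5) / 2 * s) → (x ∈ K ∧ x ∉ F ∧ ‖x - t‖ ≤ δ * (κ / 5) / 2 * s) := by
    intro t
    by_cases h : ∃ y, y ∈ K ∧ y ∉ F ∧ ‖y - t‖ ≤ δ * (κ / 5) / 2 * s
    · obtain ⟨y, hy⟩ := h; exact ⟨y, fun _ => hy⟩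
    · exact ⟨0, fun h' => absurd h' h⟩
  choose p hp using pick
  refine ⟨(G0.image p).filter (fun x => x ∈ K ∧ x ∉ F), T0.biUnion T, ?_, ?_, ?_, ?_, ?_⟩
  · exact (Finset.card_filter_le _ _).trans (Finset.card_image_le.trans hG01)
  · exact (Finset.card_biUnion_le_card_mul _ _ _ fun c _ => hT1 c).trans (by gcongr)
  · intro x hx
    by_cases hxF : x ∈ F
    · obtain ⟨c, hc, hxc⟩ := hT02 x (hKz hx)
      obtain ⟨t, ht, hxt⟩ := hT2 c x hxF hxc
      exact Or.inr ⟨t, Finset.mem_biUnion.2 ⟨c, hc, ht⟩, hxt⟩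
    · obtain ⟨t, ht, hxt⟩ := hG02 x (hKz hx)
      obtain ⟨h1, h2, h3⟩ := hp t ⟨x, hx, hxF, hxt⟩
      refine Or.inl ⟨p t, Finset.mem_filter.2 ⟨Finset.mem_image_of_mem _ ht, h1, h2⟩, ?_⟩
      have := norm_sub_le_norm_sub_add_norm_sub x t (p t)
      rw [norm_sub_rev t] at this
      linarith
  · intro t ht x hx hxt
    obtain ⟨ht, htK, htF⟩ := Finset.mem_filter.1 ht
    have hcu : Continuous u := (hu x hx).1.continuous
    have ht2 : M u t (2 * (κ * s)) ≤ 2 ^ ((1 - η / 2) * N) * M u t (κ * s) := by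
      by_contra hc
      push Not at hc
      exact htF ⟨htK, hc⟩
    set r := κ / 5 * s with hr
    have r5 : κ * s = 5 * r := by rw [hr]; ring
    have r0 : 0 < r := by positivity
    have δr : δ * r ≤ 1/128 * r := by gcongr
    have δr0 : 0 < δ * r := by positivity
    have h1 : M u x (2 * r) ≤ M u t ((2 + δ) * r) := M_sub hcu (ball_subset_ball' (by rw [dist_eq_norm]; linarith))
    have h2 : M u t ((1 - δ) * r) ≤ M u x r := M_sub hcu (ball_subset_ball' (by rw [dist_comm, dist_eq_norm]; linarith))
    have h3 := Ha u t s hs hsa (hu t htK) ((1 - δ) * r) ((2 + δ) * r) (κ * s) (2 * (κ * s)) ((1 - η / 2) * N) (by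
      rw [div_mul_eq_mul_div]; linarith) (by linarith) (by linarith) le_rfl (by linarith) (by nlinarith) (by
        have e : 2 * (κ * s) / (κ * s) = 2 := by field_simp
        rw [e]; exact ht2)
    have e : (2 + δ) * r / ((1 - δ) * r) = (2 + δ) / (1 - δ) := by rw [mul_div_mul_right _ _ r0.ne']
    rw [e] at h3
    have h4 := del_alg η0 η1 N0.le
    calc M u x (2 * r) ≤ _ := h1
      _ ≤ _ := h3
      _ ≤ 2 ^ ((1 - η / 8) * N) * M u x r := mul_le_mul h4 h2 (M_nonneg _ _) (by positivity)
  · intro x hx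
    have := Hb u x s hs hsb (hu x hx) (κb * s) (2 * (κb * s)) s (2 * s) N le_rfl le_rfl (by linarith) le_rfl le_rfl hNb (by
      rw [e2s]; exact hdb x hx)
    have e : 2 * (κb * s) / (κb * s) = 2 := by field_simp
    rwa [e] at this
end BL
end

open MeasureTheory Metric Set
noncomputable section
namespace BL
set_option linter.unusedVariables false
set_option linter.unusedSimpArgs false
open scoped ContDiff

variable {n : ℕ} {v w : E n} {f g h u χ : E n → ℝ}


def nu (n : ℕ) (δ : ℝ) : OuterMeasure (E n) :=
  OuterMeasure.mkMetric'.pre (fun s => (Metric.ediam s) ^ ((n:ℝ) - 1)) (ENNReal.ofReal δ)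

theorem mu_eq (S : Set (E n)) : μH[(n:ℝ) - 1] S = ⨆ r > (0 : ENNReal), OuterMeasure.mkMetric'.pre (fun s => (Metric.ediam s) ^ ((n:ℝ) - 1)) r S := by
  rw [Measure.hausdorffMeasure, ← OuterMeasure.coe_mkMetric, OuterMeasure.mkMetric, OuterMeasure.mkMetric']
  simp only [OuterMeasure.iSup_apply]

theorem nu_le_mu {δ : ℝ} (hδ : 0 < δ) (S : Set (E n)) : nu n δ S ≤ μH[(n:ℝ) - 1] S := by
  rw [mu_eq]
  exact le_iSup₂_of_le (ENNReal.ofReal δ) (by simpa using hδ) le_rfl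

theorem mu_le {S : Set (E n)} {B : ENNReal} (h : ∀ δ > 0, nu n δ S ≤ B) : μH[(n:ℝ) - 1] S ≤ B := by
  rw [mu_eq]
  refine iSup₂_le fun r hr => ?_
  by_cases ht : r = ⊤
  · refine le_trans (OuterMeasure.mkMetric'.mono_pre _ (r := ENNReal.ofReal 1) (by rw [ht]; exact le_top) S) (h 1 one_pos)
  · have := h r.toReal (ENNReal.toReal_pos hr.ne' ht)
    rwa [nu, ENNReal.ofReal_toReal ht] at this

theorem nu_small (hn : 1 ≤ n) {δ s : ℝ} (hs : 0 ≤ s) (h : 2 * s ≤ δ) {S : Set (E n)} {z : E n} (hS : S ⊆ closedBall z s) :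
    nu n δ S ≤ ENNReal.ofReal ((2 * s) ^ (n - 1)) := by
  have hd : Metric.ediam S ≤ ENNReal.ofReal (2 * s) := by
    apply Metric.ediam_le
    intro x hx y hy
    rw [edist_dist]
    apply ENNReal.ofReal_le_ofReal
    have h1 := hS hx
    have h2 := hS hy
    rw [mem_closedBall] at h1 h2
    have := dist_triangle_right x y z
    linarith
  refine (OuterMeasure.mkMetric'.pre_le (hd.trans (ENNReal.ofReal_le_ofReal h))).trans ?_
  have e : ((n:ℝ) - 1) = ((n - 1 : ℕ) : ℝ) := by push_cast [hn]; ring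
  rw [e, ENNReal.rpow_natCast, ENNReal.ofReal_pow (by linarith)]
  gcongr

theorem nu_cov {δ : ℝ} {S : Set (E n)} {R : Set (E n)} {G : Finset (E n)} {f : E n → Set (E n)} (h : S ⊆ R ∪ ⋃ t ∈ G, f t) {m : ℕ} (hm : G.card ≤ m) {b : ℝ} (hb : 0 ≤ b)
    (hf : ∀ t ∈ G, nu n δ (f t) ≤ ENNReal.ofReal b) : nu n δ S ≤ nu n δ R + ENNReal.ofReal (m * b) := by
  calc nu n δ S ≤ nu n δ (R ∪ ⋃ t ∈ G, f t) := measure_mono h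
    _ ≤ nu n δ R + nu n δ (⋃ t ∈ G, f t) := measure_union_le _ _
    _ ≤ nu n δ R + ∑ t ∈ G, nu n δ (f t) := by gcongr; exact measure_biUnion_finset_le _ _
    _ ≤ nu n δ R + ∑ t ∈ G, ENNReal.ofReal b := by gcongr with t ht; exact hf t ht
    _ ≤ _ := by
      gcongr
      rw [Finset.sum_const, nsmul_eq_mul, ENNReal.ofReal_mul (by positivity), ENNReal.ofReal_natCast]
      gcongr

def LeafP (n : ℕ) : Prop := ∀ N0 : ℝ, ∃ s1 : ℝ, 0 < s1 ∧ ∃ C : ℝ, 0 < C ∧ ∀ (u : E n → ℝ) (K : Set (E n)) (z : E n) (s : ℝ), 0 < s → s ≤ s1 → 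
  (∀ x ∈ K, Sol u x (1/2)) → K ⊆ closedBall z s → (∀ x ∈ K, ∀ r > 0, 0 < M u x r) → (∀ x ∈ K, M u x (2 * s) ≤ 2 ^ N0 * M u x s) →
  μH[(n:ℝ) - 1] {x ∈ K | u x = 0} ≤ ENNReal.ofReal (C * s ^ (n - 1))

theorem REC (hn : 2 ≤ n) (HLf : LeafP n) : ∃ N0 : ℝ, 1 ≤ N0 ∧ ∃ α : ℕ, 1 ≤ α ∧ ∃ s0 : ℝ, 0 < s0 ∧ s0 ≤ 1/4 ∧ ∃ Λ : ℝ, 0 < Λ ∧ ∀ (u : E n → ℝ) (δ : ℝ), 0 < δ → ∀ (k : ℕ) (K : Set (E n)) (z : E n) (s N : ℝ), 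
    s ≤ 4 ^ k * (δ / 2) → 0 < s → s ≤ s0 → (∀ x ∈ K, Sol u x (1/2)) → N0 ≤ N → Convex ℝ K → K ⊆ closedBall z s → (∀ x ∈ K, ∀ r > 0, 0 < M u x r) →
    (∀ x ∈ K, M u x (2 * s) ≤ 2 ^ N * M u x s) → nu n δ {x ∈ K | u x = 0} ≤ ENNReal.ofReal (Λ * N ^ α * s ^ (n - 1)) := by
  obtain ⟨κb, κg, θ, c, κb0, κb1, κg0, κg1, θ0, θ1, c0, c1, A1, B1, hB1, H⟩ := STEP hn
  obtain ⟨α, hα⟩ := exists_pow_lt_of_lt_one (show (0:ℝ) < 1 / (8 * (A1 + 1)) by positivity) (show 1 - c < 1 by linarith)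
  have hα : (1 - c) ^ (α + 1) * A1 ≤ 1 / 8 := by
    have h1 : (1 - c) ^ (α + 1) ≤ (1 - c) ^ α := pow_le_pow_of_le_one (by linarith) (by linarith) (by omega)
    calc (1 - c) ^ (α + 1) * A1 ≤ 1 / (8 * (A1 + 1)) * (A1 + 1) := by
          gcongr
          · exact h1.trans hα.le
          · linarith
      _ = 1/8 := by field_simp
  generalize α + 1 = α at hα
  obtain ⟨ε, ε0, ε1, hε⟩ : ∃ ε : ℝ, 0 < ε ∧ ε ≤ 1 ∧ (1 + ε) ^ α ≤ 3/2 := by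
    have ht : Filter.Tendsto (fun ε : ℝ => (1 + ε) ^ α) (nhds 0) (nhds 1) := by
      have : Continuous (fun ε : ℝ => (1 + ε) ^ α) := by fun_prop
      simpa using this.tendsto 0
    have h2 := ht.eventually (eventually_le_nhds (show (1:ℝ) < 3/2 by norm_num))
    obtain ⟨e, e0, he⟩ := Metric.eventually_nhds_iff.1 h2
    refine ⟨min (e / 2) 1, by positivity, min_le_right _ _, he ?_⟩
    rw [dist_zero_right, Real.norm_of_nonneg (by positivity)]
    exact (min_le_left _ _).trans_lt (by linarith)
  obtain ⟨N0', hN0', s0, s00, s01, H⟩ := H ε ε0 ε1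
  set N0 := max N0' 1 with hN0
  obtain ⟨s1, s10, Cl, Cl0, HL⟩ := HLf N0
  have α0 : α ≠ 0 ∨ α = 0 := by tauto
  set Λ := 8 * (A1 * Cl) + 2 ^ (n - 1) with hΛ
  have Λ0 : 0 < Λ := by positivity
  refine ⟨N0, le_max_right _ _, α + 1, by omega, min s0 s1, by positivity, (min_le_left _ _).trans s01, Λ, Λ0, ?_⟩
  intro u δ hδ k K z s N hk hs hs0 hu hN cK hKz hpos hdb
  have N1 : 1 ≤ N := (le_max_right _ _).trans hN
  suffices hh : nu n δ {x ∈ K | u x = 0} ≤ ENNReal.ofReal (Λ * N ^ α * s ^ (n - 1)) by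
    refine hh.trans (ENNReal.ofReal_le_ofReal ?_)
    gcongr
    omega
  clear N1
  induction k generalizing K z s N with
  | zero =>
    have N1 : 1 ≤ N := (le_max_right _ _).trans hN
    refine (nu_small (by omega) hs.le (by linarith) ((sep_subset K _).trans hKz)).trans (ENNReal.ofReal_le_ofReal ?_)
    rw [mul_pow]
    gcongr
    have h1 : 1 ≤ N ^ α := one_le_pow₀ N1
    have h2 : 2 ^ (n - 1) ≤ Λ := by rw [hΛ]; have : 0 ≤ 8 * (A1 * Cl) := by positivity
                                    linarith
    calc (2:ℝ) ^ (n-1) ≤ Λ * 1 := by linarith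
      _ ≤ Λ * N ^ α := by gcongr
  | succ k ih =>
    have N1 : 1 ≤ N := (le_max_right _ _).trans hN
    have h1 : 1 ≤ N ^ α := one_le_pow₀ N1
    obtain ⟨G, B, hG, hB, hcov, hGd, hBd⟩ := H u K z s N hs (hs0.trans (min_le_left _ _)) hu ((le_max_left _ _).trans hN) cK hKz hpos hdb
    have sub : ∀ (t : E n) (r : ℝ), {x ∈ K | ‖x - t‖ ≤ r} = K ∩ closedBall t r := by
      intro t r; ext x; simp [dist_eq_norm]
    have cvx : ∀ (t : E n) (r : ℝ), Convex ℝ {x ∈ K | ‖x - t‖ ≤ r} := by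
      intro t r; rw [sub]; exact cK.inter (convex_closedBall t r)
    have sk : s * (1/4) ≤ 4 ^ k * (δ / 2) := by rw [pow_succ] at hk; linarith
    have hgs : κg * s ≤ s * (1/4) := by rw [mul_comm]; gcongr
    have hbs : κb * s ≤ s * (1/4) := by rw [mul_comm]; gcongr
    have ss : s * (1/4) ≤ min s0 s1 := by linarith
    have Λs : 0 ≤ Λ * N ^ α * s ^ (n-1) := by positivity
    have cov : {x ∈ K | u x = 0} ⊆ (⋃ t ∈ G, {x ∈ {x ∈ K | ‖x - t‖ ≤ θ * (κg * s)} | u x = 0}) ∪ ⋃ t ∈ B, {x ∈ {x ∈ K | ‖x - t‖ ≤ κb * s} | u x = 0} := by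
      rintro x ⟨hx, hx0⟩
      rcases hcov x hx with ⟨t, ht, hxt⟩ | ⟨t, ht, hxt⟩
      · exact Or.inl (mem_iUnion₂.2 ⟨t, ht, ⟨hx, hxt⟩, hx0⟩)
      · exact Or.inr (mem_iUnion₂.2 ⟨t, ht, ⟨hx, hxt⟩, hx0⟩)
    have nB : ∀ t ∈ B, nu n δ {x ∈ {x ∈ K | ‖x - t‖ ≤ κb * s} | u x = 0} ≤ ENNReal.ofReal (Λ * ((1 + ε) * N) ^ α * (κb * s) ^ (n-1)) := by
      intro t ht
      refine ih _ t (κb * s) ((1 + ε) * N) (hbs.trans sk) (by positivity) (hbs.trans ss) (fun x hx => hu x hx.1) ?_ (cvx t _) ?_ (fun x hx => hpos x hx.1) (fun x hx => hBd x hx.1)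
      · nlinarith
      · intro x hx; rw [mem_closedBall, dist_eq_norm]; exact hx.2
    have nG : ∀ t ∈ G, nu n δ {x ∈ {x ∈ K | ‖x - t‖ ≤ θ * (κg * s)} | u x = 0} ≤ ENNReal.ofReal ((Λ * ((1 - c) * N) ^ α + Cl) * (κg * s) ^ (n-1)) := by
      intro t ht
      have hsub : {x ∈ K | ‖x - t‖ ≤ θ * (κg * s)} ⊆ closedBall t (κg * s) := by
        intro x hx; rw [mem_closedBall, dist_eq_norm]; refine hx.2.trans (mul_le_of_le_one_left (by positivity) θ1)
      have cc : 0 ≤ 1 - c := by linarith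
      by_cases hN' : N0 ≤ (1 - c) * N
      · refine (ih _ t (κg * s) ((1 - c) * N) (hgs.trans sk) (by positivity) (hgs.trans ss) (fun x hx => hu x hx.1) hN' (cvx t _) hsub (fun x hx => hpos x hx.1) 
          (fun x hx => hGd t ht x hx.1 hx.2)).trans (ENNReal.ofReal_le_ofReal ?_)
        gcongr; linarith
      · push Not at hN'
        refine (nu_le_mu hδ _).trans ((HL u _ t (κg * s) (by positivity) ((hgs.trans ss).trans (min_le_right _ _)) (fun x hx => hu x hx.1) hsub (fun x hx => hpos x hx.1) ?_).trans (ENNReal.ofReal_le_ofReal ?_))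
        · intro x hx
          refine (hGd t ht x hx.1 hx.2).trans (mul_le_mul_of_nonneg_right ?_ (M_nonneg _ _))
          exact Real.rpow_le_rpow_of_exponent_le (by norm_num) hN'.le
        · gcongr
          have : 0 ≤ Λ * ((1 - c) * N) ^ α := by positivity
          linarith
    have p1 : 0 ≤ (Λ * ((1 - c) * N) ^ α + Cl) * (κg * s) ^ (n-1) := by
      have : 0 ≤ (1 - c) * N := mul_nonneg (by linarith) (by linarith)
      positivity
    have p2 : 0 ≤ Λ * ((1 + ε) * N) ^ α * (κb * s) ^ (n-1) := by positivity
    refine (nu_cov cov hB p2 nB).trans ?_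
    have q1 := nu_cov (R := ∅) (by simp : (⋃ t ∈ G, {x ∈ {x ∈ K | ‖x - t‖ ≤ θ * (κg * s)} | u x = 0}) ⊆ ∅ ∪ _) hG p1 nG
    rw [measure_empty, zero_add] at q1
    refine (add_le_add q1 le_rfl).trans ?_
    rw [← ENNReal.ofReal_add (by positivity) (by positivity)]
    apply ENNReal.ofReal_le_ofReal
    have kg : κg ^ (n-1) ≤ 1 := pow_le_one₀ κg0.le (by linarith)
    set P := N ^ α
    set T := s ^ (n-1)
    have T0 : 0 < T := by positivity
    have i1 : (A1:ℝ) * ((Λ * ((1 - c) * N) ^ α + Cl) * (κg * s) ^ (n-1)) ≤ (Λ * P * (1/8) + A1 * Cl) * T := by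
      rw [mul_pow, mul_pow]
      have cp : 0 ≤ (1 - c) ^ α := pow_nonneg (by linarith) _
      calc (A1:ℝ) * ((Λ * ((1 - c) ^ α * P) + Cl) * (κg ^ (n-1) * T)) ≤ (A1:ℝ) * ((Λ * ((1 - c) ^ α * P) + Cl) * (1 * T)) := by gcongr
        _ = (Λ * P * ((1 - c) ^ α * A1) + A1 * Cl) * T := by ring
        _ ≤ _ := by gcongr
    have i2 : (B1:ℝ) * (Λ * ((1 + ε) * N) ^ α * (κb * s) ^ (n-1)) ≤ Λ * P * (3/4) * T := by
      rw [mul_pow, mul_pow]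
      calc (B1:ℝ) * (Λ * ((1 + ε) ^ α * P) * (κb ^ (n-1) * T)) = Λ * P * ((1 + ε) ^ α * (B1 * κb ^ (n-1))) * T := by ring
        _ ≤ Λ * P * (3/2 * (1/2)) * T := by gcongr
        _ = _ := by ring
    have i3 : A1 * Cl ≤ Λ * P * (1/8) := by
      have : 8 * (A1 * Cl) ≤ Λ := by rw [hΛ]; have : (0:ℝ) < 2 ^ (n-1) := by positivity
                                     linarith
      have : Λ * 1 ≤ Λ * P := by gcongr
      linarith
    have i4 := mul_le_mul_of_nonneg_right i3 T0.le
    linarith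
end BL
end

open MeasureTheory Metric Set
noncomputable section
namespace BL
set_option linter.unusedVariables false
set_option linter.unusedSimpArgs false
open scoped ContDiff

variable {n : ℕ} {v w : E n} {f g h u χ : E n → ℝ}

theorem fd_bd (f : E n → ℝ) (x : E n) : ‖fderiv ℝ f x‖ ≤ ∑ i, |dd (ee i) f x| := by
  refine ContinuousLinearMap.opNorm_le_bound _ (Finset.sum_nonneg fun i _ => abs_nonneg _) fun z => ?_
  rw [fderiv_eq_sum, Real.norm_eq_abs, Finset.sum_mul]
  refine (Finset.abs_sum_le_sum_abs _ _).trans (Finset.sum_le_sum fun i _ => ?_)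
  rw [abs_mul, mul_comm]
  have := PiLp.norm_apply_le z i
  rw [Real.norm_eq_abs] at this
  gcongr

theorem ord_van (m : ℕ) : ∀ (f : E n → ℝ), ContDiff ℝ ∞ f → ∀ x, (∀ l : List (Fin n), l.length < m → pl l f x = 0) →
    ∃ C : ℝ, 0 ≤ C ∧ ∀ y ∈ closedBall x 1, |f y| ≤ C * ‖y - x‖ ^ m := by
  induction m with
  | zero =>
    intro f hf x _
    obtain ⟨C, hC⟩ := (isCompact_closedBall x 1).exists_bound_of_continuousOn (f := f) hf.continuous.continuousOn
    refine ⟨max C 0, le_max_right _ _, fun y hy => ?_⟩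
    simpa using Or.inl (hC y hy)
  | succ m ih =>
    intro f hf x hl
    have := fun i : Fin n => ih (dd (ee i) f) (by fun_prop) x (fun l h => by
      rw [← dd_pl hf]; exact hl (i :: l) (by simpa using h))
    choose C C0 hC using this
    refine ⟨∑ i, C i, Finset.sum_nonneg fun i _ => C0 i, fun y hy => ?_⟩
    have hy1 : ‖y - x‖ ≤ 1 := by simpa [dist_eq_norm] using hy
    have h1 := (convex_closedBall x ‖y - x‖).norm_image_sub_le_of_norm_fderiv_le (𝕜 := ℝ) (f := f)
      (C := ∑ i, C i * ‖y - x‖ ^ m) (fun z _ => sm_diff hf z) (fun z hz => ?_) (mem_closedBall_self (norm_nonneg _))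
      (show y ∈ closedBall x ‖y - x‖ by simp [dist_eq_norm])
    · have h0 : f x = 0 := hl [] (by simp)
      rw [h0, sub_zero, Real.norm_eq_abs] at h1
      rw [pow_succ, ← mul_assoc, Finset.sum_mul]; exact h1
    · refine (fd_bd f z).trans (Finset.sum_le_sum fun i _ => ?_)
      have hz' : ‖z - x‖ ≤ ‖y - x‖ := by simpa [dist_eq_norm] using hz
      refine (hC i z (by rw [mem_closedBall, dist_eq_norm]; linarith)).trans ?_
      have := C0 i
      gcongr

theorem M_pos (hn : 2 ≤ n) (hu : Sol u 0 1) (hnz : ∃ z ∈ ball (0 : E n) 1, u z ≠ 0) {x : E n} (hx : x ∈ ball (0 : E n) 1) {r : ℝ}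
    (hr : 0 < r) : 0 < M u x r := by
  rcases (M_nonneg (u := u) x r).lt_or_eq with h | h
  · exact h
  · obtain ⟨z, hz, hz'⟩ := hnz
    refine absurd (ucp hn hu hx hr (fun y hy => ?_) z hz) hz'
    have := le_M hu.1.continuous hy
    rw [← h] at this
    exact abs_eq_zero.1 (le_antisymm this (abs_nonneg _))

theorem fin_ord (hn : 2 ≤ n) (hu : Sol u 0 1) (hnz : ∃ z ∈ ball (0 : E n) 1, u z ≠ 0) {x : E n} (hx : x ∈ ball (0 : E n) 1) :
    ∃ l : List (Fin n), pl l u x ≠ 0 := by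
  by_contra! hl
  obtain ⟨ρ0, h0, h1, H⟩ := lowE hn
  set S := 1 - ‖x‖ with hS
  have S0 : 0 < S := by rw [mem_ball_zero_iff] at hx; linarith
  have S1 : S ≤ 1 := by have := norm_nonneg x; linarith
  have hSol : Sol u x S := ⟨hu.1, fun y hy => hu.2 y (by
    rw [mem_ball_zero_iff]; rw [mem_ball, dist_eq_norm] at hy
    have := norm_add_le (y - x) x
    rw [sub_add_cancel] at this; linarith)⟩
  set s := ρ0 * S with hs
  have s0 : 0 < s := by positivity
  have s1 : s ≤ 1 := by nlinarith
  have m1 : 0 < M u x s := M_pos hn hu hnz hx s0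
  have m2 : 0 < M u x (s / 2) := M_pos hn hu hnz hx (by positivity)
  obtain ⟨c, c0, P, P0, H⟩ := H (Real.logb 2 (M u x s / M u x (s / 2)))
  have H := H u x S S0 S1 hSol s hs (by
    rw [Real.rpow_logb (by norm_num) (by norm_num) (by positivity), div_mul_cancel₀ _ m2.ne'])
  set k := ⌈P⌉₊ with hk
  obtain ⟨C, C0, hC⟩ := ord_van (k + 1) u hu.1 x (fun l _ => hl l)
  set q := c * M u x s with hq
  have q0 : 0 < q := by positivity
  set a := min (s / 2) (q / (s ^ k * (C + 1)) / 2) with ha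
  have a0 : 0 < a := by rw [ha]; positivity
  have a1 : a ≤ s / 2 := min_le_left _ _
  have a2 : a ≤ q / (s ^ k * (C + 1)) / 2 := min_le_right _ _
  have h3 := H a a0 a1
  have h4 : M u x a ≤ C * a ^ (k + 1) := M_le a0 fun y hy => by
    rw [mem_ball, dist_eq_norm] at hy
    refine (hC y (by rw [mem_closedBall, dist_eq_norm]; linarith)).trans ?_
    gcongr
  have h5 : (a / s) ^ k ≤ (a / s) ^ P := by
    rw [← Real.rpow_natCast]
    exact Real.rpow_le_rpow_of_exponent_ge (by positivity) (by rw [div_le_one s0]; linarith) (Nat.le_ceil P)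
  have h6 : q * (a / s) ^ k ≤ C * a ^ (k + 1) := by
    calc q * (a / s) ^ k ≤ q * (a / s) ^ P := by gcongr
      _ = c * (a / s) ^ P * M u x s := by rw [hq]; ring
      _ ≤ _ := h3.trans h4
  rw [div_pow, pow_succ, ← mul_div_assoc, div_le_iff₀ (by positivity)] at h6
  have h7 : q ≤ C * a * s ^ k := by
    have : a ^ k * q ≤ a ^ k * (C * a * s ^ k) := by linarith
    exact le_of_mul_le_mul_left this (by positivity)
  have h8 : a * (s ^ k * (C + 1)) ≤ q / 2 := by
    rw [div_right_comm] at a2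
    rwa [le_div_iff₀ (by positivity)] at a2
  have : 0 < a * s ^ k := by positivity
  nlinarith
end BL
end

open MeasureTheory Metric Set
noncomputable section
namespace BL
set_option linter.unusedVariables false
set_option linter.unusedSimpArgs false
open scoped ContDiff

variable {n : ℕ} {v w : E n} {f g h u χ : E n → ℝ}

theorem antilip_mu {F : Type*} [NormedAddCommGroup F] [MeasurableSpace F] [BorelSpace F] (S : Set (E n)) (π : E n → F) (c : NNReal)
    (h : ∀ y ∈ S, ∀ z ∈ S, dist y z ≤ c * dist (π y) (π z)) {d : ℝ} (hd : 0 ≤ d) : μH[d] S ≤ (c : ENNReal) ^ d * μH[d] (π '' S) := by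
  have h1 : AntilipschitzWith c (fun y : S => π y) := AntilipschitzWith.of_le_mul_dist fun y z => h y y.2 z z.2
  have h2 := h1.le_hausdorffMeasure_image hd univ
  have h3 := (isometry_subtype_coe (s := S)).hausdorffMeasure_image (Or.inl hd) univ
  rw [image_univ, Subtype.range_coe] at h3
  rw [h3]
  convert h2 using 3
  ext z; simp

theorem ker_hess {A : E n →ₗ[ℝ] (Fin n → ℝ)} (hs : ∀ i j, A (ee i) j = A (ee j) i) (ht : ∑ i, A (ee i) i = 0)
    (h0 : ∃ i j, A (ee i) j ≠ 0) : Module.finrank ℝ A.ker + 2 ≤ n := by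
  have h1 := A.finrank_range_add_finrank_ker
  rw [finrank_euclideanSpace_fin] at h1
  suffices ¬ Module.finrank ℝ A.range ≤ 1 by omega
  intro h2
  obtain ⟨w, hw⟩ := finrank_le_one_iff.1 h2
  choose a ha using fun i => hw ⟨A (ee i), LinearMap.mem_range_self _ _⟩
  have hA : ∀ i j, A (ee i) j = a i * (w : Fin n → ℝ) j := fun i j => by
    have := congrArg (fun z : A.range => (z : Fin n → ℝ) j) (ha i)
    simpa using this.symm
  have h3 : ∑ i, ∑ j, (A (ee i) j) ^ 2 = 0 := by
    calc ∑ i, ∑ j, (A (ee i) j) ^ 2 = ∑ i, ∑ j, A (ee i) i * A (ee j) j := by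
          refine Finset.sum_congr rfl fun i _ => Finset.sum_congr rfl fun j _ => ?_
          have := hs i j
          calc A (ee i) j ^ 2 = A (ee i) j * A (ee j) i := by rw [← this]; ring
            _ = _ := by simp only [hA]; ring
      _ = 0 := by simp [← Finset.mul_sum, ht]
  obtain ⟨i, j, hij⟩ := h0
  rw [Finset.sum_eq_zero_iff_of_nonneg (fun i _ => Finset.sum_nonneg fun j _ => sq_nonneg _)] at h3
  have h4 := h3 i (Finset.mem_univ _)
  rw [Finset.sum_eq_zero_iff_of_nonneg (fun j _ => sq_nonneg _)] at h4
  exact hij (pow_eq_zero_iff two_ne_zero |>.1 (h4 j (Finset.mem_univ _)))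

theorem null_hess (hg : ContDiff ℝ ∞ g) {x : E n} (ht : lp g x = 0) (h0 : ∃ i j, dd (ee i) (dd (ee j) g) x ≠ 0) :
    ∃ V ∈ nhds x, μH[(n:ℝ) - 1] ({y | ∀ i, dd (ee i) g y = 0} ∩ V) = 0 := by
  set F : E n → Fin n → ℝ := fun y i => dd (ee i) g y with hF
  have hFs : ContDiff ℝ ∞ F := contDiff_pi.2 fun i => by fun_prop
  have hd : HasStrictFDerivAt F (fderiv ℝ F x) x := hFs.contDiffAt.hasStrictFDerivAt (by simp)
  set A := fderiv ℝ F x with hA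
  have hAe : ∀ i j, A (ee i) j = dd (ee i) (dd (ee j) g) x := fun i j => by
    have e : ContDiff ℝ ∞ (dd (ee j) g) := by fun_prop
    have := hasFDerivAt_pi'.1 hd.hasFDerivAt j
    simp only [dd] at this ⊢
    rw [this.fderiv]; rfl
  have hk := ker_hess (A := A.toLinearMap) (fun i j => by
      simp only [ContinuousLinearMap.coe_coe]; rw [hAe, hAe, dd_comm hg]) (by
      simp only [ContinuousLinearMap.coe_coe]
      rw [← ht, lp, Finset.sum_apply]; exact Finset.sum_congr rfl fun i _ => hAe i i) (by
      obtain ⟨i, j, h⟩ := h0; exact ⟨i, j, by simp only [ContinuousLinearMap.coe_coe]; rwa [hAe]⟩)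
  set K := A.toLinearMap.ker with hK
  set P := K.orthogonalProjectionOnto with hP
  obtain ⟨c, c0, hc⟩ := LinearMap.exists_antilipschitzWith (A.toLinearMap.prod P.toLinearMap) (by
    rw [LinearMap.ker_eq_bot']
    intro v hv
    have h1 : A v = 0 := congrArg Prod.fst hv
    have h2 : P v = 0 := congrArg Prod.snd hv
    have h3 : v ∈ K := by rw [hK, LinearMap.mem_ker]; exact h1
    have h4 : P v = ⟨v, h3⟩ := K.orthogonalProjectionOnto_mem_subspace_eq_self ⟨v, h3⟩
    rw [h2] at h4
    exact (congrArg Subtype.val h4).symm)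
  have hc' : ∀ v, ‖v‖ ≤ c * max ‖A v‖ ‖P v‖ := fun v => by
    have := hc.le_mul_dist v 0
    simpa [dist_eq_norm, Prod.norm_def] using this
  have c0' : (0:ℝ) < c := c0
  have hsm := hd.isLittleO.def (c := 1 / (2 * c)) (by positivity)
  rw [nhds_prod_eq, Filter.eventually_prod_self_iff'] at hsm
  obtain ⟨V, hV, hsm⟩ := hsm
  refine ⟨V, hV, ?_⟩
  have n1 : (1:ℝ) ≤ n := by exact_mod_cast (by omega : 1 ≤ n)
  have h5 := antilip_mu ({y | ∀ i, dd (ee i) g y = 0} ∩ V) P c (fun y hy z hz => by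
    have h1 := hsm y hy.2 z hz.2
    have e1 : F y = 0 := funext hy.1
    have e2 : F z = 0 := funext hz.1
    simp only [e1, e2, sub_zero, zero_sub, norm_neg] at h1
    have h2 := hc' (y - z)
    rw [dist_eq_norm, dist_eq_norm, ← map_sub]
    rcases le_total ‖A (y - z)‖ ‖P (y - z)‖ with h | h
    · rwa [max_eq_right h] at h2
    · rw [max_eq_left h] at h2
      have h6 : c * ‖A (y - z)‖ ≤ ‖y - z‖ / 2 := by
        calc c * ‖A (y - z)‖ ≤ c * (1 / (2 * c) * ‖y - z‖) := by gcongr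
          _ = _ := by field_simp
      have : ‖y - z‖ ≤ 0 := by linarith
      exact this.trans (by positivity)) (d := (n:ℝ) - 1) (by linarith)
  refine le_antisymm (h5.trans ?_) bot_le
  have h7 : μH[(n:ℝ) - 1] (univ : Set K) = 0 := by
    have := hausdorffMeasure_of_dimH_lt (s := (univ : Set K)) (d := Real.toNNReal ((n:ℝ) - 1)) (by
      rw [Real.dimH_univ_eq_finrank]
      have : (Module.finrank ℝ K : ℝ) < n - 1 := by
        have : (Module.finrank ℝ K : ℝ) + 2 ≤ n := by exact_mod_cast hk
        linarith
      rw [← ENNReal.coe_natCast, ENNReal.coe_lt_coe, ← NNReal.coe_lt_coe, Real.coe_toNNReal _ (by linarith)]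
      simpa using this)
    rwa [Real.coe_toNNReal _ (by linarith)] at this
  rw [measure_mono_null (subset_univ _) h7, mul_zero]

theorem null_sing (hn : 2 ≤ n) (hs : ContDiff ℝ ∞ g) (hh : ∀ x ∈ ball (0 : E n) 1, lp g x = 0) (hnz : ∃ z ∈ ball (0 : E n) 1, g z ≠ 0) :
    μH[(n:ℝ) - 1] {x ∈ ball (0 : E n) 1 | g x = 0 ∧ ∀ i, dd (ee i) g x = 0} = 0 := by
  have hSol : Sol g 0 1 := ⟨hs, fun y hy => by
    rw [lp_eqOn (g := 0) isOpen_ball hh hy]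
    simp [lp, dd_zero]⟩
  have hpl : ∀ (l : List (Fin n)), ∀ x ∈ ball (0 : E n) 1, lp (pl l g) x = 0 := fun l x hx => by
    rw [pl_lp hs, pl_eqOn (g := 0) isOpen_ball hh l hx, pl_zero']; rfl
  refine measure_mono_null (t := ⋃ l : List (Fin n), {x ∈ ball (0 : E n) 1 | (∀ i, dd (ee i) (pl l g) x = 0) ∧
    ∃ i j, dd (ee i) (dd (ee j) (pl l g)) x ≠ 0}) ?_ ?_
  · rintro x ⟨hx, h1, h2⟩
    obtain ⟨l0, hl0⟩ := fin_ord hn hSol hnz hx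
    classical
    have hex : ∃ k, ∃ l : List (Fin n), l.length = k ∧ pl l g x ≠ 0 := ⟨_, l0, rfl, hl0⟩
    obtain ⟨l, hl, hl'⟩ := Nat.find_spec hex
    have hmin : ∀ l' : List (Fin n), l'.length < l.length → pl l' g x = 0 := fun l' h => by
      by_contra h'
      exact Nat.find_min hex (hl ▸ h) ⟨l', rfl, h'⟩
    match l, hl', hmin with
    | [], hl', _ => exact absurd h1 hl'
    | [i], hl', _ => exact absurd (h2 i) hl'
    | i :: j :: l, hl', hmin =>
      exact mem_iUnion.2 ⟨l, hx, fun k => hmin (k :: l) (by simp), i, j, hl'⟩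
  · refine measure_iUnion_null fun l => measure_null_of_locally_null _ ?_
    rintro x ⟨hx, h1, h2⟩
    obtain ⟨V, hV, h⟩ := null_hess (sm_pl hs l) (hpl l x hx) h2
    refine ⟨_, Filter.inter_mem self_mem_nhdsWithin (mem_nhdsWithin_of_mem_nhds hV), measure_mono_null ?_ h⟩
    rintro y ⟨⟨_, hy, _⟩, hyV⟩
    exact ⟨hy, hyV⟩

theorem null_bad (hn : 2 ≤ n) (hs : ContDiff ℝ ∞ g) (hh : ∀ x ∈ ball (0 : E n) 1, lp (lp g) x = 0) (hnz : ∃ z ∈ ball (0 : E n) 1, g z ≠ 0) :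
    μH[(n:ℝ) - 1] {x ∈ ball (0 : E n) 1 | ∀ l : List (Fin n), l.length ≤ 3 → pl l g x = 0} = 0 := by
  by_cases h : ∃ z ∈ ball (0 : E n) 1, lp g z ≠ 0
  · refine measure_mono_null ?_ (null_sing hn (sm_lp hs) hh h)
    rintro x ⟨hx, hl⟩
    refine ⟨hx, ?_, fun i => ?_⟩
    · rw [lp_pl, Finset.sum_apply]; exact Finset.sum_eq_zero fun i _ => hl _ (by simp)
    · rw [lp_pl, dd_sum _ _ (fun i _ => sm_pl hs _), Finset.sum_apply]
      exact Finset.sum_eq_zero fun j _ => hl [i, j, j] (by simp)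
  · push Not at h
    refine measure_mono_null ?_ (null_sing hn hs h hnz)
    rintro x ⟨hx, hl⟩
    exact ⟨hx, hl [] (by simp), fun i => hl [i] (by simp)⟩
end BL
end

open MeasureTheory Metric Set
noncomputable section
namespace BL
set_option linter.unusedVariables false
set_option linter.unusedSimpArgs false
open scoped ContDiff

variable {n : ℕ} {v w : E n} {f g h u χ : E n → ℝ}

theorem rolle_card (k : ℕ) : ∀ (G : ℕ → ℝ → ℝ) (J : Set ℝ), J.OrdConnected → (∀ i t, HasDerivAt (G i) (G (i + 1) t) t) →
    (∀ t ∈ J, G k t ≠ 0) → ∀ T : Finset ℝ, (∀ t ∈ T, t ∈ J ∧ G 0 t = 0) → T.card ≤ k := by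
  induction k with
  | zero =>
    intro G J _ _ h T hT
    rw [Nat.le_zero, Finset.card_eq_zero, Finset.eq_empty_iff_forall_notMem]
    exact fun t ht => h t (hT t ht).1 (hT t ht).2
  | succ k ih =>
    intro G J hJ hd h T hT
    have hr : ∀ a ∈ T, ∀ b ∈ T, a < b → ∃ c, a < c ∧ c < b ∧ G 1 c = 0 := fun a ha b hb hab => by
      obtain ⟨c, hc, h0⟩ := exists_hasDerivAt_eq_zero hab (fun t _ => (hd 0 t).continuousAt.continuousWithinAt)
        (by rw [(hT a ha).2, (hT b hb).2]) (fun t _ => hd 0 t)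
      exact ⟨c, hc.1, hc.2, h0⟩
    choose! c hc1 hc2 hc3 using hr
    set t := ((T ×ˢ T).filter (fun p => p.1 < p.2)).image (fun p => c p.1 p.2) with ht
    have h1 : t.card ≤ k := ih (fun i => G (i + 1)) J hJ (fun i => hd (i + 1)) h t (fun z hz => by
      rw [ht, Finset.mem_image] at hz
      obtain ⟨p, hp, rfl⟩ := hz
      rw [Finset.mem_filter, Finset.mem_product] at hp
      obtain ⟨⟨p1, p2⟩, p3⟩ := hp
      exact ⟨hJ.out (hT _ p1).1 (hT _ p2).1 ⟨(hc1 _ p1 _ p2 p3).le, (hc2 _ p1 _ p2 p3).le⟩, hc3 _ p1 _ p2 p3⟩)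
    have h2 : T.card ≤ (t \ T).card + 1 := Finset.card_le_sdiff_of_interleaved fun a ha b hb hab _ =>
      ⟨c a b, Finset.mem_image.2 ⟨(a, b), by simp [ha, hb, hab], rfl⟩, hc1 a ha b hb hab, hc2 a ha b hb hab⟩
    have h3 : (t \ T).card ≤ t.card := Finset.card_le_card Finset.sdiff_subset
    omega

theorem sheet_mu {ι : Type*} [Fintype ι] {d : ℝ} (hd : d = Fintype.card ι) (Z : Set (E n)) (hZ : MeasurableSet Z) (π : E n → ι → ℝ)
    (hπ : Continuous π) (c : NNReal) (k : ℕ) (q : ι → ℝ) (hq : ∀ y ∈ Z, π y ∈ closedBall q 1)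
    (hloc : ∀ y ∈ Z, ∃ V ∈ nhds y, ∀ z ∈ Z ∩ V, ∀ z' ∈ Z ∩ V, dist z z' ≤ c * dist (π z) (π z'))
    (hfib : ∀ (p : ι → ℝ) (T : Finset (E n)), (∀ y ∈ T, y ∈ Z ∧ π y = p) → T.card ≤ k) :
    μH[d] Z ≤ (c : ENNReal) ^ d * (k * 2 ^ Fintype.card ι) := by
  have d0 : 0 ≤ d := by rw [hd]; positivity
  choose! V hV hVc using hloc
  obtain ⟨t, htZ, htc, hcov⟩ := TopologicalSpace.countable_cover_nhdsWithin (s := Z) (f := fun y => interior (V y))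
    (fun y hy => mem_nhdsWithin_of_mem_nhds (interior_mem_nhds.2 (hV y hy)))
  rcases t.eq_empty_or_nonempty with rfl | hne
  · have : Z = ∅ := by simpa using hcov
    simp [this]
  obtain ⟨a, rfl⟩ := htc.exists_eq_range hne
  set P : ℕ → Set (E n) := fun j => Z ∩ disjointed (fun j => interior (V (a j))) j with hP
  have hPm : ∀ j, MeasurableSet (P j) := fun j =>
    hZ.inter (MeasurableSet.disjointed (fun j => isOpen_interior.measurableSet) j)
  have hPV : ∀ j, P j ⊆ Z ∩ V (a j) := fun j y hy => ⟨hy.1, interior_subset (disjointed_subset _ j hy.2)⟩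
  have hPa : ∀ j, ∀ z ∈ P j, ∀ z' ∈ P j, dist z z' ≤ c * dist (π z) (π z') := fun j z hz z' hz' =>
    hVc (a j) (htZ (mem_range_self j)) z (hPV j hz) z' (hPV j hz')
  have hPi : ∀ j, MeasurableSet (π '' P j) := fun j =>
    (hPm j).image_of_continuousOn_injOn hπ.continuousOn (fun z hz z' hz' h => by
      have := hPa j z hz z' hz'
      rw [h, dist_self, mul_zero] at this
      exact dist_le_zero.1 this)
  have hZP : Z ⊆ ⋃ j, P j := by
    rw [hP, ← inter_iUnion, iUnion_disjointed]
    refine subset_inter subset_rfl fun y hy => ?_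
    simpa using hcov hy
  have hdis : ∀ i j, i ≠ j → ∀ y, y ∈ P i → y ∉ P j := fun i j hij y hi hj =>
    (disjoint_disjointed (fun j => interior (V (a j))) hij).le_bot ⟨hi.2, hj.2⟩
  have hsum : ∀ p, ∑' j, (π '' P j).indicator (fun _ => (1 : ENNReal)) p ≤ (closedBall q 1).indicator (fun _ => (k : ENNReal)) p := by
    intro p
    by_cases hp : p ∈ closedBall q 1
    · rw [indicator_of_mem hp]
      refine ENNReal.tsum_le_of_sum_range_le fun m => ?_
      classical
      have e : ∑ j ∈ Finset.range m, (π '' P j).indicator (fun _ => (1 : ENNReal)) p =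
          (((Finset.range m).filter (fun j => p ∈ π '' P j)).card : ENNReal) := by
        simp [Set.indicator_apply, Finset.sum_ite]
      rw [e]
      have : ∀ j, ∃ y, p ∈ π '' P j → y ∈ P j ∧ π y = p := fun j => by
        by_cases h : p ∈ π '' P j
        · obtain ⟨y, h1, h2⟩ := h; exact ⟨y, fun _ => ⟨h1, h2⟩⟩
        · exact ⟨0, fun h' => absurd h' h⟩
      choose Y hY using this
      have h1 := hfib p (((Finset.range m).filter (fun j => p ∈ π '' P j)).image Y) (fun y hy => by
        rw [Finset.mem_image] at hy
        obtain ⟨j, hj, rfl⟩ := hy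
        have := hY j (Finset.mem_filter.1 hj).2
        exact ⟨this.1.1, this.2⟩)
      rw [Finset.card_image_of_injOn] at h1
      · exact_mod_cast h1
      · intro i hi j hj hij
        by_contra hne
        have hi := hY i (Finset.mem_filter.1 hi).2
        have hj := hY j (Finset.mem_filter.1 hj).2
        exact hdis i j hne _ hi.1 (hij ▸ hj.1)
    · have : ∀ j, p ∉ π '' P j := by
        rintro j ⟨y, hy, rfl⟩
        exact hp (hq y hy.1)
      simp [this]
  calc μH[d] Z ≤ ∑' j, μH[d] (P j) := (measure_mono hZP).trans (measure_iUnion_le _)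
    _ ≤ ∑' j, (c : ENNReal) ^ d * volume (π '' P j) := by
        refine ENNReal.tsum_le_tsum fun j => ?_
        have := antilip_mu (P j) π c (hPa j) d0
        refine this.trans (le_of_eq ?_)
        rw [← hausdorffMeasure_pi_real, hd]
    _ = (c : ENNReal) ^ d * ∫⁻ p, ∑' j, (π '' P j).indicator (fun _ => (1 : ENNReal)) p := by
        rw [ENNReal.tsum_mul_left, lintegral_tsum (fun j => (measurable_const.indicator (hPi j)).aemeasurable)]
        congr 2; ext j
        rw [lintegral_indicator (hPi j)]; simp
    _ ≤ (c : ENNReal) ^ d * ∫⁻ p, (closedBall q 1).indicator (fun _ => (k : ENNReal)) p := by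
        gcongr with p; exact hsum p
    _ = _ := by
        rw [lintegral_indicator isClosed_closedBall.measurableSet]
        simp only [lintegral_const, MeasurableSet.univ, Measure.restrict_apply, univ_inter]
        rw [Real.volume_pi_closedBall _ (by norm_num)]
        simp [ENNReal.ofReal_pow]
end BL
end

open MeasureTheory Metric Set
noncomputable section
namespace BL
set_option linter.unusedVariables false
set_option linter.unusedSimpArgs false
open scoped ContDiff

variable {n : ℕ} {v w : E n} {f g h u χ : E n → ℝ}

open RealInnerProductSpace
/-- iterated directional derivatives, first entry applied first -/
def pv : List (E n) → (E n → ℝ) → E n → ℝ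
  | [], f => f
  | v :: l, f => pv l (dd v f)

theorem sm_pv (l : List (E n)) : ∀ {f : E n → ℝ}, ContDiff ℝ ∞ f → ContDiff ℝ ∞ (pv l f) := by
  induction l with
  | nil => intro f hf; exact hf
  | cons i l ih => intro f hf; exact ih (by fun_prop)

theorem dd_pv (l : List (E n)) : ∀ {f : E n → ℝ}, ContDiff ℝ ∞ f → dd v (pv l f) = pv l (dd v f) := by
  induction l with
  | nil => intro f hf; rfl
  | cons i l ih => intro f hf; simp only [pv]; rw [ih (by fun_prop), dd_comm hf]

theorem line_card (hf : ContDiff ℝ ∞ f) {b p x : E n} {ρ : ℝ} {k : ℕ} (hb : b ≠ 0)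
    (h : ∀ y ∈ ball x ρ, pv (List.replicate k b) f y ≠ 0) (T : Finset (E n)) 
    (hT : ∀ y ∈ T, y ∈ ball x ρ ∧ f y = 0 ∧ ∃ s : ℝ, y = p + s • b) : T.card ≤ k := by
  classical
  set J : Set ℝ := (fun s : ℝ => p + s • b) ⁻¹' ball x ρ with hJ
  have hJc : Convex ℝ J := by
    have := (convex_ball x ρ).affine_preimage (AffineMap.lineMap p (p + b) : ℝ →ᵃ[ℝ] E n)
    have e : J = (AffineMap.lineMap p (p + b) : ℝ →ᵃ[ℝ] E n) ⁻¹' ball x ρ := by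
      ext s; simp [hJ, AffineMap.lineMap_apply, add_comm]
    rw [e]; exact this
  have hd : ∀ i t, HasDerivAt (fun s : ℝ => pv (List.replicate i b) f (p + s • b)) (pv (List.replicate (i+1) b) f (p + t • b)) t := by
    intro i t
    have h1 : HasFDerivAt (pv (List.replicate i b) f) (fderiv ℝ (pv (List.replicate i b) f) (p + t • b)) (p + t • b) :=
      (sm_diff (sm_pv _ hf) _).hasFDerivAt
    have h2 : HasDerivAt (fun s : ℝ => p + s • b) b t := by
      simpa using ((hasDerivAt_id t).smul_const b).const_add p
    have h3 := h1.comp_hasDerivAt t h2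
    have e : pv (List.replicate (i+1) b) f = dd b (pv (List.replicate i b) f) := by
      rw [dd_pv _ hf]; rfl
    rw [e]; exact h3
  choose! s hs using fun y hy => (hT y hy).2.2
  have := rolle_card k (fun i s => pv (List.replicate i b) f (p + s • b)) J hJc.ordConnected hd (fun t ht => h _ ht)
    (T.image s) (fun t ht => by
      obtain ⟨y, hy, rfl⟩ := Finset.mem_image.1 ht
      refine ⟨?_, ?_⟩
      · show p + s y • b ∈ ball x ρ
        rw [← hs y hy]; exact (hT y hy).1
      · show f (p + s y • b) = 0
        rw [← hs y hy]; exact (hT y hy).2.1)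
  rwa [Finset.card_image_of_injOn] at this
  intro y hy z hz hyz
  rw [hs y hy, hs z hz, hyz]

theorem reg_alg {s a h W L β N ε : ℝ} (hβ : 0 < β) (hW : 0 < W) (hε : ε = W / (2 * β)) 
    (h1 : h ≤ s + N * a) (h2 : s * (W / β) ≤ ε * h + N * (a * (L * W))) : s ≤ (1 + 2 * L * β) * (N * a) := by
  subst hε
  have h3 : W / (2 * β) * h ≤ W / (2 * β) * (s + N * a) := by gcongr
  have h4 : s * (W / β) ≤ W / (2 * β) * (s + N * a) + N * (a * (L * W)) := by linarith
  have e : s * (W / β) - W / (2 * β) * (s + N * a) - N * (a * (L * W)) = (W / (2 * β)) * (s - (1 + 2 * L * β) * (N * a)) := by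
    field_simp; ring
  have h5 : (W / (2 * β)) * (s - (1 + 2 * L * β) * (N * a)) ≤ 0 := by linarith
  have h6 : 0 < W / (2 * β) := by positivity
  by_contra hc
  push Not at hc
  have := mul_pos h6 (sub_pos.2 hc)
  linarith

theorem sheet (hn : 1 ≤ n) (b : E n) (hb : b ≠ 0) (L : ℝ) (hL : 0 ≤ L) (k : ℕ) : ∃ D : ENNReal, D ≠ ⊤ ∧ ∀ (f : E n → ℝ), ContDiff ℝ ∞ f → 
    ∀ (x : E n) (ρ : ℝ), ρ ≤ 1 → (∀ y ∈ ball x ρ, pv (List.replicate k b) f y ≠ 0) →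
    μH[(n:ℝ) - 1] {y ∈ ball x ρ | f y = 0 ∧ dd b f y ≠ 0 ∧ ‖fderiv ℝ f y‖ ≤ L * |dd b f y|} ≤ D := by
  have hb0 : 0 < ‖b‖ := norm_pos_iff.2 hb
  obtain ⟨e, i0, he⟩ := exists_onb hn (‖b‖⁻¹ • b) (by rw [norm_smul, norm_inv, norm_norm, inv_mul_cancel₀ hb0.ne'])
  set π : E n → {i // i ≠ i0} → ℝ := fun y i => ⟪e i, y⟫ with hπ
  have hcard : (n:ℝ) - 1 = Fintype.card {i // i ≠ i0} := by
    rw [Fintype.card_subtype_compl]; simp [Nat.cast_sub hn]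
  have n0 : (0:ℝ) < n := by exact_mod_cast hn
  set c : NNReal := ⟨(2 + 2 * L * ‖b‖) * n, by positivity⟩ with hc
  refine ⟨(c : ENNReal) ^ ((n:ℝ) - 1) * (k * 2 ^ Fintype.card {i // i ≠ i0}), ?_, ?_⟩
  · refine ENNReal.mul_ne_top (ENNReal.rpow_ne_top_of_nonneg (by rw [hcard]; positivity) ENNReal.coe_ne_top) ?_
    exact ENNReal.mul_ne_top (by simp) (by simp)
  intro f hf x ρ hρ hk
  have hdec : ∀ v : E n, v = ∑ i, ⟪e i, v⟫ • e i := fun v => (e.sum_repr' v).symm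
  have hcoord : ∀ v (i : {i // i ≠ i0}), |⟪e i, v⟫| ≤ ‖π v‖ := fun v i => by
    have := norm_le_pi_norm (π v) i
    simpa [hπ] using this
  have hsplit : ∀ G : Fin n → ℝ, ∑ i, G i = G i0 + ∑ i : {i // i ≠ i0}, G i := fun G =>
    Fintype.sum_eq_add_sum_subtype_ne _ _
  have hcard2 : (Fintype.card {i // i ≠ i0} : ℝ) ≤ n := by rw [← hcard]; linarith
  refine sheet_mu hcard _ ?_ π (by rw [hπ]; fun_prop) c k (π x) ?_ ?_ ?_
  · have c1 : Continuous f := hf.continuous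
    have c2 : Continuous (dd b f) := (sm_dd hf).continuous
    have c3 : Continuous (fun y => fderiv ℝ f y) := hf.continuous_fderiv (by simp)
    refine isOpen_ball.measurableSet.inter ((isClosed_eq c1 continuous_const).measurableSet.inter 
      ((isOpen_ne_fun c2 continuous_const).measurableSet.inter (isClosed_le c3.norm (by fun_prop)).measurableSet))
  · rintro y ⟨hy, -⟩
    rw [mem_closedBall, dist_pi_le_iff (by norm_num)]
    intro i
    rw [Real.dist_eq, hπ]
    simp only [← inner_sub_right]
    have := abs_real_inner_le_norm (e i) (y - x)
    rw [e.norm_eq_one, one_mul] at this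
    rw [mem_ball, dist_eq_norm] at hy
    linarith
  · rintro y ⟨hy, h0, h1, h2⟩
    have hd : HasStrictFDerivAt f (fderiv ℝ f y) y := hf.contDiffAt.hasStrictFDerivAt (by simp)
    set A := fderiv ℝ f y with hA
    have W0 : 0 < |dd b f y| := abs_pos.2 h1
    set W := |dd b f y| with hW
    have hsm := hd.isLittleO.def (c := W / (2 * ‖b‖)) (by positivity)
    rw [nhds_prod_eq, Filter.eventually_prod_self_iff'] at hsm
    obtain ⟨V, hV, hsm⟩ := hsm
    refine ⟨V, hV, fun z hz z' hz' => ?_⟩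
    have h3 := hsm z hz.2 z' hz'.2
    rw [hz.1.2.1, hz'.1.2.1, sub_zero, zero_sub, norm_neg, Real.norm_eq_abs] at h3
    set v := z - z' with hv
    have hπv : dist (π z) (π z') = ‖π v‖ := by
      rw [dist_eq_norm]; congr 1; ext i; simp [hπ, hv, inner_sub_right]
    rw [hπv, dist_eq_norm, ← hv]
    set s := ⟪e i0, v⟫ with hs
    have b1 : ‖v‖ ≤ |s| + n * ‖π v‖ := by
      calc ‖v‖ = ‖∑ i, ⟪e i, v⟫ • e i‖ := by rw [← hdec]
        _ ≤ ∑ i, |⟪e i, v⟫| := (norm_sum_le _ _).trans (le_of_eq (Finset.sum_congr rfl fun i _ => by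
            rw [norm_smul, e.norm_eq_one, mul_one, Real.norm_eq_abs]))
        _ = |s| + ∑ i : {i // i ≠ i0}, |⟪e i, v⟫| := hsplit _
        _ ≤ |s| + ∑ i : {i // i ≠ i0}, ‖π v‖ := by gcongr with i; exact hcoord v i
        _ = |s| + Fintype.card {i // i ≠ i0} * ‖π v‖ := by simp only [Finset.sum_const, nsmul_eq_mul, Finset.card_univ]
        _ ≤ _ := by gcongr
    have b2 : |s| * (W / ‖b‖) ≤ W / (2 * ‖b‖) * ‖v‖ + n * (‖π v‖ * (L * W)) := by
      have e1 : A v = s * A (e i0) + ∑ i : {i // i ≠ i0}, ⟪e i, v⟫ * A (e i) := by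
        conv_lhs => rw [hdec v]
        rw [map_sum, ← hsplit (fun i => ⟪e i, v⟫ * A (e i))]
        simp
      have e2 : |A (e i0)| = W / ‖b‖ := by
        rw [he, map_smul, smul_eq_mul, abs_mul, abs_of_pos (inv_pos.2 hb0), hW, dd, div_eq_inv_mul]
      have e3 : |∑ i : {i // i ≠ i0}, ⟪e i, v⟫ * A (e i)| ≤ n * (‖π v‖ * (L * W)) := by
        calc |∑ i : {i // i ≠ i0}, ⟪e i, v⟫ * A (e i)| ≤ ∑ i : {i // i ≠ i0}, ‖π v‖ * (L * W) := by
              refine (Finset.abs_sum_le_sum_abs _ _).trans (Finset.sum_le_sum fun i _ => ?_)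
              rw [abs_mul]
              have g1 := hcoord v i
              have g2 : |A (e i)| ≤ L * W := by
                have := A.le_opNorm (e i)
                rw [e.norm_eq_one, mul_one, Real.norm_eq_abs] at this
                exact this.trans h2
              gcongr
          _ = Fintype.card {i // i ≠ i0} * (‖π v‖ * (L * W)) := by simp only [Finset.sum_const, nsmul_eq_mul, Finset.card_univ]
          _ ≤ _ := by gcongr
      rw [← e2, ← abs_mul]
      have e4 : s * A (e i0) = A v - ∑ i : {i // i ≠ i0}, ⟪e i, v⟫ * A (e i) := by linarith
      rw [e4]
      exact (abs_sub _ _).trans (by linarith)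
    have b3 := reg_alg hb0 W0 rfl b1 b2
    have : (c : ℝ) = (2 + 2 * L * ‖b‖) * n := rfl
    rw [this]
    nlinarith
  · intro p T hT
    rcases T.eq_empty_or_nonempty with rfl | ⟨y0, hy0⟩
    · simp
    refine line_card hf hb (p := y0) hk T fun y hy => ⟨(hT y hy).1.1, (hT y hy).1.2.1, ⟪e i0, y - y0⟫ * ‖b‖⁻¹, ?_⟩
    have e1 := hdec (y - y0)
    rw [Fintype.sum_eq_add_sum_subtype_ne _ i0] at e1 
    have e2 : ∀ i : {i // i ≠ i0}, ⟪e i, y - y0⟫ = 0 := fun i => by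
      have := congrFun ((hT y hy).2.trans (hT y0 hy0).2.symm) i
      rw [inner_sub_right, sub_eq_zero]; exact this
    simp only [e2, zero_smul, Finset.sum_const_zero, add_zero] at e1
    rw [mul_smul, ← he, ← e1]; abel
end BL
end

open MeasureTheory Metric Set
noncomputable section
namespace BL
set_option linter.unusedVariables false
set_option linter.unusedSimpArgs false
open scoped ContDiff

variable {n : ℕ} {v w : E n} {f g h u χ : E n → ℝ}

theorem REG (hn : 1 ≤ n) (β : Option (Fin n) → E n) (hβ : ∀ j, β j ≠ 0) (L : ℝ) (hL0 : 0 ≤ L)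
    (hL : ∀ T : E n →L[ℝ] ℝ, ∃ j, ‖T‖ ≤ L * |T (β j)|) (k : ℕ) : ∃ D : ENNReal, D ≠ ⊤ ∧ ∀ (f : E n → ℝ), ContDiff ℝ ∞ f →
    ∀ (x : E n) (ρ : ℝ), ρ ≤ 1 → (∀ l : List (Option (Fin n)), l.length = k → ∀ y ∈ ball x ρ, pv (l.map β) f y ≠ 0) →
    μH[(n:ℝ) - 1] {y ∈ ball x ρ | f y = 0} ≤ D := by
  induction k with
  | zero =>
    refine ⟨0, by simp, fun f hf x ρ hρ h => ?_⟩
    have : {y ∈ ball x ρ | f y = 0} = ∅ := by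
      ext y; simp only [mem_ofPred_eq, mem_empty_iff_false, iff_false, not_and]
      exact fun hy => h [] rfl y hy
    rw [this]; simp
  | succ k ih =>
    obtain ⟨D, hD, ih⟩ := ih
    choose D' hD' hs using fun j => sheet hn (β j) (hβ j) L hL0 (k + 1)
    refine ⟨D + ∑ j, D' j, ENNReal.add_ne_top.2 ⟨hD, ENNReal.sum_ne_top.2 fun j _ => hD' j⟩, fun f hf x ρ hρ h => ?_⟩
    have hsub : {y ∈ ball x ρ | f y = 0} ⊆ {y ∈ ball x ρ | dd (β none) f y = 0} ∪ ⋃ j ∈ (Finset.univ : Finset (Option (Fin n))),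
        {y ∈ ball x ρ | f y = 0 ∧ dd (β j) f y ≠ 0 ∧ ‖fderiv ℝ f y‖ ≤ L * |dd (β j) f y|} := by
      rintro y ⟨hy, h0⟩
      by_cases h1 : dd (β none) f y = 0
      · exact Or.inl ⟨hy, h1⟩
      · right
        obtain ⟨j, hj⟩ := hL (fderiv ℝ f y)
        refine mem_iUnion₂.2 ⟨j, Finset.mem_univ _, hy, h0, fun h2 => h1 ?_, hj⟩
        have h3 : fderiv ℝ f y (β j) = 0 := h2
        rw [h3, abs_zero, mul_zero] at hj
        have : fderiv ℝ f y = 0 := norm_le_zero_iff.1 hj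
        rw [dd, this]; rfl
    refine (measure_mono hsub).trans ((measure_union_le _ _).trans (add_le_add ?_ ?_))
    · exact ih _ (by fun_prop) x ρ hρ fun l hl y hy => h (none :: l) (by simp [hl]) y hy
    · refine (measure_biUnion_finset_le _ _).trans (Finset.sum_le_sum fun j _ => hs j f hf x ρ hρ fun y hy => ?_)
      have := h (List.replicate (k + 1) j) (by simp) y hy
      rwa [List.map_replicate] at this

theorem pol2 (hg : ContDiff ℝ ∞ g) {x : E n} (h : ∀ v, dd v (dd v g) x = 0) (a b : E n) : dd a (dd b g) x = 0 := by
  have h1 := h (a + b)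
  rw [dd_vec_add hg, dd_add (by fun_prop) (by fun_prop), dd_vec_add (by fun_prop), dd_vec_add (by fun_prop), dd_comm (v := b) (w := a) hg] at h1
  simp only [Pi.add_apply, h a, h b] at h1
  linarith

theorem pol3 (hg : ContDiff ℝ ∞ g) {x : E n} (h : ∀ v, dd v (dd v (dd v g)) x = 0) (a v : E n) : dd v (dd v (dd a g)) x = 0 := by
  have key : ∀ v, dd a (dd a (dd v g)) x + dd v (dd v (dd a g)) x = 0 := fun v => by
    have h1 := h (a + v)
    have s1 : ContDiff ℝ ∞ (dd a g) := by fun_prop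
    have s2 : ContDiff ℝ ∞ (dd v g) := by fun_prop
    have e1 : dd (a + v) (dd (a + v) g) = dd a (dd a g) + dd a (dd v g) + (dd a (dd v g) + dd v (dd v g)) := by
      rw [dd_vec_add hg, dd_add s1 s2, dd_vec_add s1, dd_vec_add s2, dd_comm (v := v) (w := a) hg]
    have e2 : dd (a + v) (dd (a + v) (dd (a + v) g)) = dd (a + v) (dd (a + v) (dd a g)) + dd (a + v) (dd (a + v) (dd v g)) := by
      rw [dd_vec_add hg, dd_add s1 s2, dd_add (by fun_prop) (by fun_prop)]
    have q : ∀ k, ContDiff ℝ ∞ k → dd (a + v) (dd (a + v) k) = dd a (dd a k) + dd a (dd v k) + (dd a (dd v k) + dd v (dd v k)) := fun k hk => by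
      rw [dd_vec_add hk, dd_add (by fun_prop) (by fun_prop), dd_vec_add (by fun_prop), dd_vec_add (by fun_prop), dd_comm (v := v) (w := a) hk]
    rw [e2, q _ s1, q _ s2] at h1
    have f1 : dd a (dd v (dd a g)) = dd a (dd a (dd v g)) := by rw [dd_comm (v := v) (w := a) hg]
    have f2 : dd a (dd v (dd v g)) = dd v (dd v (dd a g)) := by
      rw [dd_comm (v := a) (w := v) s2, dd_comm (v := a) (w := v) hg]
    simp only [Pi.add_apply, f1, f2, h a, h v] at h1
    linarith
  have h2 := key v
  have h3 := key ((-1 : ℝ) • v)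
  rw [dd_vec_smul, dd_vec_smul, dd_vec_smul, dd_smul _ (by fun_prop), dd_smul _ (by fun_prop), dd_smul _ (by fun_prop)] at h3
  simp only [Pi.smul_apply, smul_eq_mul] at h3
  linarith

theorem polar (hn : 1 ≤ n) (hg : ContDiff ℝ ∞ g) {x : E n} {l : List (Fin n)} (hl : l.length ≤ 3) (h : pl l g x ≠ 0) :
    ∃ v : E n, v ≠ 0 ∧ pv (List.replicate l.length v) g x ≠ 0 := by
  have hne : ∀ (k : ℕ) (v : E n), pv (List.replicate (k + 1) v) g x ≠ 0 → v ≠ 0 := by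
    rintro k v hv rfl
    apply hv
    have : dd (0 : E n) g = 0 := by ext y; simp [dd]
    simp only [List.replicate_succ, pv, this]
    have : ∀ l : List (E n), pv l (0 : E n → ℝ) = 0 := fun l => by
      induction l with
      | nil => rfl
      | cons i l ih => simp only [pv, dd_zero, ih]
    rw [this]; rfl
  match l, hl, h with
  | [], _, h => exact ⟨ee ⟨0, hn⟩, by simp, h⟩
  | [i], _, h => exact ⟨ee i, by simp, h⟩
  | [i, j], _, h =>
    by_contra! hc
    exact h (pol2 hg (fun v => by
      by_contra h'; exact h' (hc v (hne 1 v h'))) _ _)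
  | [i, j, k], _, h =>
    by_contra! hc
    have h3 := pol3 hg (x := x) (fun v => by
      by_contra h'; exact h' (hc v (hne 2 v h')))
    exact h (pol2 (g := dd (ee k) g) (by fun_prop) (h3 (ee k)) _ _)

theorem pv_sub (l : List (E n)) : ∀ {f g : E n → ℝ}, ContDiff ℝ ∞ f → ContDiff ℝ ∞ g → pv l (f - g) = pv l f - pv l g := by
  induction l with
  | nil => intro f g _ _; rfl
  | cons i l ih => intro f g hf hg; simp only [pv]; rw [dd_sub hf hg, ih (by fun_prop) (by fun_prop)]

theorem pv_lin (l : List (E n)) (t : ℝ) : ∀ {f g : E n → ℝ}, ContDiff ℝ ∞ f → ContDiff ℝ ∞ g → pv l (f + t • g) = pv l f + t • pv l g := by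
  induction l with
  | nil => intro f g _ _; rfl
  | cons i l ih => intro f g hf hg; simp only [pv]; rw [dd_add hf (by fun_prop), dd_smul _ hg, ih (by fun_prop) (by fun_prop)]

theorem pv_le (l : List (E n)) (c : ℝ) (hc : ∀ v ∈ l, ∑ i, |v i| ≤ c) (y : E n) : ∀ (f : E n → ℝ) (A : ℝ), ContDiff ℝ ∞ f →
    (∀ q : List (Fin n), q.length = l.length → |pl q f y| ≤ A) → 0 ≤ A → |pv l f y| ≤ c ^ l.length * A := by
  induction l with
  | nil => intro f A hf h A0; simpa [pv, pl] using h [] rfl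
  | cons v l ih =>
    intro f A hf h A0
    have c0 : 0 ≤ c := (Finset.sum_nonneg fun i _ => abs_nonneg _).trans (hc v (by simp))
    have := ih (fun w hw => hc w (List.mem_cons_of_mem _ hw)) (dd v f) (c * A) (by fun_prop) (fun q hq => by
      rw [← dd_pl hf, dd, fderiv_eq_sum]
      calc |∑ i, v i * dd (ee i) (pl q f) y| ≤ ∑ i, |v i| * A := by
            refine (Finset.abs_sum_le_sum_abs _ _).trans (Finset.sum_le_sum fun i _ => ?_)
            rw [abs_mul]
            have := h (i :: q) (by simp [hq])
            simp only [pl] at this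
            gcongr
        _ ≤ c * A := by
            rw [← Finset.sum_mul]
            exact mul_le_mul_of_nonneg_right (hc v (by simp)) A0) (by positivity)
    simp only [pv, List.length_cons, pow_succ]
    linarith

/-- perturbed directions -/
def bt (v : E n) (t : ℝ) : Option (Fin n) → E n
  | none => v
  | some i => v + t • ee i

theorem bt_cont (v y : E n) (l : List (Option (Fin n))) : ∀ {f : E n → ℝ}, ContDiff ℝ ∞ f → Continuous (fun t => pv (l.map (bt v t)) f y) := by
  induction l with
  | nil => intro f hf; exact continuous_const
  | cons j l ih =>
    intro f hf
    cases j with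
    | none => exact ih (f := dd v f) (by fun_prop)
    | some i =>
      have : (fun t => pv ((some i :: l).map (bt v t)) f y) = fun t => pv (l.map (bt v t)) (dd v f) y + t * pv (l.map (bt v t)) (dd (ee i) f) y := by
        ext t
        simp only [List.map_cons, pv, bt]
        rw [dd_vec_add hf, dd_vec_smul, pv_lin _ _ (by fun_prop) (by fun_prop)]; rfl
      rw [this]
      exact (ih (f := dd v f) (by fun_prop)).add (continuous_id.mul (ih (f := dd (ee i) f) (by fun_prop)))

theorem bt_span (hn : 1 ≤ n) (v : E n) {t : ℝ} (ht : 0 < t) (T : E n →L[ℝ] ℝ) : ∃ j, ‖T‖ ≤ (2 * n / t) * |T (bt v t j)| := by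
  obtain ⟨j, hj⟩ := Finite.exists_max (fun j => |T (bt v t j)|)
  refine ⟨j, ?_⟩
  set m := |T (bt v t j)| with hm
  have h1 : ∀ i, |T (ee i)| ≤ 2 * m / t := fun i => by
    have e : t * T (ee i) = T (bt v t (some i)) - T (bt v t none) := by simp [bt]
    rw [le_div_iff₀ ht]
    calc |T (ee i)| * t = |t * T (ee i)| := by rw [abs_mul, abs_of_pos ht, mul_comm]
      _ ≤ |T (bt v t (some i))| + |T (bt v t none)| := by rw [e]; exact abs_sub _ _
      _ ≤ m + m := add_le_add (hj _) (hj _)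
      _ = 2 * m := by ring
  refine T.opNorm_le_bound (by positivity) fun z => ?_
  have e : T z = ∑ i, z i * T (ee i) := by
    have h2 : (z : E n) = ∑ i, z i • ee i := by
      ext k; simp [Finset.sum_apply, Pi.single_apply]
    conv_lhs => rw [h2]
    rw [map_sum]; simp
  rw [e, Real.norm_eq_abs]
  calc |∑ i, z i * T (ee i)| ≤ ∑ i : Fin n, ‖z‖ * (2 * m / t) := by
        refine (Finset.abs_sum_le_sum_abs _ _).trans (Finset.sum_le_sum fun i _ => ?_)
        rw [abs_mul]
        have := PiLp.norm_apply_le z i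
        rw [Real.norm_eq_abs] at this
        have := h1 i
        gcongr
    _ = _ := by simp only [Finset.sum_const, Finset.card_univ, Fintype.card_fin, nsmul_eq_mul]; ring

theorem regpt (hn : 1 ≤ n) (hg : ContDiff ℝ ∞ g) {x : E n} {l : List (Fin n)} (hl : l.length ≤ 3) (h : pl l g x ≠ 0) :
    ∃ ρ : ℝ, 0 < ρ ∧ ρ ≤ 1 ∧ ∃ η : ℝ, 0 < η ∧ ∃ D : ENNReal, D ≠ ⊤ ∧ ∀ f : E n → ℝ, ContDiff ℝ ∞ f → 
    (∀ y ∈ ball x ρ, ∀ q : List (Fin n), q.length ≤ 3 → |pl q f y - pl q g y| ≤ η) → μH[(n:ℝ) - 1] {y ∈ ball x ρ | f y = 0} ≤ D := by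
  obtain ⟨v, v0, hv⟩ := polar hn hg hl h
  set k := l.length with hk
  have fin : {L : List (Option (Fin n)) | L.length = k}.Finite := List.finite_length_eq _ _
  have e1 : ∀ᶠ t in nhdsWithin (0:ℝ) (Ioi 0), ∀ L ∈ {L : List (Option (Fin n)) | L.length = k}, pv (L.map (bt v t)) g x ≠ 0 := by
    refine (Filter.eventually_all_finite fin).2 fun L hL => ?_
    refine nhdsWithin_le_nhds (((bt_cont v x L hg).tendsto 0).eventually_ne ?_)
    have : L.map (bt v 0) = List.replicate k v := by
      rw [← (show L.length = k from hL), ← List.map_const']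
      refine List.map_congr_left fun j _ => ?_
      cases j <;> simp [bt]
    rwa [this]
  have e2 : ∀ᶠ t in nhdsWithin (0:ℝ) (Ioi 0), ∀ i : Fin n, v + t • ee i ≠ 0 := by
    refine Filter.eventually_all.2 fun i => nhdsWithin_le_nhds ?_
    have : Continuous (fun t : ℝ => v + t • ee i) := by fun_prop
    exact (this.tendsto 0).eventually_ne (by simpa using v0)
  obtain ⟨t, ⟨ht1, ht2⟩, ht0⟩ := ((e1.and e2).and self_mem_nhdsWithin).exists
  have ht0 : 0 < t := ht0
  have hβ : ∀ j, bt v t j ≠ 0 := by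
    intro j
    cases j with
    | none => exact v0
    | some i => exact ht2 i
  obtain ⟨D, hD, hreg⟩ := REG hn (bt v t) hβ (2 * n / t) (by positivity) (bt_span hn v ht0) k
  have e3 : ∀ᶠ μ in nhdsWithin (0:ℝ) (Ioi 0), ∀ L ∈ {L : List (Option (Fin n)) | L.length = k}, μ < |pv (L.map (bt v t)) g x| := by
    refine (Filter.eventually_all_finite fin).2 fun L hL => nhdsWithin_le_nhds ?_
    exact eventually_lt_nhds (abs_pos.2 (ht1 L hL))
  obtain ⟨μ, hμ, μ0⟩ := (e3.and self_mem_nhdsWithin).exists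
  have μ0 : 0 < μ := μ0
  have e4 : ∀ᶠ y in nhds x, ∀ L ∈ {L : List (Option (Fin n)) | L.length = k}, μ < |pv (L.map (bt v t)) g y| := by
    refine (Filter.eventually_all_finite fin).2 fun L hL => ?_
    exact ((sm_pv (L.map (bt v t)) hg).continuous.abs.tendsto x).eventually (eventually_gt_nhds (hμ L hL))
  obtain ⟨ρ', hρ', hρ⟩ := Metric.eventually_nhds_iff_ball.1 e4
  obtain ⟨c, hc⟩ : ∃ c : ℝ, ∀ j, ∑ i, |bt v t j i| ≤ c := by
    obtain ⟨j, hj⟩ := Finite.exists_max (fun j => ∑ i, |bt v t j i|)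
    exact ⟨_, hj⟩
  have c0 : 0 ≤ c := (Finset.sum_nonneg fun i _ => abs_nonneg _).trans (hc none)
  refine ⟨min ρ' 1, by positivity, min_le_right _ _, μ / (c ^ k + 1), by positivity, D, hD, fun f hf hclose => ?_⟩
  refine hreg f hf x _ (min_le_right _ _) fun L hL y hy h0 => ?_
  have h1 := hρ y (ball_subset_ball (min_le_left _ _) hy) L hL
  have h2 := pv_le (L.map (bt v t)) c (fun w hw => by
    obtain ⟨j, _, rfl⟩ := List.mem_map.1 hw; exact hc j) y (f - g) (μ / (c ^ k + 1)) (by fun_prop) (fun q hq => by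
      rw [pl_sub hf hg]
      exact hclose y hy q (by rw [hq, List.length_map, hL]; exact hl)) (by positivity)
  rw [pv_sub _ hf hg, Pi.sub_apply, h0, zero_sub, abs_neg, List.length_map, hL] at h2
  have h3 : c ^ k * (μ / (c ^ k + 1)) ≤ μ := by
    rw [← mul_div_assoc, div_le_iff₀ (by positivity)]
    nlinarith [pow_nonneg c0 k]
  linarith
end BL
end

open MeasureTheory Metric Set
noncomputable section
namespace BL
set_option linter.unusedVariables false
set_option linter.unusedSimpArgs false
open scoped ContDiff

variable {n : ℕ} {v w : E n} {f g h u χ : E n → ℝ}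


theorem moll_negdd {φ : E n → ℝ} (h : Moll φ) (v : E n) : Moll (fun z => - dd v φ z) := by
  have h1 := h.dd (v := v)
  refine ⟨h1.1.neg, ?_⟩
  have : tsupport (fun z => - dd v φ z) = tsupport (dd v φ) := tsupport_neg (dd v φ)
  rw [this]; exact h1.2

theorem Av1_cv {φ : E n → ℝ} (x : E n) :
    Av 1 φ g x = (convolution g (fun z => φ (-z)) (ContinuousLinearMap.mul ℝ ℝ) volume) x := by
  rw [convolution_def]
  have := integral_add_right_eq_self (μ := (volume : Measure (E n))) (fun t => g t * φ (t - x)) x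
  simp only [Av, one_smul, ContinuousLinearMap.mul_apply', neg_sub]
  rw [← this]
  congr 1; ext t; rw [add_comm x t, add_sub_cancel_right]

theorem Moll.ref {φ : E n → ℝ} (h : Moll φ) :
    ContDiff ℝ ∞ (fun z => φ (-z)) ∧ HasCompactSupport (fun z => φ (-z)) := by
  refine ⟨h.1.comp contDiff_neg, ?_⟩
  exact h.hcs.comp_homeomorph (Homeomorph.neg (E n))

theorem Av1_sm {φ : E n → ℝ} (h : Moll φ) (hg : Continuous g) : ContDiff ℝ ∞ (Av 1 φ g) := by
  have : Av 1 φ g = convolution g (fun z => φ (-z)) (ContinuousLinearMap.mul ℝ ℝ) volume := by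
    ext x; exact Av1_cv x
  rw [this]
  exact h.ref.2.contDiff_convolution_right _ hg.locallyIntegrable h.ref.1

theorem Av1_dd {φ : E n → ℝ} (h : Moll φ) (hg : Continuous g) (v : E n) :
    dd v (Av 1 φ g) = Av 1 (fun z => - dd v φ z) g := by
  have e : Av 1 φ g = convolution g (fun z => φ (-z)) (ContinuousLinearMap.mul ℝ ℝ) volume := by
    ext x; exact Av1_cv x
  ext x
  have h1 := h.ref.2.hasFDerivAt_convolution_right (ContinuousLinearMap.mul ℝ ℝ)
    (hg.locallyIntegrable (μ := volume)) (h.ref.1.of_le (by simp)) x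
  have c1 : Continuous (fderiv ℝ (fun z => φ (-z))) := h.ref.1.continuous_fderiv (by simp)
  simp only [dd]
  rw [e, h1.fderiv, convolution_precompR_apply _ hg.locallyIntegrable (h.ref.2.fderiv ℝ) c1,
    Av1_cv]
  congr 1
  ext z
  have : HasFDerivAt (fun z => φ (-z)) ((fderiv ℝ φ (-z)).comp (-(ContinuousLinearMap.id ℝ (E n)))) z := by
    refine HasFDerivAt.comp z (h.1.differentiable (by simp) _).hasFDerivAt ?_
    exact (hasFDerivAt_id z).neg
  rw [this.fderiv]; simp

theorem Av1_dd_sm {φ : E n → ℝ} (h : Moll φ) (hf : ContDiff ℝ ∞ f) (v : E n) :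
    dd v (Av 1 φ f) = Av 1 φ (dd v f) := by
  rw [Av1_dd h hf.continuous]
  ext x
  simp only [Av, one_smul]
  have h1 := ibp (v := v) (f := fun z => f (z + x)) (g := φ) (by fun_prop) h.1 h.hcs
  simp only [dd_comp_add] at h1
  simp only [mul_neg, integral_neg, add_comm x]
  rw [h1]

theorem Av1_pl {φ : E n → ℝ} (h : Moll φ) (l : List (Fin n)) : ∃ φ', Moll φ' ∧
    (∀ g : E n → ℝ, Continuous g → pl l (Av 1 φ g) = Av 1 φ' g) := by
  induction l with
  | nil => exact ⟨φ, h, fun g _ => rfl⟩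
  | cons i l ih =>
    obtain ⟨φ', h', e⟩ := ih
    refine ⟨_, moll_negdd h' (ee i), fun g hg => ?_⟩
    show dd (ee i) (pl l (Av 1 φ g)) = _
    rw [e g hg, Av1_dd h' hg]

theorem Av1_pl_sm {φ : E n → ℝ} (h : Moll φ) (hf : ContDiff ℝ ∞ f) (l : List (Fin n)) :
    pl l (Av 1 φ f) = Av 1 φ (pl l f) := by
  induction l with
  | nil => rfl
  | cons i l ih =>
    show dd (ee i) (pl l (Av 1 φ f)) = Av 1 φ (dd (ee i) (pl l f))
    rw [ih, Av1_dd_sm h (sm_pl hf l)]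

theorem Av_sub {φ : E n → ℝ} (h : Moll φ) (hf : Continuous f) (hg : Continuous g) (x : E n) :
    Av 1 φ f x - Av 1 φ g x = Av 1 φ (fun y => f y - g y) x := by
  simp only [Av]
  rw [← integral_sub (Av_int h hf 1 x) (Av_int h hg 1 x)]
  congr 1; ext z; ring

theorem AA (F : ℕ → E n → ℝ) (hF : ∀ j, Continuous (F j)) (L : ℝ) (hL : 0 ≤ L)
    (hb : ∀ j, ∀ y ∈ closedBall (0 : E n) 3, |F j y| ≤ 1)
    (hl : ∀ j, ∀ y ∈ closedBall (0 : E n) 3, ∀ z ∈ closedBall (0 : E n) 3,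
      |F j y - F j z| ≤ L * ‖y - z‖) :
    ∃ k : ℕ → ℕ, StrictMono k ∧ ∃ g : E n → ℝ, Continuous g ∧ ∀ ε > 0, ∀ᶠ j in Filter.atTop,
      ∀ y ∈ closedBall (0 : E n) 3, |F (k j) y - g y| ≤ ε := by
  have : CompactSpace (closedBall (0 : E n) 3) := isCompact_iff_compactSpace.1 (isCompact_closedBall _ _)
  let G : ℕ → BoundedContinuousFunction (closedBall (0 : E n) 3) ℝ := fun j =>
    BoundedContinuousFunction.mkOfCompact ⟨fun y => F j y, by fun_prop⟩
  have hc : IsCompact (closure (range G)) := by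
    refine BoundedContinuousFunction.arzela_ascoli (Icc (-1) 1) isCompact_Icc _ ?_ ?_
    · rintro _ x ⟨j, rfl⟩
      exact abs_le.1 (hb j x x.2)
    · refine Metric.equicontinuous_of_continuity_modulus (fun t => L * t) ?_ _ ?_
      · have : Continuous (fun t : ℝ => L * t) := by fun_prop
        simpa using this.tendsto 0
      · rintro x y ⟨_, j, rfl⟩
        have := hl j x x.2 y y.2
        rw [← Real.norm_eq_abs, ← dist_eq_norm, ← dist_eq_norm] at this
        exact this
  obtain ⟨g0, -, k, hk, ht⟩ := hc.tendsto_subseq (x := G) (fun j => subset_closure (mem_range_self j))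
  obtain ⟨g, hg⟩ := ContinuousMap.exists_restrict_eq (isClosed_closedBall (x := (0 : E n)) (ε := 3))
    g0.toContinuousMap
  refine ⟨k, hk, g, g.continuous, fun ε hε => ?_⟩
  filter_upwards [(Metric.tendsto_nhds.1 ht) ε hε] with j hj y hy
  have h1 := (BoundedContinuousFunction.dist_coe_le_dist (f := G (k j)) (g := g0) ⟨y, hy⟩)
  have h2 : g y = g0 ⟨y, hy⟩ := by
    have := congrArg (fun q => q ⟨y, hy⟩) hg
    simpa using this
  rw [h2]
  exact (h1.trans hj.le)

theorem lp_Av {φ : E n → ℝ} (h : Moll φ) : ∃ φ', Moll φ' ∧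
    (∀ g : E n → ℝ, Continuous g → lp (Av 1 φ g) = Av 1 φ' g) := by
  refine ⟨lp φ, ⟨by have := h.1; fun_prop, ?_⟩, fun g hg => ?_⟩
  · refine closure_minimal ?_ isClosed_closedBall
    intro x hx
    by_contra hc
    apply hx
    have : ∀ i : Fin n, dd (ee i) (dd (ee i) φ) x = 0 := by
      intro i
      exact image_eq_zero_of_notMem_tsupport (fun h' => hc ((h.dd (v := ee i)).dd.2 h'))
    simp [lp, this]
  · have e : ∀ i : Fin n, dd (ee i) (dd (ee i) (Av 1 φ g)) = Av 1 (dd (ee i) (dd (ee i) φ)) g := by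
      intro i
      rw [Av1_dd h hg, Av1_dd (moll_negdd h _) hg]
      congr 1; ext z
      have : dd (ee i) (fun z => -dd (ee i) φ z) z = - dd (ee i) (dd (ee i) φ) z := by
        simp only [dd]; rw [fderiv_fun_neg]; rfl
      rw [this, neg_neg]
    ext x
    simp only [lp, Finset.sum_apply, e]
    simp only [Av, Finset.sum_apply, Finset.mul_sum]
    rw [integral_finsetSum]
    intro i _
    exact Av_int (h.dd.dd) hg 1 x

theorem lp_Av_sm {φ : E n → ℝ} (h : Moll φ) (hf : ContDiff ℝ ∞ f) :
    lp (Av 1 φ f) = Av 1 φ (lp f) := by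
  ext x
  simp only [lp, Finset.sum_apply]
  have e : ∀ i : Fin n, dd (ee i) (dd (ee i) (Av 1 φ f)) = Av 1 φ (dd (ee i) (dd (ee i) f)) := by
    intro i
    rw [Av1_dd_sm h hf, Av1_dd_sm h (f := dd (ee i) f) (by fun_prop)]
  simp only [e]
  simp only [Av, Finset.sum_apply, Finset.sum_mul]
  rw [integral_finsetSum]
  intro i _
  exact Av_int h (show ContDiff ℝ ∞ (dd (ee i) (dd (ee i) f)) by fun_prop).continuous 1 x

theorem COMP (hn : 1 ≤ n) (F : ℕ → E n → ℝ) (hF : ∀ j, ContDiff ℝ ∞ (F j))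
    (sg : ℕ → ℝ) (hs : Filter.Tendsto sg Filter.atTop (nhds 0)) (hs1 : ∀ j, sg j ≤ 1)
    (hb : ∀ j, ∀ y ∈ ball (0 : E n) 4, |F j y| ≤ 1)
    (hl : ∀ j, ∀ y ∈ ball (0 : E n) 4, |lp (lp (F j)) y| ≤ sg j) :
    ∃ k : ℕ → ℕ, StrictMono k ∧ ∃ H : E n → ℝ, ContDiff ℝ ∞ H ∧
      (∀ x ∈ ball (0 : E n) 2, lp (lp H) x = 0) ∧
      ∀ l : List (Fin n), l.length ≤ 3 → ∀ ε > 0, ∀ᶠ j in Filter.atTop,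
        ∀ y ∈ ball (0 : E n) 2, |pl l (F (k j)) y - pl l H y| ≤ ε := by
  obtain ⟨C, hC, hd⟩ := der_bd hn
  have hL : ∀ j, ∀ y ∈ closedBall (0 : E n) 3, ‖fderiv ℝ (F j) y‖ ≤ n * (4 * C) := by
    intro j y hy
    refine (fd_bd _ _).trans ?_
    have : ∀ i : Fin n, |dd (ee i) (F j) y| ≤ 4 * C := by
      intro i
      have hsub : ball y 1 ⊆ ball (0 : E n) 4 := by
        apply ball_subset_ball'
        have := mem_closedBall.1 hy
        linarith
      have := hd [i] (by simp) (F j) (hF j) y 1 1 1 one_pos (fun z hz => hb j z (hsub hz))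
        (fun z hz => (hl j z (hsub hz)).trans (hs1 j))
      simp only [pl, one_pow, one_mul, mul_one] at this
      linarith
    calc _ ≤ ∑ i : Fin n, 4 * C := Finset.sum_le_sum (fun i _ => this i)
      _ = _ := by simp
  obtain ⟨k, hk, g, hg, hlim⟩ := AA F (fun j => (hF j).continuous) (n * (4 * C)) (by positivity)
    (fun j y hy => hb j y (closedBall_subset_ball (by norm_num) hy)) (by
      intro j y hy z hz
      exact (convex_closedBall (0 : E n) 3).norm_image_sub_le_of_norm_fderiv_le (𝕜 := ℝ)
        (fun x _ => (hF j).differentiable (by simp) x) (hL j) hz hy)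
  obtain ⟨ψ, hψ, -, hap⟩ := der_approx hn
  have sub1 : ∀ x ∈ ball (0 : E n) 2, ball x 1 ⊆ closedBall (0 : E n) 3 := by
    intro x hx
    refine (ball_subset_ball' ?_).trans ball_subset_closedBall
    have := mem_ball.1 hx
    linarith
  have hsk : Filter.Tendsto (fun j => sg (k j)) Filter.atTop (nhds 0) := hs.comp hk.tendsto_atTop
  have key : ∀ φ : E n → ℝ, Moll φ → ∀ ε > 0, ∀ᶠ j in Filter.atTop, ∀ x ∈ ball (0 : E n) 2,
      |Av 1 φ (F (k j)) x - Av 1 φ g x| ≤ ε := by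
    intro φ hφ ε hε
    have hI : 0 ≤ ∫ z, |φ z| := integral_nonneg (fun z => abs_nonneg _)
    filter_upwards [hlim (ε / (1 + ∫ z, |φ z|)) (by positivity)] with j hj x hx
    rw [Av_sub hφ (hF _).continuous hg]
    refine (Av_le hφ ((hF _).continuous.sub hg) one_pos
      (fun y hy => hj y (sub1 x hx hy))).trans ?_
    rw [div_mul_eq_mul_div, div_le_iff₀ (by positivity)]
    nlinarith
  refine ⟨k, hk, Av 1 ψ g, Av1_sm hψ hg, ?_, ?_⟩
  · intro x hx
    obtain ⟨φ1, h1, e1⟩ := lp_Av hψ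
    obtain ⟨φ2, h2, e2⟩ := lp_Av h1
    have hI : 0 ≤ ∫ z, |ψ z| := integral_nonneg (fun z => abs_nonneg _)
    have e3 : ∀ f : E n → ℝ, Continuous f → lp (lp (Av 1 ψ f)) = Av 1 φ2 f := by
      intro f hf; rw [e1 f hf, e2 f hf]
    rw [e3 g hg]
    have t1 : Filter.Tendsto (fun j => Av 1 φ2 (F (k j)) x) Filter.atTop (nhds (Av 1 φ2 g x)) := by
      rw [Metric.tendsto_nhds]
      intro ε hε
      filter_upwards [key φ2 h2 (ε/2) (by positivity)] with j hj
      have := hj x hx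
      rw [Real.dist_eq]; linarith
    have t2 : Filter.Tendsto (fun j => Av 1 φ2 (F (k j)) x) Filter.atTop (nhds 0) := by
      refine squeeze_zero_norm (a := fun j => sg (k j) * ∫ z, |ψ z|) (fun j => ?_)
        (by simpa using hsk.mul_const (∫ z, |ψ z|))
      rw [← e3 _ (hF _).continuous, lp_Av_sm hψ (hF _), lp_Av_sm hψ (by have := hF (k j); fun_prop)]
      refine Av_le hψ (by have := hF (k j); exact (show ContDiff ℝ ∞ (lp (lp (F (k j)))) by fun_prop).continuous) one_pos
        (fun y hy => hl _ y (closedBall_subset_ball (by norm_num) (sub1 x hx hy)))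
    exact tendsto_nhds_unique t1 t2
  · intro l hl3 ε hε
    obtain ⟨C1, hC1, hap1⟩ := hap l hl3
    obtain ⟨φ', h', e'⟩ := Av1_pl hψ l
    have hsm : ∀ᶠ j in Filter.atTop, sg (k j) < ε / (2 * C1) :=
      hsk.eventually_lt_const (by positivity)
    filter_upwards [key φ' h' (ε/2) (by positivity), hsm] with j hj hj2 x hx
    have a1 := hap1 (F (k j)) (hF _) x 1 (sg (k j)) one_pos
      (fun y hy => hl _ y (closedBall_subset_ball (by norm_num) (sub1 x hx hy)))
    have a2 := hj x hx
    rw [← e' g hg, ← e' _ (hF _).continuous, Av1_pl_sm hψ (hF _)] at a2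
    simp only [one_pow, one_mul] at a1
    have a3 : C1 * sg (k j) ≤ ε / 2 := by
      have := mul_le_mul_of_nonneg_left hj2.le hC1.le
      refine this.trans (le_of_eq ?_)
      field_simp
    have := abs_sub_le (pl l (F (k j)) x) (Av 1 ψ (pl l (F (k j))) x) (pl l (Av 1 ψ g) x)
    linarith
end BL
end

open MeasureTheory Metric Set
noncomputable section
namespace BL
set_option linter.unusedVariables false
set_option linter.unusedSimpArgs false
open scoped ContDiff

variable {n : ℕ} {v w : E n} {f g h u χ : E n → ℝ}


theorem null_cov (hn : 2 ≤ n) {A : Set (E n)} (hA : IsCompact A)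
    (h0 : μH[(n:ℝ)-1] A = 0) : ∃ T : Finset ℕ, ∃ c : ℕ → E n, ∃ r : ℕ → ℝ,
      (∀ j, 0 < r j ∧ r j ≤ 1/8) ∧ ∑ j ∈ T, (4 * r j)^(n-1) ≤ 1/2 ∧
      A ⊆ ⋃ j ∈ T, ball (c j) (r j) := by
  have hn1 : n - 1 ≠ 0 := by omega
  have hd : ((n:ℝ)-1) = ((n-1 : ℕ) : ℝ) := by rw [Nat.cast_sub (by omega)]; simp
  set ε : ℝ := 1 / (4 * 4^(n-1)) with hε
  have he : 0 < ε := by positivity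
  rw [Measure.hausdorffMeasure_apply, hd] at h0
  simp only [ENNReal.iSup_eq_zero] at h0
  have h1 := h0 (ENNReal.ofReal (1/16)) (by simp)
  have h2 : (⨅ (t : ℕ → Set (E n)) (_ : A ⊆ ⋃ n, t n) (_ : ∀ j, Metric.ediam (t j) ≤ ENNReal.ofReal (1/16)),
      ∑' j, ⨆ _ : (t j).Nonempty, Metric.ediam (t j) ^ (((n-1:ℕ)):ℝ)) < ENNReal.ofReal ε := by
    rw [h1]; simpa using he
  simp only [iInf_lt_iff] at h2
  obtain ⟨t, ht, htd, hts⟩ := h2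
  set a : ℕ → ℝ := fun j => (Metric.ediam (t j)).toReal with ha
  have ha0 : ∀ j, 0 ≤ a j := fun j => ENNReal.toReal_nonneg
  have hae : ∀ j, Metric.ediam (t j) = ENNReal.ofReal (a j) := fun j =>
    (ENNReal.ofReal_toReal (ne_top_of_le_ne_top ENNReal.ofReal_ne_top (htd j))).symm
  have ha1 : ∀ j, a j ≤ 1/16 := fun j => by
    have := htd j
    rw [hae] at this
    exact (ENNReal.ofReal_le_ofReal_iff (by norm_num)).1 this
  have hterm : ∀ j, (⨆ _ : (t j).Nonempty, Metric.ediam (t j) ^ (((n-1:ℕ)):ℝ)) = ENNReal.ofReal (a j ^ (n-1)) := by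
    intro j
    rw [ENNReal.ofReal_pow (ha0 j), ← hae, ENNReal.rpow_natCast]
    by_cases h : (t j).Nonempty
    · simp [h]
    · rw [not_nonempty_iff_eq_empty] at h
      simp [h, hn1]
  simp only [hterm] at hts
  have hr : ∀ j : ℕ, ∃ r, a j < r ∧ r ≤ 1/8 ∧ r^(n-1) ≤ a j ^ (n-1) + ε / 2 / 2^j := by
    intro j
    have c1 : Filter.Tendsto (fun r : ℝ => r^(n-1)) (nhdsWithin (a j) (Ioi (a j))) (nhds (a j ^ (n-1))) :=
      ((continuous_pow (n-1)).tendsto (a j)).mono_left nhdsWithin_le_nhds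
    have e1 := c1.eventually_le_const (u := a j ^ (n-1) + ε / 2 / 2^j) (by
      have : 0 < ε / 2 / 2^j := by positivity
      linarith)
    have e2 : ∀ᶠ r in nhdsWithin (a j) (Ioi (a j)), r ∈ Ioo (a j) (1/8) :=
      Ioo_mem_nhdsGT (by have := ha1 j; linarith)
    obtain ⟨r, h1, h2⟩ := (e1.and e2).exists
    exact ⟨r, h2.1, h2.2.le, h1⟩
  choose r hr1 hr2 hr3 using hr
  have hc : ∀ j, ∃ c : E n, t j ⊆ ball c (r j) := by
    intro j
    by_cases h : (t j).Nonempty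
    · obtain ⟨c, hc⟩ := h
      refine ⟨c, fun y hy => ?_⟩
      have := Metric.edist_le_ediam_of_mem hy hc
      rw [hae, edist_dist] at this
      rw [mem_ball]
      exact ((ENNReal.ofReal_le_ofReal_iff (ha0 j)).1 this).trans_lt (hr1 j)
    · rw [not_nonempty_iff_eq_empty] at h
      exact ⟨0, by simp [h]⟩
  choose c hc using hc
  obtain ⟨T, hT⟩ := hA.elim_finite_subcover (fun j => ball (c j) (r j)) (fun j => isOpen_ball)
    (ht.trans (iUnion_mono hc))
  refine ⟨T, c, r, fun j => ⟨(ha0 j).trans_lt (hr1 j), hr2 j⟩, ?_, hT⟩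
  have s1 : ∑ j ∈ T, a j ^ (n-1) ≤ ε := by
    have := (ENNReal.sum_le_tsum (f := fun j => ENNReal.ofReal (a j ^ (n-1))) T).trans hts.le
    rw [← ENNReal.ofReal_sum_of_nonneg (fun j _ => pow_nonneg (ha0 j) _)] at this
    exact (ENNReal.ofReal_le_ofReal_iff he.le).1 this
  have s2 : ∑ j ∈ T, ε / 2 / 2^j ≤ ε := by
    have := (summable_geometric_two' ε).sum_le_tsum T (fun j _ => by positivity)
    rwa [tsum_geometric_two'] at this
  have s3 : ∑ j ∈ T, r j ^ (n-1) ≤ 2 * ε := by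
    have := Finset.sum_le_sum (fun j (_ : j ∈ T) => hr3 j)
    rw [Finset.sum_add_distrib] at this
    linarith
  simp only [mul_pow, ← Finset.mul_sum]
  calc _ ≤ 4^(n-1) * (2 * ε) := by gcongr
    _ = 1/2 := by rw [hε]; field_simp; norm_num

theorem LS (hn : 2 ≤ n) (N1 : ℝ) (hN : 1 ≤ N1) : ∃ sg : ℝ, 0 < sg ∧ ∃ D : ℝ, 0 < D ∧
    ∀ f : E n → ℝ, ContDiff ℝ ∞ f → (∀ y ∈ ball (0 : E n) 4, |f y| ≤ 1) →
    (∀ y ∈ ball (0 : E n) 4, |lp (lp f) y| ≤ sg) → (∃ y ∈ ball (0 : E n) 1, 1 / (2 * N1) ≤ |f y|) →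
    ∃ T : Finset ℕ, ∃ c : ℕ → E n, ∃ r : ℕ → ℝ,
      (∀ j, 0 < r j ∧ r j ≤ 1/8) ∧ ∑ j ∈ T, (4 * r j)^(n-1) ≤ 1/2 ∧
      μH[(n:ℝ)-1] {y ∈ closedBall (0 : E n) (1/2) | f y = 0 ∧ ∀ j ∈ T, y ∉ ball (c j) (r j)}
        ≤ ENNReal.ofReal D := by
  by_contra hcon
  push Not at hcon
  have hp : ∀ j : ℕ, 0 < 1 / ((j:ℝ) + 1) := fun j => by positivity
  choose F hF hF1 hF2 hF3 hF4 using fun j : ℕ =>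
    hcon (1 / ((j:ℝ) + 1)) (hp j) ((j:ℝ) + 1) (by positivity)
  obtain ⟨k, hk, H, hH, hH0, hlim⟩ := COMP (by omega) F hF (fun j => 1 / ((j:ℝ) + 1))
    tendsto_one_div_add_atTop_nhds_zero_nat (fun j => by
      rw [div_le_one (by positivity)]; have : (0:ℝ) ≤ j := by positivity
      linarith) hF1 hF2
  have hne : ∃ z ∈ ball (0 : E n) 1, H z ≠ 0 := by
    obtain ⟨j, hj⟩ := (hlim [] (by simp) (1 / (4 * N1)) (by positivity)).exists
    obtain ⟨y, hy, hy1⟩ := hF3 (k j)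
    refine ⟨y, hy, fun h0 => ?_⟩
    have := hj y (ball_subset_ball (by norm_num) hy)
    simp only [pl, h0, sub_zero] at this
    have h4 : 1 / (4 * N1) < 1 / (2 * N1) := by
      apply one_div_lt_one_div_of_lt <;> linarith
    linarith
  have hnull := null_bad hn hH (fun x hx => hH0 x (ball_subset_ball (by norm_num) hx)) hne
  set A : Set (E n) := closedBall 0 (1/2) ∩ {x | ∀ l : List (Fin n), l.length ≤ 3 → pl l H x = 0} with hA
  have hAc : IsCompact A := by
    refine (isCompact_closedBall _ _).inter_right ?_
    simp only [setOf_forall]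
    refine isClosed_iInter fun l => isClosed_iInter fun hl => ?_
    exact isClosed_eq (sm_pl hH l).continuous continuous_const
  have hA0 : μH[(n:ℝ)-1] A = 0 := by
    refine measure_mono_null ?_ hnull
    rintro x ⟨h1, h2⟩
    exact ⟨closedBall_subset_ball (by norm_num) h1, h2⟩
  obtain ⟨T, c, r, hr, hs, hcov⟩ := null_cov hn hAc hA0
  set B : Set (E n) := closedBall 0 (1/2) \ ⋃ j ∈ T, ball (c j) (r j) with hB
  have hBc : IsCompact B := (isCompact_closedBall _ _).diff
    (isOpen_biUnion fun j _ => isOpen_ball)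
  have hreg : ∀ x : E n, ∃ ρ, 0 < ρ ∧ ρ ≤ 1 ∧ ∃ η > 0, ∃ D : ENNReal, D ≠ ⊤ ∧ (x ∈ B → ∀ f : E n → ℝ,
      ContDiff ℝ ∞ f → (∀ y ∈ ball x ρ, ∀ q : List (Fin n), q.length ≤ 3 → |pl q f y - pl q H y| ≤ η) →
      μH[(n:ℝ)-1] {y | y ∈ ball x ρ ∧ f y = 0} ≤ D) := by
    intro x
    by_cases hx : x ∈ B
    · have : ∃ l : List (Fin n), l.length ≤ 3 ∧ pl l H x ≠ 0 := by
        by_contra hno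
        push Not at hno
        exact hx.2 (hcov ⟨hx.1, hno⟩)
      obtain ⟨l, hl, hl0⟩ := this
      obtain ⟨ρ, h1, h2, η, h3, D, h4, h5⟩ := regpt (by omega) hH hl hl0
      exact ⟨ρ, h1, h2, η, h3, D, h4, fun _ => h5⟩
    · exact ⟨1, one_pos, le_rfl, 1, one_pos, 0, by simp, fun h => absurd h hx⟩
  choose ρ hρ0 hρ1 η hη D hD hDD using hreg
  obtain ⟨X, hXB, hX⟩ := hBc.elim_nhds_subcover (fun x => ball x (ρ x)) (fun x _ => ball_mem_nhds x (hρ0 x))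
  have hev : ∀ᶠ j in Filter.atTop, ∀ x ∈ (X : Set (E n)), ∀ q ∈ {q : List (Fin n) | q.length ≤ 3},
      ∀ y ∈ ball (0 : E n) 2, |pl q (F (k j)) y - pl q H y| ≤ η x := by
    rw [Filter.eventually_all_finite X.finite_toSet]
    intro x hx
    rw [Filter.eventually_all_finite (List.finite_length_le (Fin n) 3)]
    intro q hq
    exact hlim q hq (η x) (hη x)
  have hDf : ∑ x ∈ X, D x ≠ ⊤ := by
    simp [ENNReal.sum_eq_top, hD]
  have hev2 : ∀ᶠ j : ℕ in Filter.atTop, (∑ x ∈ X, D x).toReal ≤ (k j : ℝ) := by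
    have : Filter.Tendsto (fun j => ((k j : ℕ) : ℝ)) Filter.atTop Filter.atTop :=
      tendsto_natCast_atTop_atTop.comp hk.tendsto_atTop
    exact this.eventually_ge_atTop _
  obtain ⟨j, hj1, hj2⟩ := (hev.and hev2).exists
  have hbad := hF4 (k j) T c r hr hs
  refine absurd hbad (not_lt.2 ?_)
  calc _ ≤ μH[(n:ℝ)-1] (⋃ x ∈ X, {y | y ∈ ball x (ρ x) ∧ F (k j) y = 0}) := by
        apply measure_mono
        rintro y ⟨h1, h2, h3⟩
        have : y ∈ B := ⟨h1, by simpa using h3⟩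
        have := hX this
        simp only [mem_iUnion] at this ⊢
        obtain ⟨x, hx, hy⟩ := this
        exact ⟨x, hx, hy, h2⟩
    _ ≤ ∑ x ∈ X, μH[(n:ℝ)-1] {y | y ∈ ball x (ρ x) ∧ F (k j) y = 0} := measure_biUnion_finset_le _ _
    _ ≤ ∑ x ∈ X, D x := by
        refine Finset.sum_le_sum fun x hx => ?_
        refine hDD x (hXB x hx) _ (hF _) (fun y hy q hq => hj1 x hx q hq y ?_)
        have h1 := (hXB x hx).1
        rw [mem_closedBall] at h1
        refine ball_subset_ball' ?_ hy
        have := hρ1 x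
        linarith
    _ = ENNReal.ofReal (∑ x ∈ X, D x).toReal := (ENNReal.ofReal_toReal hDf).symm
    _ ≤ _ := by
        apply ENNReal.ofReal_le_ofReal
        linarith
end BL
end

open MeasureTheory Metric Set
noncomputable section
namespace BL
set_option linter.unusedVariables false
set_option linter.unusedSimpArgs false
open scoped ContDiff

variable {n : ℕ} {v w : E n} {f g h u χ : E n → ℝ}


theorem zero_scale {S : Set (E n)} (x : E n) {t D : ℝ} (hn : 1 ≤ n) (ht : 0 < t) (hD : 0 ≤ D)
    (h : μH[(n:ℝ)-1] S ≤ ENNReal.ofReal D) :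
    μH[(n:ℝ)-1] ((fun z => x + t • z) '' S) ≤ ENNReal.ofReal (D * t^(n-1)) := by
  have hl : LipschitzWith (Real.toNNReal t) (fun z : E n => x + t • z) := by
    refine LipschitzWith.of_dist_le_mul fun a b => ?_
    rw [dist_add_left, dist_smul₀, Real.norm_of_nonneg ht.le, Real.coe_toNNReal _ ht.le]
  have hd : ((n:ℝ)-1) = ((n-1 : ℕ) : ℝ) := by rw [Nat.cast_sub (by omega)]; simp
  have := hl.hausdorffMeasure_image_le (d := (n:ℝ)-1) (by rw [hd]; positivity) S
  refine this.trans ?_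
  rw [mul_comm D, ENNReal.ofReal_mul (by positivity), hd, ENNReal.rpow_natCast,
    ENNReal.ofReal_pow ht.le]
  rw [hd] at h
  gcongr
  exact le_rfl

theorem leaf_step (hn : 2 ≤ n) {N1 sg D : ℝ} (hN1 : 1 ≤ N1) (hD : 0 < D)
    (hLS : ∀ f : E n → ℝ, ContDiff ℝ ∞ f → (∀ y ∈ ball (0 : E n) 4, |f y| ≤ 1) →
    (∀ y ∈ ball (0 : E n) 4, |lp (lp f) y| ≤ sg) → (∃ y ∈ ball (0 : E n) 1, 1 / (2 * N1) ≤ |f y|) →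
    ∃ T : Finset ℕ, ∃ c : ℕ → E n, ∃ r : ℕ → ℝ,
      (∀ j, 0 < r j ∧ r j ≤ 1/8) ∧ ∑ j ∈ T, (4 * r j)^(n-1) ≤ 1/2 ∧
      μH[(n:ℝ)-1] {y ∈ closedBall (0 : E n) (1/2) | f y = 0 ∧ ∀ j ∈ T, y ∉ ball (c j) (r j)}
        ≤ ENNReal.ofReal D) {x : E n} {t : ℝ} (ht : 0 < t) (ht1 : t ≤ 1/8) (hts : t ≤ sg)
    (hu : Sol u x (1/2)) (hp : 0 < M u x (4 * t)) (hM : M u x (4 * t) ≤ N1 * M u x t) :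
    ∃ T : Finset ℕ, ∃ c : ℕ → E n, ∃ r : ℕ → ℝ,
      (∀ j, 0 < r j ∧ r j ≤ t/8) ∧ ∑ j ∈ T, (4 * r j)^(n-1) ≤ t^(n-1)/2 ∧
      μH[(n:ℝ)-1] {y ∈ closedBall x (t/2) | u y = 0 ∧ ∀ j ∈ T, y ∉ ball (c j) (r j)}
        ≤ ENNReal.ofReal (D * t^(n-1)) := by
  have cu : Continuous u := hu.1.continuous
  set m := M u x (4 * t) with hm
  set f : E n → ℝ := fun z => m⁻¹ * u (x + t • z) with hf
  have hinb : ∀ z ∈ ball (0 : E n) 4, x + t • z ∈ ball x (4 * t) := by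
    intro z hz
    rw [mem_ball_zero_iff] at hz
    rw [mem_ball, dist_eq_norm, add_sub_cancel_left, norm_smul, Real.norm_of_nonneg ht.le]
    nlinarith
  have hf1 : ∀ y ∈ ball (0 : E n) 4, |f y| ≤ 1 := by
    intro y hy
    have := le_M cu (hinb y hy)
    simp only [hf, abs_mul, abs_inv, abs_of_pos hp]
    rw [inv_mul_le_one₀ hp]
    exact this
  have hfs : ContDiff ℝ ∞ f := by
    have := hu.1
    simp only [hf]; fun_prop
  have hlf : ∀ y, lp (lp f) y = m⁻¹ * (t^4 * lp (lp u) (x + t • y)) := by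
    intro y
    have := hu.1
    have e : f = m⁻¹ • (fun z => u (x + t • z)) := rfl
    have hsm : ContDiff ℝ ∞ (fun z => u (x + t • z)) := by fun_prop
    rw [e, lp_smul _ hsm, lp_smul _ (by fun_prop), Pi.smul_apply, lplp_scale hu.1, smul_eq_mul]
  obtain ⟨T, c, r, hr, hs, hmu⟩ := hLS f hfs hf1 (by
      intro y hy
      have h1 := hu.2 _ (ball_subset_ball (by linarith) (hinb y hy))
      have h2 := le_M cu (hinb y hy)
      rw [hlf, abs_mul, abs_mul, abs_inv, abs_of_pos hp, abs_of_pos (pow_pos ht 4)]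
      have h3 : |lp (lp u) (x + t • y)| ≤ m := h1.trans h2
      have h4 : t^4 ≤ sg := by
        refine le_trans ?_ hts
        exact pow_le_of_le_one ht.le (by linarith) (by norm_num)
      calc m⁻¹ * (t^4 * |lp (lp u) (x + t • y)|) ≤ m⁻¹ * (t^4 * m) := by gcongr
        _ = t^4 := by field_simp
        _ ≤ sg := h4) (by
      by_contra hno
      push Not at hno
      have : M u x t ≤ m / (2 * N1) := by
        refine M_le ht (fun y hy => ?_)
        have hz := hno (t⁻¹ • (y - x)) (by
          rw [mem_ball_zero_iff, norm_smul, norm_inv, Real.norm_of_nonneg ht.le,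
            inv_mul_lt_one₀ ht, ← dist_eq_norm]
          exact hy)
        simp only [hf, smul_inv_smul₀ ht.ne', add_sub_cancel, abs_mul, abs_inv, abs_of_pos hp] at hz
        rw [inv_mul_lt_iff₀ hp] at hz
        refine hz.le.trans (le_of_eq ?_)
        ring
      have h2 : N1 * (m / (2 * N1)) = m / 2 := by field_simp
      have h3 := mul_le_mul_of_nonneg_left this (by linarith : 0 ≤ N1)
      linarith)
  refine ⟨T, fun j => x + t • c j, fun j => t * r j, fun j => ⟨mul_pos ht (hr j).1, ?_⟩, ?_, ?_⟩
  · have := mul_le_mul_of_nonneg_left (hr j).2 ht.le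
    linarith
  · have : ∀ j, (4 * (t * r j))^(n-1) = t^(n-1) * (4 * r j)^(n-1) := fun j => by
      rw [← mul_pow]; ring
    simp only [this, ← Finset.mul_sum]
    have := mul_le_mul_of_nonneg_left hs (pow_nonneg ht.le (n-1))
    linarith
  · refine le_trans (measure_mono ?_) (zero_scale x (by omega) ht hD.le hmu)
    rintro y ⟨h1, h2, h3⟩
    have e1 : x + t • (t⁻¹ • (y - x)) = y := by rw [smul_inv_smul₀ ht.ne', add_sub_cancel]
    refine ⟨t⁻¹ • (y - x), ⟨?_, ?_, ?_⟩, e1⟩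
    · rw [mem_closedBall_zero_iff, norm_smul, norm_inv, Real.norm_of_nonneg ht.le,
        inv_mul_le_iff₀ ht, ← dist_eq_norm]
      rw [mem_closedBall] at h1
      linarith
    · simp only [hf, e1, h2, mul_zero]
    · intro j hj hb
      apply h3 j hj
      rw [mem_ball, dist_eq_norm] at hb ⊢
      have : y - (x + t • c j) = t • (t⁻¹ • (y - x) - c j) := by
        rw [smul_sub, smul_inv_smul₀ ht.ne']; abel
      rw [this, norm_smul, Real.norm_of_nonneg ht.le]
      exact mul_lt_mul_of_pos_left hb ht

theorem LEAF (hn : 2 ≤ n) : LeafP n := by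
  intro N0
  obtain ⟨ρ0, hρ0, hρ1, hLO⟩ := LOWN hn
  obtain ⟨s1, hs1, hs11, N1, hN1, hLO⟩ := hLO N0
  obtain ⟨sg, hsg, D, hD, hLS⟩ := LS hn N1 hN1
  obtain ⟨m, hm⟩ := cov_ball n (ρ := 1/16) (by norm_num)
  set Λ := 1 + 2 * D with hΛ
  refine ⟨min (min (ρ0 * s1 / 2) (ρ0 / 4)) (min sg (1/4)), by positivity, (m + 1) * Λ, by positivity, ?_⟩
  intro u K z s hs hss hSol hKz hpos hdb
  have l1 : s ≤ ρ0 * s1 / 2 := hss.trans ((min_le_left _ _).trans (min_le_left _ _))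
  have l2 : s ≤ ρ0 / 4 := hss.trans ((min_le_left _ _).trans (min_le_right _ _))
  have l3 : s ≤ sg := hss.trans ((min_le_right _ _).trans (min_le_left _ _))
  have l4 : s ≤ 1/4 := hss.trans ((min_le_right _ _).trans (min_le_right _ _))
  have hdoub : ∀ x ∈ K, ∀ t, 0 < t → t ≤ s / 2 → M u x (4 * t) ≤ N1 * M u x t := by
    intro x hx t ht hts
    have hS : 2 * s / ρ0 ≤ s1 := by rw [div_le_iff₀ hρ0]; linarith
    have hS2 : 2 * s / ρ0 ≤ 1/2 := by rw [div_le_iff₀ hρ0]; linarith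
    have := hLO u x (2 * s / ρ0) (by positivity) hS
      ((hSol x hx).mono hS2) (2 * s) (by field_simp)
      (by have := hdb x hx; rwa [mul_div_cancel_left₀ s (by norm_num : (2:ℝ) ≠ 0)])
      (4 * t) (by positivity) (by linarith)
    rwa [mul_div_cancel_left₀ t (by norm_num : (4:ℝ) ≠ 0)] at this
  have main : ∀ δ > 0, ∀ k : ℕ, ∀ t, 0 < t → t ≤ s / 2 → t ≤ 2^k * δ → ∀ x ∈ K,
      nu n δ {y ∈ K | u y = 0 ∧ y ∈ closedBall x (t/2)} ≤ ENNReal.ofReal (Λ * t^(n-1)) := by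
    intro δ hδ k
    induction k with
    | zero =>
      intro t ht hts htd x hx
      have := nu_small (n := n) (by omega) (δ := δ) (s := t/2) (by positivity) (by linarith)
        (S := {y ∈ K | u y = 0 ∧ y ∈ closedBall x (t/2)}) (z := x) (fun y hy => hy.2.2)
      refine this.trans (ENNReal.ofReal_le_ofReal ?_)
      rw [mul_div_cancel₀ t (by norm_num : (2:ℝ) ≠ 0)]
      have : 0 ≤ t^(n-1) := by positivity
      nlinarith
    | succ k ih =>
      intro t ht hts htd x hx
      obtain ⟨T, c, r, hr, hsum, hmu⟩ := leaf_step hn hN1 hD hLS ht (by linarith) (by linarith)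
        (hSol x hx) (hpos x hx (4 * t) (by positivity)) (hdoub x hx t ht hts)
      have hch : ∀ j ∈ T, nu n δ {y ∈ K | u y = 0 ∧ y ∈ ball (c j) (r j)} ≤
          ENNReal.ofReal (Λ * (4 * r j)^(n-1)) := by
        intro j hj
        rcases eq_empty_or_nonempty {y ∈ K | u y = 0 ∧ y ∈ ball (c j) (r j)} with he | ⟨y, hy⟩
        · rw [he]; simp
        · have h1 := hr j
          refine le_trans (measure_mono ?_) (ih (4 * r j) (by linarith [h1.1]) (by linarith [h1.2])
            (by rw [pow_succ] at htd; linarith [h1.2]) y hy.1)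
          rintro w ⟨hw1, hw2, hw3⟩
          refine ⟨hw1, hw2, ?_⟩
          have := dist_triangle_right w y (c j)
          have h5 := mem_ball.1 hw3
          have h6 := mem_ball.1 hy.2.2
          rw [mem_closedBall]
          linarith
      calc _ ≤ nu n δ ({y ∈ closedBall x (t/2) | u y = 0 ∧ ∀ j ∈ T, y ∉ ball (c j) (r j)} ∪
            ⋃ j ∈ T, {y ∈ K | u y = 0 ∧ y ∈ ball (c j) (r j)}) := by
            apply measure_mono
            rintro y ⟨h1, h2, h3⟩
            by_cases h : ∀ j ∈ T, y ∉ ball (c j) (r j)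
            · exact Or.inl ⟨h3, h2, h⟩
            · push Not at h
              obtain ⟨j, hj, hy⟩ := h
              refine Or.inr ?_
              simp only [mem_iUnion]
              exact ⟨j, hj, h1, h2, hy⟩
        _ ≤ ENNReal.ofReal (D * t^(n-1)) + ∑ j ∈ T, ENNReal.ofReal (Λ * (4 * r j)^(n-1)) := by
            refine (measure_union_le _ _).trans (add_le_add ((nu_le_mu hδ _).trans hmu) ?_)
            exact (measure_biUnion_finset_le _ _).trans (Finset.sum_le_sum hch)
        _ = ENNReal.ofReal (D * t^(n-1) + Λ * ∑ j ∈ T, (4 * r j)^(n-1)) := by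
            have hnn : ∀ j ∈ T, 0 ≤ Λ * (4 * r j)^(n-1) := fun j _ => by
              have := (hr j).1
              positivity
            rw [← ENNReal.ofReal_sum_of_nonneg hnn, ← ENNReal.ofReal_add (by positivity)
              (Finset.sum_nonneg hnn), Finset.mul_sum]
        _ ≤ _ := by
            apply ENNReal.ofReal_le_ofReal
            have h1 := mul_le_mul_of_nonneg_left hsum (by positivity : 0 ≤ Λ)
            have h2 : 0 < t^(n-1) := by positivity
            rw [hΛ] at h1 ⊢
            nlinarith
  apply mu_le
  intro δ hδ
  obtain ⟨k, hk⟩ := pow_unbounded_of_one_lt (s / δ) (one_lt_two : (1:ℝ) < 2)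
  rw [div_lt_iff₀ hδ] at hk
  obtain ⟨G, hG, hcov⟩ := hm z s hs
  have := nu_cov (n := n) (δ := δ) (S := {x ∈ K | u x = 0}) (R := ∅) (G := G)
    (f := fun t => {y ∈ K | u y = 0 ∧ ‖y - t‖ ≤ 1/16 * s}) (by
      rintro y ⟨h1, h2⟩
      obtain ⟨t, ht, hy⟩ := hcov y (hKz h1)
      refine Or.inr ?_
      simp only [mem_iUnion]
      exact ⟨t, ht, h1, h2, hy⟩) hG (b := Λ * s^(n-1)) (by positivity) (by
      intro t ht
      rcases eq_empty_or_nonempty {y ∈ K | u y = 0 ∧ ‖y - t‖ ≤ 1/16 * s} with he | ⟨y, hy⟩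
      · rw [he]; simp
      · refine le_trans (measure_mono ?_) ((main δ hδ k (s/4) (by positivity) (by linarith)
          (by linarith) y hy.1).trans (ENNReal.ofReal_le_ofReal ?_))
        · rintro w ⟨hw1, hw2, hw3⟩
          refine ⟨hw1, hw2, ?_⟩
          have := dist_triangle_right w y t
          have h6 := hy.2.2
          rw [← dist_eq_norm] at hw3 h6
          rw [mem_closedBall]
          linarith
        · have : s/4 ≤ s := by linarith
          gcongr)
  refine this.trans ?_
  simp only [measure_empty, zero_add]
  apply ENNReal.ofReal_le_ofReal
  have : 0 ≤ Λ * s^(n-1) := by positivity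
  nlinarith
end BL
end

open MeasureTheory Metric Set
noncomputable section
namespace BL
set_option linter.unusedVariables false
set_option linter.unusedSimpArgs false
open scoped ContDiff

variable {n : ℕ} {v w : E n} {f g h u χ : E n → ℝ}


theorem inf_M {K : Set (E n)} (hK : IsCompact K) (cu : Continuous u)
    (hpos : ∀ x ∈ K, ∀ r > 0, 0 < M u x r) {ρ : ℝ} (hρ : 0 < ρ) :
    ∃ m, 0 < m ∧ ∀ x ∈ K, m ≤ M u x ρ := by
  obtain ⟨X, hX, hc⟩ := hK.elim_nhds_subcover (fun x => ball x (ρ/2)) (fun x _ => ball_mem_nhds x (by positivity))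
  have : ∃ m, 0 < m ∧ ∀ y ∈ X, m ≤ M u y (ρ/2) := by
    rcases X.eq_empty_or_nonempty with h | h
    · exact ⟨1, one_pos, by simp [h]⟩
    · obtain ⟨y, hy, hm⟩ := X.exists_min_image (fun y => M u y (ρ/2)) h
      exact ⟨_, hpos y (hX y hy) (ρ/2) (by positivity), hm⟩
  obtain ⟨m, hm, h⟩ := this
  refine ⟨m, hm, fun x hx => ?_⟩
  have := hc hx
  simp only [mem_iUnion] at this
  obtain ⟨y, hy, hxy⟩ := this
  refine (h y hy).trans (M_sub cu (ball_subset_ball' ?_))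
  rw [mem_ball, dist_comm] at hxy
  linarith

theorem geo_dec {a : ℕ → ℝ} {q A : ℝ} (hq : 0 ≤ q) (h0 : a 0 ≤ A) (L : ℕ) (h : ∀ k < L, a (k+1) ≤ q * a k) :
    a L ≤ q^L * A := by
  induction L with
  | zero => simpa using h0
  | succ L ih =>
    have := ih (fun k hk => h k (by omega))
    calc a (L+1) ≤ q * a L := h L (by omega)
      _ ≤ q * (q^L * A) := by gcongr
      _ = _ := by ring

theorem dbl_bdd (hn : 2 ≤ n) {K : Set (E n)} (hK : IsCompact K) (hS : ∀ x ∈ K, Sol u x (1/2))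
    (cu : Continuous u) (hpos : ∀ x ∈ K, ∀ r > 0, 0 < M u x r) :
    ∃ B, 0 < B ∧ ∀ x ∈ K, ∀ ρ, 0 < ρ → ρ ≤ 1 → M u x (2 * ρ) ≤ B * M u x ρ := by
  obtain ⟨R, hR⟩ := hK.isBounded.subset_closedBall 0
  set A := 1 + M u 0 (R + 2) with hA
  have hA0 : 0 < A := by have := M_nonneg (u := u) 0 (R + 2); linarith
  have hMA : ∀ x ∈ K, ∀ ρ, ρ ≤ 2 → M u x ρ ≤ A := by
    intro x hx ρ hρ
    have : M u x ρ ≤ M u 0 (R + 2) := M_sub cu (ball_subset_ball' (by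
      have := mem_closedBall.1 (hR hx); linarith))
    linarith
  obtain ⟨ρL, hρL, hρL1, hlow⟩ := lowE hn
  set s := ρL * (1/2) with hs
  have hs0 : 0 < s := by positivity
  have hs1 : s ≤ 1/2 := by linarith
  obtain ⟨m2, hm2, hm2'⟩ := inf_M hK cu hpos (ρ := s/2) (by positivity)
  obtain ⟨m, hm, hm'⟩ := inf_M hK cu hpos hs0
  obtain ⟨N, hN⟩ := pow_unbounded_of_one_lt (A / m2) (one_lt_two : (1:ℝ) < 2)
  rw [div_lt_iff₀ hm2] at hN
  obtain ⟨c, hc, P, hP, hlow⟩ := hlow (N:ℝ)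
  have hlow2 : ∀ x ∈ K, ∀ a, 0 < a → a ≤ s/2 → c * (a/s)^P * m ≤ M u x a := by
    intro x hx a ha has
    refine le_trans ?_ (hlow u x (1/2) (by norm_num) (by norm_num) (hS x hx) s hs ?_ a ha has)
    · have := hm' x hx
      gcongr
    · rw [Real.rpow_natCast]
      have := hMA x hx s (by linarith)
      have h2 := mul_le_mul_of_nonneg_left (hm2' x hx) (by positivity : (0:ℝ) ≤ 2^N)
      linarith
  obtain ⟨ρ0, hρ0, hρ01, hLO⟩ := LOWN hn
  obtain ⟨s1, hs1', hs11, N1, hN1, hLO⟩ := hLO (P + 1)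
  set t0 := min (ρ0 * min s1 (1/2)) (s/2) with ht0
  have ht : 0 < t0 := by positivity
  have htl : t0 ≤ ρ0 * min s1 (1/2) := min_le_left _ _
  have htr : t0 ≤ s/2 := min_le_right _ _
  set Y : ℝ := (2:ℝ)^P with hY
  have hY0 : 0 < Y := by positivity
  obtain ⟨L, hL⟩ := pow_unbounded_of_one_lt (A / (c * (t0/s)^P * m)) (one_lt_two : (1:ℝ) < 2)
  rw [div_lt_iff₀ (by positivity)] at hL
  have hak : ∀ k : ℕ, 0 < t0 / 2^k ∧ t0 / 2^k ≤ t0 := fun k =>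
    ⟨by positivity, div_le_self ht.le (one_le_pow₀ (by norm_num))⟩
  have claim : ∀ x ∈ K, ∃ k < L, M u x (t0/2^k) ≤ 2^(P+1) * M u x (t0/2^k/2) := by
    intro x hx
    by_contra hno
    push Not at hno
    have h1 := geo_dec (a := fun k => M u x (t0/2^k)) (q := (Y * 2)⁻¹) (A := A) (by positivity)
      (by simpa using hMA x hx t0 (by linarith)) L (by
        intro k hk
        have := hno k hk
        rw [Real.rpow_add (by norm_num), Real.rpow_one] at this
        have e : t0 / 2^(k+1) = t0/2^k/2 := by rw [pow_succ]; field_simp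
        rw [e, inv_mul_eq_div, le_div_iff₀ (by positivity), mul_comm]
        exact this.le)
    have h2 := hlow2 x hx (t0/2^L) (hak L).1 ((hak L).2.trans htr)
    have e2 : (t0/2^L/s)^P = (t0/s)^P * (Y^L)⁻¹ := by
      rw [hY, Real.rpow_pow_comm (by norm_num), ← Real.inv_rpow (by positivity),
        ← Real.mul_rpow (by positivity) (by positivity)]
      congr 1; field_simp
    rw [e2] at h2
    have h3 := h2.trans h1
    rw [inv_pow, mul_pow, mul_inv, mul_assoc (Y^L)⁻¹] at h3
    have h4 : (Y^L)⁻¹ * (c * (t0/s)^P * m) ≤ (Y^L)⁻¹ * ((2^L)⁻¹ * A) := by linarith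
    have h5 := le_of_mul_le_mul_left h4 (by positivity)
    rw [inv_mul_eq_div, le_div_iff₀ (by positivity)] at h5
    linarith
  obtain ⟨mL, hmL, hmL'⟩ := inf_M hK cu hpos (ρ := t0/2^L) (hak L).1
  refine ⟨N1 + A / mL, by positivity, fun x hx ρ hρ hρ1 => ?_⟩
  obtain ⟨k, hk, hdk⟩ := claim x hx
  have hM0 := M_nonneg (u := u) x ρ
  by_cases h : 2 * ρ ≤ t0/2^k
  · have hS1 : t0/2^k/ρ0 ≤ min s1 (1/2) := by
      rw [div_le_iff₀ hρ0, mul_comm]; exact (hak k).2.trans htl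
    have h1 := hLO u x (t0/2^k/ρ0) (div_pos (hak k).1 hρ0) (hS1.trans (min_le_left _ _))
      ((hS x hx).mono (hS1.trans (min_le_right _ _))) (t0/2^k) (by field_simp) hdk
      (2 * ρ) (by positivity) h
    have h2 : M u x (2 * ρ / 4) ≤ M u x ρ := M_mono cu (by linarith)
    have h3 := mul_le_mul_of_nonneg_left h2 (by linarith : 0 ≤ N1)
    have : 0 ≤ A / mL * M u x ρ := by positivity
    linarith
  · push Not at h
    have h1 : t0/2^L ≤ ρ := by
      have : t0/2^L ≤ t0/2^(k+1) := by
        apply div_le_div_of_nonneg_left ht.le (by positivity)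
        exact pow_le_pow_right₀ (by norm_num) hk
      rw [pow_succ] at this
      have e : t0 / (2^k*2) = t0/2^k/2 := by field_simp
      linarith
    have h2 := (hmL' x hx).trans (M_mono cu h1)
    have h3 := hMA x hx (2 * ρ) (by linarith)
    have h4 : A ≤ A / mL * M u x ρ := by
      rw [div_mul_eq_mul_div, le_div_iff₀ hmL]
      gcongr
    have : 0 ≤ N1 * M u x ρ := by positivity
    linarith

theorem ext_u (hn : 2 ≤ n) {W u : E n → ℝ} (hW : ∀ x, |W x| ≤ 1)
    (hu : ContDiffOn ℝ ∞ u (ball 0 1))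
    (hl : ∀ x ∈ ball (0 : E n) 1, lap (lap u) x = W x * u x)
    (hne : ∃ x ∈ ball (0 : E n) 1, u x ≠ 0) :
    ∃ U : E n → ℝ, EqOn U u (ball 0 (7/8)) ∧ (∀ x ∈ ball (0 : E n) (1/4), Sol U x (1/2)) ∧
      Continuous U ∧ ∀ x ∈ ball (0 : E n) (1/4), ∀ r > 0, 0 < M U x r := by
  obtain ⟨z, hz, hz0⟩ := hne
  rw [mem_ball_zero_iff] at hz
  obtain ⟨R, hR1, hR2⟩ : ∃ R, max (7/8) ‖z‖ < R ∧ R < 1 := exists_between (max_lt (by norm_num) hz)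
  have hR7 : 7/8 < R := (le_max_left _ _).trans_lt hR1
  have hRz : ‖z‖ < R := (le_max_right _ _).trans_lt hR1
  let χ : ContDiffBump (0 : E n) := ⟨R, (1 + R)/2, by linarith, by linarith⟩
  set U : E n → ℝ := fun x => χ x * u x with hU
  have hsm : ContDiff ℝ ∞ U := by
    rw [contDiff_iff_contDiffAt]
    intro x
    by_cases hx : x ∈ ball (0 : E n) 1
    · exact (χ.contDiff.contDiffAt).mul (hu.contDiffAt (isOpen_ball.mem_nhds hx))
    · have : U =ᶠ[nhds x] fun _ => 0 := by
        have hx' : x ∉ tsupport χ := by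
          rw [χ.tsupport_eq]
          rw [mem_ball_zero_iff] at hx
          rw [mem_closedBall_zero_iff]
          show ¬ ‖x‖ ≤ (1 + R)/2
          linarith
        filter_upwards [(isClosed_tsupport χ).isOpen_compl.mem_nhds hx'] with y hy
        simp [hU, image_eq_zero_of_notMem_tsupport hy]
      exact contDiffAt_const.congr_of_eventuallyEq this
  have heq : EqOn U u (ball 0 R) := by
    intro x hx
    simp only [hU]
    rw [χ.one_of_mem_closedBall (ball_subset_closedBall hx), one_mul]
  have hlap : EqOn (lap U) (lap u) (ball 0 R) := fun x hx =>
    lap_congr (Filter.eventuallyEq_of_mem (isOpen_ball.mem_nhds hx) heq)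
  have hlap2 : EqOn (lap (lap U)) (lap (lap u)) (ball 0 R) := fun x hx =>
    lap_congr (Filter.eventuallyEq_of_mem (isOpen_ball.mem_nhds hx) hlap)
  have e1 : lap U = lp U := funext (lap_eq_lp hsm)
  have e2 : lap (lp U) = lp (lp U) := funext (lap_eq_lp (by fun_prop))
  have hsol : ∀ x ∈ ball (0 : E n) R, |lp (lp U) x| ≤ |U x| := by
    intro x hx
    rw [← e2, ← e1, hlap2 hx, hl x (ball_subset_ball hR2.le hx), heq hx, abs_mul]
    have := hW x
    have h2 := abs_nonneg (u x)
    nlinarith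
  have R0 : 0 < R := by linarith
  refine ⟨U, heq.mono (ball_subset_ball hR7.le), ?_, hsm.continuous, ?_⟩
  · intro x hx
    refine ⟨hsm, fun y hy => hsol y (ball_subset_ball' ?_ hy)⟩
    rw [mem_ball] at hx
    linarith
  · intro x hx r hr
    have hS : Sol U 0 R := ⟨hsm, hsol⟩
    have hV := Sol_scale R0 hR2.le hS
    have hx1 : R⁻¹ • x ∈ ball (0 : E n) 1 := by
      rw [mem_ball_zero_iff] at hx ⊢
      rw [norm_smul, norm_inv, Real.norm_of_nonneg R0.le, inv_mul_lt_one₀ R0]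
      linarith
    have h1 := M_pos hn hV ⟨R⁻¹ • z, by
        rw [mem_ball_zero_iff, norm_smul, norm_inv, Real.norm_of_nonneg R0.le, inv_mul_lt_one₀ R0]
        exact hRz, by
        simp only [zero_add, smul_inv_smul₀ R0.ne']
        rw [heq (mem_ball_zero_iff.2 hRz)]; exact hz0⟩ hx1 (r := R⁻¹ * r) (by positivity)
    by_contra hno
    push Not at hno
    refine absurd h1 (not_lt.2 (M_le (by positivity) ?_))
    intro y hy
    refine le_trans (le_M hsm.continuous (x := x) (r := r) ?_) hno
    rw [mem_ball, dist_eq_norm] at hy ⊢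
    have e : (0 : E n) + R • y - x = R • (y - R⁻¹ • x) := by
      rw [smul_sub, smul_inv_smul₀ R0.ne', zero_add]
    rw [e, norm_smul, Real.norm_of_nonneg R0.le]
    calc R * ‖y - R⁻¹ • x‖ < R * (R⁻¹ * r) := mul_lt_mul_of_pos_left hy R0
      _ = r := by field_simp

theorem cube_geo (hn : 1 ≤ n) (c : E n) {ℓ : ℝ} (hℓ : 0 < ℓ) (hb : Bornology.IsBounded (cube c ℓ)) :
    c ∈ cube c ℓ ∧ Convex ℝ (cube c ℓ) ∧ IsClosed (cube c ℓ) ∧ 0 < diam (cube c ℓ) ∧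
      cube c ℓ ⊆ closedBall c (diam (cube c ℓ) / 2) := by
  have hc : c ∈ cube c ℓ := fun i => ⟨by linarith, by linarith⟩
  have key : ∀ x ∈ cube c ℓ, 2 * dist x c ≤ diam (cube c ℓ) := by
    intro x hx
    have hx' : (2:ℝ) • c - x ∈ cube c ℓ := by
      intro i
      have := hx i
      simp only [PiLp.sub_apply, PiLp.smul_apply, smul_eq_mul]
      exact ⟨by linarith [this.2], by linarith [this.1]⟩
    have := dist_le_diam_of_mem hb hx hx'
    have e : x - ((2:ℝ) • c - x) = (2:ℝ) • (x - c) := by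
      rw [smul_sub, two_smul, two_smul]; abel
    rw [dist_eq_norm, e, norm_smul, ← dist_eq_norm] at this
    simpa using this
  refine ⟨hc, ?_, ?_, ?_, ?_⟩
  · intro x hx y hy a b ha hb hab i
    have := (convex_Icc (c i - ℓ/2) (c i + ℓ/2)) (hx i) (hy i) ha hb hab
    simpa using this
  · simp only [cube, setOf_forall]
    refine isClosed_iInter fun i => ?_
    exact isClosed_Icc.preimage (by fun_prop)
  · have h1 : c + (ℓ/2) • ee (⟨0, hn⟩ : Fin n) ∈ cube c ℓ := by
      intro i
      simp only [PiLp.add_apply, PiLp.smul_apply, smul_eq_mul, ee, EuclideanSpace.single_apply]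
      split_ifs <;> constructor <;> linarith
    have := key _ h1
    rw [dist_eq_norm, add_sub_cancel_left, norm_smul] at this
    have e : ‖ee (⟨0, hn⟩ : Fin n)‖ = 1 := by simp [ee]
    rw [e, Real.norm_of_nonneg (by positivity)] at this
    linarith
  · intro x hx
    rw [mem_closedBall]
    linarith [key x hx]
end BL
end


theorem stmt_15 (n : ℕ) (hn : 2 ≤ n) :
    ∃ r : ℝ, 0 < r ∧ ∃ C : ℝ, 0 < C ∧ ∃ α₀ : ℝ, 0 < α₀ ∧
      ∀ (W : EuclideanSpace ℝ (Fin n) → ℝ), Measurable W → (∀ x, |W x| ≤ 1) →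
      ∀ (u : EuclideanSpace ℝ (Fin n) → ℝ),
        ContDiffOn ℝ (⊤ : ℕ∞) u (ball (0 : EuclideanSpace ℝ (Fin n)) 1) →
        (∀ x ∈ ball (0 : EuclideanSpace ℝ (Fin n)) 1, lap (lap u) x = W x * u x) →
        (∃ x ∈ ball (0 : EuclideanSpace ℝ (Fin n)) 1, u x ≠ 0) →
      ∀ (c : EuclideanSpace ℝ (Fin n)) (ℓ : ℝ), 0 < ℓ →
        cube c ℓ ⊆ ball (0 : EuclideanSpace ℝ (Fin n)) r →
        μH[(n : ℝ) - 1] {x ∈ cube c ℓ | u x = 0}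
          ≤ ENNReal.ofReal (C * diam (cube c ℓ) ^ (n - 1)
              * (1 + cubeN u (cube c ℓ)) ^ α₀) := by
  obtain ⟨N0, hN0, α, hα, s0, hs0, hs01, Λ, hΛ, hrec⟩ := BL.REC hn (BL.LEAF hn)
  refine ⟨min s0 (1/8), by positivity, Λ * N0^α, by positivity, (α : ℝ), by exact_mod_cast hα, ?_⟩
  intro W _ hW u hu hl hne c ℓ hℓ hsub
  obtain ⟨U, hUu, hSol, cU, hpos⟩ := BL.ext_u hn hW hu hl hne
  have hbd : Bornology.IsBounded (cube c ℓ) := isBounded_ball.subset hsub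
  obtain ⟨hcc, hconv, hcl, hd, hcb⟩ := BL.cube_geo (by omega) c hℓ hbd
  set Q := cube c ℓ with hQ
  set d := diam Q with hdd
  have hd2 : d ≤ 2 * min s0 (1/8) :=
    (diam_mono hsub isBounded_ball).trans (diam_ball (by positivity))
  have hm1 : min s0 (1/8) ≤ s0 := min_le_left _ _
  have hm2 : min s0 (1/8) ≤ 1/8 := min_le_right _ _
  have hQ4 : Q ⊆ ball (0 : BL.E n) (1/4) := hsub.trans (ball_subset_ball (by linarith))
  have hcomp : IsCompact Q := Metric.isCompact_of_isClosed_isBounded hcl hbd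
  obtain ⟨B, hB, hdbl⟩ := BL.dbl_bdd hn hcomp (fun x hx => hSol x (hQ4 hx)) cU
    (fun x hx => hpos x (hQ4 hx))
  have hsup : ∀ x ∈ Q, ∀ r, r ≤ 1/2 → supAbs u (ball x r) = BL.M U x r := by
    intro x hx r hr
    unfold BL.M supAbs
    congr 1
    refine image_congr fun y hy => ?_
    have hxx := mem_ball.1 (hQ4 hx)
    have : y ∈ ball (0 : BL.E n) (7/8) := ball_subset_ball' (by linarith) hy
    simp only [hUu this]
  have hdbi : ∀ x ∈ Q, ∀ r, 0 < r → r < d → dbIdx u x r = Real.logb 2 (BL.M U x (2 * r) / BL.M U x r) := by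
    intro x hx r hr hrd
    unfold dbIdx
    rw [hsup x hx _ (by linarith), hsup x hx _ (by linarith)]
  have hbdd : BddAbove {N : ℝ | ∃ x ∈ Q, ∃ r : ℝ, 0 < r ∧ r < d ∧ N = dbIdx u x r} := by
    refine ⟨Real.logb 2 B, ?_⟩
    rintro _ ⟨x, hx, r, hr, hrd, rfl⟩
    have p1 := hpos x (hQ4 hx) r hr
    have p2 := hpos x (hQ4 hx) (2 * r) (by positivity)
    rw [hdbi x hx r hr hrd]
    refine Real.logb_le_logb_of_le (by norm_num) (by positivity) ?_
    rw [div_le_iff₀ p1]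
    exact hdbl x hx r hr (by linarith)
  set cN := cubeN u Q with hcN
  have hle : ∀ x ∈ Q, ∀ r, 0 < r → r < d → dbIdx u x r ≤ cN := fun x hx r hr hrd =>
    le_csSup hbdd ⟨x, hx, r, hr, hrd, rfl⟩
  have hcN0 : 0 ≤ cN := by
    refine le_trans ?_ (hle c hcc (d/2) (by positivity) (by linarith))
    rw [hdbi c hcc _ (by positivity) (by linarith)]
    refine Real.logb_nonneg (by norm_num) ?_
    rw [one_le_div (hpos c (hQ4 hcc) _ (by positivity))]
    exact BL.M_mono cU (by linarith)
  have hNN : N0 ≤ N0 * (1 + cN) := by nlinarith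
  have hNc : cN ≤ N0 * (1 + cN) := by nlinarith
  have hset : {x ∈ Q | u x = 0} = {x | x ∈ Q ∧ U x = 0} := by
    ext x
    refine and_congr_right fun hx => ?_
    rw [hUu (ball_subset_ball (by norm_num) (hQ4 hx))]
  rw [hset]
  apply BL.mu_le
  intro δ hδ
  obtain ⟨k, hk⟩ := pow_unbounded_of_one_lt (d / 2 / (δ / 2)) (by norm_num : (1:ℝ) < 4)
  rw [div_lt_iff₀ (by positivity)] at hk
  have h := hrec U δ hδ k Q c (d/2) (N0 * (1 + cN)) hk.le (by positivity) (by linarith)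
    (fun x hx => hSol x (hQ4 hx)) hNN hconv hcb (fun x hx => hpos x (hQ4 hx)) (by
      intro x hx
      have p1 := hpos x (hQ4 hx) (d/2) (by positivity)
      have p2 := hpos x (hQ4 hx) (2 * (d/2)) (by positivity)
      have h1 := (hle x hx (d/2) (by positivity) (by linarith)).trans hNc
      rw [hdbi x hx _ (by positivity) (by linarith),
        Real.logb_le_iff_le_rpow (by norm_num) (by positivity), div_le_iff₀ p1] at h1
      exact h1)
  refine h.trans (ENNReal.ofReal_le_ofReal ?_)
  rw [Real.rpow_natCast, mul_pow]
  have : (d/2)^(n-1) ≤ d^(n-1) := by gcongr; linarith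
  calc Λ * (N0^α * (1 + cN)^α) * (d/2)^(n-1) ≤ Λ * (N0^α * (1 + cN)^α) * d^(n-1) := by gcongr
    _ = _ := by ring
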